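/- For every disorder strength δ > 0 there exists λ* > 0 such that, for almost every realization of the Bernoulli potential V (with respect to the i.i.d. Bernoulli(1/2) product measure on {0,1}^{ℤ³}), the following holds: for every function u : ℤ³ → ℝ and every λ ∈ [0, λ*], if (-Δu)(a) + δ·V(a)·u(a) = λ·u(a) for all a ∈ ℤ³ and inf_{n ∈ ℤ, n ≥ 0} sup_{a ∈ ℤ³} (1+|a|)^{-n}·|u(a)| < ∞, then inf_{t > 0} sup_{a ∈ ℤ³} exp(t·|a|)·|u(a)| < ∞. -/

import Mathlib

open scoped ENNReal

/-- Euclidean norm of a point of `ℤ³`. -/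
noncomputable def znorm (a : Fin 3 → ℤ) : ℝ :=
  Real.sqrt (∑ i, ((a i : ℝ)) ^ 2)

/-- The standard basis vectors of `ℤ³`. -/
def stdv (i : Fin 3) : Fin 3 → ℤ := fun j => if j = i then 1 else 0

/-- The discrete Laplacian on `ℤ³`:
`Δu(a) = -6 u(a) + ∑_{|a-b|=1} u(b)`. -/
noncomputable def discLap (u : (Fin 3 → ℤ) → ℝ) (a : Fin 3 → ℤ) : ℝ :=
  -6 * u a + ∑ i : Fin 3, (u (a + stdv i) + u (a - stdv i))

/-- `μ` is the i.i.d. Bernoulli(1/2) product measure on `{0,1}^{ℤ³}`,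
characterized by its values on cylinder sets. -/
def IsBernoulliProduct (μ : MeasureTheory.Measure ((Fin 3 → ℤ) → Bool)) : Prop :=
  MeasureTheory.IsProbabilityMeasure μ ∧
    ∀ (S : Finset (Fin 3 → ℤ)) (σ : (Fin 3 → ℤ) → Bool),
      μ {V | ∀ a ∈ S, V a = σ a} = (1 / 2 : ℝ≥0∞) ^ S.card

/-- Points of the lattice `ℤ³`. -/
abbrev Z3 := Fin 3 → ℤ

/-- Configurations of the potential. -/
abbrev Cfg := Z3 → Bool

/-- The sum of `u` over the six nearest neighbours. -/
noncomputable def nbs (u : Z3 → ℝ) (a : Z3) : ℝ :=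
  ∑ i : Fin 3, (u (a + stdv i) + u (a - stdv i))

/-- The operator `-Δ + δ V - E`. -/
noncomputable def T (δ E : ℝ) (V : Cfg) (u : Z3 → ℝ) (a : Z3) : ℝ :=
  (6 + δ * (if V a then 1 else 0) - E) * u a - nbs u a

/-- The discrete cube with lower corner `c` and side `n`. -/
noncomputable def cube (c : Z3) (n : ℕ) : Finset Z3 :=
  Fintype.piFinset fun i => Finset.Ico (c i) (c i + n)

/-- The corner of the subcube of side `l` of `cube c L` around `y`. -/
noncomputable def subc (c : Z3) (L l : ℕ) (y : Z3) : Z3 :=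
  fun i => max (c i) (min (y i - (l / 2 : ℕ)) (c i + L - l))

section Geometry

lemma mem_cube {c : Z3} {n : ℕ} {x : Z3} :
    x ∈ cube c n ↔ ∀ i, c i ≤ x i ∧ x i < c i + n := by
  simp [cube, Fintype.mem_piFinset]

lemma card_cube (c : Z3) (n : ℕ) : (cube c n).card = n ^ 3 := by
  simp [cube, Fintype.card_piFinset]

lemma dist_le_iff {x y : Z3} {r : ℝ} (hr : 0 ≤ r) :
    dist x y ≤ r ↔ ∀ i, |(x i : ℝ) - y i| ≤ r := by
  rw [dist_pi_le_iff hr]; simp [Int.dist_eq]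

lemma dist_lt_iff' {x y : Z3} {r : ℝ} (hr : 0 < r) :
    dist x y < r ↔ ∀ i, |(x i : ℝ) - y i| < r := by
  rw [dist_pi_lt_iff hr]; simp [Int.dist_eq]

lemma abs_coord_le_dist (x y : Z3) (i : Fin 3) : |(x i : ℝ) - y i| ≤ dist x y := by
  have := dist_le_pi_dist x y i
  rwa [Int.dist_eq] at this

lemma le_dist_of_coord {x y : Z3} {r : ℝ} (i : Fin 3) (h : r ≤ |(x i : ℝ) - y i|) :
    r ≤ dist x y := h.trans (abs_coord_le_dist x y i)

lemma exists_nat_dist (x y : Z3) : ∃ n : ℕ, dist x y = n := by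
  obtain ⟨i, -, hi⟩ := Finset.exists_max_image (Finset.univ : Finset (Fin 3))
    (fun i => (x i - y i).natAbs) ⟨0, by simp⟩
  refine ⟨(x i - y i).natAbs, le_antisymm ?_ ?_⟩
  · rw [dist_le_iff (by positivity)]
    intro j
    have := hi j (by simp)
    have h2 : ((x j - y j).natAbs : ℝ) ≤ (x i - y i).natAbs := by exact_mod_cast this
    rw [Nat.cast_natAbs (α := ℝ) (x j - y j)] at h2
    simpa using h2
  · have := abs_coord_le_dist x y i
    rw [Nat.cast_natAbs]; simpa using this

lemma dist_add_stdv (a : Z3) (i : Fin 3) : dist (a + stdv i) a ≤ 1 := by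
  rw [dist_le_iff (by norm_num)]
  intro j
  simp only [Pi.add_apply, stdv]; split_ifs <;> simp

lemma dist_sub_stdv (a : Z3) (i : Fin 3) : dist (a - stdv i) a ≤ 1 := by
  rw [dist_le_iff (by norm_num)]
  intro j
  simp only [Pi.sub_apply, stdv]; split_ifs <;> simp

lemma dist_lt_of_mem_cube {c : Z3} {n : ℕ} {x y : Z3} (hx : x ∈ cube c n) (hy : y ∈ cube c n) :
    dist x y < n := by
  have hn : 0 < n := by
    have := mem_cube.1 hx 0
    omega
  rw [dist_lt_iff' (by exact_mod_cast hn)]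
  intro i
  have h1 := mem_cube.1 hx i
  have h2 := mem_cube.1 hy i
  have : |x i - y i| < (n : ℤ) := by rw [abs_lt]; constructor <;> omega
  exact_mod_cast this

lemma mem_subcube {c : Z3} {L l : ℕ} (hl : 0 < l) (hlL : l ≤ L) {y : Z3} (hy : y ∈ cube c L) :
    y ∈ cube (subc c L l y) l := by
  rw [mem_cube] at *
  intro i
  have := hy i
  simp only [subc]
  omega

lemma subcube_subset {c : Z3} {L l : ℕ} (hlL : l ≤ L) (y : Z3) :
    cube (subc c L l y) l ⊆ cube c L := by
  intro x hx
  rw [mem_cube] at *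
  intro i
  have := hx i
  simp only [subc] at this
  omega

lemma half_le_dist_of_notMem_subcube {c : Z3} {L l : ℕ} {y w : Z3}
    (hw : w ∈ cube c L) (hw' : w ∉ cube (subc c L l y) l) :
    ((l : ℝ) - 1) / 2 ≤ dist w y := by
  rw [mem_cube] at *
  push Not at hw'
  obtain ⟨i, hi⟩ := hw'
  have h1 := hw i
  simp only [subc] at hi
  apply le_dist_of_coord i
  have : (l : ℤ) - 1 ≤ 2 * |w i - y i| := by
    rcases abs_cases (w i - y i) with h | h <;> omega
  have h2 : (l : ℝ) - 1 ≤ 2 * |(w i : ℝ) - y i| := by exact_mod_cast this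
  linarith

lemma cube_disjoint_of_dist {c d : Z3} {n : ℕ} (h : (n : ℝ) ≤ dist c d) :
    Disjoint (cube c n) (cube d n) := by
  rw [Finset.disjoint_left]
  intro x hx hy
  rcases Nat.eq_zero_or_pos n with rfl | hn
  · have := mem_cube.1 hx 0
    simp at this; omega
  · have : dist c d < n := by
      rw [dist_lt_iff' (by exact_mod_cast hn)]
      intro i
      have h1 := mem_cube.1 hx i
      have h2 := mem_cube.1 hy i
      have : |c i - d i| < (n : ℤ) := by rw [abs_lt]; constructor <;> omega
      exact_mod_cast this
    linarith

end Geometry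

section Operator

variable {δ E : ℝ} {V W : Cfg}

lemma nbs_add (u v : Z3 → ℝ) (a : Z3) : nbs (fun x => u x + v x) a = nbs u a + nbs v a := by
  simp only [nbs, ← Finset.sum_add_distrib]
  exact Finset.sum_congr rfl fun _ _ => by ring

lemma nbs_mul (c : ℝ) (u : Z3 → ℝ) (a : Z3) : nbs (fun x => c * u x) a = c * nbs u a := by
  simp only [nbs, Finset.mul_sum]
  exact Finset.sum_congr rfl fun _ _ => by ring

lemma T_add (u v : Z3 → ℝ) (a : Z3) :
    T δ E V (fun x => u x + v x) a = T δ E V u a + T δ E V v a := by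
  simp only [T, nbs_add]; ring

lemma T_mul (c : ℝ) (u : Z3 → ℝ) (a : Z3) :
    T δ E V (fun x => c * u x) a = c * T δ E V u a := by
  simp only [T, nbs_mul]; ring

lemma T_sub (u v : Z3 → ℝ) (a : Z3) :
    T δ E V (fun x => u x - v x) a = T δ E V u a - T δ E V v a := by
  have := T_add (δ := δ) (E := E) (V := V) u (fun x => (-1) * v x) a
  rw [T_mul] at this
  simp only [neg_one_mul, ← sub_eq_add_neg] at this
  exact this

lemma T_zero (a : Z3) : T δ E V (fun _ => 0) a = 0 := by simp [T, nbs]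

lemma T_sum {ι : Type*} (s : Finset ι) (f : ι → Z3 → ℝ) (a : Z3) :
    T δ E V (fun x => ∑ i ∈ s, f i x) a = ∑ i ∈ s, T δ E V (f i) a := by
  classical
  induction s using Finset.induction_on with
  | empty => simp [T_zero]
  | insert i s hi ih => simp only [Finset.sum_insert hi, T_add, ih]

lemma nbs_congr {u v : Z3 → ℝ} {a : Z3} (h : ∀ b, dist b a ≤ 1 → u b = v b) :
    nbs u a = nbs v a := by
  unfold nbs
  exact Finset.sum_congr rfl fun i _ => by
    rw [h _ (dist_add_stdv a i), h _ (dist_sub_stdv a i)]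

lemma T_congr {u v : Z3 → ℝ} {a : Z3} (hV : V a = W a) (h : ∀ b, dist b a ≤ 1 → u b = v b) :
    T δ E V u a = T δ E W v a := by
  rw [T, T, nbs_congr h, h a (by simp), hV]

lemma nbs_abs_le {u : Z3 → ℝ} {a : Z3} {C : ℝ} (h : ∀ b, dist b a ≤ 1 → |u b| ≤ C) :
    |nbs u a| ≤ 6 * C := by
  calc |nbs u a| ≤ ∑ i : Fin 3, |u (a + stdv i) + u (a - stdv i)| := Finset.abs_sum_le_sum_abs _ _
    _ ≤ ∑ _i : Fin 3, 2 * C := by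
        refine Finset.sum_le_sum fun i _ => (abs_add_le _ _).trans ?_
        have h1 := h _ (dist_add_stdv a i)
        have h2 := h _ (dist_sub_stdv a i)
        linarith
    _ = 6 * C := by simp; ring

lemma sum_shift (Λ : Finset Z3) (e : Z3) (u g : Z3 → ℝ) (hu : ∀ x ∉ Λ, u x = 0)
    (hg : ∀ x ∉ Λ, g x = 0) :
    ∑ x ∈ Λ, g x * u (x + e) = ∑ x ∈ Λ, g (x - e) * u x := by
  have h1 : ∑ᶠ x, g x * u (x + e) = ∑ x ∈ Λ, g x * u (x + e) := by
    apply finsum_eq_sum_of_support_subset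
    intro x hx
    by_contra h
    exact hx (by simp [hg x h])
  have h2 : ∑ᶠ x, g (x - e) * u x = ∑ x ∈ Λ, g (x - e) * u x := by
    apply finsum_eq_sum_of_support_subset
    intro x hx
    by_contra h
    exact hx (by simp [hu x h])
  rw [← h1, ← h2, ← finsum_comp_equiv (Equiv.addRight e) (f := fun x => g (x - e) * u x)]
  simp

lemma sum_mul_T_comm (Λ : Finset Z3) (u g : Z3 → ℝ) (hu : ∀ x ∉ Λ, u x = 0)
    (hg : ∀ x ∉ Λ, g x = 0) :
    ∑ x ∈ Λ, g x * T δ E V u x = ∑ x ∈ Λ, u x * T δ E V g x := by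
  have key : ∑ x ∈ Λ, g x * nbs u x = ∑ x ∈ Λ, u x * nbs g x := by
    simp only [nbs, Finset.mul_sum]
    rw [Finset.sum_comm, Finset.sum_comm (s := Λ)]
    refine Finset.sum_congr rfl fun i _ => ?_
    simp only [mul_add, Finset.sum_add_distrib]
    have a1 := sum_shift Λ (stdv i) u g hu hg
    have a2 := sum_shift Λ (stdv i) g u hg hu
    rw [a1, add_comm]
    congr 1
    · calc _ = ∑ x ∈ Λ, u (x - stdv i) * g x := Finset.sum_congr rfl fun _ _ => mul_comm _ _
        _ = _ := a2.symm
    · exact Finset.sum_congr rfl fun _ _ => mul_comm _ _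
  simp only [T, mul_sub, Finset.sum_sub_distrib, key]
  congr 1
  exact Finset.sum_congr rfl fun _ _ => by ring

/-- The matrix of `-Δ + δ V - E` restricted to the finite set `Q`. -/
noncomputable def opMat (δ E : ℝ) (Q : Finset Z3) (V : Cfg) : Matrix Q Q ℝ :=
  fun x y => T δ E V (Pi.single (y : Z3) 1) x

open Classical in
/-- The Green function of `Q`, extended by zero. -/
noncomputable def Gf (δ E : ℝ) (Q : Finset Z3) (V : Cfg) (x y : Z3) : ℝ :=
  if h : x ∈ Q ∧ y ∈ Q then (opMat δ E Q V)⁻¹ ⟨x, h.1⟩ ⟨y, h.2⟩ else 0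

lemma eq_sum_single {Q : Finset Z3} {v : Z3 → ℝ} (hv : ∀ x ∉ Q, v x = 0) :
    v = fun x => ∑ y ∈ Q, v y * (Pi.single y (1 : ℝ) : Z3 → ℝ) x := by
  ext x
  by_cases hx : x ∈ Q
  · rw [Finset.sum_eq_single x]
    · simp
    · intro b _ hb
      simp [hb.symm]
    · exact fun h => absurd hx h
  · rw [hv x hx, Finset.sum_eq_zero]
    intro y hy
    have : x ≠ y := fun h => hx (h ▸ hy)
    simp [this]

lemma opMat_mulVec {Q : Finset Z3} {v : Z3 → ℝ} (hv : ∀ x ∉ Q, v x = 0) (x : Q) :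
    (opMat δ E Q V).mulVec (fun y : Q => v y) x = T δ E V v x := by
  conv_rhs => rw [eq_sum_single hv, T_sum]
  simp only [Matrix.mulVec, dotProduct, opMat, T_mul]
  rw [← Finset.sum_coe_sort Q]
  exact Finset.sum_congr rfl fun _ _ => mul_comm _ _

lemma single_zero_off {Q : Finset Z3} {y : Z3} (hy : y ∈ Q) :
    ∀ x ∉ Q, (Pi.single y (1 : ℝ) : Z3 → ℝ) x = 0 := by
  intro x hx
  have : x ≠ y := fun h => hx (h ▸ hy)
  simp [this]

lemma opMat_isSymm (Q : Finset Z3) : (opMat δ E Q V).IsSymm := by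
  ext x y
  have := sum_mul_T_comm (δ := δ) (E := E) (V := V) Q (Pi.single (x : Z3) 1) (Pi.single (y : Z3) 1)
    (single_zero_off x.2) (single_zero_off y.2)
  rw [Finset.sum_eq_single (y : Z3), Finset.sum_eq_single (x : Z3)] at this
  · simpa [opMat] using this
  all_goals first
    | (intro b _ hb; simp [hb])
    | (intro h; simp at h)

lemma opMat_congr {Q : Finset Z3} (h : ∀ x ∈ Q, V x = W x) : opMat δ E Q V = opMat δ E Q W := by
  ext x y
  exact T_congr (h x x.2) fun _ _ => rfl

lemma Gf_congr {Q : Finset Z3} (h : ∀ x ∈ Q, V x = W x) : Gf δ E Q V = Gf δ E Q W := by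
  ext x y
  simp only [Gf, opMat_congr h]

lemma Gf_off_left {Q : Finset Z3} {x : Z3} (hx : x ∉ Q) (y : Z3) : Gf δ E Q V x y = 0 := by
  simp [Gf, hx]

lemma Gf_off_right {Q : Finset Z3} {y : Z3} (hy : y ∉ Q) (x : Z3) : Gf δ E Q V x y = 0 := by
  simp [Gf, hy]

lemma Gf_symm (Q : Finset Z3) (x y : Z3) : Gf δ E Q V x y = Gf δ E Q V y x := by
  by_cases hx : x ∈ Q
  · by_cases hy : y ∈ Q
    · have h := (opMat_isSymm (δ := δ) (E := E) (V := V) Q).inv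
      simp only [Gf, hx, hy, and_self, dite_true]
      exact h.apply _ _
    · rw [Gf_off_left hy, Gf_off_right hy]
  · rw [Gf_off_left hx, Gf_off_right hx]

lemma Gf_repr {Q : Finset Z3} (hdet : (opMat δ E Q V).det ≠ 0) {v : Z3 → ℝ}
    (hv : ∀ x ∉ Q, v x = 0) (x : Z3) : v x = ∑ y ∈ Q, Gf δ E Q V x y * T δ E V v y := by
  by_cases hx : x ∈ Q
  · have hu : IsUnit (opMat δ E Q V).det := isUnit_iff_ne_zero.2 hdet
    have h1 : (opMat δ E Q V)⁻¹.mulVec ((opMat δ E Q V).mulVec (fun y : Q => v y)) ⟨x, hx⟩ = v x := by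
      rw [Matrix.mulVec_mulVec, Matrix.nonsing_inv_mul _ hu, Matrix.one_mulVec]
    rw [← h1]
    conv_lhs => rw [Matrix.mulVec, dotProduct]
    simp only [opMat_mulVec hv]
    rw [← Finset.sum_coe_sort Q]
    refine Finset.sum_congr rfl fun y _ => ?_
    simp [Gf, hx]
  · rw [hv x hx, Finset.sum_eq_zero]
    intro y _
    rw [Gf_off_left hx, zero_mul]

lemma T_Gf {Q : Finset Z3} (hdet : (opMat δ E Q V).det ≠ 0) {x y : Z3} (hx : x ∈ Q) (hy : y ∈ Q) :
    T δ E V (fun z => Gf δ E Q V z y) x = if x = y then 1 else 0 := by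
  have hu : IsUnit (opMat δ E Q V).det := isUnit_iff_ne_zero.2 hdet
  have h := opMat_mulVec (δ := δ) (E := E) (V := V) (Q := Q) (v := fun z => Gf δ E Q V z y)
    (fun z hz => Gf_off_left hz y) ⟨x, hx⟩
  rw [← h]
  have h2 := congrFun (congrFun (Matrix.mul_nonsing_inv (opMat δ E Q V) hu) ⟨x, hx⟩) ⟨y, hy⟩
  rw [Matrix.one_apply] at h2
  simp only [Subtype.mk.injEq] at h2
  rw [← h2, Matrix.mul_apply, Matrix.mulVec, dotProduct]
  refine Finset.sum_congr rfl fun z _ => ?_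
  simp [Gf, hy]

lemma det_ne_zero_of_inj {Q : Finset Z3}
    (h : ∀ v : Z3 → ℝ, (∀ x ∉ Q, v x = 0) → (∀ x ∈ Q, T δ E V v x = 0) → ∀ x, v x = 0) :
    (opMat δ E Q V).det ≠ 0 := by
  classical
  intro h0
  obtain ⟨w, hw, hw0⟩ := Matrix.exists_mulVec_eq_zero_iff.2 h0
  apply hw
  set v : Z3 → ℝ := fun x => if hx : x ∈ Q then w ⟨x, hx⟩ else 0 with hv
  have hv0 : ∀ x ∉ Q, v x = 0 := fun x hx => by simp [hv, hx]
  have hvw : (fun y : Q => v y) = w := by ext y; simp [hv]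
  have := h v hv0 fun x hx => by
    rw [← opMat_mulVec (Q := Q) hv0 ⟨x, hx⟩, hvw, hw0]; rfl
  ext y
  rw [← hvw]; simp [this]

/-- Green representation of an arbitrary function inside `Q`. -/
lemma Gf_repr_boundary {Q : Finset Z3} (hdet : (opMat δ E Q V).det ≠ 0) (u : Z3 → ℝ) {x : Z3}
    (hx : x ∈ Q) : u x = ∑ y ∈ Q, Gf δ E Q V x y *
      (T δ E V u y + nbs (fun w => if w ∈ Q then 0 else u w) y) := by
  have h := Gf_repr hdet (v := fun w => if w ∈ Q then u w else 0) (fun z hz => by simp [hz]) x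
  simp only [hx, if_true] at h
  rw [h]
  refine Finset.sum_congr rfl fun y hy => ?_
  congr 1
  have h2 : u = fun w => (if w ∈ Q then u w else 0) + (if w ∈ Q then 0 else u w) := by
    ext w; split_ifs <;> simp
  conv_rhs => rw [h2, T_add]
  simp only [T, hy, if_true]
  have h3 : nbs (fun w => if w ∈ Q then 0 else ((if w ∈ Q then u w else 0) + (if w ∈ Q then 0 else u w))) y
      = nbs (fun w => if w ∈ Q then 0 else u w) y := by
    congr 1; ext w; split_ifs <;> simp
  rw [h3]
  ring

end Operator

/-- The subcube of side `s ^ 2` of `cube c L` around `y`. -/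
noncomputable def sub (c : Z3) (L s : ℕ) (y : Z3) : Finset Z3 := cube (subc c L (s ^ 2) y) (s ^ 2)

/-- Exponential decay of the Green function at scale `s`. -/
def Good (δ E M : ℝ) (s : ℕ) (Q : Finset Z3) (V : Cfg) : Prop :=
  (opMat δ E Q V).det ≠ 0 ∧ ∀ x ∈ Q, ∀ y ∈ Q, |Gf δ E Q V x y| <
    if (s : ℝ) ^ 2 / 8 ≤ dist x y then Real.exp (-(1 / M + 3 / s) * dist x y) else Real.exp s

/-- The standing assumptions on the parameters and on the scale. -/
structure Big (δ E M : ℝ) (s : ℕ) : Prop where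
  hM : 10 ^ 6 ≤ M
  hδ : 0 < δ
  hδM : 13 + δ ≤ M
  hδM' : 1 ≤ δ * M
  hE0 : 0 ≤ E
  hE1 : E ≤ 1
  hs : M ^ 200 ≤ s
  hexp : 20000 * Real.log s ≤ s / M ^ 10

namespace Big

variable {δ E M : ℝ} {s : ℕ}

lemma one_le_M (h : Big δ E M s) : 1 ≤ M := by linarith [h.hM]

lemma M_pos (h : Big δ E M s) : 0 < M := by linarith [h.hM]

lemma pow_le (h : Big δ E M s) {k : ℕ} (hk : k ≤ 200) : M ^ k ≤ s :=
  (pow_le_pow_right₀ h.one_le_M hk).trans h.hs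

lemma M_le (h : Big δ E M s) : M ≤ s := by simpa using h.pow_le (k := 1) (by norm_num)

lemma le_s (h : Big δ E M s) : (10 : ℝ) ^ 6 ≤ s := h.hM.trans h.M_le

lemma s_pos (h : Big δ E M s) : (0 : ℝ) < s := by linarith [h.le_s]

lemma s_pos' (h : Big δ E M s) : 0 < s := by exact_mod_cast h.s_pos

lemma log_nonneg (h : Big δ E M s) : 0 ≤ Real.log s := Real.log_nonneg (by linarith [h.le_s])

lemma one_le_log (h : Big δ E M s) : 1 ≤ Real.log s := by
  rw [Real.le_log_iff_exp_le h.s_pos]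
  have := Real.exp_one_lt_d9
  linarith [h.le_s]

lemma log_le (h : Big δ E M s) : 20000 * Real.log s ≤ s := by
  refine h.hexp.trans (div_le_self h.s_pos.le (one_le_pow₀ h.one_le_M))

lemma pow_eq (h : Big δ E M s) (k : ℕ) : (s : ℝ) ^ k = Real.exp (k * Real.log s) := by
  rw [mul_comm, Real.exp_mul, Real.exp_log h.s_pos, Real.rpow_natCast]

lemma good_le_exp (h : Big δ E M s) {Q : Finset Z3} {V : Cfg} (hQ : Good δ E M s Q V) (x y : Z3) :
    |Gf δ E Q V x y| ≤ Real.exp s := by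
  by_cases hx : x ∈ Q
  · by_cases hy : y ∈ Q
    · refine (hQ.2 x hx y hy).le.trans ?_
      split_ifs with h1
      · rw [Real.exp_le_exp]
        have : 0 ≤ (1 / M + 3 / (s : ℝ)) * dist x y := by
          have := h.M_pos
          positivity
        linarith [h.s_pos]
      · exact le_rfl
    · rw [Gf_off_right hy]; simpa using (Real.exp_pos _).le
  · rw [Gf_off_left hx]; simpa using (Real.exp_pos _).le

end Big

section MaxPrinciple

variable {δ E M : ℝ} {s : ℕ} {V : Cfg}

lemma sub_subset {c : Z3} {L : ℕ} (hL : s ^ 2 ≤ L) (y : Z3) : sub c L s y ⊆ cube c L :=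
  subcube_subset hL y

lemma mem_sub {c : Z3} {L : ℕ} (h : Big δ E M s) (hL : s ^ 2 ≤ L) {y : Z3} (hy : y ∈ cube c L) :
    y ∈ sub c L s y :=
  mem_subcube (by have := h.s_pos'; positivity) hL hy

lemma card_sub (c : Z3) (L : ℕ) (y : Z3) : ((sub c L s y).card : ℝ) = (s : ℝ) ^ 6 := by
  rw [sub, card_cube]; push_cast; ring

lemma dist_lt_of_mem_sub {c : Z3} {L : ℕ} {x y z : Z3} (hx : x ∈ sub c L s z)
    (hy : y ∈ sub c L s z) : dist x y < (s : ℝ) ^ 2 := by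
  have := dist_lt_of_mem_cube hx hy
  exact_mod_cast this

lemma le_dist_of_notMem_sub {c : Z3} {L : ℕ} {y w : Z3} (hw : w ∈ cube c L)
    (hw' : w ∉ sub c L s y) : ((s : ℝ) ^ 2 - 1) / 2 ≤ dist w y := by
  have := half_le_dist_of_notMem_subcube hw hw'
  exact_mod_cast this

/-- Maximum principle: a function which is nearly annihilated by the operator on a region covered
by good cubes is controlled, with an exponential weight, by its values off that region. -/
lemma max_principle (h : Big δ E M s) {c : Z3} {L : ℕ} (hL : s ^ 2 ≤ L) {u : Z3 → ℝ}
    (hu : ∀ x ∉ cube c L, u x = 0) (𝒢 : Z3 → Prop)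
    (hG : ∀ y ∈ cube c L, 𝒢 y → Good δ E M s (sub c L s y) V) {Φ : Z3 → ℝ}
    (hΦ : ∀ x y, |Φ x - Φ y| ≤ (1 / M + 2 / s) * dist x y) {R A : ℝ}
    (hR : ∀ y ∈ cube c L, 𝒢 y → ∀ z ∈ sub c L s y, |T δ E V u z| * Real.exp (Φ y) ≤ R)
    (hA : ∀ y ∈ cube c L, ¬ 𝒢 y → |u y| * Real.exp (Φ y) ≤ A) {x : Z3} (hx : x ∈ cube c L) :
    |u x| * Real.exp (Φ x) ≤ max A (2 * s ^ 6 * Real.exp s * R) := by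
  obtain ⟨y, hy, hmax⟩ := Finset.exists_max_image (cube c L) (fun x => |u x| * Real.exp (Φ x)) ⟨x, hx⟩
  refine (hmax x hx).trans ?_
  by_cases hgy : 𝒢 y
  swap
  · exact le_max_of_le_left (hA y hy hgy)
  apply le_max_of_le_right
  set X := |u y| * Real.exp (Φ y) with hX
  have hgood := hG y hy hgy
  have hyQ : y ∈ sub c L s y := mem_sub h hL hy
  have hsp := h.s_pos
  have hMp := h.M_pos
  have hX0 : 0 ≤ X := by positivity
  -- the boundary terms
  have hb : ∀ z ∈ sub c L s y, |Gf δ E (sub c L s y) V y z| *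
      |nbs (fun w => if w ∈ sub c L s y then 0 else u w) z| * Real.exp (Φ y)
        ≤ 6 * X * Real.exp (-(s : ℝ) / 2 + 3) := by
    intro z hz
    by_cases hzd : ∃ w ∈ cube c L, w ∉ sub c L s y ∧ dist w z ≤ 1
    · obtain ⟨w, hw, hw', hwz⟩ := hzd
      have hd1 := le_dist_of_notMem_sub hw hw'
      have hd2 : ((s : ℝ) ^ 2 - 1) / 2 - 1 ≤ dist y z := by
        have := dist_triangle w z y
        rw [dist_comm z y] at this
        linarith
      have hs2 : (10 : ℝ) ^ 6 * s ≤ s ^ 2 := by nlinarith [h.le_s]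
      have hfar : (s : ℝ) ^ 2 / 8 ≤ dist y z := by linarith [h.le_s]
      have hg := (hgood.2 y hyQ z hz).le
      rw [if_pos hfar] at hg
      have hn : |nbs (fun w => if w ∈ sub c L s y then 0 else u w) z| ≤
          6 * (X * Real.exp (-Φ y + (1 / M + 2 / s) * (dist y z + 1))) := by
        apply nbs_abs_le
        intro b hbz
        split_ifs with hbQ
        · simp; positivity
        by_cases hbΛ : b ∈ cube c L
        · have h1 := hmax b hbΛ
          have h2 : |u b| = (|u b| * Real.exp (Φ b)) * Real.exp (-Φ b) := by
            rw [mul_assoc, ← Real.exp_add]; simp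
          rw [h2]
          refine mul_le_mul h1 ?_ (Real.exp_pos _).le hX0
          rw [Real.exp_le_exp]
          have h3 := (abs_le.1 (hΦ b y)).1
          have h4 : dist b y ≤ dist y z + 1 := by
            have := dist_triangle b z y
            rw [dist_comm z y] at this
            linarith
          have h5 : (1 / M + 2 / (s : ℝ)) * dist b y ≤ (1 / M + 2 / s) * (dist y z + 1) := by
            gcongr
          linarith
        · rw [hu b hbΛ]; simp; positivity
      calc _ ≤ Real.exp (-(1 / M + 3 / s) * dist y z) *
            (6 * (X * Real.exp (-Φ y + (1 / M + 2 / s) * (dist y z + 1)))) * Real.exp (Φ y) := by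
            gcongr
        _ = 6 * X * Real.exp (-(1 / M + 3 / s) * dist y z + (-Φ y + (1 / M + 2 / s) * (dist y z + 1))
            + Φ y) := by
            rw [Real.exp_add (_ + _) (Φ y), Real.exp_add (-(1 / M + 3 / (s : ℝ)) * dist y z)]; ring
        _ ≤ _ := by
          refine mul_le_mul_of_nonneg_left (Real.exp_le_exp.2 ?_) (by positivity)
          have h6 : -(1 / M + 3 / s) * dist y z + (-Φ y + (1 / M + 2 / s) * (dist y z + 1)) + Φ y
            = -(1 / s) * dist y z + (1 / M + 2 / s) := by ring
          rw [h6]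
          have h7 : (1 / (s : ℝ)) * (((s : ℝ) ^ 2 - 1) / 2 - 1) ≤ (1 / s) * dist y z := by gcongr
          have h8 : (1 / (s : ℝ)) * (((s : ℝ) ^ 2 - 1) / 2 - 1) = s / 2 - (3 / 2) * (1 / s) := by
            field_simp; ring
          have h9 : 1 / (s : ℝ) ≤ 1 := by rw [div_le_one hsp]; linarith [h.le_s]
          have h10 : 1 / M ≤ 1 := by rw [div_le_one hMp]; exact h.one_le_M
          have h11 : 2 / (s : ℝ) = 2 * (1 / s) := by ring
          have h12 : 1 / (s : ℝ) ≤ 1 / 10 ^ 6 := one_div_le_one_div_of_le (by norm_num) h.le_s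
          linarith
    · push Not at hzd
      have hn : |nbs (fun w => if w ∈ sub c L s y then 0 else u w) z| ≤ 6 * 0 := by
        apply nbs_abs_le
        intro b hbz
        split_ifs with hbQ
        · simp
        by_cases hbΛ : b ∈ cube c L
        · exact absurd hbz (not_le.2 (hzd b hbΛ hbQ))
        · simp [hu b hbΛ]
      have hn' : |nbs (fun w => if w ∈ sub c L s y then 0 else u w) z| = 0 :=
        le_antisymm (by simpa using hn) (abs_nonneg _)
      rw [hn']; simp; positivity
  have hmain : X ≤ s ^ 6 * (Real.exp s * R) + s ^ 6 * (6 * X * Real.exp (-(s : ℝ) / 2 + 3)) := by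
    rw [hX]
    conv_lhs => rw [Gf_repr_boundary hgood.1 u hyQ]
    calc _ ≤ (∑ z ∈ sub c L s y, |Gf δ E (sub c L s y) V y z *
          (T δ E V u z + nbs (fun w => if w ∈ sub c L s y then 0 else u w) z)|) * Real.exp (Φ y) := by
          gcongr; exact Finset.abs_sum_le_sum_abs _ _
      _ ≤ ∑ z ∈ sub c L s y, (Real.exp s * R + 6 * X * Real.exp (-(s : ℝ) / 2 + 3)) := by
          rw [Finset.sum_mul]
          refine Finset.sum_le_sum fun z hz => ?_
          rw [abs_mul]
          have h1 := hb z hz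
          have h2 := hR y hy hgy z hz
          have h3 := h.good_le_exp hgood y z
          have h4 : |Gf δ E (sub c L s y) V y z| * (|T δ E V u z| * Real.exp (Φ y)) ≤ Real.exp s * R :=
            mul_le_mul h3 h2 (by positivity) (Real.exp_pos _).le
          calc _ ≤ |Gf δ E (sub c L s y) V y z| * (|T δ E V u z| +
                |nbs (fun w => if w ∈ sub c L s y then 0 else u w) z|) * Real.exp (Φ y) := by
                gcongr; exact abs_add_le _ _
            _ = |Gf δ E (sub c L s y) V y z| * (|T δ E V u z| * Real.exp (Φ y)) +
                |Gf δ E (sub c L s y) V y z| *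
                |nbs (fun w => if w ∈ sub c L s y then 0 else u w) z| * Real.exp (Φ y) := by ring
            _ ≤ _ := add_le_add h4 h1
      _ = _ := by rw [Finset.sum_const, nsmul_eq_mul, card_sub]; ring
  have hsmall : (s : ℝ) ^ 6 * (6 * Real.exp (-(s : ℝ) / 2 + 3)) ≤ 1 / 2 := by
    have h1 : (12 : ℝ) ≤ Real.exp (Real.log s) := by
      rw [Real.exp_log hsp]; linarith [h.le_s]
    have h2 : (s : ℝ) ^ 6 * (12 * Real.exp (-(s : ℝ) / 2 + 3)) ≤ 1 := by
      calc _ ≤ Real.exp (6 * Real.log s) * (Real.exp (Real.log s) * Real.exp (-(s : ℝ) / 2 + 3)) := by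
            rw [h.pow_eq 6]; push_cast; gcongr
        _ = Real.exp (7 * Real.log s - s / 2 + 3) := by
            rw [← Real.exp_add, ← Real.exp_add]; congr 1; ring
        _ ≤ 1 := by
            rw [Real.exp_le_one_iff]
            linarith [h.log_le, h.one_le_log]
    linarith
  have : X * ((s : ℝ) ^ 6 * (6 * Real.exp (-(s : ℝ) / 2 + 3))) ≤ X * (1 / 2) :=
    mul_le_mul_of_nonneg_left hsmall hX0
  nlinarith

end MaxPrinciple

/-- The configuration `V` with the value at `x` flipped. -/
def flipAt (V : Cfg) (x : Z3) : Cfg := Function.update V x (!V x)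

/-- The site `x` of `Q` carries a well behaved local Green function when the potential is removed
at `x`. -/
def Clean (δ E M : ℝ) (s : ℕ) (V : Cfg) (Q : Finset Z3) (x : Z3) : Prop :=
  x ∈ Q ∧ ∃ r : Z3 → ℝ, (∀ z ∉ Q, r z = 0) ∧
    (∀ z ∈ Q, T δ E (Function.update V x false) r z = if z = x then 1 else 0) ∧
    -(1 / (2 * M) - 1 / s) ≤ r x ∧ ∑ z ∈ Q, r z ^ 2 ≤ (M - 1 / s) ^ 2 ∧
    ∀ z ∈ Q, (s : ℝ) ^ 2 / 8 ≤ dist z x → |r z| ≤ Real.exp (-(1 / M + 3 / s) * dist z x)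

/-- Oriented height of a site. -/
def hgt (σ : ℤ) (x : Z3) : ℤ := σ * x 2

/-- A step which gains one or two units of height and moves by at most one unit sideways. -/
def Step (σ : ℤ) (x y : Z3) : Prop :=
  1 ≤ hgt σ y - hgt σ x ∧ hgt σ y - hgt σ x ≤ 2 ∧ |y 0 - x 0| ≤ 1 ∧ |y 1 - x 1| ≤ 1

/-- Every long ascending path in `Q` meets a clean site. -/
def Hit (δ E M : ℝ) (s : ℕ) (Q : Finset Z3) (V : Cfg) : Prop :=
  ∀ σ : ℤ, (σ = 1 ∨ σ = -1) → ∀ (γ : ℕ → Z3) (N : ℕ), (∀ n < N, Step σ (γ n) (γ (n + 1))) →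
    (∀ n ≤ N, γ n ∈ Q) → (s : ℝ) ^ 2 / 8 ≤ hgt σ (γ N) - hgt σ (γ 0) →
    ∃ n ≤ N, Clean δ E M s V Q (γ n)

/-- Robustly good cubes. -/
def RG (δ E M : ℝ) (s : ℕ) (Q : Finset Z3) (V : Cfg) : Prop :=
  Good δ E M s Q V ∧ (∀ x ∈ Q, Good δ E M s Q (flipAt V x)) ∧ Hit δ E M s Q V

/-- A site of a large cube which is clean for a subcube around a nearby point. -/
def CleanL (δ E M : ℝ) (s : ℕ) (c : Z3) (L : ℕ) (V : Cfg) (x : Z3) : Prop :=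
  ∃ y ∈ cube c L, dist x y ≤ (s : ℝ) ^ 2 / 4 ∧ Clean δ E M s V (sub c L s y) x

section Chain

variable {δ E M : ℝ} {s : ℕ} {V : Cfg} {σ : ℤ}

lemma Step.dist_le {x y : Z3} (hσ : σ = 1 ∨ σ = -1) (h : Step σ x y) :
    dist x y ≤ ((hgt σ y - hgt σ x : ℤ) : ℝ) := by
  obtain ⟨h1, h2, h3, h4⟩ := h
  have h0 : (0 : ℝ) ≤ ((hgt σ y - hgt σ x : ℤ) : ℝ) := by
    exact_mod_cast (by omega : 0 ≤ hgt σ y - hgt σ x)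
  rw [dist_le_iff h0]
  have key : ∀ i, |x i - y i| ≤ hgt σ y - hgt σ x := by
    intro i
    fin_cases i
    · rw [abs_sub_comm]; exact h3.trans h1
    · rw [abs_sub_comm]; exact h4.trans h1
    · simp only [hgt] at *
      rcases hσ with rfl | rfl <;> simp only [Fin.reduceFinMk] <;> rw [abs_le] <;> omega
  intro i
  exact_mod_cast key i

lemma path_dist_le (hσ : σ = 1 ∨ σ = -1) {γ : ℕ → Z3} {N : ℕ}
    (h : ∀ n < N, Step σ (γ n) (γ (n + 1))) {a b : ℕ} (hab : a ≤ b) (hb : b ≤ N) :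
    dist (γ a) (γ b) ≤ ((hgt σ (γ b) - hgt σ (γ a) : ℤ) : ℝ) := by
  induction b, hab using Nat.le_induction with
  | base => simp
  | succ b hab ih =>
    have h1 := ih (by omega)
    have h2 := (h b (by omega)).dist_le hσ
    have := dist_triangle (γ a) (γ b) (γ (b + 1))
    push_cast at *
    linarith

lemma path_gain {γ : ℕ → Z3} {N : ℕ} (h : ∀ n < N, Step σ (γ n) (γ (n + 1))) {a b : ℕ}
    (hab : a ≤ b) (hb : b ≤ N) :
    ((b - a : ℕ) : ℤ) ≤ hgt σ (γ b) - hgt σ (γ a) ∧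
      hgt σ (γ b) - hgt σ (γ a) ≤ 2 * ((b - a : ℕ) : ℤ) := by
  induction b, hab using Nat.le_induction with
  | base => simp
  | succ b hab ih =>
    have h1 := ih (by omega)
    have h2 := h b (by omega)
    have h3 := h2.1
    have h4 := h2.2.1
    omega

lemma chain_step (hB : Big δ E M s) (hσ : σ = 1 ∨ σ = -1) {u : Z3 → ℝ} {ε : ℝ} {x : Z3}
    (hT : |T δ E V u (x + σ • stdv 2)| ≤ ε) (hx : u x ≠ 0) (hε : M * ε ≤ |u x|) :
    ∃ y, Step σ x y ∧ |u x| ≤ M * |u y| := by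
  by_contra hcon
  push Not at hcon
  have hM := hB.M_pos
  have hx0 : 0 < |u x| := abs_pos.2 hx
  set y := x + σ • stdv 2 with hy
  have hst : ∀ z, Step σ x z → |u z| ≤ |u x| / M := fun z hz => by
    rw [le_div_iff₀ hM, mul_comm]; exact (hcon z hz).le
  have s0 : Step σ x y := by
    rcases hσ with rfl | rfl <;> simp [Step, hgt, hy, stdv] 
  have s1 : Step σ x (y + σ • stdv 2) := by
    rcases hσ with rfl | rfl <;> simp [Step, hgt, hy, stdv] <;> omega
  have s2 : Step σ x (y + stdv 0) := by
    rcases hσ with rfl | rfl <;> simp [Step, hgt, hy, stdv] 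
  have s3 : Step σ x (y - stdv 0) := by
    rcases hσ with rfl | rfl <;> simp [Step, hgt, hy, stdv] 
  have s4 : Step σ x (y + stdv 1) := by
    rcases hσ with rfl | rfl <;> simp [Step, hgt, hy, stdv] 
  have s5 : Step σ x (y - stdv 1) := by
    rcases hσ with rfl | rfl <;> simp [Step, hgt, hy, stdv] 
  have hback : y - σ • stdv 2 = x := by simp [hy]
  have hn : nbs u y = u x + u (y + σ • stdv 2) + u (y + stdv 0) + u (y - stdv 0) + u (y + stdv 1)
      + u (y - stdv 1) := by
    rw [← hback]
    rcases hσ with rfl | rfl <;> simp [nbs, Fin.sum_univ_three, sub_eq_add_neg] <;> ring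
  have b0 := hst _ s0
  have b1 := hst _ s1
  have b2 := hst _ s2
  have b3 := hst _ s3
  have b4 := hst _ s4
  have b5 := hst _ s5
  have hco : |6 + δ * (if V y then 1 else 0) - E| ≤ 6 + δ := by
    have := hB.hE0; have := hB.hE1; have := hB.hδ
    rw [abs_le]; split_ifs <;> constructor <;> linarith
  have hux : u x = (6 + δ * (if V y then 1 else 0) - E) * u y - T δ E V u y - u (y + σ • stdv 2)
      - u (y + stdv 0) - u (y - stdv 0) - u (y + stdv 1) - u (y - stdv 1) := by
    simp only [T]; rw [hn]; ring
  have h1 : |u x| ≤ (6 + δ) * (|u x| / M) + ε + |u x| / M + |u x| / M + |u x| / M + |u x| / M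
      + |u x| / M := by
    conv_lhs => rw [hux]
    refine (abs_sub _ _).trans (add_le_add ?_ b5)
    refine (abs_sub _ _).trans (add_le_add ?_ b4)
    refine (abs_sub _ _).trans (add_le_add ?_ b3)
    refine (abs_sub _ _).trans (add_le_add ?_ b2)
    refine (abs_sub _ _).trans (add_le_add ?_ b1)
    refine (abs_sub _ _).trans (add_le_add ?_ hT)
    rw [abs_mul]
    exact mul_le_mul hco b0 (abs_nonneg _) (by linarith [hB.hδ])
  have h2 : ε ≤ |u x| / M := by rw [le_div_iff₀ hM, mul_comm]; exact hε
  have h3 : |u x| = M * (|u x| / M) := by field_simp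
  have h4 : 0 < |u x| / M := by positivity
  have h5 := hB.hδM
  nlinarith

lemma chain_path (hB : Big δ E M s) (hσ : σ = 1 ∨ σ = -1) {Λ : Finset Z3} {u : Z3 → ℝ} {ε : ℝ}
    (hu : ∀ x ∉ Λ, u x = 0) (hT : ∀ x ∈ Λ, |T δ E V u x| ≤ ε) {x : Z3} (hux : u x ≠ 0) (N : ℕ)
    (hε : M ^ (N + 1) * ε ≤ |u x|)
    (hroom : ∀ y ∈ Λ, hgt σ y ≤ hgt σ x + 2 * N → y + σ • stdv 2 ∈ Λ) :
    ∃ γ : ℕ → Z3, γ 0 = x ∧ (∀ n < N, Step σ (γ n) (γ (n + 1))) ∧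
      ∀ n ≤ N, γ n ∈ Λ ∧ |u x| ≤ M ^ n * |u (γ n)| := by
  classical
  have hM := hB.M_pos
  have hmem : ∀ y, u y ≠ 0 → y ∈ Λ := fun y hy => by
    by_contra h
    exact hy (hu y h)
  induction N with
  | zero => exact ⟨fun _ => x, rfl, by simp, fun n hn => ⟨hmem x hux, by
      rw [Nat.le_zero.1 hn]; simp⟩⟩
  | succ N ih =>
    have hε0 : 0 ≤ ε := (abs_nonneg _).trans (hT x (hmem x hux))
    obtain ⟨γ, h0, hst, hγ⟩ := ih
      (le_trans (mul_le_mul_of_nonneg_right (pow_le_pow_right₀ hB.one_le_M (by omega)) hε0) hε)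
      (fun y hy h => hroom y hy (by push_cast; omega))
    have hN := hγ N le_rfl
    have hg := (path_gain hst (Nat.zero_le N) le_rfl).2
    have hpos : 0 < |u (γ N)| := by
      by_contra h
      have : |u (γ N)| = 0 := le_antisymm (not_lt.1 h) (abs_nonneg _)
      rw [this, mul_zero] at hN
      exact hux (abs_eq_zero.1 (le_antisymm hN.2 (abs_nonneg _)))
    have hmem1 : γ N + σ • stdv 2 ∈ Λ := by
      apply hroom _ hN.1
      rw [h0] at hg
      push_cast; omega
    obtain ⟨y, hy1, hy2⟩ := chain_step hB hσ (hT _ hmem1) (abs_pos.1 hpos) (by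
      have h1 : M ^ N * (M ^ 2 * ε) ≤ M ^ N * |u (γ N)| := by
        calc _ = M ^ (N + 1 + 1) * ε := by ring
          _ ≤ _ := hε.trans hN.2
      have h2 := le_of_mul_le_mul_left h1 (by positivity)
      refine le_trans ?_ h2
      have := hB.one_le_M
      exact mul_le_mul_of_nonneg_right (by nlinarith) hε0)
    have hfin : |u x| ≤ M ^ (N + 1) * |u y| := by
      calc _ ≤ M ^ N * |u (γ N)| := hN.2
        _ ≤ M ^ N * (M * |u y|) := by gcongr
        _ = _ := by ring
    have hy0 : u y ≠ 0 := by
      intro h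
      rw [h] at hfin; simp at hfin; exact hux hfin
    refine ⟨fun n => if n ≤ N then γ n else y, by simp [h0], ?_, ?_⟩
    · intro n hn
      rcases Nat.lt_succ_iff_lt_or_eq.1 hn with h | h
      · have h1 : n ≤ N := h.le
        have h2 : n + 1 ≤ N := h
        simp only [h1, h2, if_true]
        exact hst n h
      · subst h; simpa using hy1
    · intro n hn
      rcases Nat.le_succ_iff.1 hn with h | h
      · simp only [h, if_true]; exact hγ n h
      · subst h
        simp only [Nat.succ_eq_add_one, Nat.not_succ_le_self, if_false]
        exact ⟨hmem y hy0, hfin⟩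

/-- A nearly harmonic function propagates upwards to a clean site of a prescribed slab. -/
lemma chain_clean (hB : Big δ E M s) (hσ : σ = 1 ∨ σ = -1) {c : Z3} {L : ℕ}
    {u : Z3 → ℝ} {ε : ℝ}
    (hu : ∀ x ∉ cube c L, u x = 0) (hT : ∀ x ∈ cube c L, |T δ E V u x| ≤ ε) {x : Z3}
    (hux : u x ≠ 0) {t : ℤ} {D : ℕ} (hxt : hgt σ x ≤ t) (hD : t + s ^ 2 ≤ hgt σ x + D)
    (hε : M ^ (D + 1) * ε ≤ |u x|)
    (hroom : ∀ y ∈ cube c L, hgt σ y ≤ hgt σ x + 2 * D → y + σ • stdv 2 ∈ cube c L)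
    (hhit : ∀ y ∈ cube c L, t ≤ hgt σ y → hgt σ y < t + s ^ 2 → Hit δ E M s (sub c L s y) V) :
    ∃ z ∈ cube c L, CleanL δ E M s c L V z ∧ t ≤ hgt σ z ∧ hgt σ z < t + s ^ 2 ∧
      |u x| ≤ M ^ D * |u z| := by
  classical
  obtain ⟨γ, h0, hst, hγ⟩ := chain_path hB hσ hu hT hux D hε hroom
  have hs6 : (10 : ℝ) ^ 6 ≤ s := hB.le_s
  have hs6' : 10 ^ 6 ≤ s := by exact_mod_cast hs6
  obtain ⟨q, hq⟩ : ∃ q : ℕ, s ^ 2 / 8 = q := ⟨_, rfl⟩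
  have hs2 : 10 ^ 12 ≤ s ^ 2 := by nlinarith
  have hq1 : 8 * q ≤ s ^ 2 := by omega
  have hq2 : s ^ 2 ≤ 8 * q + 7 := by omega
  have hqz1 : 8 * (q : ℤ) ≤ (s : ℤ) ^ 2 := by exact_mod_cast hq1
  have hqz2 : (s : ℤ) ^ 2 ≤ 8 * q + 7 := by exact_mod_cast hq2
  have hq3 : (10 : ℤ) ^ 6 ≤ q := by have : (10 : ℤ) ^ 12 ≤ (s : ℤ) ^ 2 := by exact_mod_cast hs2
                                    omega
  have hgD := path_gain hst (Nat.zero_le D) le_rfl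
  rw [h0] at hgD
  have hex : ∃ n, t ≤ hgt σ (γ n) := ⟨D, by omega⟩
  set n := Nat.find hex with hn
  have hn1 : t ≤ hgt σ (γ n) := Nat.find_spec hex
  have hnD : n ≤ D := Nat.find_min' hex (by omega)
  have hn2 : hgt σ (γ n) ≤ t + 1 := by
    rcases Nat.eq_zero_or_pos n with h | h
    · rw [h, h0]; omega
    · have h1 := Nat.find_min hex (show n - 1 < n by omega)
      have h2 := (hst (n - 1) (by omega)).2.1
      rw [Nat.sub_add_cancel h] at h2
      omega
  have hex2 : ∃ m, hgt σ (γ n) + q + 1 ≤ hgt σ (γ m) := ⟨D, by omega⟩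
  set m := Nat.find hex2 with hm
  have hm1 : hgt σ (γ n) + q + 1 ≤ hgt σ (γ m) := Nat.find_spec hex2
  have hmD : m ≤ D := Nat.find_min' hex2 (by omega)
  have hnm : n ≤ m := by
    by_contra h
    have := (path_gain hst (not_le.1 h).le hnD).1
    omega
  have hm2 : hgt σ (γ m) ≤ hgt σ (γ n) + q + 2 := by
    rcases Nat.eq_zero_or_pos m with h | h
    · have : n = 0 := by omega
      rw [h, this] at *
      omega
    · have h1 := Nat.find_min hex2 (show m - 1 < m by omega)
      have h2 := (hst (m - 1) (by omega)).2.1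
      rw [Nat.sub_add_cancel h] at h2
      omega
  have hdist : ∀ k, n ≤ k → k ≤ m → dist (γ k) (γ n) ≤ (q : ℝ) + 2 ∧ hgt σ (γ k) ≤ hgt σ (γ n) + q + 2
      ∧ hgt σ (γ n) ≤ hgt σ (γ k) := by
    intro k hk1 hk2
    have h1 := path_dist_le hσ hst hk1 (hk2.trans hmD)
    have h2 := (path_gain hst hk2 hmD).1
    have h3 := (path_gain hst hk1 (hk2.trans hmD)).1
    have h4 : hgt σ (γ k) - hgt σ (γ n) ≤ q + 2 := by omega
    refine ⟨?_, by omega, by omega⟩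
    rw [dist_comm]
    refine h1.trans ?_
    exact_mod_cast h4
  have hqr : 8 * (q : ℝ) ≤ (s : ℝ) ^ 2 := by exact_mod_cast hq1
  have hqr2 : (s : ℝ) ^ 2 ≤ 8 * q + 7 := by exact_mod_cast hq2
  have hq3r : (10 : ℝ) ^ 6 ≤ q := by exact_mod_cast hq3
  obtain ⟨k, hk, hclean⟩ := hhit (γ n) (hγ n hnD).1 hn1 (by omega) σ hσ (fun k => γ (n + k)) (m - n)
    (fun k hk => hst (n + k) (by omega))
    (fun k hk => by
      by_contra hcon
      have h1 := le_dist_of_notMem_sub (hγ (n + k) (by omega)).1 hcon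
      have h2 := (hdist (n + k) (by omega) (by omega)).1
      linarith)
    (by
      have : n + (m - n) = m := by omega
      simp only [this, add_zero]
      have h1 : ((hgt σ (γ n) : ℤ) : ℝ) + q + 1 ≤ hgt σ (γ m) := by exact_mod_cast hm1
      linarith)
  have hk' := hdist (n + k) (by omega) (by omega)
  have hmem := hγ (n + k) (by omega)
  refine ⟨γ (n + k), hmem.1, ⟨γ n, (hγ n hnD).1, by linarith [hk'.1], hclean⟩, by omega, by omega, ?_⟩
  refine hmem.2.trans ?_
  gcongr
  · exact hB.one_le_M
  · omega

end Chain

section LowRank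

open Module

lemma sum_norm_sq_proj {ι : Type*} [Fintype ι] [DecidableEq ι]
    (K : Submodule ℝ (EuclideanSpace ℝ ι)) :
    ∑ i, ‖K.starProjection (EuclideanSpace.single i (1 : ℝ))‖ ^ 2 = finrank ℝ K := by
  have hproj : LinearMap.IsProj K (K.starProjection : EuclideanSpace ℝ ι →ₗ[ℝ] EuclideanSpace ℝ ι) :=
    ⟨fun x => K.starProjection_apply_mem x, fun x hx => K.starProjection_eq_self_iff.2 hx⟩
  have h1 := hproj.trace
  rw [LinearMap.trace_eq_sum_inner _ (EuclideanSpace.basisFun ι ℝ)] at h1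
  rw [← h1]
  refine Finset.sum_congr rfl fun i _ => ?_
  rw [EuclideanSpace.basisFun_apply]
  change _ = inner ℝ (EuclideanSpace.single i (1 : ℝ)) (K.starProjection (EuclideanSpace.single i (1 : ℝ)))
  have h2 : inner ℝ (EuclideanSpace.single i (1 : ℝ)) (K.starProjection (EuclideanSpace.single i (1 : ℝ)))
      = inner ℝ (K.starProjection (EuclideanSpace.single i (1 : ℝ)))
        (K.starProjection (EuclideanSpace.single i (1 : ℝ))) := by
    rw [Submodule.inner_starProjection_left_eq_right,
      K.starProjection_eq_self_iff.2 (K.starProjection_apply_mem _)]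
  rw [h2, real_inner_self_eq_norm_sq]

/-- A matrix with a large diagonal, square summable weighted columns and approximately low rank
has small total weight. -/
lemma weight_sum_le {ι κ : Type*} [Fintype ι] [Fintype κ] [DecidableEq ι]
    (A : ι → ι → ℝ) (F : κ → ι → ℝ) (w : ι → ℝ) {c0 C τ : ℝ} (hc0 : 0 < c0)
    (hτ0 : 0 ≤ τ) (hC : 0 ≤ C) (hw0 : ∀ i, 0 ≤ w i) (hw1 : ∀ i, w i ≤ 1)
    (hdiag : ∀ i, c0 ≤ |A i i|) (hcol : ∀ i, w i * ∑ j, A j i ^ 2 ≤ C)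
    (hF : ∀ v : ι → ℝ, (∀ k, ∑ i, F k i * v i = 0) → ∀ j, |∑ i, A j i * v i| ≤ τ * ∑ i, |v i|)
    (hτ : τ * (Fintype.card ι : ℝ) ^ 2 ≤ c0 / 2) :
    ∑ i, w i ≤ 1 + 4 * C * Fintype.card κ / c0 ^ 2 := by
  classical
  set W := ∑ i, w i with hW
  rcases le_total W 1 with hW1 | hW1
  · have : 0 ≤ 4 * C * Fintype.card κ / c0 ^ 2 := by positivity
    linarith
  set θ : ι → ℝ := fun i => w i * SignType.sign (A i i) with hθ
  have hθ1 : ∀ i, |θ i| ≤ 1 := by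
    intro i
    rw [hθ, abs_mul, abs_of_nonneg (hw0 i)]
    have : |((SignType.sign (A i i) : SignType) : ℝ)| ≤ 1 := by
      rcases lt_trichotomy (A i i) 0 with h | h | h <;> simp [h]
    exact mul_le_one₀ (hw1 i) (abs_nonneg _) this
  have hθsq : ∀ i, θ i ^ 2 ≤ w i ^ 2 := by
    intro i
    have : |((SignType.sign (A i i) : SignType) : ℝ)| ≤ 1 := by
      rcases lt_trichotomy (A i i) 0 with h | h | h <;> simp [h]
    have h2 : |θ i| ≤ w i := by
      rw [hθ, abs_mul, abs_of_nonneg (hw0 i)]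
      exact mul_le_of_le_one_right (hw0 i) this
    exact sq_le_sq.2 (by rwa [abs_of_nonneg (hw0 i)])
  let G : EuclideanSpace ℝ ι →ₗ[ℝ] (κ → ℝ) :=
    { toFun := fun v k => ∑ i, F k i * (θ i * v i)
      map_add' := fun v v' => by
        ext k; simp only [PiLp.add_apply, Pi.add_apply, ← Finset.sum_add_distrib]
        exact Finset.sum_congr rfl fun _ _ => by ring
      map_smul' := fun a v => by
        ext k
        simp only [PiLp.smul_apply, smul_eq_mul, Pi.smul_apply, RingHom.id_apply, Finset.mul_sum]
        exact Finset.sum_congr rfl fun _ _ => by ring }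
  set K := LinearMap.ker G with hK
  have hrank : (finrank ℝ Kᗮ : ℝ) ≤ Fintype.card κ := by
    have h1 := K.finrank_add_finrank_orthogonal
    have h2 : finrank ℝ (LinearMap.range G) + finrank ℝ K = _ := G.finrank_range_add_finrank_ker
    have h3 : finrank ℝ (LinearMap.range G) ≤ finrank ℝ (κ → ℝ) := Submodule.finrank_le _
    rw [finrank_fintype_fun_eq_card] at h3
    have : finrank ℝ Kᗮ ≤ Fintype.card κ := by omega
    exact_mod_cast this
  set e : ι → EuclideanSpace ℝ ι := fun i => EuclideanSpace.single i (1 : ℝ) with he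
  set P : ι → EuclideanSpace ℝ ι := fun i => K.starProjection (e i) with hP
  set Q : ι → EuclideanSpace ℝ ι := fun i => Kᗮ.starProjection (e i) with hQ
  have hPQ : ∀ i j, (e i) j = P i j + Q i j := by
    intro i j
    have := K.starProjection_add_starProjection_orthogonal (e i)
    conv_lhs => rw [← this]
    rfl
  have hPle : ∀ i j, |P i j| ≤ 1 := by
    intro i j
    have h1 : ‖P i‖ ≤ ‖e i‖ := K.norm_starProjection_apply_le (e i)
    have h2 : ‖P i j‖ ≤ ‖P i‖ := PiLp.norm_apply_le _ _
    have h3 : ‖e i‖ = 1 := by simp [he]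
    rw [Real.norm_eq_abs] at h2
    linarith
  have hPsmall : ∀ i, |∑ j, A i j * (θ j * P i j)| ≤ τ * Fintype.card ι := by
    intro i
    have hmem : P i ∈ K := K.starProjection_apply_mem _
    have h1 := hF (fun j => θ j * P i j) (fun k => congrFun (LinearMap.mem_ker.1 hmem) k) i
    refine h1.trans (mul_le_mul_of_nonneg_left ?_ hτ0)
    calc ∑ j, |θ j * P i j| ≤ ∑ _j : ι, (1 : ℝ) := Finset.sum_le_sum fun j _ => by
          rw [abs_mul]; exact mul_le_one₀ (hθ1 j) (abs_nonneg _) (hPle i j)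
      _ = _ := by simp
  have htrace : c0 * W ≤ ∑ i, ∑ j, A i j * (θ j * e i j) := by
    rw [hW, Finset.mul_sum]
    refine Finset.sum_le_sum fun i _ => ?_
    rw [Finset.sum_eq_single i (fun j _ hj => by simp [he, hj]) (fun h => absurd (Finset.mem_univ _) h)]
    have : A i i * (θ i * e i i) = |A i i| * w i := by
      simp only [he, hθ, PiLp.single_apply, if_true, mul_one]
      rw [← self_mul_sign (A i i)]; ring_nf
    rw [this]
    exact mul_le_mul_of_nonneg_right (hdiag i) (hw0 i)
  have hsplit : ∑ i, ∑ j, A i j * (θ j * e i j) =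
      ∑ i, ∑ j, A i j * (θ j * P i j) + ∑ i, ∑ j, A i j * (θ j * Q i j) := by
    simp only [← Finset.sum_add_distrib]
    exact Finset.sum_congr rfl fun i _ => Finset.sum_congr rfl fun j _ => by rw [hPQ]; ring
  have h1 : ∑ i, ∑ j, A i j * (θ j * P i j) ≤ c0 / 2 := by
    refine le_trans ?_ hτ
    calc _ ≤ ∑ _i : ι, τ * Fintype.card ι := Finset.sum_le_sum fun i _ => (le_abs_self _).trans (hPsmall i)
      _ = _ := by simp; ring
  have h2 : (∑ i, ∑ j, A i j * (θ j * Q i j)) ^ 2 ≤ (C * W) * Fintype.card κ := by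
    have hcs := Finset.sum_mul_sq_le_sq_mul_sq (Finset.univ : Finset (ι × ι))
      (fun p => A p.1 p.2 * θ p.2) (fun p => Q p.1 p.2)
    rw [Fintype.sum_prod_type, Fintype.sum_prod_type, Fintype.sum_prod_type] at hcs
    simp only [mul_assoc] at hcs
    refine hcs.trans ?_
    refine mul_le_mul ?_ ?_ (by positivity) (by positivity)
    · rw [Finset.sum_comm, hW, Finset.mul_sum]
      refine Finset.sum_le_sum fun i _ => ?_
      simp only [mul_pow]
      rw [← Finset.sum_mul]
      have h5 : 0 ≤ ∑ j, A j i ^ 2 := Finset.sum_nonneg fun j _ => sq_nonneg _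
      have h6 := mul_le_mul_of_nonneg_left (hθsq i) h5
      have h7 := mul_le_mul_of_nonneg_left (hcol i) (hw0 i)
      nlinarith
    · refine le_trans (le_of_eq ?_) hrank
      rw [← sum_norm_sq_proj]
      refine Finset.sum_congr rfl fun i _ => ?_
      rw [EuclideanSpace.norm_sq_eq]
      simp [hQ, he]
  have h3 : c0 * W / 2 ≤ ∑ i, ∑ j, A i j * (θ j * Q i j) := by nlinarith
  have h4 : (c0 * W / 2) ^ 2 ≤ (C * W) * Fintype.card κ :=
    (pow_le_pow_left₀ (by positivity) h3 2).trans h2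
  have h5 : W ≤ 4 * C * Fintype.card κ / c0 ^ 2 := by
    rw [le_div_iff₀ (by positivity)]
    have hWp : 0 < W := by linarith
    nlinarith
  linarith

end LowRank

section Hyperbolic

/-- The indices after which the sequence drops for good by a factor `η`. -/
def HypIdx (Z : ℕ → ℝ) (J : ℕ) (η : ℝ) (j : ℕ) : Prop := ∀ i, j < i → i ≤ J → Z i ≤ η * Z j

open Classical in
lemma hyperbolic_count {Z : ℕ → ℝ} {J : ℕ} {κ η : ℝ} (hZ : ∀ j, 0 ≤ Z j) (hκ0 : 0 < κ) (hκ1 : κ ≤ 1)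
    (hη0 : 0 < η) (hη1 : η ≤ 1) (hstep : ∀ j < J, κ * Z j ≤ Z (j + 1)) :
    Z 0 * κ ^ ((Finset.range J).filter (HypIdx Z J η)).card * η ^ J ≤ Z J := by
  have key : ∀ k j, j + k = J →
      Z j * κ ^ ((Finset.Ico j J).filter (HypIdx Z J η)).card * η ^ k ≤ Z J := by
    intro k
    induction k using Nat.strong_induction_on with
    | _ k ih =>
    intro j hj
    rcases Nat.eq_zero_or_pos k with rfl | hk
    · have : j = J := by omega
      subst this; simp
    by_cases hh : HypIdx Z J η j
    · have h1 := ih (k - 1) (by omega) (j + 1) (by omega)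
      have hcard : ((Finset.Ico j J).filter (HypIdx Z J η)).card =
          ((Finset.Ico (j + 1) J).filter (HypIdx Z J η)).card + 1 := by
        rw [← Finset.insert_Ico_add_one_left_eq_Ico (by omega : j < J), Finset.filter_insert, if_pos hh,
          Finset.card_insert_of_notMem (by simp)]
      rw [hcard]
      refine le_trans ?_ h1
      have h2 := hstep j (by omega)
      have h3 : η ^ k ≤ η ^ (k - 1) := pow_le_pow_of_le_one hη0.le hη1 (by omega)
      have hp : 0 ≤ κ ^ ((Finset.Ico (j + 1) J).filter (HypIdx Z J η)).card := by positivity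
      calc _ = (κ * Z j) * κ ^ ((Finset.Ico (j + 1) J).filter (HypIdx Z J η)).card * η ^ k := by ring
        _ ≤ _ := by
          gcongr
          exact mul_nonneg (hZ _) hp
    · unfold HypIdx at hh
      push Not at hh
      obtain ⟨i, hi1, hi2, hi3⟩ := hh
      have h1 := ih (J - i) (by omega) i (by omega)
      refine le_trans ?_ h1
      have h3 : η ^ (k - 1) ≤ η ^ (J - i) := pow_le_pow_of_le_one hη0.le hη1 (by omega)
      have h4 : κ ^ ((Finset.Ico j J).filter (HypIdx Z J η)).card ≤
          κ ^ ((Finset.Ico i J).filter (HypIdx Z J η)).card :=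
        pow_le_pow_of_le_one hκ0.le hκ1 (Finset.card_le_card
          (Finset.filter_subset_filter _ (Finset.Ico_subset_Ico hi1.le le_rfl)))
      have h5 : η ^ k = η * η ^ (k - 1) := by
        rw [← pow_succ']; congr 1; omega
      calc _ = (η * Z j) * κ ^ ((Finset.Ico j J).filter (HypIdx Z J η)).card * η ^ (k - 1) := by
            rw [h5]; ring
        _ ≤ Z i * κ ^ ((Finset.Ico i J).filter (HypIdx Z J η)).card * η ^ (J - i) := by
          gcongr
          · exact mul_nonneg (hZ _) (by positivity)
          · exact hZ _
  have := key J 0 (by omega)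
  rwa [Nat.Ico_zero_eq_range] at this

end Hyperbolic

section Incoming

variable {δ E M : ℝ} {s : ℕ}

lemma flipAt_update_false (W : Cfg) (i : Z3) :
    Function.update (flipAt W i) i false = Function.update W i false := by
  simp [flipAt]

lemma T_change_at {W W' : Cfg} {i : Z3} (h : ∀ z, z ≠ i → W z = W' z) (u : Z3 → ℝ) (z : Z3) :
    T δ E W u z = T δ E W' u z + if z = i then
      δ * ((if W i then 1 else 0) - (if W' i then 1 else 0)) * u i else 0 := by
  by_cases hz : z = i
  · subst hz; simp only [T, if_true]; ring
  · simp only [T, hz, if_false, h z hz]; ring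

lemma Clean.resolvent_bounds (hB : Big δ E M s) {r : Z3 → ℝ} {Q : Finset Z3} {i : Z3} (hi : i ∈ Q)
    (h1 : -(1 / (2 * M) - 1 / s) ≤ r i) (h2 : ∑ z ∈ Q, r z ^ 2 ≤ (M - 1 / s) ^ 2) :
    1 / 2 ≤ 1 + δ * r i ∧ r i ≤ M ∧ ∑ z ∈ Q, r z ^ 2 ≤ M ^ 2 := by
  have hM := hB.M_pos
  have hs := hB.s_pos
  have hs1 : 0 < 1 / (s : ℝ) := by positivity
  have hs2 : 1 / (s : ℝ) ≤ 1 := by rw [div_le_one hs]; linarith [hB.le_s]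
  have h3 : ∑ z ∈ Q, r z ^ 2 ≤ M ^ 2 := h2.trans (by nlinarith [hB.one_le_M])
  refine ⟨?_, ?_, h3⟩
  · have h4 : δ * (1 / (2 * M)) ≤ 1 / 2 := by
      rw [mul_one_div, div_le_iff₀ (by positivity)]; linarith [hB.hδM]
    have h5 : δ * (-(1 / (2 * M) - 1 / s)) ≤ δ * r i := mul_le_mul_of_nonneg_left h1 hB.hδ.le
    have h6 : 0 < δ * (1 / s) := mul_pos hB.hδ hs1
    nlinarith
  · have h4 : r i ^ 2 ≤ M ^ 2 :=
      (Finset.single_le_sum (f := fun z => r z ^ 2) (fun z _ => sq_nonneg _) hi).trans h3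
    exact (abs_le_of_sq_le_sq' h4 hM.le).2

/-- Correcting a nearly annihilated function of the flipped configuration at the flipped site. -/
lemma exists_correction (hB : Big δ E M s) {c : Z3} {L : ℕ} (hL : s ^ 2 ≤ L) {W : Cfg} {i : Z3}
    {u : Z3 → ℝ} {ε : ℝ}
    (hT : ∀ x ∈ cube c L, |T δ E (flipAt W i) u x| ≤ ε)
    (hclean : CleanL δ E M s c L (flipAt W i) i) :
    ∃ (r : Z3 → ℝ) (k : ℝ), |k| ≤ 2 * M ∧ (∀ x ∉ cube c L, r x = 0) ∧
      ∑ z ∈ cube c L, r z ^ 2 ≤ M ^ 2 ∧ 1 / (2 * M ^ 2) ≤ |1 + k * r i| ∧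
      ∀ z ∈ cube c L, |T δ E W (fun x => u x + k * u i * r x) z| ≤
        ε + 12 * M * Real.exp (-(s : ℝ) ^ 2 / (8 * M)) * |u i| := by
  classical
  obtain ⟨y, hy, hdy, hiQ, r, hr0, hrT, hrx, hr2, hrdec⟩ := hclean
  rw [flipAt_update_false] at hrT
  set Q := sub c L s y with hQ
  have hQΛ : Q ⊆ cube c L := sub_subset hL y
  obtain ⟨b1, b2, b3⟩ := Clean.resolvent_bounds hB hiQ hrx hr2
  have hM := hB.M_pos
  have hM1 := hB.one_le_M
  have hs := hB.s_pos
  have hδM : δ ≤ M := by linarith [hB.hδM]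
  have hδ := hB.hδ
  have hr0' : ∀ x ∉ cube c L, r x = 0 := fun x hx => hr0 x fun h => hx (hQΛ h)
  have hsum : ∑ z ∈ cube c L, r z ^ 2 ≤ M ^ 2 := by
    rw [← Finset.sum_subset hQΛ]
    · exact b3
    · intro x _ hx; simp [hr0 x hx]
  have hfar : ∀ z ∈ cube c L, z ∉ Q → |nbs r z| ≤ 6 * Real.exp (-(s : ℝ) ^ 2 / (8 * M)) := by
    intro z hz hzQ
    apply nbs_abs_le
    intro b hb
    by_cases hbQ : b ∈ Q
    · have h1 := le_dist_of_notMem_sub hz hzQ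
      have h2 : dist z y ≤ dist b z + dist b i + dist i y := by
        have := dist_triangle z b y
        have := dist_triangle b i y
        rw [dist_comm z b] at *
        linarith
      have hs2 : (10 : ℝ) ^ 6 * s ≤ s ^ 2 := by nlinarith [hB.le_s]
      have h3 : (s : ℝ) ^ 2 / 8 ≤ dist b i := by linarith [hB.le_s]
      refine (hrdec b hbQ h3).trans ?_
      rw [Real.exp_le_exp]
      have h4 : 1 / M * ((s : ℝ) ^ 2 / 8) ≤ (1 / M + 3 / s) * dist b i := by
        refine mul_le_mul ?_ h3 (by positivity) (by positivity)
        have : 0 < 3 / (s : ℝ) := by positivity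
        linarith
      have h5 : 1 / M * ((s : ℝ) ^ 2 / 8) = -(-(s : ℝ) ^ 2 / (8 * M)) := by field_simp
      linarith
    · rw [hr0 b hbQ]; simpa using (Real.exp_pos _).le
  -- the common final estimate
  have hfin : ∀ k : ℝ, |k| ≤ 2 * M → (∀ z ∈ Q, T δ E W (fun x => u x + k * u i * r x) z =
      T δ E (flipAt W i) u z) → ∀ z ∈ cube c L, |T δ E W (fun x => u x + k * u i * r x) z| ≤
        ε + 12 * M * Real.exp (-(s : ℝ) ^ 2 / (8 * M)) * |u i| := by
    intro k hk hkQ z hz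
    by_cases hzQ : z ∈ Q
    · rw [hkQ z hzQ]
      refine (hT z hz).trans ?_
      have : 0 ≤ 12 * M * Real.exp (-(s : ℝ) ^ 2 / (8 * M)) * |u i| := by positivity
      linarith
    · have hzi : z ≠ i := fun h => hzQ (h ▸ hiQ)
      rw [T_add, T_mul]
      have h1 : T δ E W u z = T δ E (flipAt W i) u z := by
        refine T_congr ?_ fun _ _ => rfl
        simp [flipAt, hzi]
      have h2 : T δ E W r z = - nbs r z := by simp [T, hr0 z hzQ]
      rw [h1, h2]
      refine (abs_add_le _ _).trans (add_le_add (hT z hz) ?_)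
      rw [abs_mul, abs_mul, abs_neg]
      calc |k| * |u i| * |nbs r z| ≤ 2 * M * |u i| * (6 * Real.exp (-(s : ℝ) ^ 2 / (8 * M))) := by
            gcongr
            exact hfar z hz hzQ
        _ = _ := by ring
  by_cases hW : W i = true
  · refine ⟨r, -(δ / (1 + δ * r i)), ?_, hr0', hsum, ?_, ?_⟩
    · rw [abs_neg, abs_of_nonneg (by positivity), div_le_iff₀ (by linarith)]
      nlinarith
    · have h1 : 1 + -(δ / (1 + δ * r i)) * r i = 1 / (1 + δ * r i) := by
        have : 1 + δ * r i ≠ 0 := by linarith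
        field_simp
        ring
      rw [h1, abs_of_nonneg (by apply div_nonneg <;> linarith)]
      apply one_div_le_one_div_of_le (by linarith)
      have h2 : δ * r i ≤ δ * M := mul_le_mul_of_nonneg_left b2 hδ.le
      nlinarith
    · apply hfin
      · rw [abs_neg, abs_of_nonneg (by positivity), div_le_iff₀ (by linarith)]
        nlinarith
      · intro z hz
        rw [T_add, T_mul, T_change_at (W := W) (W' := flipAt W i) (i := i)
          (fun z hz => by simp [flipAt, hz]) u z,
          T_change_at (W := W) (W' := Function.update W i false) (i := i)
          (fun z hz => by simp [hz]) r z, hrT z hz]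
        by_cases hzi : z = i
        · subst hzi
          have : 1 + δ * r z ≠ 0 := by linarith
          simp only [flipAt, hW, Function.update_self, if_true, Bool.not_true, Bool.false_eq_true,
            if_false]
          field_simp
          ring
        · simp [hzi]
  · have hW' : W i = false := by simpa using hW
    refine ⟨r, δ, by rw [abs_of_pos hδ]; linarith, hr0', hsum, ?_, ?_⟩
    · rw [abs_of_nonneg (by linarith)]
      refine le_trans ?_ b1
      exact one_div_le_one_div_of_le (by norm_num) (by nlinarith)
    · apply hfin
      · rw [abs_of_pos hδ]; linarith
      · intro z hz
        have hWW : Function.update W i false = W := by rw [← hW']; simp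
        rw [hWW] at hrT
        rw [T_add, T_mul, T_change_at (W := W) (W' := flipAt W i) (i := i)
          (fun z hz => by simp [flipAt, hz]) u z, hrT z hz]
        by_cases hzi : z = i
        · subst hzi
          simp only [flipAt, hW', Function.update_self, if_true, Bool.not_false, Bool.false_eq_true,
            if_false]
          ring
        · simp [hzi]

lemma incoming_numeric (hB : Big δ E M s) {n : ℝ} (hn0 : 0 ≤ n) (hn : n ≤ (s : ℝ) ^ 120) :
    2 * s ^ 6 * Real.exp s * (13 * M * Real.exp (-(s : ℝ) ^ 2 / (8 * M))) * n ^ 2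
      ≤ 1 / (2 * M ^ 2) / 2 := by
  have hM := hB.M_pos
  have hs := hB.s_pos
  have h1 : 16 * M ≤ s := by
    have := hB.pow_le (k := 2) (by norm_num)
    nlinarith [hB.hM]
  have h2 : Real.exp (-(s : ℝ) ^ 2 / (8 * M)) ≤ Real.exp (-(2 * s)) := by
    rw [Real.exp_le_exp, div_le_iff₀ (by positivity)]
    nlinarith
  have h3 : n ^ 2 ≤ (s : ℝ) ^ 240 := by
    calc n ^ 2 ≤ ((s : ℝ) ^ 120) ^ 2 := by gcongr
      _ = _ := by ring
  have h4 : 104 * M ^ 3 ≤ (s : ℝ) := by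
    have := hB.pow_le (k := 4) (by norm_num)
    nlinarith [hB.hM, pow_pos hM 3]
  have h5 : (s : ℝ) ^ 247 ≤ Real.exp s := by
    rw [hB.pow_eq, Real.exp_le_exp]
    push_cast
    linarith [hB.log_le, hB.one_le_log]
  rw [div_div, le_div_iff₀ (by positivity)]
  calc _ ≤ 2 * s ^ 6 * Real.exp s * (13 * M * Real.exp (-(2 * s : ℝ))) * (s : ℝ) ^ 240
        * (2 * M ^ 2 * 2) := by gcongr
    _ = (104 * M ^ 3) * s ^ 246 * (Real.exp s * Real.exp (-(2 * s : ℝ))) := by ring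
    _ ≤ s * s ^ 246 * (Real.exp s * Real.exp (-(2 * s : ℝ))) := by gcongr
    _ = s ^ 247 * Real.exp (-(s : ℝ)) := by rw [← Real.exp_add]; ring_nf
    _ ≤ Real.exp s * Real.exp (-(s : ℝ)) := by gcongr
    _ = 1 := by rw [← Real.exp_add]; simp

/-- Bound for the total weight of the flips leading to a given configuration. -/
lemma incoming_weight_le (hB : Big δ E M s) {c : Z3} {L : ℕ} (hL : s ^ 2 ≤ L)
    (hL2 : L = s ^ 40) {W : Cfg} {B I : Finset Z3} (hI : I ⊆ cube c L)
    (hgood : ∀ y ∈ cube c L, y ∉ B → Good δ E M s (sub c L s y) W)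
    (u : Z3 → Z3 → ℝ) (w : Z3 → ℝ) {ε : ℝ} (hu : ∀ i ∈ I, ∀ x ∉ cube c L, u i x = 0)
    (hT : ∀ i ∈ I, ∀ x ∈ cube c L, |T δ E (flipAt W i) (u i) x| ≤ ε)
    (hu0 : ∀ i ∈ I, u i i ≠ 0)
    (hε : ∀ i ∈ I, ε ≤ Real.exp (-(s : ℝ) ^ 2 / (8 * M)) * |u i i|)
    (hclean : ∀ i ∈ I, CleanL δ E M s c L (flipAt W i) i)
    (hw0 : ∀ i ∈ I, 0 ≤ w i) (hw1 : ∀ i ∈ I, w i ≤ 1)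
    (hw : ∀ i ∈ I, w i * ∑ j ∈ I, u i j ^ 2 ≤ 4 * u i i ^ 2) :
    ∑ i ∈ I, w i ≤ 1 + M ^ 10 * B.card := by
  classical
  have hM := hB.M_pos
  have hM1 := hB.one_le_M
  have hs := hB.s_pos
  choose! r k hk hr0 hr2 hdiag hTv using fun i (hi : i ∈ I) =>
    exists_correction hB hL (hT i hi) (hclean i hi)
  set v : Z3 → Z3 → ℝ := fun i x => u i x + k i * u i i * r i x with hv
  set e' := 13 * M * Real.exp (-(s : ℝ) ^ 2 / (8 * M)) with he'
  have hTv' : ∀ i ∈ I, ∀ z ∈ cube c L, |T δ E W (v i) z| ≤ e' * |u i i| := by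
    intro i hi z hz
    refine (hTv i hi z hz).trans ?_
    have h1 := hε i hi
    have h2 : Real.exp (-(s : ℝ) ^ 2 / (8 * M)) * |u i i| ≤
        M * (Real.exp (-(s : ℝ) ^ 2 / (8 * M)) * |u i i|) := le_mul_of_one_le_left (by positivity) hM1
    rw [he']
    nlinarith
  have hmain := weight_sum_le (ι := I) (κ := B) (fun j i => v i j / u i i)
    (fun b i => v i b / u i i) (fun i => w i) (c0 := 1 / (2 * M ^ 2)) (C := 8 + 8 * M ^ 4)
    (τ := 2 * s ^ 6 * Real.exp s * e') (by positivity) (by positivity) (by positivity)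
    (fun i => hw0 i i.2) (fun i => hw1 i i.2) ?_ ?_ ?_ ?_
  · rw [Finset.sum_coe_sort I w] at hmain
    refine hmain.trans ?_
    rw [Fintype.card_coe]
    have h1 : 4 * (8 + 8 * M ^ 4) * (B.card : ℝ) / (1 / (2 * M ^ 2)) ^ 2
        = (128 * M ^ 4 + 128 * M ^ 8) * B.card := by field_simp; ring
    rw [h1]
    have h2 : 128 * M ^ 4 + 128 * M ^ 8 ≤ M ^ 10 := by
      have h3 : (256 : ℝ) ≤ M ^ 2 := by nlinarith [hB.hM]
      have h4 : M ^ 4 ≤ M ^ 8 := pow_le_pow_right₀ hM1 (by norm_num)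
      have h5 : 256 * M ^ 8 ≤ M ^ 2 * M ^ 8 := by gcongr
      nlinarith
    gcongr
  · rintro ⟨i, hi⟩
    have h1 := hdiag i hi
    have h2 : v i i / u i i = 1 + k i * r i i := by
      have := hu0 i hi
      simp only [hv]; field_simp
    simp only [h2]; exact h1
  · rintro ⟨i, hi⟩
    simp only
    rw [Finset.sum_coe_sort I (fun j => (v i j / u i i) ^ 2)]
    have hx : 0 < u i i ^ 2 := by have := hu0 i hi; positivity
    have h1 : ∀ j, (v i j / u i i) ^ 2 ≤ 2 * (u i j ^ 2 / u i i ^ 2) + 8 * M ^ 2 * r i j ^ 2 := by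
      intro j
      have h2 : v i j / u i i = u i j / u i i + k i * r i j := by
        have := hu0 i hi
        simp only [hv]; field_simp
      rw [h2, ← div_pow]
      have h3 : (k i) ^ 2 ≤ (2 * M) ^ 2 := sq_le_sq.2 (by rw [abs_of_pos (by linarith : 0 < 2 * M)]; exact hk i hi)
      have h4 := mul_le_mul_of_nonneg_right h3 (sq_nonneg (r i j))
      nlinarith [sq_nonneg (u i j / u i i - k i * r i j)]
    have h2 : ∑ j ∈ I, r i j ^ 2 ≤ M ^ 2 :=
      (Finset.sum_le_sum_of_subset_of_nonneg hI fun _ _ _ => sq_nonneg _).trans (hr2 i hi)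
    have h3 : w i * ∑ j ∈ I, (u i j ^ 2 / u i i ^ 2) ≤ 4 := by
      rw [← Finset.sum_div, ← mul_div_assoc, div_le_iff₀ hx]
      exact hw i hi
    calc w i * ∑ j ∈ I, (v i j / u i i) ^ 2
        ≤ w i * ∑ j ∈ I, (2 * (u i j ^ 2 / u i i ^ 2) + 8 * M ^ 2 * r i j ^ 2) := by
          refine mul_le_mul_of_nonneg_left (Finset.sum_le_sum fun j _ => h1 j) (hw0 i hi)
      _ = 2 * (w i * ∑ j ∈ I, (u i j ^ 2 / u i i ^ 2)) + w i * (8 * M ^ 2 * ∑ j ∈ I, r i j ^ 2) := by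
          rw [Finset.sum_add_distrib, ← Finset.mul_sum, ← Finset.mul_sum]; ring
      _ ≤ 2 * 4 + 1 * (8 * M ^ 2 * M ^ 2) := by
          refine add_le_add (by linarith) (mul_le_mul (hw1 i hi) (by gcongr) ?_ zero_le_one)
          exact mul_nonneg (by positivity) (Finset.sum_nonneg fun _ _ => sq_nonneg _)
      _ = _ := by ring
  · intro a ha j
    set f : Z3 → ℝ := fun x => ∑ i : I, (a i / u i i) * v i x with hf
    have hf0 : ∀ x ∉ cube c L, f x = 0 := by
      intro x hx
      refine Finset.sum_eq_zero fun i _ => ?_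
      simp [hv, hu i i.2 x hx, hr0 i i.2 x hx]
    have hfB : ∀ y ∈ B, f y = 0 := by
      intro y hy
      rw [← ha ⟨y, hy⟩]
      exact Finset.sum_congr rfl fun i _ => by ring
    have hfT : ∀ z ∈ cube c L, |T δ E W f z| ≤ e' * ∑ i, |a i| := by
      intro z hz
      rw [hf, T_sum]
      refine (Finset.abs_sum_le_sum_abs _ _).trans ?_
      rw [Finset.mul_sum]
      refine Finset.sum_le_sum fun i _ => ?_
      rw [T_mul, abs_mul, abs_div]
      have h1 := hTv' i i.2 z hz
      have h2 : 0 < |u i i| := abs_pos.2 (hu0 i i.2)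
      calc |a i| / |u i i| * |T δ E W (v i) z| ≤ |a i| / |u i i| * (e' * |u i i|) := by gcongr
        _ = _ := by field_simp
    have hmp := max_principle hB hL hf0 (fun y => y ∉ B) hgood (Φ := fun _ => 0)
      (fun x y => by simp; have := hM; positivity) (R := e' * ∑ i, |a i|) (A := 0)
      (fun y hy _ z hz => by simpa using hfT z (sub_subset hL y hz))
      (fun y _ hyB => by simp [hfB y (not_not.1 hyB)]) (hI j.2)
    have hpos : 0 ≤ 2 * s ^ 6 * Real.exp s * (e' * ∑ i, |a i|) := by
      have : 0 ≤ ∑ i, |a i| := Finset.sum_nonneg fun _ _ => abs_nonneg _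
      positivity
    rw [max_eq_right hpos] at hmp
    have hfj : f j = ∑ i : I, v i j / u i i * a i :=
      Finset.sum_congr rfl fun i _ => by ring
    simp only [Real.exp_zero, mul_one] at hmp
    rw [← hfj]
    refine hmp.trans (le_of_eq (by ring))
  · rw [Fintype.card_coe]
    refine incoming_numeric hB (by positivity) ?_
    have h1 := Finset.card_le_card hI
    rw [card_cube, hL2] at h1
    have h2 : (I.card : ℝ) ≤ (((s ^ 40) ^ 3 : ℕ) : ℝ) := by exact_mod_cast h1
    refine h2.trans (le_of_eq ?_)
    push_cast
    ring

end Incoming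

/-- A quasimode with error `ε` in the large cube, whose surroundings are robustly good up to
height `H` above the reference point `a`. -/
structure QMode (δ E M : ℝ) (s : ℕ) (c a : Z3) (σ : ℤ) (B : Finset Z3) (ε H : ℝ) (V : Cfg)
    (u : Z3 → ℝ) : Prop where
  supp : ∀ x ∉ cube c (s ^ 40), u x = 0
  norm : ∑ x ∈ cube c (s ^ 40), u x ^ 2 ≤ 1
  top : 1 / (s : ℝ) ^ 60 ≤ |u a|
  err : ∀ x ∈ cube c (s ^ 40), |T δ E V u x| ≤ ε
  good : ∀ y ∈ cube c (s ^ 40), y ∉ B → Good δ E M s (sub c (s ^ 40) s y) V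
  rg : ∀ y ∈ cube c (s ^ 40), y ∉ B → ((hgt σ y - hgt σ a : ℤ) : ℝ) ≤ H →
    RG δ E M s (sub c (s ^ 40) s y) V

/-- A range of heights above `a` which is free of bad points. -/
structure FreeZone (M : ℝ) (s : ℕ) (c a : Z3) (σ : ℤ) (B : Finset Z3) (X X' : ℝ) : Prop where
  hσ : σ = 1 ∨ σ = -1
  hX : (s : ℝ) ^ 19 ≤ X
  hX' : X' = M ^ 6 * X
  hX's : X' ≤ (s : ℝ) ^ 20
  room : ∀ y ∈ cube c (s ^ 40), ((hgt σ y - hgt σ a : ℤ) : ℝ) ≤ (s : ℝ) ^ 40 / 4 →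
    y + σ • stdv 2 ∈ cube c (s ^ 40)
  free : ∀ y ∈ cube c (s ^ 40), X ≤ ((hgt σ y - hgt σ a : ℤ) : ℝ) →
    ((hgt σ y - hgt σ a : ℤ) : ℝ) ≤ X' → y ∉ B

/-- The lowest height of the `j`-th slab. -/
noncomputable def slabLow (s : ℕ) (σ : ℤ) (a : Z3) (X : ℝ) (j : ℕ) : ℤ :=
  hgt σ a + ⌈2 * X⌉ + j * s ^ 2

open Classical in
/-- The clean sites in the `j`-th slab. -/
noncomputable def slabClean (δ E M : ℝ) (s : ℕ) (c a : Z3) (σ : ℤ) (X : ℝ) (V : Cfg) (j : ℕ) :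
    Finset Z3 :=
  (cube c (s ^ 40)).filter fun x => slabLow s σ a X j ≤ hgt σ x ∧
    hgt σ x < slabLow s σ a X j + s ^ 2 ∧ CleanL δ E M s c (s ^ 40) V x

/-- The number of slabs. -/
noncomputable def slabNum (M : ℝ) (s : ℕ) (X' : ℝ) : ℕ := ⌊X' / (200 * M ^ 2 * s ^ 2)⌋₊

section Zone

variable {δ E M : ℝ} {s : ℕ} {c a : Z3} {σ : ℤ} {B : Finset Z3} {X X' ε : ℝ} {V : Cfg} {u : Z3 → ℝ}

lemma QMode.abs_le_one (h : QMode δ E M s c a σ B ε X' V u) (x : Z3) : |u x| ≤ 1 := by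
  by_cases hx : x ∈ cube c (s ^ 40)
  · have h1 : u x ^ 2 ≤ 1 :=
      (Finset.single_le_sum (f := fun z => u z ^ 2) (fun z _ => sq_nonneg _) hx).trans h.norm
    exact abs_le_one_iff_mul_self_le_one.2 (by nlinarith)
  · simp [h.supp x hx]

lemma abs_hgt_sub_le (hσ : σ = 1 ∨ σ = -1) (x y : Z3) :
    |((hgt σ x - hgt σ y : ℤ) : ℝ)| ≤ dist x y := by
  refine le_trans (le_of_eq ?_) (abs_coord_le_dist x y 2)
  rcases hσ with rfl | rfl
  · simp [hgt]
  · simp only [hgt]; push_cast; rw [← abs_neg]; congr 1; ring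

lemma FreeZone.X_pos (hB : Big δ E M s) (hz : FreeZone M s c a σ B X X') : 0 < X :=
  lt_of_lt_of_le (pow_pos hB.s_pos 19) hz.hX

lemma FreeZone.sq_le (hB : Big δ E M s) (hz : FreeZone M s c a σ B X X') :
    (s : ℝ) ^ 16 * s ^ 2 ≤ X := by
  refine le_trans ?_ hz.hX
  rw [← pow_add]
  exact pow_le_pow_right₀ (by linarith [hB.le_s]) (by norm_num)

lemma pow_s_ge (hB : Big δ E M s) {k : ℕ} (hk : 1 ≤ k) : (s : ℝ) ≤ s ^ k := by
  simpa using pow_le_pow_right₀ (a := (s : ℝ)) (by linarith [hB.le_s]) hk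

lemma slabNum_mul_le (hB : Big δ E M s) (hX : 0 ≤ X') :
    (slabNum M s X' : ℝ) * s ^ 2 ≤ X' / (200 * M ^ 2) := by
  have hs := hB.s_pos
  have hM := hB.M_pos
  have h := Nat.floor_le (a := X' / (200 * M ^ 2 * s ^ 2)) (by positivity)
  calc (slabNum M s X' : ℝ) * s ^ 2 ≤ X' / (200 * M ^ 2 * s ^ 2) * s ^ 2 := by
        unfold slabNum; gcongr
    _ = _ := by field_simp

lemma le_slabNum_mul (hB : Big δ E M s) (hz : FreeZone M s c a σ B X X') :
    M ^ 4 * X / 400 ≤ (slabNum M s X' : ℝ) * s ^ 2 := by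
  have hs := hB.s_pos
  have hM := hB.M_pos
  have hX := hz.X_pos hB
  have h := Nat.lt_floor_add_one (X' / (200 * M ^ 2 * s ^ 2))
  have h1 : X' / (200 * M ^ 2) ≤ ((slabNum M s X' : ℝ) + 1) * s ^ 2 := by
    calc X' / (200 * M ^ 2) = X' / (200 * M ^ 2 * s ^ 2) * s ^ 2 := by field_simp
      _ ≤ _ := by unfold slabNum; gcongr
  have h2 : X' / (200 * M ^ 2) = M ^ 4 * X / 200 := by rw [hz.hX']; field_simp
  have h3 := hz.sq_le hB
  have h4 : (10:ℝ)^6 ≤ s ^ 16 := hB.le_s.trans (pow_s_ge hB (by norm_num))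
  have h5 : (10 : ℝ) ^ 6 * s ^ 2 ≤ X := le_trans (by gcongr) h3
  have h6 : 1 ≤ M ^ 4 := one_le_pow₀ hB.one_le_M
  nlinarith

lemma slab_height (hB : Big δ E M s) (hz : FreeZone M s c a σ B X X') {j : ℕ}
    (hj : j ≤ slabNum M s X') {x : Z3} (h1 : slabLow s σ a X j ≤ hgt σ x)
    (h2 : hgt σ x < slabLow s σ a X j + s ^ 2) :
    2 * X + j * s ^ 2 ≤ ((hgt σ x - hgt σ a : ℤ) : ℝ) ∧
    ((hgt σ x - hgt σ a : ℤ) : ℝ) ≤ X' / (100 * M ^ 2) := by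
  have hs := hB.s_pos
  have hM := hB.M_pos
  have hX := hz.X_pos hB
  have e1 := Int.le_ceil (2 * X)
  have e2 := Int.ceil_lt_add_one (2 * X)
  have h1' : (hgt σ a : ℝ) + (⌈2 * X⌉ : ℝ) + j * s ^ 2 ≤ hgt σ x := by
    exact_mod_cast h1
  have h2' : (hgt σ x : ℝ) ≤ (hgt σ a : ℝ) + (⌈2 * X⌉ : ℝ) + j * s ^ 2 + s ^ 2 := by
    exact_mod_cast h2.le
  push_cast
  refine ⟨by linarith, ?_⟩
  have h3 : (j : ℝ) * s ^ 2 ≤ slabNum M s X' * s ^ 2 := by gcongr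
  have hX'0 : 0 ≤ X' := by rw [hz.hX']; positivity
  have h4 := slabNum_mul_le hB hX'0
  have h5 := hz.sq_le hB
  have h6 : (10:ℝ)^6 ≤ s ^ 16 := hB.le_s.trans (pow_s_ge hB (by norm_num))
  have h7 : (10 : ℝ) ^ 6 * s ^ 2 ≤ X := le_trans (by gcongr) h5
  have h8 : X' / (200 * M ^ 2) = M ^ 4 * X / 200 := by rw [hz.hX']; field_simp
  have h9 : X' / (100 * M ^ 2) = M ^ 4 * X / 100 := by rw [hz.hX']; field_simp
  have h10 : (10 : ℝ) ^ 6 ≤ M ^ 4 := by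
    have := pow_le_pow_right₀ hB.one_le_M (show 1 ≤ 4 by norm_num)
    linarith [hB.hM, pow_one M]
  have h11 : (1 : ℝ) ≤ s ^ 2 := one_le_pow₀ (by linarith [hB.le_s])
  nlinarith

lemma slab_le (hB : Big δ E M s) (hz : FreeZone M s c a σ B X X') {x : Z3}
    (h : ((hgt σ x - hgt σ a : ℤ) : ℝ) ≤ X' / (100 * M ^ 2)) :
    ((hgt σ x - hgt σ a : ℤ) : ℝ) + 10 * s ^ 2 ≤ X' := by
  have hM := hB.M_pos
  have hX := hz.X_pos hB
  have h9 : X' / (100 * M ^ 2) = M ^ 4 * X / 100 := by rw [hz.hX']; field_simp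
  have h5 := hz.sq_le hB
  have h6 : (10:ℝ)^6 ≤ s ^ 16 := hB.le_s.trans (pow_s_ge hB (by norm_num))
  have h7 : (10 : ℝ) ^ 6 * s ^ 2 ≤ X := le_trans (by gcongr) h5
  have h8 : M ^ 4 ≤ M ^ 6 := pow_le_pow_right₀ hB.one_le_M (by norm_num)
  have h10 : 1 ≤ M ^ 6 := one_le_pow₀ hB.one_le_M
  rw [hz.hX']
  nlinarith

/-- Decay of a quasimode inside a free zone. -/
lemma QMode.decay (hB : Big δ E M s) (hz : FreeZone M s c a σ B X X')
    (h : QMode δ E M s c a σ B (Real.exp (-X' / (2 * M))) X' V u) {x : Z3}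
    (hx : x ∈ cube c (s ^ 40)) (h1 : X ≤ ((hgt σ x - hgt σ a : ℤ) : ℝ))
    (h2 : ((hgt σ x - hgt σ a : ℤ) : ℝ) ≤ X' / (100 * M ^ 2)) :
    |u x| ≤ Real.exp (-(1 / M) * (((hgt σ x - hgt σ a : ℤ) : ℝ) - X)) := by
  have hs := hB.s_pos
  have hM := hB.M_pos
  have hX := hz.X_pos hB
  have hX'0 : 0 < X' := by rw [hz.hX']; positivity
  set H : Z3 → ℝ := fun y => ((hgt σ y - hgt σ a : ℤ) : ℝ) with hH
  set A := X' / (100 * M ^ 2) with hA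
  have hA0 : 0 ≤ A := by positivity
  set m := 1 / M + 2 / (s : ℝ) with hm
  have hm0 : 0 ≤ m := by positivity
  have hHl : ∀ y z, |H y - H z| ≤ dist y z := by
    intro y z
    have := abs_hgt_sub_le hz.hσ y z
    simp only [hH]
    push_cast at this ⊢
    convert this using 2; ring
  set Φ : Z3 → ℝ := fun y => m * max 0 (min (H y - X) (min (X' - H y) A)) with hΦ
  have hΦl : ∀ y z, |Φ y - Φ z| ≤ m * dist y z := by
    intro y z
    simp only [hΦ]
    rw [← mul_sub, abs_mul, abs_of_nonneg hm0]
    refine mul_le_mul_of_nonneg_left (le_trans ?_ (hHl y z)) hm0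
    have e1 := abs_max_sub_max_le_max 0 (min (H y - X) (min (X' - H y) A)) 0
      (min (H z - X) (min (X' - H z) A))
    have e2 := abs_min_sub_min_le_max (H y - X) (min (X' - H y) A) (H z - X) (min (X' - H z) A)
    have e3 := abs_min_sub_min_le_max (X' - H y) A (X' - H z) A
    have e4 : |H y - X - (H z - X)| = |H y - H z| := by congr 1; ring
    have e5 : |X' - H y - (X' - H z)| = |H y - H z| := by rw [abs_sub_comm]; congr 1; ring
    rw [e4] at e2
    rw [e5] at e3
    simp only [sub_self, abs_zero] at e1 e3
    have e6 := abs_nonneg (H y - H z)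
    rw [max_eq_left e6] at e3
    rw [max_eq_left e3] at e2
    exact e1.trans (max_le e6 e2)
  have hL : s ^ 2 ≤ s ^ 40 := Nat.pow_le_pow_right hB.s_pos' (by norm_num)
  have hmp := max_principle hB hL h.supp (fun y => X ≤ H y ∧ H y ≤ X') 
    (fun y hy hyG => h.good y hy (hz.free y hy hyG.1 hyG.2)) (Φ := Φ) hΦl
    (R := Real.exp (-X' / (2 * M)) * Real.exp (m * A)) (A := 1)
    (fun y hy _ z hzz => by
      refine mul_le_mul (h.err z (sub_subset hL y hzz)) ?_ (Real.exp_pos _).le (Real.exp_pos _).le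
      rw [Real.exp_le_exp]
      refine mul_le_mul_of_nonneg_left ?_ hm0
      exact max_le hA0 ((min_le_right _ _).trans (min_le_right _ _)))
    (fun y hy hyG => by
      have : Φ y = 0 := by
        simp only [hΦ]
        rw [not_and_or, not_le, not_le] at hyG
        rw [max_eq_left, mul_zero]
        rcases hyG with h | h
        · exact (min_le_left _ _).trans (by linarith)
        · exact (min_le_right _ _).trans ((min_le_left _ _).trans (by linarith))
      rw [this, Real.exp_zero, mul_one]
      exact h.abs_le_one y) hx
  have hms : m ≤ 2 / M := by
    have h1 : 2 / (s : ℝ) ≤ 1 / M := by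
      rw [div_le_div_iff₀ hs hM]
      have := hB.pow_le (k := 2) (by norm_num)
      nlinarith [hB.hM]
    have : 2 / M = 1 / M + 1 / M := by ring
    linarith
  have hR : 2 * (s : ℝ) ^ 6 * Real.exp s * (Real.exp (-X' / (2 * M)) * Real.exp (m * A)) ≤ 1 := by
    have e1 : 2 * (s : ℝ) ^ 6 ≤ Real.exp s := by
      calc (2 : ℝ) * (s : ℝ) ^ 6 ≤ (s : ℝ) * (s : ℝ) ^ 6 := by gcongr; linarith [hB.le_s]
        _ = (s : ℝ) ^ 7 := by ring
        _ ≤ _ := by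
          rw [hB.pow_eq, Real.exp_le_exp]
          push_cast
          linarith [hB.log_le, hB.one_le_log]
    have e2 : m * A ≤ X' / (8 * M) := by
      calc m * A ≤ 2 / M * A := by gcongr
        _ = X' / (8 * M) * (16 / (100 * M ^ 2)) := by rw [hA]; field_simp; ring
        _ ≤ X' / (8 * M) * 1 := by
          gcongr
          rw [div_le_one (by positivity)]
          nlinarith [hB.hM]
        _ = _ := mul_one _
    have e3 : 2 * (s : ℝ) ≤ X' / (8 * M) := by
      rw [le_div_iff₀ (by positivity), hz.hX']
      have f1 := hz.hX
      have f2 := pow_s_ge hB (show 1 ≤ 19 by norm_num)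
      have f3 : M * 16 ≤ M ^ 6 := by
        have := pow_le_pow_right₀ hB.one_le_M (show 2 ≤ 6 by norm_num)
        nlinarith [hB.hM]
      nlinarith
    calc _ ≤ Real.exp s * Real.exp s * (Real.exp (-X' / (2 * M)) * Real.exp (m * A)) := by gcongr
      _ = Real.exp (2 * s - X' / (2 * M) + m * A) := by
        rw [← Real.exp_add, ← Real.exp_add, ← Real.exp_add]; congr 1; ring
      _ ≤ 1 := by
        rw [Real.exp_le_one_iff]
        have : X' / (2 * M) = 4 * (X' / (8 * M)) := by field_simp; ring
        have : 0 ≤ X' / (8 * M) := by positivity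
        linarith
  rw [max_eq_left hR] at hmp
  have hΦx : (1 / M) * (H x - X) ≤ Φ x := by
    have e1 : min (H x - X) (min (X' - H x) A) = H x - X := by
      rw [min_eq_left]
      refine le_min ?_ (by linarith)
      have e2 : 2 * A ≤ X' := by
        have : X' = A * (100 * M ^ 2) := by rw [hA]; field_simp
        have : 1 ≤ M ^ 2 := one_le_pow₀ hB.one_le_M
        nlinarith
      linarith
    simp only [hΦ]
    rw [e1, max_eq_right (by linarith), hm]
    have : 0 ≤ 2 / (s : ℝ) * (H x - X) := mul_nonneg (by positivity) (by linarith)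
    linarith
  have hfin : |u x| * Real.exp ((1 / M) * (H x - X)) ≤ 1 :=
    le_trans (by gcongr) hmp
  calc |u x| = |u x| * Real.exp ((1 / M) * (H x - X)) * Real.exp (-(1 / M) * (H x - X)) := by
        rw [mul_assoc, ← Real.exp_add]; simp
    _ ≤ 1 * _ := by gcongr
    _ = _ := one_mul _

end Zone

/-- The mass of a function on the clean sites of a slab. -/
noncomputable def slabSum (δ E M : ℝ) (s : ℕ) (c a : Z3) (σ : ℤ) (X : ℝ) (V : Cfg) (u : Z3 → ℝ)
    (j : ℕ) : ℝ := ∑ x ∈ slabClean δ E M s c a σ X V j, u x ^ 2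

section Slabs

variable {δ E M : ℝ} {s : ℕ} {c a : Z3} {σ : ℤ} {B : Finset Z3} {X X' ε : ℝ} {V : Cfg} {u : Z3 → ℝ}

lemma Big.pow_M_le (hB : Big δ E M s) (D : ℕ) : M ^ D ≤ Real.exp (M * D) := by
  rw [mul_comm, Real.exp_nat_mul]
  exact pow_le_pow_left₀ hB.M_pos.le (by linarith [Real.add_one_le_exp M]) D

lemma FreeZone.sq_le' (hB : Big δ E M s) (hz : FreeZone M s c a σ B X X') :
    (10 : ℝ) ^ 6 * s ^ 2 ≤ X :=
  le_trans (by gcongr; exact hB.le_s.trans (pow_s_ge hB (by norm_num))) (hz.sq_le hB)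

lemma FreeZone.log_le (hB : Big δ E M s) (hz : FreeZone M s c a σ B X X') :
    10 ^ 6 * Real.log s ≤ X := by
  have h1 := hB.log_le
  have h2 := hz.sq_le' hB
  have h3 : (s : ℝ) ≤ s ^ 2 := pow_s_ge hB (by norm_num)
  linarith [hB.log_nonneg]

lemma slabClean_room (hB : Big δ E M s) (hz : FreeZone M s c a σ B X X') {y : Z3}
    (hy : y ∈ cube c (s ^ 40)) (h : ((hgt σ y - hgt σ a : ℤ) : ℝ) ≤ 100 * X') :
    y + σ • stdv 2 ∈ cube c (s ^ 40) := by
  refine hz.room y hy (h.trans ?_)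
  have h1 := hz.hX's
  have h2 : (400 : ℝ) ≤ s ^ 20 := by linarith [hB.le_s, pow_s_ge hB (show 1 ≤ 20 by norm_num)]
  have h3 : (s : ℝ) ^ 40 = s ^ 20 * s ^ 20 := by ring
  rw [h3]
  nlinarith

lemma exists_slab_zero (hB : Big δ E M s) (hz : FreeZone M s c a σ B X X')
    (h : QMode δ E M s c a σ B (Real.exp (-X' / (2 * M))) X' V u) :
    Real.exp (-(7 * M * X)) ≤ slabSum δ E M s c a σ X V u 0 := by
  have hs := hB.s_pos
  have hM := hB.M_pos
  have hX := hz.X_pos hB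
  have hX'0 : 0 < X' := by rw [hz.hX']; positivity
  have hsq := hz.sq_le' hB
  have hlog := hz.log_le hB
  have hs1 : (1 : ℝ) ≤ s ^ 2 := one_le_pow₀ (by linarith [hB.le_s])
  have hM1 := hB.one_le_M
  have e1 := Int.le_ceil (2 * X)
  have e2 := Int.ceil_lt_add_one (2 * X)
  set D : ℕ := (⌈2 * X⌉ + s ^ 2).toNat with hD
  have hD0 : 0 ≤ ⌈2 * X⌉ + (s : ℤ) ^ 2 := by
    have : 0 ≤ ⌈2 * X⌉ := Int.ceil_nonneg (by positivity)
    positivity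
  have hDz : (D : ℤ) = ⌈2 * X⌉ + s ^ 2 := Int.toNat_of_nonneg hD0
  have hDr : (D : ℝ) = ⌈2 * X⌉ + s ^ 2 := by exact_mod_cast hDz
  have hD3 : (D : ℝ) + 1 ≤ 3 * X := by rw [hDr]; linarith
  have hap : 0 < |u a| := lt_of_lt_of_le (by positivity) h.top
  have hMX : X ≤ M * X := le_mul_of_one_le_left hX.le hM1
  have htop : Real.exp (-(60 * Real.log s)) ≤ |u a| := by
    refine le_trans (le_of_eq ?_) h.top
    rw [hB.pow_eq, Real.exp_neg]; simp
  have hX'M : 100 * (M * X) ≤ X' / (2 * M) := by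
    rw [le_div_iff₀ (by positivity), hz.hX']
    have : 200 * M ^ 2 ≤ M ^ 6 := by
      have h2 := pow_le_pow_right₀ hM1 (show 3 ≤ 6 by norm_num)
      have h3 : 200 * M ^ 2 ≤ M ^ 3 := by
        rw [pow_succ M 2, mul_comm]; gcongr; linarith [hB.hM]
      linarith
    nlinarith
  obtain ⟨z, hzm, hzc, hz1, hz2, hz3⟩ := chain_clean hB hz.hσ h.supp h.err (x := a)
    (abs_pos.1 hap) (t := slabLow s σ a X 0) (D := D)
    (by have := Int.ceil_nonneg (a := 2 * X) (by positivity); simp [slabLow]; exact this)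
    (by simp only [slabLow]; rw [hDz]; push_cast; linarith)
    (by
      refine le_trans ?_ htop
      refine (mul_le_mul_of_nonneg_right (hB.pow_M_le (D + 1)) (Real.exp_pos _).le).trans ?_
      rw [← Real.exp_add, Real.exp_le_exp]
      push_cast
      have : M * (D + 1) ≤ M * (3 * X) := by gcongr
      rw [neg_div]
      nlinarith)
    (by
      intro y hy hyh
      apply slabClean_room hB hz hy
      have : ((hgt σ y - hgt σ a : ℤ) : ℝ) ≤ 2 * D := by
        have : hgt σ y - hgt σ a ≤ 2 * D := by omega
        exact_mod_cast this
      have h6 : 1 ≤ M ^ 6 := one_le_pow₀ hM1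
      rw [hz.hX']
      nlinarith)
    (by
      intro y hy hy1 hy2
      have hh := slab_height hB hz (j := 0) (Nat.zero_le _) hy1 hy2
      have hle := slab_le hB hz hh.2
      have hX1 : X ≤ ((hgt σ y - hgt σ a : ℤ) : ℝ) := by
        have := hh.1
        simp only [Nat.cast_zero, zero_mul, add_zero] at this
        linarith
      exact (h.rg y hy (hz.free y hy hX1 (by linarith)) (by linarith)).2.2)
  have hzs : z ∈ slabClean δ E M s c a σ X V 0 := by
    simp only [slabClean, Finset.mem_filter]
    exact ⟨hzm, hz1, hz2, hzc⟩
  refine le_trans ?_ (Finset.single_le_sum (f := fun x => u x ^ 2) (fun _ _ => sq_nonneg _) hzs)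
  have hzl : Real.exp (-(60 * Real.log s) - M * (3 * X)) ≤ |u z| := by
    have h1 : Real.exp (-(60 * Real.log s)) ≤ Real.exp (M * (3 * X)) * |u z| := by
      refine htop.trans (hz3.trans ?_)
      gcongr
      refine (hB.pow_M_le D).trans (Real.exp_le_exp.2 ?_)
      gcongr; linarith
    rw [sub_eq_add_neg, Real.exp_add]
    calc _ ≤ Real.exp (M * (3 * X)) * |u z| * Real.exp (-(M * (3 * X))) := by gcongr
      _ = |u z| * (Real.exp (M * (3 * X)) * Real.exp (-(M * (3 * X)))) := by ring
      _ = _ := by rw [← Real.exp_add]; simp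
  calc Real.exp (-(7 * M * X)) ≤ Real.exp (-(60 * Real.log s) - M * (3 * X)) ^ 2 := by
        rw [← Real.exp_nat_mul, Real.exp_le_exp]; push_cast; nlinarith
    _ ≤ |u z| ^ 2 := by gcongr
    _ = _ := sq_abs _

lemma exists_slab_succ (hB : Big δ E M s) (hz : FreeZone M s c a σ B X X')
    (h : QMode δ E M s c a σ B (Real.exp (-X' / (2 * M))) X' V u) {j : ℕ}
    (hj : j < slabNum M s X') {x : Z3} (hx : x ∈ slabClean δ E M s c a σ X V j)
    (hux : Real.exp (-X' / (16 * M)) ≤ |u x|) :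
    ∃ z ∈ slabClean δ E M s c a σ X V (j + 1), |u x| ≤ Real.exp (2 * M * s ^ 2) * |u z| := by
  have hs := hB.s_pos
  have hM := hB.M_pos
  have hX := hz.X_pos hB
  have hX'0 : 0 < X' := by rw [hz.hX']; positivity
  have hsq := hz.sq_le' hB
  have hs1 : (1 : ℝ) ≤ s ^ 2 := one_le_pow₀ (by linarith [hB.le_s])
  have hM1 := hB.one_le_M
  simp only [slabClean, Finset.mem_filter] at hx
  obtain ⟨hxm, hx1, hx2, hxc⟩ := hx
  have hup : 0 < |u x| := lt_of_lt_of_le (Real.exp_pos _) hux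
  have hlow : slabLow s σ a X (j + 1) = slabLow s σ a X j + s ^ 2 := by
    simp only [slabLow]; push_cast; ring
  have hhx := slab_height hB hz hj.le hx1 hx2
  have hlx := slab_le hB hz hhx.2
  obtain ⟨z, hzm, hzc, hz1, hz2, hz3⟩ := chain_clean hB hz.hσ h.supp h.err (x := x)
    (abs_pos.1 hup) (t := slabLow s σ a X (j + 1)) (D := 2 * s ^ 2)
    (by rw [hlow]; exact hx2.le)
    (by rw [hlow]; push_cast; linarith)
    (by
      refine le_trans ?_ hux
      refine (mul_le_mul_of_nonneg_right (hB.pow_M_le (2 * s ^ 2 + 1)) (Real.exp_pos _).le).trans ?_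
      rw [← Real.exp_add, Real.exp_le_exp]
      push_cast
      have h1 : M * (3 * s ^ 2) ≤ X' / (16 * M) := by
        rw [le_div_iff₀ (by positivity), hz.hX']
        have : M ^ 2 ≤ M ^ 6 := pow_le_pow_right₀ hM1 (by norm_num)
        have h0 : 0 < M ^ 2 := by positivity
        nlinarith
      have h2 : X' / (2 * M) = 8 * (X' / (16 * M)) := by field_simp; ring
      rw [neg_div, neg_div, h2]
      have : M * 1 ≤ M * s ^ 2 := by gcongr
      have : 0 ≤ X' / (16 * M) := by positivity
      nlinarith)
    (by
      intro y hy hyh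
      apply slabClean_room hB hz hy
      have : ((hgt σ y - hgt σ a : ℤ) : ℝ) ≤ ((hgt σ x - hgt σ a : ℤ) : ℝ) + 4 * s ^ 2 := by
        have : hgt σ y - hgt σ a ≤ (hgt σ x - hgt σ a) + 4 * s ^ 2 := by
          push_cast at hyh; linarith
        exact_mod_cast this
      linarith)
    (by
      intro y hy hy1 hy2
      have hh := slab_height hB hz (j := j + 1) hj hy1 hy2
      have hle := slab_le hB hz hh.2
      have hX1 : X ≤ ((hgt σ y - hgt σ a : ℤ) : ℝ) := by
        have := hh.1
        have : (0 : ℝ) ≤ ((j + 1 : ℕ) : ℝ) * s ^ 2 := by positivity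
        linarith
      exact (h.rg y hy (hz.free y hy hX1 (by linarith)) (by linarith)).2.2)
  refine ⟨z, by simp only [slabClean, Finset.mem_filter]; exact ⟨hzm, hz1, hz2, hzc⟩, ?_⟩
  refine hz3.trans ?_
  gcongr
  refine (hB.pow_M_le _).trans (le_of_eq ?_)
  push_cast; ring_nf

lemma slabSum_nonneg (j : ℕ) : 0 ≤ slabSum δ E M s c a σ X V u j :=
  Finset.sum_nonneg fun _ _ => sq_nonneg _

lemma card_big_cube (s : ℕ) (c : Z3) : ((cube c (s ^ 40)).card : ℝ) = (s : ℝ) ^ 120 := by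
  rw [card_cube]; push_cast; ring

lemma slabClean_subset (j : ℕ) : slabClean δ E M s c a σ X V j ⊆ cube c (s ^ 40) := by
  classical
  exact Finset.filter_subset _ _

lemma slabClean_card_le (j : ℕ) :
    ((slabClean δ E M s c a σ X V j).card : ℝ) ≤ (s : ℝ) ^ 120 := by
  rw [← card_big_cube s c]
  exact_mod_cast Finset.card_le_card (slabClean_subset j)

lemma slabSum_step (hB : Big δ E M s) (hz : FreeZone M s c a σ B X X')
    (h : QMode δ E M s c a σ B (Real.exp (-X' / (2 * M))) X' V u) {j : ℕ}
    (hj : j < slabNum M s X')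
    (hlow : Real.exp (-X' / (16 * M)) ≤ slabSum δ E M s c a σ X V u j) :
    Real.exp (-(5 * M * s ^ 2)) * slabSum δ E M s c a σ X V u j ≤
      slabSum δ E M s c a σ X V u (j + 1) := by
  have hs := hB.s_pos
  have hM := hB.M_pos
  have hX := hz.X_pos hB
  have hM1 := hB.one_le_M
  have hX'0 : 0 < X' := by rw [hz.hX']; positivity
  have hne : (slabClean δ E M s c a σ X V j).Nonempty := by
    by_contra hne
    rw [Finset.not_nonempty_iff_eq_empty] at hne
    rw [slabSum, hne, Finset.sum_empty] at hlow
    exact absurd hlow (not_le.2 (Real.exp_pos _))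
  obtain ⟨x, hx, hmax⟩ := Finset.exists_max_image _ (fun x => u x ^ 2) hne
  have hle : slabSum δ E M s c a σ X V u j ≤ s ^ 120 * u x ^ 2 := by
    calc _ ≤ ∑ _y ∈ slabClean δ E M s c a σ X V j, u x ^ 2 := Finset.sum_le_sum hmax
      _ = (slabClean δ E M s c a σ X V j).card * u x ^ 2 := by simp
      _ ≤ _ := by gcongr; exact slabClean_card_le j
  have h120 := hB.pow_eq 120
  have hlog := hz.log_le hB
  have hux2 : Real.exp (-X' / (16 * M)) ^ 2 ≤ |u x| ^ 2 := by
    rw [sq_abs]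
    have h1 : Real.exp (-X' / (16 * M)) * Real.exp (-(120 * Real.log s)) ≤ u x ^ 2 := by
      rw [Real.exp_neg (120 * _), ← div_eq_mul_inv, div_le_iff₀ (Real.exp_pos _)]
      have := hlow.trans hle
      rw [h120] at this
      push_cast at this
      linarith
    refine le_trans ?_ h1
    rw [← Real.exp_nat_mul, ← Real.exp_add, Real.exp_le_exp]
    have h2 : 120 * Real.log s ≤ X' / (16 * M) := by
      rw [le_div_iff₀ (by positivity), hz.hX']
      have : M ≤ M ^ 6 := by simpa using pow_le_pow_right₀ hM1 (show 1 ≤ 6 by norm_num)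
      have := hB.log_nonneg
      nlinarith
    rw [neg_div]
    push_cast
    linarith
  have hux : Real.exp (-X' / (16 * M)) ≤ |u x| :=
    le_of_sq_le_sq hux2 (abs_nonneg _)
  obtain ⟨z, hzm, hzu⟩ := exists_slab_succ hB hz h hj hx hux
  refine le_trans ?_ (Finset.single_le_sum (f := fun x => u x ^ 2) (fun _ _ => sq_nonneg _) hzm)
  have h3 : u x ^ 2 ≤ Real.exp (4 * M * s ^ 2) * u z ^ 2 := by
    rw [← sq_abs (u x), ← sq_abs (u z)]
    calc |u x| ^ 2 ≤ (Real.exp (2 * M * s ^ 2) * |u z|) ^ 2 := by gcongr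
      _ = Real.exp (2 * M * s ^ 2) ^ 2 * |u z| ^ 2 := by ring
      _ = _ := by rw [← Real.exp_nat_mul]; push_cast; ring_nf
  have h4 : (s : ℝ) ^ 120 ≤ Real.exp (M * s ^ 2) := by
    rw [h120, Real.exp_le_exp]
    push_cast
    have := hB.log_le
    have h5 : (s : ℝ) ≤ s ^ 2 := pow_s_ge hB (by norm_num)
    nlinarith [hB.log_nonneg]
  calc _ ≤ Real.exp (-(5 * M * s ^ 2)) * (Real.exp (M * s ^ 2) * (Real.exp (4 * M * s ^ 2) * u z ^ 2)) := by
        gcongr; exact hle.trans (by gcongr)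
    _ = (Real.exp (-(5 * M * s ^ 2)) * Real.exp (M * s ^ 2) * Real.exp (4 * M * s ^ 2)) * u z ^ 2 := by
        ring
    _ = u z ^ 2 := by
        rw [← Real.exp_add, ← Real.exp_add]
        ring_nf; simp

lemma slabSum_lower_aux (hB : Big δ E M s) (hz : FreeZone M s c a σ B X X')
    {j : ℕ} (hj : j ≤ slabNum M s X') :
    -X' / (16 * M) ≤ -(7 * M * X) - 5 * M * s ^ 2 * j := by
  have hs := hB.s_pos
  have hM := hB.M_pos
  have hX := hz.X_pos hB
  have hM1 := hB.one_le_M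
  have hX'0 : 0 < X' := by rw [hz.hX']; positivity
  have h1 := slabNum_mul_le hB hX'0.le
  have h2 : (j : ℝ) * s ^ 2 ≤ X' / (200 * M ^ 2) := le_trans (by gcongr) h1
  have h3 : 5 * M * s ^ 2 * j ≤ X' / (40 * M) := by
    calc 5 * M * s ^ 2 * j = 5 * M * (j * s ^ 2) := by ring
      _ ≤ 5 * M * (X' / (200 * M ^ 2)) := by gcongr
      _ = _ := by field_simp; ring
  have h4 : 7 * M * X ≤ X' / (80 * M) := by
    rw [le_div_iff₀ (by positivity), hz.hX']
    have : 560 * M ^ 2 ≤ M ^ 6 := by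
      have h2 := pow_le_pow_right₀ hM1 (show 3 ≤ 6 by norm_num)
      have h3 : 560 * M ^ 2 ≤ M ^ 3 := by
        rw [pow_succ M 2, mul_comm]; gcongr; linarith [hB.hM]
      linarith
    nlinarith
  have h5 : X' / (40 * M) = 2 * (X' / (80 * M)) := by field_simp; ring
  have h6 : X' / (16 * M) = 5 * (X' / (80 * M)) := by field_simp; ring
  rw [neg_div, h6]
  have : 0 ≤ X' / (80 * M) := by positivity
  linarith

lemma slabSum_lower (hB : Big δ E M s) (hz : FreeZone M s c a σ B X X')
    (h : QMode δ E M s c a σ B (Real.exp (-X' / (2 * M))) X' V u) (j : ℕ)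
    (hj : j ≤ slabNum M s X') :
    Real.exp (-(7 * M * X) - 5 * M * s ^ 2 * j) ≤ slabSum δ E M s c a σ X V u j := by
  induction j with
  | zero => simpa using exists_slab_zero hB hz h
  | succ j ih =>
    have ih := ih (by omega)
    have h1 : Real.exp (-X' / (16 * M)) ≤ slabSum δ E M s c a σ X V u j :=
      (Real.exp_le_exp.2 (slabSum_lower_aux hB hz (j := j) (by omega))).trans ih
    refine le_trans ?_ (slabSum_step hB hz h hj h1)
    calc _ = Real.exp (-(5 * M * s ^ 2)) * Real.exp (-(7 * M * X) - 5 * M * s ^ 2 * j) := by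
          rw [← Real.exp_add]; congr 1; push_cast; ring
      _ ≤ _ := by gcongr

lemma slabSum_lower' (hB : Big δ E M s) (hz : FreeZone M s c a σ B X X')
    (h : QMode δ E M s c a σ B (Real.exp (-X' / (2 * M))) X' V u) {j : ℕ}
    (hj : j ≤ slabNum M s X') :
    Real.exp (-X' / (16 * M)) ≤ slabSum δ E M s c a σ X V u j :=
  (Real.exp_le_exp.2 (slabSum_lower_aux hB hz hj)).trans (slabSum_lower hB hz h j hj)

open Classical in
/-- There are many hyperbolic slabs. -/
lemma card_hypIdx (hB : Big δ E M s) (hz : FreeZone M s c a σ B X X')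
    (h : QMode δ E M s c a σ B (Real.exp (-X' / (2 * M))) X' V u) :
    (s : ℝ) ^ 17 ≤ ((Finset.range (slabNum M s X')).filter
      (HypIdx (slabSum δ E M s c a σ X V u) (slabNum M s X') (1 / s ^ 500))).card := by
  have hs := hB.s_pos
  have hM := hB.M_pos
  have hX := hz.X_pos hB
  have hM1 := hB.one_le_M
  have hX'0 : 0 < X' := by rw [hz.hX']; positivity
  set J := slabNum M s X' with hJ
  set n := ((Finset.range J).filter
      (HypIdx (slabSum δ E M s c a σ X V u) J (1 / s ^ 500))).card with hn
  have hs1 : (1 : ℝ) ≤ s ^ 500 := one_le_pow₀ (by linarith [hB.le_s])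
  have hmain := hyperbolic_count (Z := slabSum δ E M s c a σ X V u) (J := J)
    (κ := Real.exp (-(5 * M * s ^ 2))) (η := 1 / s ^ 500) slabSum_nonneg (Real.exp_pos _)
    (Real.exp_le_one_iff.2 (by simp; positivity)) (by positivity)
    (by rw [div_le_one (by positivity)]; exact hs1)
    (fun j hj => slabSum_step hB hz h hj (slabSum_lower' hB hz h hj.le))
  have hup : slabSum δ E M s c a σ X V u J ≤
      Real.exp (120 * Real.log s - 2 / M * (J * s ^ 2)) := by
    calc slabSum δ E M s c a σ X V u J ≤
        ∑ _x ∈ slabClean δ E M s c a σ X V J, Real.exp (- (2 / M * (J * s ^ 2))) := by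
          refine Finset.sum_le_sum fun x hx => ?_
          simp only [slabClean, Finset.mem_filter] at hx
          obtain ⟨hxm, hx1, hx2, -⟩ := hx
          have hh := slab_height hB hz le_rfl hx1 hx2
          have hd := h.decay hB hz hxm (by
            have : (0 : ℝ) ≤ (slabNum M s X' : ℝ) * s ^ 2 := by positivity
            linarith [hh.1]) hh.2
          rw [← sq_abs]
          calc |u x| ^ 2 ≤ Real.exp (-(1 / M) * (J * s ^ 2)) ^ 2 := by
                refine pow_le_pow_left₀ (abs_nonneg _) (hd.trans (Real.exp_le_exp.2 ?_)) 2
                rw [neg_mul, neg_mul, neg_le_neg_iff]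
                gcongr
                linarith [hh.1]
            _ = _ := by rw [← Real.exp_nat_mul]; congr 1; push_cast; ring
      _ = (slabClean δ E M s c a σ X V J).card * Real.exp (- (2 / M * (J * s ^ 2))) := by simp
      _ ≤ (s : ℝ) ^ 120 * Real.exp (- (2 / M * (J * s ^ 2))) := by
          gcongr; exact slabClean_card_le J
      _ = _ := by rw [hB.pow_eq, ← Real.exp_add]; congr 1
  have hlow : Real.exp (-(7 * M * X)) * Real.exp (-(5 * M * s ^ 2)) ^ n * (1 / (s : ℝ) ^ 500) ^ J
      ≤ Real.exp (120 * Real.log s - 2 / M * (J * s ^ 2)) := by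
    refine le_trans ?_ (hmain.trans hup)
    gcongr
    exact exists_slab_zero hB hz h
  have he : (1 / (s : ℝ) ^ 500) ^ J = Real.exp (-(500 * Real.log s * J)) := by
    have : (1 / (s : ℝ) ^ 500) = Real.exp (-(500 * Real.log s)) := by
      rw [hB.pow_eq, Real.exp_neg]; simp
    rw [this, ← Real.exp_nat_mul]; congr 1; ring
  rw [he, ← Real.exp_nat_mul, ← Real.exp_add, ← Real.exp_add, Real.exp_le_exp] at hlow
  have hJs := le_slabNum_mul hB hz
  rw [← hJ] at hJs
  have hlog := hz.log_le hB
  have h1 : 500 * Real.log s * J ≤ J * s ^ 2 / (4 * M) := by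
    rw [le_div_iff₀ (by positivity)]
    have h2 : 500 * Real.log s * (4 * M) ≤ s ^ 2 := by
      have a1 := hB.log_le
      have a2 := hB.M_le
      have a3 := hB.log_nonneg
      have a4 : M * Real.log s ≤ s * Real.log s := by gcongr
      nlinarith
    have : (0 : ℝ) ≤ J := by positivity
    nlinarith
  have hM4 : 10 ^ 6 * M ≤ M ^ 2 := by nlinarith [hB.hM]
  have h2 : 7 * M * X + 120 * Real.log s ≤ J * s ^ 2 / (4 * M) := by
    rw [le_div_iff₀ (by positivity)]
    have a1 : 120 * Real.log s ≤ M * X := by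
      have : X ≤ M * X := le_mul_of_one_le_left hX.le hM1
      linarith [hB.log_nonneg]
    have a2 : 10 ^ 6 * M ^ 2 ≤ M ^ 4 := by
      have : M ^ 4 = M ^ 2 * M ^ 2 := by ring
      rw [this]
      gcongr
      nlinarith [hB.hM]
    have : 7 * M * X + 120 * Real.log s ≤ 8 * M * X := by linarith
    calc _ ≤ 8 * M * X * (4 * M) := by gcongr
      _ = 32 * M ^ 2 * X := by ring
      _ ≤ M ^ 4 * X / 400 := by
        rw [le_div_iff₀ (by norm_num)]
        nlinarith
      _ ≤ _ := hJs
  have h3 : J * s ^ 2 / M ≤ n * (5 * M * s ^ 2) := by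
    have : 2 / M * ((J : ℝ) * s ^ 2) = 2 * (J * s ^ 2 / M) := by ring
    have : (J : ℝ) * s ^ 2 / M = 4 * (J * s ^ 2 / (4 * M)) := by field_simp
    have : (0 : ℝ) ≤ J * s ^ 2 / (4 * M) := by positivity
    linarith
  rw [div_le_iff₀ hM] at h3
  have h4 : M ^ 4 * X / 400 ≤ n * (5 * M ^ 2 * s ^ 2) := by
    refine hJs.trans (h3.trans (le_of_eq ?_)); ring
  have h5 : M ^ 4 * s ^ 19 / 400 ≤ n * (5 * M ^ 2 * s ^ 2) := by
    refine le_trans ?_ h4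
    gcongr
    exact hz.hX
  have h6 : (0 : ℝ) < M ^ 2 * s ^ 2 := by positivity
  have h7 : M ^ 2 * s ^ 17 ≤ n * 2000 := by
    have : M ^ 2 * s ^ 2 * (M ^ 2 * s ^ 17) ≤ M ^ 2 * s ^ 2 * (n * 2000) := by
      have e : M ^ 4 * (s : ℝ) ^ 19 = M ^ 2 * s ^ 2 * (M ^ 2 * s ^ 17) := by ring
      rw [← e]
      linarith
    exact le_of_mul_le_mul_left this h6
  have h8 : (0 : ℝ) < s ^ 17 := by positivity
  nlinarith [hB.hM]

end Slabs

section Congr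

variable {δ E M : ℝ} {s : ℕ} {Q : Finset Z3} {V W : Cfg}

lemma Good_congr (h : ∀ x ∈ Q, V x = W x) (hG : Good δ E M s Q V) : Good δ E M s Q W := by
  unfold Good at *
  rwa [← opMat_congr h, ← Gf_congr h]

lemma Clean_congr {x : Z3} (h : ∀ z ∈ Q, z ≠ x → V z = W z) (hG : Clean δ E M s V Q x) :
    Clean δ E M s W Q x := by
  obtain ⟨hx, r, h0, h1, h2⟩ := hG
  refine ⟨hx, r, h0, fun z hz => ?_, h2⟩
  rw [← h1 z hz]
  apply T_congr _ fun _ _ => rfl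
  by_cases hzx : z = x
  · subst hzx; simp
  · simp [hzx, h z hz hzx]

lemma Hit_congr (h : ∀ x ∈ Q, V x = W x) (hG : Hit δ E M s Q V) : Hit δ E M s Q W := by
  intro σ hσ γ N h1 h2 h3
  obtain ⟨n, hn, hc⟩ := hG σ hσ γ N h1 h2 h3
  exact ⟨n, hn, Clean_congr (fun z hz _ => h z hz) hc⟩

lemma flipAt_congr {x z : Z3} (h : V z = W z) (h' : V x = W x) : flipAt V x z = flipAt W x z := by
  simp only [flipAt, Function.update_apply]
  split_ifs with h1
  · rw [h']
  · exact h

lemma RG_congr (h : ∀ x ∈ Q, V x = W x) (hG : RG δ E M s Q V) : RG δ E M s Q W :=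
  ⟨Good_congr h hG.1, fun x hx => Good_congr (fun z hz => flipAt_congr (h z hz) (h x hx)) (hG.2.1 x hx),
    Hit_congr h hG.2.2⟩

lemma flipAt_of_ne {x z : Z3} (h : z ≠ x) : flipAt V x z = V z := by simp [flipAt, h]

lemma flipAt_flipAt (x : Z3) : flipAt (flipAt V x) x = V := by
  ext z
  by_cases h : z = x
  · subst h; simp [flipAt]
  · simp [flipAt, h]

end Congr

section Flip

variable {δ E M : ℝ} {s : ℕ} {c a : Z3} {σ : ℤ} {B : Finset Z3} {X X' ε : ℝ} {V : Cfg} {u : Z3 → ℝ}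

lemma slabClean_mem {j : ℕ} {x : Z3} : x ∈ slabClean δ E M s c a σ X V j ↔
    x ∈ cube c (s ^ 40) ∧ slabLow s σ a X j ≤ hgt σ x ∧
    hgt σ x < slabLow s σ a X j + s ^ 2 ∧ CleanL δ E M s c (s ^ 40) V x := by
  classical
  simp only [slabClean, Finset.mem_filter]

lemma QMode.slab_decay (hB : Big δ E M s) (hz : FreeZone M s c a σ B X X')
    (h : QMode δ E M s c a σ B (Real.exp (-X' / (2 * M))) X' V u) {j : ℕ}
    (hj : j ≤ slabNum M s X') {i : Z3} (hi : i ∈ slabClean δ E M s c a σ X V j) :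
    |u i| ≤ Real.exp (-X / M) := by
  have hM := hB.M_pos
  have hX := hz.X_pos hB
  obtain ⟨hi0, hi1, hi2, -⟩ := slabClean_mem.1 hi
  have hh := slab_height hB hz hj hi1 hi2
  have h0 : (0 : ℝ) ≤ j * s ^ 2 := by positivity
  refine (h.decay hB hz hi0 (by linarith [hh.1]) hh.2).trans (Real.exp_le_exp.2 ?_)
  have : X / M ≤ (1 / M) * (((hgt σ i - hgt σ a : ℤ) : ℝ) - X) := by
    rw [div_eq_inv_mul, one_div]; gcongr; linarith [hh.1]
  rw [neg_div]; linarith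

/-- Flipping the potential at a clean site of a free zone turns a quasimode into a slightly worse
quasimode. -/
lemma QMode.flip (hB : Big δ E M s) (hz : FreeZone M s c a σ B X X')
    (h : QMode δ E M s c a σ B (Real.exp (-X' / (2 * M))) X' V u) {j : ℕ}
    (hj : j ≤ slabNum M s X') {i : Z3} (hi : i ∈ slabClean δ E M s c a σ X V j) :
    QMode δ E M s c a σ B (Real.exp (-X / (2 * M))) X (flipAt V i) u := by
  have hs := hB.s_pos
  have hM := hB.M_pos
  have hX := hz.X_pos hB
  have hM1 := hB.one_le_M
  have hX'0 : 0 < X' := by rw [hz.hX']; positivity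
  have hsq := hz.sq_le' hB
  have hui := h.slab_decay hB hz hj hi
  obtain ⟨hi0, hi1, hi2, -⟩ := slabClean_mem.1 hi
  have hh := slab_height hB hz hj hi1 hi2
  have hle := slab_le hB hz hh.2
  have hL : s ^ 2 ≤ s ^ 40 := Nat.pow_le_pow_right hB.s_pos' (by norm_num)
  have hh0 : (0 : ℝ) ≤ j * s ^ 2 := by positivity
  have hs2 : (0 : ℝ) ≤ s ^ 2 := by positivity
  refine ⟨h.supp, h.norm, h.top, ?_, ?_, ?_⟩
  · intro x hx
    have hT := T_change_at (δ := δ) (E := E) (W := flipAt V i) (W' := V) (i := i)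
      (fun z hz => flipAt_of_ne hz) u x
    have hb : |T δ E (flipAt V i) u x| ≤ Real.exp (-X' / (2 * M)) + M * Real.exp (-X / M) := by
      rw [hT]
      refine (abs_add_le _ _).trans (add_le_add (h.err x hx) ?_)
      by_cases hxi : x = i
      · rw [if_pos hxi, abs_mul, abs_mul, abs_of_pos hB.hδ]
        have hd : |(if flipAt V i i = true then (1 : ℝ) else 0) - if V i = true then 1 else 0| ≤ 1 := by
          split_ifs <;> simp
        have := hB.hδ
        calc _ ≤ δ * 1 * Real.exp (-X / M) := by
              refine mul_le_mul (mul_le_mul_of_nonneg_left hd this.le) hui (abs_nonneg _) (by simpa using this.le)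
          _ ≤ _ := by rw [mul_one]; gcongr; linarith [hB.hδM]
      · rw [if_neg hxi, abs_zero]; positivity
    refine hb.trans ?_
    have e1 : Real.exp (-X' / (2 * M)) ≤ Real.exp (-X / M) := by
      rw [Real.exp_le_exp, hz.hX', div_le_div_iff₀ (by positivity) hM]
      have : 2 ≤ M ^ 6 := by
        have := pow_le_pow_right₀ hM1 (show 1 ≤ 6 by norm_num)
        linarith [hB.hM, pow_one M]
      nlinarith [mul_pos hX hM]
    have e2 : 2 * M ≤ Real.exp (X / (2 * M)) := by
      have a1 : 4 * M ^ 2 ≤ X := by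
        have := hB.pow_le (k := 3) (by norm_num)
        have h3 : (s : ℝ) ≤ s ^ 2 := pow_s_ge hB (by norm_num)
        nlinarith [hB.hM, pow_pos hM 2]
      have a2 : 2 * M ≤ X / (2 * M) := by
        rw [le_div_iff₀ (by positivity)]; linarith
      linarith [Real.add_one_le_exp (X / (2 * M))]
    have e3 : Real.exp (-X / M) = Real.exp (-X / (2 * M)) * Real.exp (-X / (2 * M)) := by
      rw [← Real.exp_add]; congr 1; field_simp; ring
    have e4 : Real.exp (X / (2 * M)) * Real.exp (-X / (2 * M)) = 1 := by
      rw [← Real.exp_add]; simp [neg_div]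
    have e5 : 2 * M * Real.exp (-X / (2 * M)) ≤ 1 := by
      rw [← e4]; gcongr
    have e6 : 0 < Real.exp (-X / (2 * M)) := Real.exp_pos _
    calc _ ≤ Real.exp (-X / M) + M * Real.exp (-X / M) := by gcongr
      _ ≤ 2 * M * Real.exp (-X / M) := by
        have := Real.exp_pos (-X / M)
        nlinarith
      _ = 2 * M * Real.exp (-X / (2 * M)) * Real.exp (-X / (2 * M)) := by rw [e3]; ring
      _ ≤ 1 * Real.exp (-X / (2 * M)) := by gcongr
      _ = _ := one_mul _
  · intro y hy hyB
    by_cases hiy : i ∈ sub c (s ^ 40) s y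
    · have hd := dist_lt_of_mem_sub (mem_sub hB hL hy) hiy
      have hhy := (abs_le.1 (abs_hgt_sub_le hz.hσ y i)).2
      refine (h.rg y hy hyB ?_).2.1 i hiy
      push_cast at hhy hle ⊢
      linarith
    · exact Good_congr (fun z hz => (flipAt_of_ne fun h => hiy (by rw [← h]; exact hz)).symm) (h.good y hy hyB)
  · intro y hy hyB hyX
    have hiy : i ∉ sub c (s ^ 40) s y := by
      intro hiy
      have hd := dist_lt_of_mem_sub (mem_sub hB hL hy) hiy
      have hhy := (abs_le.1 (abs_hgt_sub_le hz.hσ y i)).1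
      have := hh.1
      push_cast at hhy this hyX
      linarith
    refine RG_congr (fun z hz => (flipAt_of_ne fun h => hiy (by rw [← h]; exact hz)).symm) (h.rg y hy hyB ?_)
    linarith

end Flip

/-- Coordinatewise residues. -/
def resid (s : ℕ) (x : Z3) : Z3 := fun i => x i % (s : ℤ) ^ 2

lemma resid_mem {s : ℕ} (hs : 0 < s) (x : Z3) : resid s x ∈ cube 0 (s ^ 2) := by
  rw [mem_cube]
  intro i
  have h : (0 : ℤ) < (s : ℤ) ^ 2 := by positivity
  exact ⟨by simpa [resid] using Int.emod_nonneg _ h.ne', by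
    simpa [resid] using Int.emod_lt_of_pos (x i) h⟩

lemma le_dist_of_resid_eq {s : ℕ} {x y : Z3} (h : resid s x = resid s y) (hne : x ≠ y) :
    (s : ℝ) ^ 2 ≤ dist x y := by
  obtain ⟨i, hi⟩ := Function.ne_iff.1 hne
  apply le_dist_of_coord i
  have h1 : (s : ℤ) ^ 2 ∣ x i - y i := Int.ModEq.dvd (congrFun h i).symm
  have h2 := Int.le_of_dvd (abs_pos.2 (sub_ne_zero.2 hi)) ((dvd_abs _ _).2 h1)
  exact_mod_cast h2

section Weights

variable {δ E M : ℝ} {s : ℕ} {c a : Z3} {σ : ℤ} {B : Finset Z3} {X X' ε : ℝ} {V : Cfg} {u : Z3 → ℝ}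

open Classical in
/-- The mass of a function on the clean sites of a slab in one residue class. -/
noncomputable def resSum (δ E M : ℝ) (s : ℕ) (c a : Z3) (σ : ℤ) (X : ℝ) (V : Cfg) (u : Z3 → ℝ)
    (j : ℕ) (ρ : Z3) : ℝ :=
  ∑ x ∈ (slabClean δ E M s c a σ X V j).filter (fun x => resid s x = ρ), u x ^ 2

/-- The index of the slab containing a site. -/
noncomputable def slabIdx (s : ℕ) (σ : ℤ) (a : Z3) (X : ℝ) (i : Z3) : ℕ :=
  ((hgt σ i - slabLow s σ a X 0) / (s : ℤ) ^ 2).toNat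

lemma slabIdx_eq (hs : 0 < s) {j : ℕ} {i : Z3} (h1 : slabLow s σ a X j ≤ hgt σ i)
    (h2 : hgt σ i < slabLow s σ a X j + s ^ 2) : slabIdx s σ a X i = j := by
  have hs2 : (0 : ℤ) < (s : ℤ) ^ 2 := by positivity
  have e : slabLow s σ a X j = slabLow s σ a X 0 + j * s ^ 2 := by simp [slabLow]
  have : (hgt σ i - slabLow s σ a X 0) / (s : ℤ) ^ 2 = j := by
    rw [Int.ediv_eq_iff_of_pos hs2]
    constructor <;> linarith
  rw [slabIdx, this]; simp

/-- The sites at which a flip is allowed. -/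
structure Allowed (δ E M : ℝ) (s : ℕ) (c a : Z3) (σ : ℤ) (X X' : ℝ) (V : Cfg) (u : Z3 → ℝ)
    (i : Z3) : Prop where
  lt : slabIdx s σ a X i < slabNum M s X'
  clean : i ∈ slabClean δ E M s c a σ X V (slabIdx s σ a X i)
  hyp : HypIdx (slabSum δ E M s c a σ X V u) (slabNum M s X') (1 / s ^ 500) (slabIdx s σ a X i)
  fav : slabSum δ E M s c a σ X V u (slabIdx s σ a X i) ≤
    s ^ 6 * resSum δ E M s c a σ X V u (slabIdx s σ a X i) (resid s i)
  large : resSum δ E M s c a σ X V u (slabIdx s σ a X i) (resid s i) ≤ 2 * s ^ 120 * u i ^ 2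

/-- The weight of a flip. -/
noncomputable def flipWeight (δ E M : ℝ) (s : ℕ) (c a : Z3) (σ : ℤ) (X : ℝ) (V : Cfg)
    (u : Z3 → ℝ) (i : Z3) : ℝ :=
  u i ^ 2 / resSum δ E M s c a σ X V u (slabIdx s σ a X i) (resid s i)

lemma resSum_nonneg (j : ℕ) (ρ : Z3) : 0 ≤ resSum δ E M s c a σ X V u j ρ := by
  classical
  exact Finset.sum_nonneg fun _ _ => sq_nonneg _

lemma flipWeight_nonneg (i : Z3) : 0 ≤ flipWeight δ E M s c a σ X V u i :=
  div_nonneg (sq_nonneg _) (resSum_nonneg _ _)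

lemma exists_resSum (hs : 0 < s) (j : ℕ) : ∃ ρ, slabSum δ E M s c a σ X V u j ≤
    s ^ 6 * resSum δ E M s c a σ X V u j ρ := by
  classical
  have hsum : slabSum δ E M s c a σ X V u j =
      ∑ ρ ∈ cube 0 (s ^ 2), resSum δ E M s c a σ X V u j ρ :=
    (Finset.sum_fiberwise_of_maps_to (fun x _ => resid_mem hs x) _).symm
  obtain ⟨ρ, -, hρ⟩ := Finset.exists_max_image (cube 0 (s ^ 2))
    (fun ρ => resSum δ E M s c a σ X V u j ρ) ⟨_, resid_mem hs 0⟩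
  refine ⟨ρ, ?_⟩
  rw [hsum]
  refine (Finset.sum_le_sum hρ).trans (le_of_eq ?_)
  rw [Finset.sum_const, card_cube, nsmul_eq_mul]
  push_cast; ring

open Classical in
lemma outgoing_weight (hB : Big δ E M s) (hz : FreeZone M s c a σ B X X')
    (h : QMode δ E M s c a σ B (Real.exp (-X' / (2 * M))) X' V u) :
    (s : ℝ) ^ 17 / 2 ≤ ∑ i ∈ (cube c (s ^ 40)).filter (Allowed δ E M s c a σ X X' V u),
      flipWeight δ E M s c a σ X V u i := by
  set 𝒥 := (Finset.range (slabNum M s X')).filter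
      (HypIdx (slabSum δ E M s c a σ X V u) (slabNum M s X') (1 / s ^ 500)) with h𝒥
  have hs := hB.s_pos
  have h1 : ∀ j ∈ 𝒥, 1 / 2 ≤ ∑ i ∈ ((cube c (s ^ 40)).filter
      (Allowed δ E M s c a σ X X' V u)).filter (fun i => slabIdx s σ a X i = j),
      flipWeight δ E M s c a σ X V u i := by
    intro j hj
    rw [h𝒥, Finset.mem_filter, Finset.mem_range] at hj
    obtain ⟨ρ, hρ⟩ := exists_resSum (δ := δ) (E := E) (M := M) (c := c) (a := a) (σ := σ) (X := X)
      (V := V) (u := u) hB.s_pos' j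
    set R := resSum δ E M s c a σ X V u j ρ with hR
    have hRpos : 0 < R := by
      have h2 := (Real.exp_pos _).trans_le (slabSum_lower' hB hz h hj.1.le)
      have h3 := h2.trans_le hρ
      exact pos_of_mul_pos_right h3 (by positivity)
    set F := (slabClean δ E M s c a σ X V j).filter (fun x => resid s x = ρ) with hF
    have hRF : R = ∑ x ∈ F, u x ^ 2 := rfl
    set G := F.filter (fun x => R ≤ 2 * s ^ 120 * u x ^ 2) with hG
    have hidx : ∀ x ∈ F, slabIdx s σ a X x = j ∧ resid s x = ρ ∧ x ∈ slabClean δ E M s c a σ X V j := by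
      intro x hx
      rw [hF, Finset.mem_filter] at hx
      obtain ⟨-, a1, a2, -⟩ := slabClean_mem.1 hx.1
      exact ⟨slabIdx_eq hB.s_pos' a1 a2, hx.2, hx.1⟩
    have hsub : G ⊆ ((cube c (s ^ 40)).filter
      (Allowed δ E M s c a σ X X' V u)).filter (fun i => slabIdx s σ a X i = j) := by
      intro x hx
      rw [hG, Finset.mem_filter] at hx
      obtain ⟨b1, b2, b3⟩ := hidx x hx.1
      rw [Finset.mem_filter, Finset.mem_filter]
      refine ⟨⟨slabClean_subset j b3, ?_⟩, b1⟩
      refine ⟨?_, ?_, ?_, ?_, ?_⟩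
      · rw [b1]; exact hj.1
      · rw [b1]; exact b3
      · rw [b1]; exact hj.2
      · rw [b1, b2]; exact hρ
      · rw [b1, b2]; exact hx.2
    refine le_trans ?_ (Finset.sum_le_sum_of_subset_of_nonneg hsub fun _ _ _ => flipWeight_nonneg _)
    have hw : ∑ i ∈ G, flipWeight δ E M s c a σ X V u i = (∑ i ∈ G, u i ^ 2) / R := by
      rw [Finset.sum_div]
      refine Finset.sum_congr rfl fun x hx => ?_
      obtain ⟨b1, b2, b3⟩ := hidx x (Finset.mem_filter.1 hx).1
      rw [flipWeight, b1, b2]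
    rw [hw, le_div_iff₀ hRpos]
    have hsplit := Finset.sum_filter_add_sum_filter_not F (fun x => R ≤ 2 * s ^ 120 * u x ^ 2)
      (fun x => u x ^ 2)
    have hrest : ∑ x ∈ F.filter (fun x => ¬ R ≤ 2 * s ^ 120 * u x ^ 2), u x ^ 2 ≤ R / 2 := by
      calc _ ≤ ∑ _x ∈ F.filter (fun x => ¬ R ≤ 2 * s ^ 120 * u x ^ 2), R / (2 * s ^ 120) := by
            refine Finset.sum_le_sum fun x hx => ?_
            rw [Finset.mem_filter, not_le] at hx
            rw [le_div_iff₀ (by positivity)]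
            linarith [hx.2]
        _ = (F.filter (fun x => ¬ R ≤ 2 * s ^ 120 * u x ^ 2)).card * (R / (2 * s ^ 120)) := by simp
        _ ≤ (s : ℝ) ^ 120 * (R / (2 * s ^ 120)) := by
            gcongr
            refine le_trans ?_ (slabClean_card_le (δ := δ) (E := E) (M := M) (s := s) (c := c)
              (a := a) (σ := σ) (X := X) (V := V) j)
            exact_mod_cast Finset.card_le_card
              ((Finset.filter_subset _ _).trans (Finset.filter_subset _ _))
        _ = R / 2 := by field_simp
    rw [← hRF] at hsplit
    linarith
  calc (s : ℝ) ^ 17 / 2 ≤ 𝒥.card * (1 / 2) := by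
        have := card_hypIdx hB hz h
        rw [← h𝒥] at this
        linarith
    _ = ∑ _j ∈ 𝒥, (1 / 2 : ℝ) := by simp
    _ ≤ ∑ j ∈ 𝒥, ∑ i ∈ ((cube c (s ^ 40)).filter
      (Allowed δ E M s c a σ X X' V u)).filter (fun i => slabIdx s σ a X i = j),
      flipWeight δ E M s c a σ X V u i := Finset.sum_le_sum h1
    _ ≤ _ := Finset.sum_fiberwise_le_sum_of_sum_fiber_nonneg fun y _ =>
        Finset.sum_nonneg fun _ _ => flipWeight_nonneg _

end Weights

section Incoming

variable {δ E M : ℝ} {s : ℕ} {c a : Z3} {σ : ℤ} {B : Finset Z3} {X X' ε : ℝ} {V W : Cfg}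
  {u u' : Z3 → ℝ}

lemma slabClean_cross {i j : Z3} {k : ℕ}
    (hj : j ∈ slabClean δ E M s c a σ X (flipAt W j) k) (hr : resid s i = resid s j) :
    j ∈ slabClean δ E M s c a σ X (flipAt W i) k := by
  by_cases hij : i = j
  · subst hij; exact hj
  obtain ⟨h0, h1, h2, y, hy, hjy, hcl⟩ := slabClean_mem.1 hj
  refine slabClean_mem.2 ⟨h0, h1, h2, y, hy, hjy, Clean_congr (fun z hz hzj => ?_) hcl⟩
  have hzi : z ≠ i := by
    rintro rfl
    have := dist_lt_of_mem_sub hz hcl.1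
    linarith [le_dist_of_resid_eq hr hij]
  rw [flipAt_of_ne hzj, flipAt_of_ne hzi]

lemma Allowed.res_pos (hB : Big δ E M s) (hz : FreeZone M s c a σ B X X')
    (h : QMode δ E M s c a σ B (Real.exp (-X' / (2 * M))) X' V u) {i : Z3}
    (hA : Allowed δ E M s c a σ X X' V u i) :
    0 < resSum δ E M s c a σ X V u (slabIdx s σ a X i) (resid s i) := by
  have hs := hB.s_pos
  have h2 := ((Real.exp_pos _).trans_le (slabSum_lower' hB hz h hA.lt.le)).trans_le hA.fav
  exact pos_of_mul_pos_right h2 (by positivity)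

lemma Allowed.le_res {i : Z3} (hA : Allowed δ E M s c a σ X X' V u i) :
    u i ^ 2 ≤ resSum δ E M s c a σ X V u (slabIdx s σ a X i) (resid s i) := by
  classical
  unfold resSum
  exact Finset.single_le_sum (f := fun x => u x ^ 2) (fun _ _ => sq_nonneg _)
    (Finset.mem_filter.2 ⟨hA.clean, rfl⟩)

lemma Allowed.lower (hB : Big δ E M s) (hz : FreeZone M s c a σ B X X')
    (h : QMode δ E M s c a σ B (Real.exp (-X' / (2 * M))) X' V u) {i : Z3}
    (hA : Allowed δ E M s c a σ X X' V u i) : Real.exp (-X' / (16 * M)) ≤ |u i| := by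
  have hs := hB.s_pos
  have hM := hB.M_pos
  have hM1 := hB.one_le_M
  have hX := hz.X_pos hB
  have hX'0 : 0 < X' := by rw [hz.hX']; positivity
  apply le_of_sq_le_sq _ (abs_nonneg _)
  have h1 : Real.exp (-X' / (16 * M)) ≤ s ^ 127 * u i ^ 2 := by
    refine (slabSum_lower' hB hz h hA.lt.le).trans (hA.fav.trans ?_)
    calc _ ≤ (s : ℝ) ^ 6 * (2 * s ^ 120 * u i ^ 2) := by gcongr; exact hA.large
      _ = 2 * (s ^ 126 * u i ^ 2) := by ring
      _ ≤ s * (s ^ 126 * u i ^ 2) := by gcongr; linarith [hB.le_s]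
      _ = _ := by ring
  rw [hB.pow_eq] at h1
  have h2 : Real.exp (-X' / (16 * M)) * Real.exp (-(127 * Real.log s)) ≤ u i ^ 2 := by
    rw [Real.exp_neg (127 * _), ← div_eq_mul_inv, div_le_iff₀ (Real.exp_pos _)]
    push_cast at h1
    linarith
  rw [sq_abs]
  refine le_trans ?_ h2
  rw [← Real.exp_nat_mul, ← Real.exp_add, Real.exp_le_exp]
  have h3 : 127 * Real.log s ≤ X' / (16 * M) := by
    rw [le_div_iff₀ (by positivity), hz.hX']
    have := hz.log_le hB
    have : M ≤ M ^ 6 := by simpa using pow_le_pow_right₀ hM1 (show 1 ≤ 6 by norm_num)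
    have := hB.log_nonneg
    nlinarith
  rw [neg_div]
  push_cast
  linarith

lemma exp_zone_le (hB : Big δ E M s) (hz : FreeZone M s c a σ B X X') :
    2 * s ^ 120 * M * s ^ 180 * Real.exp (-X' / (2 * M)) ≤ Real.exp (-X' / (8 * M)) := by
  have hs := hB.s_pos
  have hM := hB.M_pos
  have hM1 := hB.one_le_M
  have hX := hz.X_pos hB
  have hX'0 : 0 < X' := by rw [hz.hX']; positivity
  have h1 : 2 * s ^ 120 * M * s ^ 180 ≤ (s : ℝ) ^ 302 := by
    calc 2 * s ^ 120 * M * s ^ 180 ≤ s * s ^ 120 * s * (s : ℝ) ^ 180 := by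
          gcongr
          · linarith [hB.le_s]
          · exact hB.M_le
      _ = _ := by ring
  calc _ ≤ (s : ℝ) ^ 302 * Real.exp (-X' / (2 * M)) := by gcongr
    _ = Real.exp (302 * Real.log s - X' / (2 * M)) := by
      rw [hB.pow_eq, ← Real.exp_add, neg_div]; congr 1
    _ ≤ _ := by
      rw [Real.exp_le_exp]
      have h2 : X' / (2 * M) = 4 * (X' / (8 * M)) := by field_simp; ring
      have h3 : 302 * Real.log s ≤ X' / (8 * M) := by
        rw [le_div_iff₀ (by positivity), hz.hX']
        have := hz.log_le hB
        have : M ≤ M ^ 6 := by simpa using pow_le_pow_right₀ hM1 (show 1 ≤ 6 by norm_num)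
        have := hB.log_nonneg
        nlinarith
      have : 0 ≤ X' / (8 * M) := by positivity
      rw [h2, neg_div]
      linarith

set_option maxRecDepth 4000 in
/-- The pairing identity between quasimodes of two flips of the same configuration. -/
lemma flip_pairing (hB : Big δ E M s) {i j : Z3} (hε : 0 ≤ ε)
    (hi : i ∈ cube c (s ^ 40)) (hj : j ∈ cube c (s ^ 40))
    (hu : QMode δ E M s c a σ B ε X' (flipAt W i) u)
    (hu' : QMode δ E M s c a σ B ε X' (flipAt W j) u') :
    |u' j| * |u j| ≤ |u i| * |u' i| + 2 * s ^ 120 * M * ε := by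
  have hsymm := sum_mul_T_comm (δ := δ) (E := E) (V := W) (cube c (s ^ 40)) u u' hu.supp hu'.supp
  have key : ∀ (f g : Z3 → ℝ) (k : Z3), k ∈ cube c (s ^ 40) →
      QMode δ E M s c a σ B ε X' (flipAt W k) f → (∀ x, |g x| ≤ 1) →
      ∃ e d : ℝ, |e| ≤ s ^ 120 * ε ∧ |d| = δ ∧
        ∑ x ∈ cube c (s ^ 40), g x * T δ E W f x = e + d * f k * g k := by
    intro f g k hk hf hg
    refine ⟨∑ x ∈ cube c (s ^ 40), g x * T δ E (flipAt W k) f x,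
      δ * ((if W k then 1 else 0) - (if flipAt W k k then 1 else 0)), ?_, ?_, ?_⟩
    · refine (Finset.abs_sum_le_sum_abs _ _).trans ?_
      calc _ ≤ ∑ _x ∈ cube c (s ^ 40), ε := by
            refine Finset.sum_le_sum fun x hx => ?_
            rw [abs_mul]
            calc _ ≤ 1 * ε := mul_le_mul (hg x) (hf.err x hx) (abs_nonneg _) (by norm_num)
              _ = ε := one_mul _
        _ = _ := by rw [Finset.sum_const, nsmul_eq_mul, card_big_cube]
    · rw [abs_mul, abs_of_pos hB.hδ]
      cases h : W k <;> simp [flipAt, h]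
    · have hT := fun x => T_change_at (δ := δ) (E := E) (W := W) (W' := flipAt W k) (i := k)
        (fun z hz => (flipAt_of_ne hz).symm) f x
      simp only [hT, mul_add, Finset.sum_add_distrib, mul_ite, mul_zero]
      rw [Finset.sum_ite_eq' _ k, if_pos hk]
      ring
  obtain ⟨e1, d1, he1, hd1, h1⟩ := key u u' i hi hu hu'.abs_le_one
  obtain ⟨e2, d2, he2, hd2, h2⟩ := key u' u j hj hu' hu.abs_le_one
  rw [h1, h2] at hsymm
  have h3 : d2 * u' j * u j = e1 - e2 + d1 * u i * u' i := by linarith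
  have h4 : δ * (|u' j| * |u j|) ≤ 2 * (s ^ 120 * ε) + δ * (|u i| * |u' i|) := by
    calc δ * (|u' j| * |u j|) = |d2 * u' j * u j| := by rw [abs_mul, abs_mul, hd2]; ring
      _ = |e1 - e2 + d1 * u i * u' i| := by rw [h3]
      _ ≤ |e1 - e2| + |d1 * u i * u' i| := abs_add_le _ _
      _ ≤ |e1| + |e2| + |d1 * u i * u' i| := by gcongr; exact abs_sub _ _
      _ ≤ _ := by
        rw [abs_mul, abs_mul, hd1]
        generalize (s : ℝ) ^ 120 = P at *
        linarith
  have hδ := hB.hδ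
  have h5 : 2 * (s ^ 120 * ε) ≤ δ * (2 * s ^ 120 * M * ε) := by
    have h0 : (0 : ℝ) ≤ 2 * s ^ 120 * ε := by positivity
    calc 2 * (s ^ 120 * ε) = 1 * (2 * s ^ 120 * ε) := by rw [one_mul, mul_assoc]
      _ ≤ (δ * M) * (2 * s ^ 120 * ε) := mul_le_mul_of_nonneg_right hB.hδM' h0
      _ = _ := by
        generalize (s : ℝ) ^ 120 = P
        ring
  have h6 : δ * (|u' j| * |u j|) ≤ δ * (|u i| * |u' i| + 2 * s ^ 120 * M * ε) := by
    rw [mul_add]; linarith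
  exact le_of_mul_le_mul_left h6 hδ

set_option maxRecDepth 4000 in
/-- The value of a quasimode at another allowed site of a different slab is small. -/
lemma off_slab_bound (hB : Big δ E M s) (hz : FreeZone M s c a σ B X X') {i j : Z3}
    (hu : QMode δ E M s c a σ B (Real.exp (-X' / (2 * M))) X' (flipAt W i) u)
    (hu' : QMode δ E M s c a σ B (Real.exp (-X' / (2 * M))) X' (flipAt W j) u')
    (hAi : Allowed δ E M s c a σ X X' (flipAt W i) u i)
    (hAj : Allowed δ E M s c a σ X X' (flipAt W j) u' j) (hr : resid s i = resid s j)
    (hne : slabIdx s σ a X i ≠ slabIdx s σ a X j) :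
    u j ^ 2 ≤ resSum δ E M s c a σ X (flipAt W i) u (slabIdx s σ a X i) (resid s i) / s ^ 120 := by
  have hs := hB.s_pos
  have hM := hB.M_pos
  have hX := hz.X_pos hB
  have hX'0 : 0 < X' := by rw [hz.hX']; positivity
  set R := resSum δ E M s c a σ X (flipAt W i) u (slabIdx s σ a X i) (resid s i) with hR
  have hRpos : 0 < R := hAi.res_pos hB hz hu
  have outer : ∀ (p q : Z3) (f : Z3 → ℝ), Allowed δ E M s c a σ X X' (flipAt W p) f p →
      q ∈ slabClean δ E M s c a σ X (flipAt W q) (slabIdx s σ a X q) →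
      slabIdx s σ a X q < slabNum M s X' → resid s p = resid s q →
      slabIdx s σ a X p < slabIdx s σ a X q →
      f q ^ 2 ≤ 1 / s ^ 500 * (s ^ 6 *
        resSum δ E M s c a σ X (flipAt W p) f (slabIdx s σ a X p) (resid s p)) := by
    intro p q f hp hq hq' hpq hlt
    have h1 := slabClean_cross hq hpq
    have h2 : f q ^ 2 ≤ slabSum δ E M s c a σ X (flipAt W p) f (slabIdx s σ a X q) :=
      Finset.single_le_sum (f := fun x => f x ^ 2) (fun _ _ => sq_nonneg _) h1
    refine h2.trans ((hp.hyp _ hlt hq'.le).trans ?_)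
    gcongr
    exact hp.fav
  rcases lt_or_gt_of_ne hne with hlt | hlt
  · refine (outer i j u hAi hAj.clean hAj.lt hr hlt).trans ?_
    rw [← hR, le_div_iff₀ (by positivity)]
    have : (s : ℝ) ^ 126 ≤ s ^ 500 := pow_le_pow_right₀ (by linarith [hB.le_s]) (by norm_num)
    calc 1 / (s : ℝ) ^ 500 * (s ^ 6 * R) * s ^ 120 = s ^ 126 / s ^ 500 * R := by ring
      _ ≤ 1 * R := by
        gcongr
        rw [div_le_one (by positivity)]; exact this
      _ = R := one_mul R
  · have h1 := outer j i u' hAj hAi.clean hAi.lt hr.symm hlt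
    have h2 : u' i ^ 2 ≤ (1 / s ^ 180 * |u' j|) ^ 2 := by
      refine h1.trans ?_
      calc _ ≤ 1 / (s : ℝ) ^ 500 * (s ^ 6 * (2 * s ^ 120 * u' j ^ 2)) := by
            gcongr; exact hAj.large
        _ ≤ 1 / (s : ℝ) ^ 500 * (s ^ 6 * (s * s ^ 120 * u' j ^ 2)) := by
            gcongr; linarith [hB.le_s]
        _ = s ^ 127 / s ^ 500 * u' j ^ 2 := by ring
        _ ≤ 1 / s ^ 360 * u' j ^ 2 := by
            refine mul_le_mul_of_nonneg_right ?_ (sq_nonneg _)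
            rw [div_le_div_iff₀ (by positivity) (by positivity), one_mul, ← pow_add]
            exact pow_le_pow_right₀ (by linarith [hB.le_s]) (by norm_num)
        _ = _ := by rw [mul_pow, sq_abs, div_pow, one_pow, ← pow_mul]
    have h3 : |u' i| ≤ 1 / s ^ 180 * |u' j| := abs_le_of_sq_le_sq h2 (by positivity)
    have hp := flip_pairing hB (Real.exp_pos _).le (slabClean_subset _ hAi.clean)
      (slabClean_subset _ hAj.clean) hu hu'
    have hli := hAi.lower hB hz hu
    have hlj := hAj.lower hB hz hu'
    have hjp : 0 < |u' j| := (Real.exp_pos _).trans_le hlj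
    have h4 : 2 * s ^ 120 * M * Real.exp (-X' / (2 * M)) ≤ 1 / s ^ 180 * (|u i| * |u' j|) := by
      rw [one_div, inv_mul_eq_div, le_div_iff₀ (by positivity)]
      calc _ = 2 * s ^ 120 * M * s ^ 180 * Real.exp (-X' / (2 * M)) := by
            rw [mul_assoc _ ((s : ℝ) ^ 180), mul_comm ((s : ℝ) ^ 180), ← mul_assoc]
        _ ≤ Real.exp (-X' / (8 * M)) := exp_zone_le hB hz
        _ = Real.exp (-X' / (16 * M)) * Real.exp (-X' / (16 * M)) := by
          rw [← Real.exp_add]; congr 1; field_simp; ring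
        _ ≤ _ := by gcongr
    have h5 : |u' j| * |u j| ≤ |u' j| * (2 / s ^ 180 * |u i|) := by
      calc _ ≤ |u i| * (1 / s ^ 180 * |u' j|) + 1 / s ^ 180 * (|u i| * |u' j|) :=
            hp.trans (by gcongr)
        _ = _ := by ring
    have h6 := le_of_mul_le_mul_left h5 hjp
    have h7 := hAi.le_res
    rw [← hR] at h7
    rw [← sq_abs, le_div_iff₀ (by positivity)]
    calc |u j| ^ 2 * (s : ℝ) ^ 120 ≤ (2 / s ^ 180 * |u i|) ^ 2 * s ^ 120 := by gcongr
      _ = 4 / s ^ 240 * u i ^ 2 := by rw [mul_pow, sq_abs]; field_simp; ring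
      _ ≤ 1 * R := by
        gcongr
        rw [div_le_one (by positivity)]
        linarith [hB.le_s, pow_s_ge hB (show 1 ≤ 240 by norm_num)]
      _ = R := one_mul R

open Classical in
lemma incoming_weight_res (hB : Big δ E M s) (hz : FreeZone M s c a σ B X X')
    (U : Cfg → Z3 → ℝ) (ρ : Z3) {I : Finset Z3} (hI : I ⊆ cube c (s ^ 40))
    (hQ : ∀ i ∈ I, QMode δ E M s c a σ B (Real.exp (-X' / (2 * M))) X' (flipAt W i) (U (flipAt W i)))
    (hA : ∀ i ∈ I, Allowed δ E M s c a σ X X' (flipAt W i) (U (flipAt W i)) i)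
    (hρ : ∀ i ∈ I, resid s i = ρ) :
    ∑ i ∈ I, flipWeight δ E M s c a σ X (flipAt W i) (U (flipAt W i)) i ≤ 1 + M ^ 10 * B.card := by
  have hs := hB.s_pos
  have hM := hB.M_pos
  have hX := hz.X_pos hB
  have hX'0 : 0 < X' := by rw [hz.hX']; positivity
  rcases I.eq_empty_or_nonempty with rfl | ⟨i0, hi0⟩
  · simp; positivity
  have hL : s ^ 2 ≤ s ^ 40 := Nat.pow_le_pow_right hB.s_pos' (by norm_num)
  have hQW := (hQ i0 hi0).flip hB hz (hA i0 hi0).lt.le (hA i0 hi0).clean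
  rw [flipAt_flipAt] at hQW
  have hcardI : (I.card : ℝ) ≤ s ^ 120 := by
    rw [← card_big_cube s c]; exact_mod_cast Finset.card_le_card hI
  refine incoming_weight_le hB hL rfl hI hQW.good (fun i => U (flipAt W i)) _
    (ε := Real.exp (-X' / (2 * M))) (fun i hi => (hQ i hi).supp) (fun i hi => (hQ i hi).err)
    ?_ ?_ (fun i hi => (slabClean_mem.1 (hA i hi).clean).2.2.2) (fun i _ => flipWeight_nonneg i)
    (fun i hi => div_le_one_of_le₀ (hA i hi).le_res (resSum_nonneg _ _)) ?_
  · intro i hi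
    exact abs_pos.1 ((Real.exp_pos _).trans_le ((hA i hi).lower hB hz (hQ i hi)))
  · intro i hi
    have h1 := (hA i hi).lower hB hz (hQ i hi)
    refine le_trans ?_ (mul_le_mul_of_nonneg_left h1 (Real.exp_pos _).le)
    rw [← Real.exp_add, Real.exp_le_exp]
    have h2 : (s : ℝ) ^ 2 / (8 * M) ≤ X' / (16 * M) := by
      rw [div_le_div_iff₀ (by positivity) (by positivity), hz.hX']
      have h3 := hz.sq_le' hB
      have h4 : 1 ≤ M ^ 6 := one_le_pow₀ hB.one_le_M
      have h5 : (0 : ℝ) ≤ s ^ 2 := by positivity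
      have h6 : 2 * (s : ℝ) ^ 2 ≤ M ^ 6 * X := by nlinarith
      nlinarith
    have h3 : X' / (2 * M) = 8 * (X' / (16 * M)) := by field_simp; ring
    have h4 : 0 ≤ X' / (16 * M) := by positivity
    rw [neg_div, neg_div, neg_div, h3]
    linarith
  · intro i hi
    set u := U (flipAt W i) with hu
    set R := resSum δ E M s c a σ X (flipAt W i) u (slabIdx s σ a X i) (resid s i) with hR
    have hRpos : 0 < R := (hA i hi).res_pos hB hz (hQ i hi)
    have hsum : ∑ j ∈ I, u j ^ 2 ≤ 2 * R := by
      rw [← Finset.sum_filter_add_sum_filter_not I (fun j => slabIdx s σ a X i = slabIdx s σ a X j)]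
      have e1 : ∑ j ∈ I.filter (fun j => slabIdx s σ a X i = slabIdx s σ a X j), u j ^ 2 ≤ R := by
        rw [hR]
        unfold resSum
        refine Finset.sum_le_sum_of_subset_of_nonneg ?_ fun _ _ _ => sq_nonneg _
        intro j hj
        rw [Finset.mem_filter] at hj ⊢
        have hr : resid s i = resid s j := (hρ i hi).trans (hρ j hj.1).symm
        refine ⟨?_, hr.symm⟩
        have := slabClean_cross (hA j hj.1).clean hr
        rwa [← hj.2] at this
      have e2 : ∑ j ∈ I.filter (fun j => ¬ slabIdx s σ a X i = slabIdx s σ a X j), u j ^ 2 ≤ R := by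
        calc _ ≤ ∑ _j ∈ I.filter (fun j => ¬ slabIdx s σ a X i = slabIdx s σ a X j), R / s ^ 120 := by
              refine Finset.sum_le_sum fun j hj => ?_
              rw [Finset.mem_filter] at hj
              exact off_slab_bound hB hz (hQ i hi) (hQ j hj.1) (hA i hi) (hA j hj.1)
                ((hρ i hi).trans (hρ j hj.1).symm) hj.2
          _ = (I.filter (fun j => ¬ slabIdx s σ a X i = slabIdx s σ a X j)).card * (R / s ^ 120) := by
              simp
          _ ≤ s ^ 120 * (R / s ^ 120) := by
              gcongr
              refine le_trans ?_ hcardI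
              exact_mod_cast Finset.card_le_card (Finset.filter_subset _ _)
          _ = R := by field_simp
      linarith
    have hw : flipWeight δ E M s c a σ X (flipAt W i) u i = u i ^ 2 / R := rfl
    calc flipWeight δ E M s c a σ X (flipAt W i) u i * ∑ j ∈ I, u j ^ 2 ≤ u i ^ 2 / R * (2 * R) := by
          rw [hw]; gcongr
      _ = 2 * u i ^ 2 := by field_simp
      _ ≤ 4 * u i ^ 2 := by nlinarith [sq_nonneg (u i)]

open Classical in
lemma incoming_weight (hB : Big δ E M s) (hz : FreeZone M s c a σ B X X')
    (U : Cfg → Z3 → ℝ) {I : Finset Z3} (hI : I ⊆ cube c (s ^ 40))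
    (hQ : ∀ i ∈ I, QMode δ E M s c a σ B (Real.exp (-X' / (2 * M))) X' (flipAt W i) (U (flipAt W i)))
    (hA : ∀ i ∈ I, Allowed δ E M s c a σ X X' (flipAt W i) (U (flipAt W i)) i) :
    ∑ i ∈ I, flipWeight δ E M s c a σ X (flipAt W i) (U (flipAt W i)) i ≤
      s ^ 6 * (1 + M ^ 10 * B.card) := by
  rw [← Finset.sum_fiberwise_of_maps_to (fun x _ => resid_mem hB.s_pos' x)]
  calc _ ≤ ∑ _ρ ∈ cube 0 (s ^ 2), (1 + M ^ 10 * (B.card : ℝ)) := by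
        refine Finset.sum_le_sum fun ρ _ => ?_
        refine incoming_weight_res hB hz U ρ ((Finset.filter_subset _ _).trans hI)
          (fun i hi => hQ i (Finset.mem_filter.1 hi).1) (fun i hi => hA i (Finset.mem_filter.1 hi).1)
          (fun i hi => (Finset.mem_filter.1 hi).2)
    _ = _ := by
      rw [Finset.sum_const, card_cube, nsmul_eq_mul]; push_cast; ring

end Incoming

open Classical in
/-- The configurations which vanish outside `Λ`. -/
noncomputable def cfgs (Λ : Finset Z3) : Finset Cfg :=
  Λ.powerset.image (fun A x => decide (x ∈ A))

lemma mem_cfgs {Λ : Finset Z3} {V : Cfg} : V ∈ cfgs Λ ↔ ∀ x ∉ Λ, V x = false := by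
  classical
  simp only [cfgs, Finset.mem_image, Finset.mem_powerset]
  constructor
  · rintro ⟨A, hA, rfl⟩ x hx
    simp only [decide_eq_false_iff_not]
    exact fun h => hx (hA h)
  · intro h
    refine ⟨Λ.filter (fun x => V x = true), Finset.filter_subset _ _, ?_⟩
    ext x
    by_cases hx : x ∈ Λ
    · simp [hx]
    · simp [hx, h x hx]

lemma card_cfgs (Λ : Finset Z3) : (cfgs Λ).card = 2 ^ Λ.card := by
  classical
  rw [cfgs, Finset.card_image_of_injective, Finset.card_powerset]
  intro A B h
  ext x
  have := congrFun h x
  simpa using this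

lemma flipAt_mem_cfgs {Λ : Finset Z3} {V : Cfg} {x : Z3} (hx : x ∈ Λ) (hV : V ∈ cfgs Λ) :
    flipAt V x ∈ cfgs Λ := by
  rw [mem_cfgs] at *
  intro y hy
  rw [flipAt_of_ne (by rintro rfl; exact hy hx)]
  exact hV y hy

section Stage

variable {δ E M : ℝ} {s : ℕ} {c a : Z3} {σ : ℤ} {B : Finset Z3} {X X' : ℝ}

open Classical in
/-- The configurations on the large cube which have a quasimode. -/
noncomputable def modeCfgs (δ E M : ℝ) (s : ℕ) (c a : Z3) (σ : ℤ) (B : Finset Z3) (X : ℝ) :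
    Finset Cfg :=
  (cfgs (cube c (s ^ 40))).filter
    (fun V => ∃ u, QMode δ E M s c a σ B (Real.exp (-X / (2 * M))) X V u)

/-- Double counting of the flips at clean sites of a free zone. -/
lemma modeCfgs_stage (hB : Big δ E M s) (hz : FreeZone M s c a σ B X X') :
    ((modeCfgs δ E M s c a σ B X').card : ℝ) * (s ^ 17 / 2) ≤
      (modeCfgs δ E M s c a σ B X).card * (s ^ 6 * (1 + M ^ 10 * B.card)) := by
  classical
  set Λ := cube c (s ^ 40) with hΛ
  have hM := hB.M_pos
  have hs := hB.s_pos
  have hex : ∀ V : Cfg, ∃ u, V ∈ modeCfgs δ E M s c a σ B X' →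
      QMode δ E M s c a σ B (Real.exp (-X' / (2 * M))) X' V u := by
    intro V
    by_cases hV : V ∈ modeCfgs δ E M s c a σ B X'
    · obtain ⟨u, hu⟩ := (Finset.mem_filter.1 hV).2
      exact ⟨u, fun _ => hu⟩
    · exact ⟨0, fun h => absurd h hV⟩
  choose U hU using hex
  set F : Cfg → Z3 → ℝ := fun V i =>
    if V ∈ modeCfgs δ E M s c a σ B X' ∧ Allowed δ E M s c a σ X X' V (U V) i then
      flipWeight δ E M s c a σ X V (U V) i else 0 with hF
  have h1 : ((modeCfgs δ E M s c a σ B X').card : ℝ) * (s ^ 17 / 2) ≤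
      ∑ V ∈ cfgs Λ, ∑ i ∈ Λ, F V i := by
    rw [← nsmul_eq_mul, ← Finset.sum_const]
    refine (Finset.sum_le_sum fun V hV => ?_).trans (Finset.sum_le_sum_of_subset_of_nonneg
      (f := fun V => ∑ i ∈ Λ, F V i) (Finset.filter_subset _ _) ?_)
    · refine (outgoing_weight hB hz (hU V hV)).trans (le_of_eq ?_)
      rw [Finset.sum_filter]
      refine Finset.sum_congr rfl fun i _ => ?_
      simp [hF, hV]
    · intro V _ _
      refine Finset.sum_nonneg fun i _ => ?_
      simp only [hF]
      split_ifs
      · exact flipWeight_nonneg i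
      · exact le_rfl
  have h2 : ∑ V ∈ cfgs Λ, ∑ i ∈ Λ, F V i = ∑ W ∈ cfgs Λ, ∑ i ∈ Λ, F (flipAt W i) i := by
    rw [Finset.sum_comm, Finset.sum_comm (s := cfgs Λ)]
    refine Finset.sum_congr rfl fun i hi => ?_
    refine Finset.sum_nbij' (fun V => flipAt V i) (fun V => flipAt V i)
      (fun V hV => flipAt_mem_cfgs hi hV) (fun V hV => flipAt_mem_cfgs hi hV)
      (fun V _ => flipAt_flipAt i) (fun V _ => flipAt_flipAt i) (fun V _ => ?_)
    simp only [flipAt_flipAt]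
  rw [h2] at h1
  refine h1.trans ?_
  have h3 : ∑ W ∈ cfgs Λ, ∑ i ∈ Λ, F (flipAt W i) i =
      ∑ W ∈ modeCfgs δ E M s c a σ B X, ∑ i ∈ Λ, F (flipAt W i) i := by
    symm
    refine Finset.sum_subset (Finset.filter_subset _ _) fun W hW hW' => ?_
    refine Finset.sum_eq_zero fun i hi => ?_
    simp only [hF]
    rw [if_neg]
    rintro ⟨hm, hA⟩
    refine hW' (Finset.mem_filter.2 ⟨hW, U (flipAt W i), ?_⟩)
    have := (hU _ hm).flip hB hz hA.lt.le hA.clean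
    rwa [flipAt_flipAt] at this
  rw [h3, ← nsmul_eq_mul, ← Finset.sum_const]
  refine Finset.sum_le_sum fun W _ => ?_
  have h4 := incoming_weight hB hz (W := W) U (I := Λ.filter (fun i =>
    flipAt W i ∈ modeCfgs δ E M s c a σ B X' ∧
      Allowed δ E M s c a σ X X' (flipAt W i) (U (flipAt W i)) i)) (Finset.filter_subset _ _)
    (fun i hi => hU _ (Finset.mem_filter.1 hi).2.1) (fun i hi => (Finset.mem_filter.1 hi).2.2)
  rwa [Finset.sum_filter] at h4

lemma modeCfgs_free (hB : Big δ E M s) (hz : FreeZone M s c a σ B X X')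
    (hcard : (B.card : ℝ) ≤ s ^ 7) :
    ((modeCfgs δ E M s c a σ B X').card : ℝ) * s ≤ (modeCfgs δ E M s c a σ B X).card := by
  have h := modeCfgs_stage hB hz
  have hs := hB.le_s
  have h1 : M ^ 10 ≤ (s : ℝ) := hB.pow_le (by norm_num)
  have hM := hB.M_pos
  have h2 : (s : ℝ) ^ 6 * (1 + M ^ 10 * B.card) ≤ s ^ 16 / 2 := by
    calc (s : ℝ) ^ 6 * (1 + M ^ 10 * B.card) ≤ (s : ℝ) ^ 6 * (1 + (s : ℝ) * (s : ℝ) ^ 7) := by gcongr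
      _ ≤ (s : ℝ) ^ 6 * ((s : ℝ) * (s : ℝ) ^ 7 + (s : ℝ) * (s : ℝ) ^ 7) := by
        gcongr
        rw [← pow_succ']
        exact one_le_pow₀ (by linarith)
      _ = (s : ℝ) ^ 14 * 2 := by ring
      _ ≤ (s : ℝ) ^ 14 * ((s : ℝ) ^ 2 / 2) := by gcongr; nlinarith
      _ = _ := by ring
  have h3 := h.trans (mul_le_mul_of_nonneg_left h2 (Nat.cast_nonneg _))
  have h4 : (0 : ℝ) < s ^ 16 / 2 := by positivity
  refine le_of_mul_le_mul_right ?_ h4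
  calc _ = ((modeCfgs δ E M s c a σ B X').card : ℝ) * (s ^ 17 / 2) := by ring
    _ ≤ _ := h3

lemma modeCfgs_anti (hM : 0 < M) (h : X ≤ X') :
    (modeCfgs δ E M s c a σ B X').card ≤ (modeCfgs δ E M s c a σ B X).card := by
  classical
  refine Finset.card_le_card fun V hV => ?_
  obtain ⟨hV, u, hu⟩ := Finset.mem_filter.1 hV
  refine Finset.mem_filter.2 ⟨hV, u, hu.supp, hu.norm, hu.top, fun x hx => (hu.err x hx).trans ?_,
    hu.good, fun y hy hyB hyX => hu.rg y hy hyB (hyX.trans h)⟩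
  rw [Real.exp_le_exp]
  gcongr

open Classical in
/-- The neighbourhood of a set of centres. -/
noncomputable def nearSet (s : ℕ) (c : Z3) (P : Finset Z3) : Finset Z3 :=
  (cube c (s ^ 40)).filter (fun y => ∃ p ∈ P, dist y p ≤ 2 * (s : ℝ) ^ 2)

lemma card_ball_le (s : ℕ) (p : Z3) (A : Finset Z3) (hA : ∀ y ∈ A, dist y p ≤ 2 * (s : ℝ) ^ 2) :
    A.card ≤ (4 * s ^ 2 + 1) ^ 3 := by
  rw [← card_cube (fun i => p i - 2 * s ^ 2)]
  refine Finset.card_le_card fun y hy => ?_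
  rw [mem_cube]
  intro i
  have h1 := (abs_coord_le_dist y p i).trans (hA y hy)
  have h2 : |y i - p i| ≤ 2 * (s : ℤ) ^ 2 := by exact_mod_cast h1
  rw [abs_le] at h2
  push_cast
  constructor <;> linarith

lemma card_nearSet_le (hB : Big δ E M s) {P : Finset Z3} (hP : P.card ≤ 31) :
    ((nearSet s c P).card : ℝ) ≤ s ^ 7 := by
  classical
  have h1 : nearSet s c P ⊆ P.biUnion (fun p => (nearSet s c P).filter
      (fun y => dist y p ≤ 2 * (s : ℝ) ^ 2)) := by
    intro y hy
    obtain ⟨_, p, hp, hyp⟩ := Finset.mem_filter.1 hy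
    exact Finset.mem_biUnion.2 ⟨p, hp, Finset.mem_filter.2 ⟨hy, hyp⟩⟩
  have h2 := (Finset.card_le_card h1).trans (Finset.card_biUnion_le_card_mul _ _ _
    (fun p _ => card_ball_le s p _ (fun y hy => (Finset.mem_filter.1 hy).2)))
  have h3 := h2.trans (Nat.mul_le_mul_right _ hP)
  have hs := hB.le_s
  calc ((nearSet s c P).card : ℝ) ≤ 31 * (4 * s ^ 2 + 1) ^ 3 := by exact_mod_cast h3
    _ ≤ 31 * (5 * s ^ 2) ^ 3 := by gcongr; nlinarith
    _ = 3875 * s ^ 6 := by ring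
    _ ≤ (s : ℝ) * (s : ℝ) ^ 6 := by gcongr; linarith
    _ = s ^ 7 := by ring

/-- The heights separating consecutive zones. -/
noncomputable def zoneHt (M : ℝ) (s n : ℕ) : ℝ := s ^ 19 * M ^ (6 * n)

lemma zoneHt_succ (n : ℕ) : zoneHt M s (n + 1) = M ^ 6 * zoneHt M s n := by
  unfold zoneHt
  rw [mul_add, pow_add, mul_one]; ring

lemma zoneHt_mono (hM : 1 ≤ M) {m n : ℕ} (h : m ≤ n) : zoneHt M s m ≤ zoneHt M s n := by
  unfold zoneHt
  gcongr

lemma zone_blocked (hB : Big δ E M s) (hσ : σ = 1 ∨ σ = -1) {p y y' : Z3} {m n : ℕ} (hmn : m + 2 ≤ n)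
    (hy : dist y p ≤ 2 * (s : ℝ) ^ 2) (hy' : dist y' p ≤ 2 * (s : ℝ) ^ 2)
    (h1 : ((hgt σ y - hgt σ a : ℤ) : ℝ) ≤ zoneHt M s (m + 1))
    (h2 : zoneHt M s n ≤ ((hgt σ y' - hgt σ a : ℤ) : ℝ)) : False := by
  have h3 := (zoneHt_mono (s := s) hB.one_le_M hmn).trans h2
  rw [zoneHt_succ] at h3
  have h4 := abs_hgt_sub_le hσ y' y
  have h5 : dist y' y ≤ 4 * (s : ℝ) ^ 2 := by
    have := dist_triangle_right y' y p
    linarith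
  have h6 := (le_abs_self _).trans (h4.trans h5)
  push_cast at *
  have h7 : (2 : ℝ) ≤ M ^ 6 := by
    have := pow_le_pow_left₀ (by norm_num) (show (2 : ℝ) ≤ M by linarith [hB.hM]) 6
    linarith
  have h8 : (s : ℝ) ^ 19 ≤ zoneHt M s (m + 1) := by
    unfold zoneHt
    exact le_mul_of_one_le_right (by positivity) (one_le_pow₀ hB.one_le_M)
  have hs := hB.le_s
  have h9 : 5 * (s : ℝ) ^ 2 ≤ s ^ 19 := by
    calc 5 * (s : ℝ) ^ 2 ≤ s * s ^ 2 := by gcongr; linarith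
      _ = (s : ℝ) ^ 3 := by ring
      _ ≤ s ^ 19 := pow_le_pow_right₀ (by linarith) (by norm_num)
  have h10 : 2 * zoneHt M s (m + 1) ≤ M ^ 6 * zoneHt M s (m + 1) := by
    gcongr
    exact (by positivity : (0 : ℝ) ≤ s ^ 19).trans h8
  have h11 : (0 : ℝ) < s ^ 2 := by have := hB.s_pos; positivity
  linarith

open Classical in
/-- The zones among the first `N` which are close to some centre. -/
noncomputable def badZones (M : ℝ) (s : ℕ) (c a : Z3) (σ : ℤ) (P : Finset Z3) (N : ℕ) : Finset ℕ :=
  (Finset.range N).filter (fun n => ∃ y ∈ nearSet s c P,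
    zoneHt M s n ≤ ((hgt σ y - hgt σ a : ℤ) : ℝ) ∧
      ((hgt σ y - hgt σ a : ℤ) : ℝ) ≤ zoneHt M s (n + 1))

lemma card_badZones_le (hB : Big δ E M s) (hσ : σ = 1 ∨ σ = -1) (P : Finset Z3) (N : ℕ) :
    (badZones M s c a σ P N).card ≤ P.card * 2 := by
  classical
  set Z : Z3 → Finset ℕ := fun p => (badZones M s c a σ P N).filter (fun n => ∃ y : Z3,
    dist y p ≤ 2 * (s : ℝ) ^ 2 ∧ zoneHt M s n ≤ ((hgt σ y - hgt σ a : ℤ) : ℝ) ∧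
      ((hgt σ y - hgt σ a : ℤ) : ℝ) ≤ zoneHt M s (n + 1)) with hZ
  have h1 : badZones M s c a σ P N ⊆ P.biUnion Z := by
    intro n hn
    obtain ⟨_, y, hy, h⟩ := Finset.mem_filter.1 hn
    obtain ⟨_, p, hp, hyp⟩ := Finset.mem_filter.1 hy
    exact Finset.mem_biUnion.2 ⟨p, hp, Finset.mem_filter.2 ⟨hn, y, hyp, h⟩⟩
  refine (Finset.card_le_card h1).trans (Finset.card_biUnion_le_card_mul _ _ _ fun p _ => ?_)
  rcases (Z p).eq_empty_or_nonempty with h | h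
  · simp [h]
  have hmin := (Z p).min'_mem h
  have h2 : Z p ⊆ {(Z p).min' h, (Z p).min' h + 1} := by
    intro n hn
    have hle := (Z p).min'_le n hn
    by_contra hcon
    simp only [Finset.mem_insert, Finset.mem_singleton, not_or] at hcon
    obtain ⟨_, y, hy, h3, h4⟩ := Finset.mem_filter.1 hmin
    obtain ⟨_, y', hy', h3', h4'⟩ := Finset.mem_filter.1 hn
    exact zone_blocked hB hσ (by omega : (Z p).min' h + 2 ≤ n) hy hy' h4 h3'
  exact (Finset.card_le_card h2).trans Finset.card_le_two

/-- The Wegner type estimate: quasimodes are rare. -/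
lemma modeCfgs_card_le (hB : Big δ E M s) (hσ : σ = 1 ∨ σ = -1) {P : Finset Z3} (hP : P.card ≤ 31)
    (hroom : ∀ y ∈ cube c (s ^ 40), ((hgt σ y - hgt σ a : ℤ) : ℝ) ≤ (s : ℝ) ^ 40 / 4 →
      y + σ • stdv 2 ∈ cube c (s ^ 40)) {t : ℕ} (ht : M ^ (6 * (t + 62)) ≤ s) :
    ((modeCfgs δ E M s c a σ (nearSet s c P) (zoneHt M s (t + 62))).card : ℝ) * s ^ t ≤
      2 ^ (cube c (s ^ 40)).card := by
  classical
  have hs := hB.le_s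
  set N := t + 62 with hN
  have key : ∀ n ≤ N, ((modeCfgs δ E M s c a σ (nearSet s c P) (zoneHt M s n)).card : ℝ) * s ^ n ≤
      2 ^ (cube c (s ^ 40)).card * s ^ (badZones M s c a σ P n).card := by
    intro n
    induction n with
    | zero =>
      intro _
      have h1 : badZones M s c a σ P 0 = ∅ := by simp [badZones]
      rw [h1]
      simp only [pow_zero, mul_one, Finset.card_empty]
      have h2 := Finset.card_le_card (show modeCfgs δ E M s c a σ (nearSet s c P) (zoneHt M s 0) ⊆
        cfgs (cube c (s ^ 40)) from Finset.filter_subset _ _)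
      rw [card_cfgs] at h2
      exact_mod_cast h2
    | succ n ih =>
      intro hn
      have ih := ih (by omega)
      have hsub : badZones M s c a σ P n ⊆ badZones M s c a σ P (n + 1) :=
        Finset.filter_subset_filter _ (Finset.range_mono (by omega))
      by_cases hbad : n ∈ badZones M s c a σ P (n + 1)
      · have h1 : (badZones M s c a σ P n).card + 1 ≤ (badZones M s c a σ P (n + 1)).card := by
          rw [← Finset.card_insert_of_notMem (a := n) (by simp [badZones])]
          exact Finset.card_le_card (Finset.insert_subset hbad hsub)
        have h2 := modeCfgs_anti (δ := δ) (E := E) (s := s) (c := c) (a := a) (σ := σ)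
          (B := nearSet s c P) hB.M_pos (zoneHt_mono (s := s) hB.one_le_M (Nat.le_succ n))
        have h2' : ((modeCfgs δ E M s c a σ (nearSet s c P) (zoneHt M s (n + 1))).card : ℝ) ≤
          (modeCfgs δ E M s c a σ (nearSet s c P) (zoneHt M s n)).card := by exact_mod_cast h2
        calc _ ≤ ((modeCfgs δ E M s c a σ (nearSet s c P) (zoneHt M s n)).card : ℝ) * s ^ (n + 1) := by
              gcongr
          _ = ((modeCfgs δ E M s c a σ (nearSet s c P) (zoneHt M s n)).card : ℝ) * s ^ n * s := by
              rw [pow_succ]; ring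
          _ ≤ 2 ^ (cube c (s ^ 40)).card * s ^ (badZones M s c a σ P n).card * s := by gcongr
          _ = 2 ^ (cube c (s ^ 40)).card * s ^ ((badZones M s c a σ P n).card + 1) := by
              rw [pow_succ]; ring
          _ ≤ _ := by
              gcongr
              linarith
      · have hfree : FreeZone M s c a σ (nearSet s c P) (zoneHt M s n) (zoneHt M s (n + 1)) := by
          refine ⟨hσ, ?_, zoneHt_succ n, ?_, hroom, ?_⟩
          · exact le_mul_of_one_le_right (by positivity) (one_le_pow₀ hB.one_le_M)
          · refine (zoneHt_mono hB.one_le_M hn).trans ?_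
            calc zoneHt M s N ≤ s ^ 19 * s := by unfold zoneHt; gcongr
              _ = _ := by rw [← pow_succ]
          · intro y _ h1 h2 hyB
            exact hbad (Finset.mem_filter.2 ⟨by simp, y, hyB, h1, h2⟩)
        have h1 := modeCfgs_free hB hfree (card_nearSet_le hB hP)
        calc _ = ((modeCfgs δ E M s c a σ (nearSet s c P) (zoneHt M s (n + 1))).card : ℝ) * s *
              s ^ n := by rw [pow_succ]; ring
          _ ≤ ((modeCfgs δ E M s c a σ (nearSet s c P) (zoneHt M s n)).card : ℝ) * s ^ n := by gcongr
          _ ≤ _ := ih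
          _ ≤ _ := by
              gcongr
              linarith
  have h1 := key N le_rfl
  have h2 : (badZones M s c a σ P N).card ≤ 62 := by
    have := card_badZones_le (c := c) (a := a) hB hσ P N
    omega
  have h3 := h1.trans (mul_le_mul_of_nonneg_left (pow_le_pow_right₀ (by linarith : (1 : ℝ) ≤ s) h2)
    (by positivity))
  refine le_of_mul_le_mul_right ?_ (by positivity : (0 : ℝ) < s ^ 62)
  calc _ = ((modeCfgs δ E M s c a σ (nearSet s c P) (zoneHt M s N)).card : ℝ) * s ^ N := by
        rw [hN, pow_add, mul_assoc]
    _ ≤ _ := h3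

end Stage

section Profile

variable {R : Finset ℕ} {ω : ℕ}

/-- The truncated distance to a set of radii. -/
def gap (R : Finset ℕ) (ω t : ℕ) : ℕ := R.fold min ω (fun ρ : ℕ => ((t : ℤ) - ρ).natAbs)

/-- The number of unit intervals below `t` which are far from all radii. -/
def farCount (R : Finset ℕ) (ω t : ℕ) : ℕ :=
  ((Finset.range t).filter (fun τ => gap R ω τ = ω ∧ gap R ω (τ + 1) = ω)).card

/-- A slowly varying profile which dips near the given radii. -/
def profile (R : Finset ℕ) (ω t : ℕ) : ℕ := farCount R ω t + gap R ω t

lemma gap_le (t : ℕ) : gap R ω t ≤ ω := (Finset.fold_min_le _).2 (Or.inl le_rfl)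

lemma gap_le_of_mem {ρ : ℕ} (h : ρ ∈ R) (t : ℕ) : gap R ω t ≤ ((t : ℤ) - ρ).natAbs :=
  (Finset.fold_min_le _).2 (Or.inr ⟨ρ, h, le_rfl⟩)

lemma gap_cases (t : ℕ) : gap R ω t = ω ∨ ∃ ρ ∈ R, ((t : ℤ) - ρ).natAbs ≤ gap R ω t := by
  rcases (Finset.fold_min_le (s := R) (b := ω) (f := fun ρ : ℕ => ((t : ℤ) - ρ).natAbs)
    (gap R ω t)).1 le_rfl with h | h
  · exact Or.inl (le_antisymm (gap_le t) h)
  · exact Or.inr h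

lemma gap_lip (a b : ℕ) : gap R ω a ≤ gap R ω b + ((a : ℤ) - b).natAbs := by
  rcases gap_cases (R := R) (ω := ω) b with h | ⟨ρ, hρ, h⟩
  · rw [h]; exact (gap_le a).trans (Nat.le_add_right _ _)
  · have := gap_le_of_mem (ω := ω) hρ a
    omega

lemma farCount_succ (t : ℕ) : farCount R ω (t + 1) =
    farCount R ω t + if gap R ω t = ω ∧ gap R ω (t + 1) = ω then 1 else 0 := by
  unfold farCount
  rw [Finset.range_add_one, Finset.filter_insert]
  split_ifs with h
  · rw [Finset.card_insert_of_notMem (by simp)]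
  · simp

lemma profile_succ (t : ℕ) :
    profile R ω (t + 1) ≤ profile R ω t + 1 ∧ profile R ω t ≤ profile R ω (t + 1) + 1 := by
  have h1 := gap_lip (R := R) (ω := ω) t (t + 1)
  have h2 := gap_lip (R := R) (ω := ω) (t + 1) t
  have h3 : ((t : ℤ) - (t + 1 : ℕ)).natAbs = 1 := by omega
  have h4 : (((t + 1 : ℕ) : ℤ) - t).natAbs = 1 := by omega
  rw [h3] at h1
  rw [h4] at h2
  unfold profile
  rw [farCount_succ]
  split_ifs with h
  · rw [h.1, h.2]; omega
  · omega

lemma profile_lip (a b : ℕ) : |(profile R ω a : ℝ) - profile R ω b| ≤ |(a : ℝ) - b| := by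
  wlog hab : a ≤ b generalizing a b
  · rw [abs_sub_comm, abs_sub_comm (a : ℝ)]
    exact this b a (by omega)
  have key : profile R ω a ≤ profile R ω b + (b - a) ∧ profile R ω b ≤ profile R ω a + (b - a) := by
    induction b, hab using Nat.le_induction with
    | base => simp
    | succ b hab ih =>
      have := profile_succ (R := R) (ω := ω) b
      omega
  obtain ⟨k, rfl⟩ := Nat.exists_eq_add_of_le hab
  simp only [Nat.add_sub_cancel_left] at key
  have h1 : (profile R ω a : ℝ) ≤ profile R ω (a + k) + k := by exact_mod_cast key.1
  have h2 : (profile R ω (a + k) : ℝ) ≤ profile R ω a + k := by exact_mod_cast key.2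
  push_cast
  rw [abs_sub_comm (a : ℝ), add_sub_cancel_left, abs_of_nonneg (Nat.cast_nonneg (α := ℝ) k), abs_le]
  constructor <;> linarith

lemma profile_shell {t : ℕ} (ht : gap R ω t < ω) : farCount R ω t = 0 ∨
    ∃ p q : ℕ, p < t ∧ t < q ∧ gap R ω p = ω ∧ gap R ω q = ω ∧
      ∀ τ, p ≤ τ → τ ≤ q → farCount R ω τ = farCount R ω t := by
  by_cases hp : ∃ p < t, gap R ω p = ω
  swap
  · left
    unfold farCount
    rw [Finset.card_eq_zero, Finset.filter_eq_empty_iff]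
    intro τ hτ h
    exact hp ⟨τ, Finset.mem_range.1 hτ, h.1⟩
  right
  have hq : ∃ q, t < q ∧ gap R ω q = ω := by
    refine ⟨R.sup id + t + ω + 1, by omega, ?_⟩
    rcases gap_cases (R := R) (ω := ω) (R.sup id + t + ω + 1) with h | ⟨ρ, hρ, h⟩
    · exact h
    · have h1 : ρ ≤ R.sup id := Finset.le_sup (f := id) hρ
      have h2 := gap_le (R := R) (ω := ω) (R.sup id + t + ω + 1)
      omega
  set A := (Finset.range t).filter (fun p => gap R ω p = ω) with hA
  have hAne : A.Nonempty := by
    obtain ⟨p, hp1, hp2⟩ := hp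
    exact ⟨p, Finset.mem_filter.2 ⟨Finset.mem_range.2 hp1, hp2⟩⟩
  obtain ⟨hp1, hp2⟩ := Finset.mem_filter.1 (A.max'_mem hAne)
  set p := A.max' hAne with hpdef
  obtain ⟨hq1, hq2⟩ := Nat.find_spec hq
  set q := Nat.find hq with hqdef
  have hpt := Finset.mem_range.1 hp1
  have hin : ∀ τ, p < τ → τ < q → gap R ω τ ≠ ω := by
    intro τ h1 h2 h3
    rcases lt_trichotomy τ t with h | h | h
    · have := A.le_max' τ (Finset.mem_filter.2 ⟨Finset.mem_range.2 h, h3⟩)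
      omega
    · rw [h] at h3; omega
    · exact Nat.find_min hq h2 ⟨h, h3⟩
  refine ⟨p, q, hpt, hq1, hp2, hq2, ?_⟩
  have key : ∀ k, p + k ≤ q → farCount R ω (p + k) = farCount R ω p := by
    intro k
    induction k with
    | zero => simp
    | succ k ih =>
      intro hk
      rw [← add_assoc, farCount_succ, ih (by omega), if_neg, add_zero]
      rintro ⟨h1, h2⟩
      rcases Nat.eq_zero_or_pos k with rfl | hk0
      · exact hin (p + 0 + 1) (by omega) (by omega) h2
      · exact hin (p + k) (by omega) (by omega) h1
  intro τ h1 h2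
  have e1 := key (τ - p) (by omega)
  have e2 := key (t - p) (by omega)
  rw [show p + (τ - p) = τ by omega] at e1
  rw [show p + (t - p) = t by omega] at e2
  rw [e1, e2]

lemma le_profile (t : ℕ) : t ≤ profile R ω t + R.card * (2 * ω + 2) := by
  have h1 := Finset.card_filter_add_card_filter_not (s := Finset.range t)
    (fun τ => gap R ω τ = ω ∧ gap R ω (τ + 1) = ω)
  have h2 : ((Finset.range t).filter (fun τ => ¬ (gap R ω τ = ω ∧ gap R ω (τ + 1) = ω))).card ≤
      R.card * (2 * ω + 2) := by
    have hsub : (Finset.range t).filter (fun τ => ¬ (gap R ω τ = ω ∧ gap R ω (τ + 1) = ω)) ⊆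
        R.biUnion (fun ρ => (Finset.range (2 * ω + 2)).image (fun k => ρ + k - (ω + 1))) := by
      intro τ hτ
      have h3 := (Finset.mem_filter.1 hτ).2
      have h4 : ∃ ρ ∈ R, ((τ : ℤ) - ρ).natAbs < ω ∨ (((τ + 1 : ℕ) : ℤ) - ρ).natAbs < ω := by
        by_cases h5 : gap R ω τ = ω
        · have h6 : gap R ω (τ + 1) ≠ ω := fun h => h3 ⟨h5, h⟩
          rcases gap_cases (R := R) (ω := ω) (τ + 1) with h | ⟨ρ, hρ, h⟩
          · exact absurd h h6
          · have := gap_le (R := R) (ω := ω) (τ + 1)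
            exact ⟨ρ, hρ, Or.inr (by omega)⟩
        · rcases gap_cases (R := R) (ω := ω) τ with h | ⟨ρ, hρ, h⟩
          · exact absurd h h5
          · have := gap_le (R := R) (ω := ω) τ
            exact ⟨ρ, hρ, Or.inl (by omega)⟩
      obtain ⟨ρ, hρ, h⟩ := h4
      refine Finset.mem_biUnion.2 ⟨ρ, hρ, Finset.mem_image.2 ⟨τ + ω + 1 - ρ, ?_, ?_⟩⟩
      · rw [Finset.mem_range]; omega
      · omega
    refine (Finset.card_le_card hsub).trans (Finset.card_biUnion_le_card_mul _ _ _ fun ρ _ => ?_)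
    exact Finset.card_image_le.trans (by simp)
  rw [Finset.card_range] at h1
  unfold profile farCount
  omega

end Profile

section Resolvent

variable {δ E M : ℝ} {s : ℕ} {c : Z3} {P : Finset Z3} {W : Cfg}

/-- In the absence of quasimodes the Green function of the large cube is bounded. -/
lemma resolvent_bound_of_no_mode (hB : Big δ E M s) {B : Finset Z3} {ε H : ℝ} (hε : 0 < ε)
    (hrg : ∀ y ∈ cube c (s ^ 40), y ∉ B → RG δ E M s (sub c (s ^ 40) s y) W)
    (hno : ∀ a ∈ cube c (s ^ 40), ∃ σ : ℤ, ∀ u, ¬ QMode δ E M s c a σ B ε H W u) :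
    (opMat δ E (cube c (s ^ 40)) W).det ≠ 0 ∧
      ∀ x y, |Gf δ E (cube c (s ^ 40)) W x y| ≤ 1 / ε := by
  set Λ := cube c (s ^ 40) with hΛ
  have hs := hB.s_pos
  have key : ∀ v : Z3 → ℝ, (∀ x ∉ Λ, v x = 0) → ∀ N : ℝ, 0 < N → ∑ x ∈ Λ, v x ^ 2 = N ^ 2 →
      ∃ x ∈ Λ, ε * N < |T δ E W v x| := by
    intro v hv N hN hsum
    by_contra! hcon
    have hn1 : ∑ x ∈ Λ, (N⁻¹ * v x) ^ 2 = 1 := by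
      simp only [mul_pow]
      rw [← Finset.mul_sum, hsum]
      field_simp
    have hne : Λ.Nonempty := by
      rw [Finset.nonempty_iff_ne_empty]
      intro h
      rw [h] at hn1
      simp at hn1
    have hcardpos : (0 : ℝ) < Λ.card := by exact_mod_cast hne.card_pos
    obtain ⟨a, ha, hmax⟩ := Finset.exists_le_of_sum_le (s := Λ) hne
      (f := fun _ => 1 / (Λ.card : ℝ)) (g := fun x => (N⁻¹ * v x) ^ 2)
      (by rw [hn1, Finset.sum_const, nsmul_eq_mul]; field_simp; exact le_rfl)
    obtain ⟨σ, hσ⟩ := hno a ha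
    refine hσ (fun x => N⁻¹ * v x) ⟨?_, hn1.le, ?_, ?_, fun y hy hyB => (hrg y hy hyB).1,
      fun y hy hyB _ => hrg y hy hyB⟩
    · intro x hx; rw [hv x hx, mul_zero]
    · refine le_of_sq_le_sq ?_ (abs_nonneg _)
      rw [sq_abs, div_pow, one_pow, ← pow_mul]
      rw [card_big_cube] at hmax
      exact hmax
    · intro x hx
      rw [T_mul, abs_mul, abs_of_pos (inv_pos.2 hN), inv_mul_le_iff₀ hN, mul_comm]
      exact hcon x hx
  have hdet : (opMat δ E Λ W).det ≠ 0 := by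
    refine det_ne_zero_of_inj fun v hv hT => ?_
    by_contra hcon
    push Not at hcon
    obtain ⟨z, hz⟩ := hcon
    have hzΛ : z ∈ Λ := by
      by_contra h
      exact hz (hv z h)
    have hpos : 0 < ∑ x ∈ Λ, v x ^ 2 :=
      Finset.sum_pos' (fun _ _ => sq_nonneg _) ⟨z, hzΛ, by positivity⟩
    obtain ⟨x, hx, h⟩ := key v hv _ (Real.sqrt_pos.2 hpos) (Real.sq_sqrt hpos.le).symm
    rw [hT x hx, abs_zero] at h
    have : 0 < ε * Real.sqrt (∑ x ∈ Λ, v x ^ 2) := mul_pos hε (Real.sqrt_pos.2 hpos)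
    linarith
  refine ⟨hdet, fun x y => ?_⟩
  by_cases hy : y ∈ Λ
  swap
  · rw [Gf_off_right hy, abs_zero]; positivity
  by_cases hx : x ∈ Λ
  swap
  · rw [Gf_off_left hx, abs_zero]; positivity
  rcases eq_or_ne (Gf δ E Λ W x y) 0 with h0 | h0
  · rw [h0, abs_zero]; positivity
  have hle : Gf δ E Λ W x y ^ 2 ≤ ∑ z ∈ Λ, Gf δ E Λ W z y ^ 2 :=
    Finset.single_le_sum (f := fun z => Gf δ E Λ W z y ^ 2) (fun _ _ => sq_nonneg _) hx
  have hpos : 0 < ∑ z ∈ Λ, Gf δ E Λ W z y ^ 2 := lt_of_lt_of_le (by positivity) hle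
  obtain ⟨z, hz, h⟩ := key (fun z => Gf δ E Λ W z y) (fun z hz => Gf_off_left hz y) _
    (Real.sqrt_pos.2 hpos) (Real.sq_sqrt hpos.le).symm
  rw [T_Gf hdet hz hy] at h
  have h1 : |if z = y then (1 : ℝ) else 0| ≤ 1 := by split_ifs <;> simp
  rw [le_div_iff₀ hε]
  have h2 : |Gf δ E Λ W x y| ≤ Real.sqrt (∑ z ∈ Λ, Gf δ E Λ W z y ^ 2) := by
    rw [← Real.sqrt_sq_eq_abs]
    exact Real.sqrt_le_sqrt hle
  nlinarith

end Resolvent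

/-- The distance as a natural number. -/
noncomputable def nd (x y : Z3) : ℕ := ⌊dist x y⌋₊

lemma nd_cast (x y : Z3) : (nd x y : ℝ) = dist x y := by
  obtain ⟨n, hn⟩ := exists_nat_dist x y
  rw [nd, hn, Nat.floor_natCast]

lemma nd_lip (x y z : Z3) : |(nd x z : ℝ) - nd y z| ≤ dist x y := by
  rw [nd_cast, nd_cast]
  exact abs_dist_sub_le x y z

lemma nd_lip_nat {x y : Z3} {k : ℕ} (z : Z3) (h : dist x y ≤ k) :
    nd x z ≤ nd y z + k ∧ nd y z ≤ nd x z + k := by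
  have h1 := abs_le.1 ((nd_lip x y z).trans h)
  constructor
  · have : (nd x z : ℝ) ≤ nd y z + k := by linarith
    exact_mod_cast this
  · have : (nd y z : ℝ) ≤ nd x z + k := by linarith
    exact_mod_cast this

section Decay

variable {δ E M : ℝ} {s : ℕ} {c : Z3} {P : Finset Z3} {W : Cfg}

lemma Big.rate_le_one (hB : Big δ E M s) : 1 / M + 2 / s ≤ 1 := by
  have h1 : 1 / M ≤ 1 / 10 ^ 6 := one_div_le_one_div_of_le (by norm_num) hB.hM
  have h2 : 2 / (s : ℝ) ≤ 2 / 10 ^ 6 := by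
    gcongr
    exact hB.le_s
  norm_num at *
  linarith

lemma Big.rate_nonneg (hB : Big δ E M s) : 0 ≤ 1 / M + 2 / s := by
  have := hB.M_pos
  positivity

/-- Restriction to a shell: a solution is controlled by its values near the boundary spheres. -/
lemma shell_bound {Λ : Finset Z3} (hdet : (opMat δ E Λ W).det ≠ 0) {K b : ℝ} (hK0 : 0 ≤ K)
    (hK : ∀ x y, |Gf δ E Λ W x y| ≤ K) {u : Z3 → ℝ} {y0 : Z3} (hu : ∀ x ∉ Λ, u x = 0)
    (hTu : ∀ x ∈ Λ, x ≠ y0 → T δ E W u x = 0) {p q : ℕ}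
    (hb0 : 0 ≤ b)
    (hb : ∀ x, p ≤ nd x y0 → nd x y0 ≤ q → (nd x y0 ≤ p + 1 ∨ q ≤ nd x y0 + 1) → |u x| ≤ b)
    {x : Z3} (hxp : p < nd x y0) (hxq : nd x y0 < q) :
    |u x| ≤ Λ.card * (K * (6 * b)) := by
  set v : Z3 → ℝ := fun z => if p < nd z y0 ∧ nd z y0 < q then u z else 0 with hv
  have hvx : v x = u x := by simp only [hv]; rw [if_pos ⟨hxp, hxq⟩]
  have hvΛ : ∀ z ∉ Λ, v z = 0 := by
    intro z hz
    simp only [hv]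
    split_ifs
    · exact hu z hz
    · rfl
  have hT : ∀ z ∈ Λ, |T δ E W v z| ≤ 6 * b := by
    intro z hz
    by_cases hzs : p < nd z y0 ∧ nd z y0 < q
    · have hne : z ≠ y0 := by
        rintro rfl
        have : nd z z = 0 := by simp [nd]
        omega
      have h1 : T δ E W v z = T δ E W u z - T δ E W (fun w => u w - v w) z := by
        rw [← T_sub]
        congr 1
        ext w
        ring
      have h2 : T δ E W (fun w => u w - v w) z = - nbs (fun w => u w - v w) z := by
        have : u z - v z = 0 := by simp only [hv]; rw [if_pos hzs, sub_self]
        simp only [T, this, mul_zero, zero_sub]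
      rw [h1, hTu z hz hne, h2, zero_sub, neg_neg]
      refine nbs_abs_le fun w hw => ?_
      simp only [hv]
      split_ifs with h
      · rw [sub_self, abs_zero]; exact hb0
      · rw [sub_zero]
        have := nd_lip_nat y0 (k := 1) (by exact_mod_cast hw : dist w z ≤ (1 : ℕ))
        refine hb w ?_ ?_ ?_ <;> omega
    · have h2 : T δ E W v z = - nbs v z := by
        have : v z = 0 := by simp only [hv]; rw [if_neg hzs]
        simp only [T, this, mul_zero, zero_sub]
      rw [h2, abs_neg]
      refine nbs_abs_le fun w hw => ?_
      simp only [hv]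
      split_ifs with h
      · have := nd_lip_nat y0 (k := 1) (by exact_mod_cast hw : dist w z ≤ (1 : ℕ))
        refine hb w ?_ ?_ ?_ <;> omega
      · rw [abs_zero]; exact hb0
  rw [← hvx, Gf_repr hdet hvΛ x]
  refine (Finset.abs_sum_le_sum_abs _ _).trans ?_
  rw [← nsmul_eq_mul, ← Finset.sum_const]
  refine Finset.sum_le_sum fun z hz => ?_
  rw [abs_mul]
  exact mul_le_mul (hK x z) (hT z hz) (abs_nonneg _) hK0

set_option maxRecDepth 4000 in
lemma shell_numeric (hB : Big δ E M s) : s ^ 120 * (Real.exp (s ^ 20 / (2 * M)) * 6) *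
    Real.exp (-(1 / M + 2 / s) * (s ^ 30 - 1 - 2 * s ^ 2)) ≤ 1 / 2 := by
  have hs := hB.le_s
  have hs0 := hB.s_pos
  have hM := hB.M_pos
  have h1 : (s : ℝ) ^ 120 * 12 ≤ Real.exp s := by
    calc (s : ℝ) ^ 120 * 12 ≤ (s : ℝ) ^ 120 * s := by gcongr; linarith
      _ = (s : ℝ) ^ 121 := by rw [← pow_succ]
      _ = Real.exp ((121 : ℕ) * Real.log s) := hB.pow_eq 121
      _ ≤ _ := by
        rw [Real.exp_le_exp]
        have := hB.log_le
        have := hB.log_nonneg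
        push_cast
        linarith
  have h2 : (s : ℝ) ^ 20 / (2 * M) ≤ s ^ 20 :=
    div_le_self (by positivity) (by linarith [hB.one_le_M])
  have h3 : (s : ℝ) ^ 29 ≤ (1 / M + 2 / s) * (s ^ 30 - 1 - 2 * s ^ 2) := by
    have h4 : (s : ℝ) ^ 30 / 2 ≤ s ^ 30 - 1 - 2 * s ^ 2 := by
      have h5 : (s : ℝ) ^ 3 ≤ s ^ 30 := pow_le_pow_right₀ (by linarith) (by norm_num)
      have h6 : 1 ≤ (s : ℝ) ^ 2 := one_le_pow₀ (by linarith)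
      have h7 : 10 * (s : ℝ) ^ 2 ≤ s ^ 3 := by
        calc 10 * (s : ℝ) ^ 2 ≤ (s : ℝ) * (s : ℝ) ^ 2 := by gcongr; linarith
          _ = (s : ℝ) ^ 3 := by ring
      linarith
    calc (s : ℝ) ^ 29 = 2 / s * (s ^ 30 / 2) := by field_simp
      _ ≤ (1 / M + 2 / s) * (s ^ 30 - 1 - 2 * s ^ 2) := by
        gcongr
        have : 0 < 1 / M := by positivity
        linarith
  have h8 : (s : ℝ) + s ^ 20 ≤ s ^ 29 := by
    have h5 : (s : ℝ) ≤ s ^ 20 := le_self_pow₀ (by linarith) (by norm_num)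
    calc (s : ℝ) + s ^ 20 ≤ 2 * s ^ 20 := by linarith
      _ ≤ (s : ℝ) * (s : ℝ) ^ 20 := by gcongr; linarith
      _ = (s : ℝ) ^ 21 := by rw [← pow_succ']
      _ ≤ s ^ 29 := pow_le_pow_right₀ (by linarith) (by norm_num)
  calc _ = (s ^ 120 * 12) * Real.exp (s ^ 20 / (2 * M)) *
        Real.exp (-(1 / M + 2 / s) * (s ^ 30 - 1 - 2 * s ^ 2)) * (1 / 2) := by
        generalize (s : ℝ) ^ 120 = A
        ring
    _ ≤ Real.exp s * Real.exp (s ^ 20) * Real.exp (-(s ^ 29 : ℝ)) * (1 / 2) := by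
        gcongr
        rw [neg_mul]
        linarith
    _ = Real.exp (s + s ^ 20 - s ^ 29) * (1 / 2) := by rw [← Real.exp_add, ← Real.exp_add]; rfl
    _ ≤ 1 * (1 / 2) := by
        gcongr
        rw [Real.exp_le_one_iff]
        linarith
    _ = 1 / 2 := one_mul _

set_option maxHeartbeats 1600000 in
lemma green_profile_bound (hB : Big δ E M s) (hP : P.card ≤ 31)
    (hG : ∀ y ∈ cube c (s ^ 40), y ∉ nearSet s c P → Good δ E M s (sub c (s ^ 40) s y) W)
    (hdet : (opMat δ E (cube c (s ^ 40)) W).det ≠ 0)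
    (hK : ∀ x y, |Gf δ E (cube c (s ^ 40)) W x y| ≤ Real.exp (s ^ 20 / (2 * M)))
    {x y : Z3} (hy : y ∈ cube c (s ^ 40)) :
    |Gf δ E (cube c (s ^ 40)) W x y| ≤
      Real.exp (s ^ 20 - (1 / M + 2 / s) * (dist x y - 66 * s ^ 30)) := by
  classical
  set Λ := cube c (s ^ 40) with hΛ
  set R : Finset ℕ := insert 0 (P.image (fun p => nd p y)) with hR
  have hRcard : R.card ≤ 32 := (Finset.card_insert_le _ _).trans
    (by have := Finset.card_image_le (s := P) (f := fun p => nd p y); omega)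
  set m := 1 / M + 2 / (s : ℝ) with hm
  have hs := hB.le_s
  have hs0 := hB.s_pos
  have hM := hB.M_pos
  have hm0 : 0 ≤ m := hB.rate_nonneg
  have hm1 : m ≤ 1 := hB.rate_le_one
  set Φ : Z3 → ℝ := fun z => m * profile R (s ^ 30) (nd z y) with hΦ
  set u : Z3 → ℝ := fun z => Gf δ E Λ W z y with hu
  set K := Real.exp (s ^ 20 / (2 * M)) with hKdef
  have hΦlip : ∀ a b, |Φ a - Φ b| ≤ m * dist a b := by
    intro a b
    simp only [hΦ]
    rw [← mul_sub, abs_mul, abs_of_nonneg hm0]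
    exact mul_le_mul_of_nonneg_left ((profile_lip _ _).trans (nd_lip a b y)) hm0
  obtain ⟨z0, hz0, hmax⟩ := Finset.exists_max_image Λ (fun z => |u z| * Real.exp (Φ z)) ⟨y, hy⟩
  set F := |u z0| * Real.exp (Φ z0) with hF
  have hF0 : 0 ≤ F := by positivity
  have hubd : ∀ z, |u z| ≤ F * Real.exp (-Φ z) := by
    intro z
    by_cases hz : z ∈ Λ
    · have := hmax z hz
      rw [Real.exp_neg, ← div_eq_mul_inv, le_div_iff₀ (Real.exp_pos _)]
      exact this
    · simp only [hu]
      rw [Gf_off_left hz, abs_zero]; positivity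
  have hs30 : 2 * s ^ 2 < s ^ 30 := by
    have : 2 < s := by
      have : (2 : ℝ) < s := by linarith
      exact_mod_cast this
    calc 2 * s ^ 2 < s * s ^ 2 := by gcongr
      _ = s ^ 3 := by ring
      _ ≤ s ^ 30 := Nat.pow_le_pow_right (by omega) (by norm_num)
  have hmp := max_principle hB (Nat.pow_le_pow_right hB.s_pos' (by norm_num) : s ^ 2 ≤ s ^ 40)
    (u := u) (V := W) (fun z hz => Gf_off_left hz y) (fun z => z ∉ nearSet s c P) hG hΦlip
    (R := Real.exp (m * s ^ 2)) (A := max (K * Real.exp (m * (2 * s ^ 2))) (F / 2)) ?_ ?_ hz0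
  · have hF1 : F ≤ max (K * Real.exp (m * (2 * s ^ 2)))
        (2 * s ^ 6 * Real.exp s * Real.exp (m * s ^ 2)) := by
      rcases le_max_iff.1 hmp with h | h
      · rcases le_max_iff.1 h with h | h
        · exact le_max_of_le_left h
        · have : F ≤ 0 := by linarith
          refine this.trans (le_max_of_le_left (by positivity))
      · exact le_max_of_le_right h
    have hs2 : 10 * (s : ℝ) ^ 2 ≤ s ^ 20 := by
      calc 10 * (s : ℝ) ^ 2 ≤ (s : ℝ) * (s : ℝ) ^ 2 := by gcongr; linarith
        _ = (s : ℝ) ^ 3 := by ring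
        _ ≤ s ^ 20 := pow_le_pow_right₀ (by linarith) (by norm_num)
    have hs1 : (s : ℝ) ≤ s ^ 2 := le_self_pow₀ (by linarith) (by norm_num)
    have hF2 : F ≤ Real.exp (s ^ 20) := by
      refine hF1.trans (max_le ?_ ?_)
      · rw [hKdef, ← Real.exp_add, Real.exp_le_exp]
        have h1 : (s : ℝ) ^ 20 / (2 * M) ≤ s ^ 20 / 2 := by
          gcongr
          linarith [hB.one_le_M]
        have h2 : m * (2 * (s : ℝ) ^ 2) ≤ 1 * (2 * s ^ 2) := by gcongr
        linarith
      · calc _ ≤ Real.exp s * Real.exp s * Real.exp (1 * s ^ 2) := by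
              gcongr
              calc 2 * (s : ℝ) ^ 6 ≤ (s : ℝ) * s ^ 6 := by gcongr; linarith
                _ = (s : ℝ) ^ 7 := by ring
                _ = Real.exp ((7 : ℕ) * Real.log s) := hB.pow_eq 7
                _ ≤ _ := by
                  rw [Real.exp_le_exp]
                  have := hB.log_le
                  have := hB.log_nonneg
                  push_cast
                  linarith
          _ = Real.exp (s + s + 1 * s ^ 2) := by rw [← Real.exp_add, ← Real.exp_add]
          _ ≤ _ := by
            rw [Real.exp_le_exp]
            linarith
    refine (hubd x).trans ((mul_le_mul_of_nonneg_right hF2 (Real.exp_pos _).le).trans ?_)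
    rw [← Real.exp_add, Real.exp_le_exp, sub_eq_add_neg]
    have h1 := le_profile (R := R) (ω := s ^ 30) (nd x y)
    have h2 : R.card * (2 * s ^ 30 + 2) ≤ 66 * s ^ 30 := by
      have : 1 ≤ s ^ 2 := Nat.one_le_pow _ _ hB.s_pos'
      have h64 : 64 ≤ 2 * s ^ 30 := by
        have h3 : 32 ≤ s := by
          have : (32 : ℝ) ≤ s := by linarith
          exact_mod_cast this
        have := Nat.le_self_pow (show 30 ≠ 0 by norm_num) s
        omega
      calc _ ≤ 32 * (2 * s ^ 30 + 2) := Nat.mul_le_mul_right _ hRcard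
        _ ≤ _ := by omega
    have h3 : (nd x y : ℝ) ≤ profile R (s ^ 30) (nd x y) + 66 * s ^ 30 := by
      exact_mod_cast h1.trans (by omega)
    rw [nd_cast] at h3
    have h4 : m * (dist x y - 66 * s ^ 30) ≤ m * profile R (s ^ 30) (nd x y) := by
      gcongr
      linarith
    simp only [hΦ]
    linarith
  · intro z hz hzP w hw
    have hw' : w ∈ Λ := sub_subset (Nat.pow_le_pow_right hB.s_pos' (by norm_num)) z hw
    simp only [hu]
    rw [T_Gf hdet hw' hy]
    split_ifs with h
    · rw [abs_one, one_mul, Real.exp_le_exp]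
      simp only [hΦ]
      gcongr
      have h1 : profile R (s ^ 30) (nd z y) ≤ nd z y := by
        have h2 := profile_lip (R := R) (ω := s ^ 30) (nd z y) 0
        have h3 : profile R (s ^ 30) 0 = 0 := by
          have : gap R (s ^ 30) 0 ≤ 0 := by
            simpa using gap_le_of_mem (ω := s ^ 30) (Finset.mem_insert_self 0 _ : 0 ∈ R) 0
          simp only [profile, farCount, Finset.range_zero, Finset.filter_empty, Finset.card_empty]
          omega
        rw [h3] at h2
        simp only [Nat.cast_zero, sub_zero, Nat.abs_cast] at h2
        exact_mod_cast h2
      have h4 : dist z y < (s : ℝ) ^ 2 := by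
        rw [← h]
        exact dist_lt_of_mem_sub (mem_sub hB (Nat.pow_le_pow_right hB.s_pos' (by norm_num)) hz) hw
      rw [← nd_cast] at h4
      have h5 : (profile R (s ^ 30) (nd z y) : ℝ) ≤ nd z y := by exact_mod_cast h1
      linarith
    · rw [abs_zero, zero_mul]; positivity
  · intro z hz hzP
    push Not at hzP
    obtain ⟨-, p, hp, hzp⟩ := Finset.mem_filter.1 hzP
    have hgap : gap R (s ^ 30) (nd z y) ≤ 2 * s ^ 2 := by
      have h1 := gap_le_of_mem (R := R) (ω := s ^ 30)
        (Finset.mem_insert_of_mem (Finset.mem_image_of_mem (fun p => nd p y) hp) : nd p y ∈ R) (nd z y)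
      have h2 := nd_lip_nat y (k := 2 * s ^ 2) (by push_cast; exact hzp : dist z p ≤ ((2 * s ^ 2 : ℕ) : ℝ))
      omega
    rcases profile_shell (lt_of_le_of_lt hgap hs30) with h | ⟨p', q', hp', hq', hgp, hgq, hD⟩
    · refine le_max_of_le_left ?_
      refine mul_le_mul (hK z y) ?_ (Real.exp_pos _).le (Real.exp_pos _).le
      rw [Real.exp_le_exp]
      simp only [hΦ]
      gcongr
      have : profile R (s ^ 30) (nd z y) ≤ 2 * s ^ 2 := by
        rw [profile, h]; omega
      exact_mod_cast this
    · refine le_max_of_le_right ?_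
      set D := farCount R (s ^ 30) (nd z y) with hDdef
      have hb := shell_bound (b := F * Real.exp (-(m * (D + s ^ 30 - 1)))) hdet (Real.exp_pos _).le hK
        (u := u) (y0 := y) (fun z hz => Gf_off_left hz y)
        (fun w hw hwy => by simp only [hu]; rw [T_Gf hdet hw hy, if_neg hwy])
        (by positivity) (p := p') (q := q') ?_ hp' hq'
      · have hz1 : Φ z ≤ m * (D + 2 * s ^ 2) := by
          simp only [hΦ]
          gcongr
          rw [profile, ← hDdef]
          push_cast
          gcongr
          exact_mod_cast hgap
        have hcard : (Λ.card : ℝ) = s ^ 120 := card_big_cube s c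
        calc |u z| * Real.exp (Φ z) ≤ (Λ.card * (K * (6 * (F * Real.exp (-(m * (D + s ^ 30 - 1))))))) *
              Real.exp (m * (D + 2 * s ^ 2)) := by gcongr
          _ = F * (Λ.card * (K * 6) * (Real.exp (-(m * (D + s ^ 30 - 1))) *
              Real.exp (m * (D + 2 * s ^ 2)))) := by ring
          _ = F * (s ^ 120 * (K * 6) * Real.exp (-m * (s ^ 30 - 1 - 2 * s ^ 2))) := by
              rw [← Real.exp_add, hcard]
              congr 4
              ring
          _ ≤ F * (1 / 2) := by gcongr; exact shell_numeric hB
          _ = F / 2 := by ring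
      · intro w h1 h2 h3
        refine (hubd w).trans ?_
        gcongr
        simp only [hΦ]
        gcongr
        have h4 : D + s ^ 30 ≤ profile R (s ^ 30) (nd w y) + 1 := by
          rw [profile, hD _ h1 h2]
          rcases h3 with h3 | h3
          · have := gap_lip (R := R) (ω := s ^ 30) p' (nd w y)
            omega
          · have := gap_lip (R := R) (ω := s ^ 30) q' (nd w y)
            omega
        have h5 : (D : ℝ) + s ^ 30 ≤ profile R (s ^ 30) (nd w y) + 1 := by exact_mod_cast h4
        linarith

/-- Exponential decay at the next scale. -/
lemma good_next (hB : Big δ E M s) (hP : P.card ≤ 31)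
    (hG : ∀ y ∈ cube c (s ^ 40), y ∉ nearSet s c P → Good δ E M s (sub c (s ^ 40) s y) W)
    (hdet : (opMat δ E (cube c (s ^ 40)) W).det ≠ 0)
    (hK : ∀ x y, |Gf δ E (cube c (s ^ 40)) W x y| ≤ Real.exp (s ^ 20 / (2 * M))) :
    Good δ E M (s ^ 20) (cube c (s ^ 40)) W := by
  have hs := hB.le_s
  have hs0 := hB.s_pos
  have hM := hB.M_pos
  refine ⟨hdet, fun x hx y hy => ?_⟩
  by_cases h : ((s ^ 20 : ℕ) : ℝ) ^ 2 / 8 ≤ dist x y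
  swap
  · rw [if_neg h]
    refine (hK x y).trans_lt ?_
    rw [Real.exp_lt_exp]
    push_cast
    exact div_lt_self (by positivity) (by linarith [hB.one_le_M])
  rw [if_pos h]
  refine (green_profile_bound hB hP hG hdet hK hy).trans_lt ?_
  rw [Real.exp_lt_exp]
  push_cast at *
  rw [← pow_mul] at h
  norm_num at h
  set t := dist x y with ht
  have hm1 := hB.rate_le_one
  have h1 : (1 / M + 2 / s) * (66 * (s : ℝ) ^ 30) ≤ 1 * (66 * s ^ 30) := by gcongr
  have h2 : 3 / (s : ℝ) ^ 20 ≤ 1 / s := by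
    rw [div_le_div_iff₀ (by positivity) hs0]
    calc 3 * (s : ℝ) ≤ s * s := by gcongr; linarith
      _ = s ^ 2 := by ring
      _ ≤ s ^ 20 := pow_le_pow_right₀ (by linarith) (by norm_num)
      _ = 1 * s ^ 20 := (one_mul _).symm
  have h3 : 3 / (s : ℝ) ^ 20 * t ≤ 1 / s * t := by gcongr
  have h4 : (s : ℝ) ^ 39 / 8 ≤ 1 / s * t := by
    rw [one_div, inv_mul_eq_div, le_div_iff₀ hs0]
    calc (s : ℝ) ^ 39 / 8 * s = s ^ 40 / 8 := by ring
      _ ≤ t := h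
  have h5 : (s : ℝ) ^ 20 + 66 * s ^ 30 < s ^ 39 / 8 := by
    have h6 : (s : ℝ) ^ 20 ≤ s ^ 30 := pow_le_pow_right₀ (by linarith) (by norm_num)
    have h7 : 67 * (s : ℝ) ^ 30 < s * s ^ 30 / 8 := by
      have : (0 : ℝ) < s ^ 30 := by positivity
      have h9 : 536 < (s : ℝ) := by linarith
      linarith [mul_lt_mul_of_pos_right h9 this]
    have h8 : (s : ℝ) * s ^ 30 ≤ s ^ 39 := by
      rw [← pow_succ']
      exact pow_le_pow_right₀ (by linarith) (by norm_num)
    linarith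
  have h9 : 2 / (s : ℝ) * t = 1 / s * t + 1 / s * t := by ring
  calc (s : ℝ) ^ 20 - (1 / M + 2 / s) * (t - 66 * s ^ 30) =
      s ^ 20 - 1 / M * t - 2 / s * t + (1 / M + 2 / s) * (66 * s ^ 30) := by ring
    _ < - (1 / M * t) - 3 / s ^ 20 * t := by linarith
    _ = _ := by ring

end Decay

section HitStep

variable {δ E M : ℝ} {s : ℕ} {c : Z3} {P : Finset Z3} {V W : Cfg}

lemma far_numeric (hB : Big δ E M s) :
    Real.exp (s ^ 20 / (2 * M)) * Real.exp (-((1 / M + 2 / s) * (s ^ 25 - 5 * s ^ 2))) ≤ 1 ∧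
      2 * (s : ℝ) ^ 6 * Real.exp s * Real.exp (-((1 / M + 2 / s) * (s ^ 25 - 5 * s ^ 2))) ≤ 1 := by
  have hs := hB.le_s
  have hs0 := hB.s_pos
  have hM := hB.M_pos
  have h1 : (s : ℝ) ^ 20 ≤ (1 / M + 2 / s) * (s ^ 25 - 5 * s ^ 2) := by
    have h2 : 2 * (s : ℝ) ^ 21 ≤ s ^ 25 - 5 * s ^ 2 := by
      have h3 : (s : ℝ) ^ 2 ≤ s ^ 21 := pow_le_pow_right₀ (by linarith) (by norm_num)
      have h4 : 7 * (s : ℝ) ^ 21 ≤ s ^ 4 * s ^ 21 := by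
        gcongr
        have : (s : ℝ) ^ 1 ≤ s ^ 4 := pow_le_pow_right₀ (by linarith) (by norm_num)
        linarith
      have h5 : (s : ℝ) ^ 4 * s ^ 21 = s ^ 25 := by rw [← pow_add]
      linarith
    have h3 : 1 / (s : ℝ) ≤ 1 / M + 2 / s := by
      have : 0 < 1 / M := by positivity
      have : 1 / (s : ℝ) ≤ 2 / s := by gcongr; norm_num
      linarith
    calc (s : ℝ) ^ 20 = 1 / s * s ^ 21 := by field_simp
      _ ≤ (1 / M + 2 / s) * (s ^ 25 - 5 * s ^ 2) := by
        gcongr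
        have : 0 < (s : ℝ) ^ 21 := by positivity
        linarith
  constructor
  · rw [← Real.exp_add, Real.exp_le_one_iff]
    have : (s : ℝ) ^ 20 / (2 * M) ≤ s ^ 20 := div_le_self (by positivity) (by linarith [hB.one_le_M])
    linarith
  · have h2 : (2 : ℝ) ≤ Real.exp 1 := by linarith [Real.add_one_le_exp (1 : ℝ)]
    rw [hB.pow_eq 6]
    calc 2 * Real.exp ((6 : ℕ) * Real.log s) * Real.exp s *
          Real.exp (-((1 / M + 2 / s) * (s ^ 25 - 5 * s ^ 2)))
        ≤ Real.exp 1 * Real.exp ((6 : ℕ) * Real.log s) * Real.exp s *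
          Real.exp (-((1 / M + 2 / s) * (s ^ 25 - 5 * s ^ 2))) := by gcongr
      _ ≤ 1 := by
        rw [← Real.exp_add, ← Real.exp_add, ← Real.exp_add, Real.exp_le_one_iff]
        have h3 := hB.log_le
        have h4 : (s : ℝ) ^ 2 ≤ s ^ 20 := pow_le_pow_right₀ (by linarith) (by norm_num)
        push_cast
        nlinarith

/-- The Green function between a point near the bad set and a point far from it is small. -/
lemma green_near_far (hB : Big δ E M s)
    (hG : ∀ y ∈ cube c (s ^ 40), y ∉ nearSet s c P → Good δ E M s (sub c (s ^ 40) s y) W)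
    (hdet : (opMat δ E (cube c (s ^ 40)) W).det ≠ 0)
    (hK : ∀ x y, |Gf δ E (cube c (s ^ 40)) W x y| ≤ Real.exp (s ^ 20 / (2 * M)))
    {z y : Z3} (hz : z ∈ cube c (s ^ 40)) (hzP : ∀ p ∈ P, (s : ℝ) ^ 25 - 2 * s ^ 2 ≤ dist z p)
    (hy : y ∈ nearSet s c P) : |Gf δ E (cube c (s ^ 40)) W z y| ≤ 1 := by
  have hM := hB.M_pos
  have hs0 := hB.s_pos
  have hL : s ^ 2 ≤ s ^ 40 := Nat.pow_le_pow_right hB.s_pos' (by norm_num)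
  obtain ⟨hyΛ, -⟩ := Finset.mem_filter.1 hy
  have hfar : ∀ w ∈ nearSet s c P, (s : ℝ) ^ 25 - 4 * s ^ 2 ≤ dist w z := by
    intro w hw
    obtain ⟨-, p, hp, hwp⟩ := Finset.mem_filter.1 hw
    have h1 := hzP p hp
    have h2 := dist_triangle_left z p w
    linarith
  set m := 1 / M + 2 / (s : ℝ) with hm
  have hm0 : 0 ≤ m := hB.rate_nonneg
  have hmp := max_principle hB hL (V := W) (u := fun w => Gf δ E (cube c (s ^ 40)) W w y)
    (fun w hw => Gf_off_left hw y) (fun w => w ∉ nearSet s c P) hG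
    (Φ := fun w => -(m * dist w z))
    (R := Real.exp (-(m * (s ^ 25 - 5 * s ^ 2))))
    (A := Real.exp (s ^ 20 / (2 * M)) * Real.exp (-(m * (s ^ 25 - 5 * s ^ 2)))) ?_ ?_ ?_ hz
  · have hn := far_numeric hB
    simp only [dist_self, mul_zero, neg_zero, Real.exp_zero, mul_one] at hmp
    exact hmp.trans (max_le hn.1 hn.2)
  · intro a b
    have h1 := abs_dist_sub_le a b z
    calc |-(m * dist a z) - -(m * dist b z)| = m * |dist a z - dist b z| := by
          rw [← abs_of_nonneg hm0, ← abs_mul, ← abs_neg, abs_of_nonneg hm0]; ring_nf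
      _ ≤ m * dist a b := by gcongr
  · intro w hw hwP z' hz'
    rw [T_Gf hdet (sub_subset hL w hz') hyΛ]
    split_ifs with h
    · rw [abs_one, one_mul, Real.exp_le_exp]
      have h1 := dist_lt_of_mem_sub (mem_sub hB hL hw) hz'
      rw [h] at h1
      have h2 := hfar y hy
      have h3 := dist_triangle_left y z w
      have h4 : (s : ℝ) ^ 25 - 5 * s ^ 2 ≤ dist w z := by linarith
      have := mul_le_mul_of_nonneg_left h4 hm0
      linarith
    · rw [abs_zero, zero_mul]; positivity
  · intro w hw hwP
    push Not at hwP
    refine mul_le_mul (hK w y) ?_ (Real.exp_pos _).le (Real.exp_pos _).le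
    rw [Real.exp_le_exp]
    have h4 : (s : ℝ) ^ 25 - 5 * s ^ 2 ≤ dist w z := by
      have := hfar w hwP
      have : (0 : ℝ) ≤ s ^ 2 := by positivity
      linarith
    have := mul_le_mul_of_nonneg_left h4 hm0
    linarith

lemma close_numeric (hB : Big δ E M s) :
    (s : ℝ) ^ 120 * (6 * Real.exp (-(s ^ 2 / (8 * M)))) ≤ 1 / s ^ 130 ∧
      2 * (s : ℝ) ^ 6 * Real.exp s * (6 * Real.exp (-(s ^ 2 / (8 * M)))) ≤ 1 / s ^ 130 := by
  have hs := hB.le_s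
  have hs0 := hB.s_pos
  have hM := hB.M_pos
  have h1 : 2 * (s : ℝ) ≤ s ^ 2 / (8 * M) := by
    rw [le_div_iff₀ (by positivity)]
    have h2 := hB.pow_le (k := 2) (by norm_num)
    have h3 := hB.hM
    nlinarith
  have h2 : (12 : ℝ) ≤ Real.exp 3 := by
    have := Real.exp_one_gt_d9
    have h3 : Real.exp 3 = Real.exp 1 * Real.exp 1 * Real.exp 1 := by
      rw [← Real.exp_add, ← Real.exp_add]; norm_num
    rw [h3]
    nlinarith
  have h3 := hB.log_le
  rw [le_div_iff₀ (by positivity), le_div_iff₀ (by positivity), hB.pow_eq 130, hB.pow_eq 120,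
    hB.pow_eq 6]
  constructor
  · calc Real.exp ((120 : ℕ) * Real.log s) * (6 * Real.exp (-(s ^ 2 / (8 * M)))) *
          Real.exp ((130 : ℕ) * Real.log s)
        ≤ Real.exp ((120 : ℕ) * Real.log s) * (Real.exp 3 * Real.exp (-(s ^ 2 / (8 * M)))) *
          Real.exp ((130 : ℕ) * Real.log s) := by gcongr; linarith
      _ ≤ 1 := by
        rw [← Real.exp_add, ← Real.exp_add, ← Real.exp_add, ← Real.exp_zero, Real.exp_le_exp]
        push_cast
        linarith
  · calc 2 * Real.exp ((6 : ℕ) * Real.log s) * Real.exp s * (6 * Real.exp (-(s ^ 2 / (8 * M)))) *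
          Real.exp ((130 : ℕ) * Real.log s)
        = Real.exp ((6 : ℕ) * Real.log s) * Real.exp s * (12 * Real.exp (-(s ^ 2 / (8 * M)))) *
          Real.exp ((130 : ℕ) * Real.log s) := by ring
      _ ≤ Real.exp ((6 : ℕ) * Real.log s) * Real.exp s * (Real.exp 3 * Real.exp (-(s ^ 2 / (8 * M)))) *
          Real.exp ((130 : ℕ) * Real.log s) := by gcongr
      _ ≤ 1 := by
        rw [← Real.exp_add, ← Real.exp_add, ← Real.exp_add, ← Real.exp_add, ← Real.exp_zero,
          Real.exp_le_exp]
        push_cast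
        linarith

/-- The Green function of a large cube is close to that of a subcube far from the bad set. -/
lemma resolvent_close (hB : Big δ E M s)
    (hG : ∀ y ∈ cube c (s ^ 40), y ∉ nearSet s c P → Good δ E M s (sub c (s ^ 40) s y) W)
    (hdet : (opMat δ E (cube c (s ^ 40)) W).det ≠ 0)
    (hK : ∀ x y, |Gf δ E (cube c (s ^ 40)) W x y| ≤ Real.exp (s ^ 20 / (2 * M)))
    {x y0 : Z3} (hy0 : y0 ∈ cube c (s ^ 40)) (hyP : ∀ p ∈ P, (s : ℝ) ^ 25 ≤ dist y0 p)
    (hx : x ∈ sub c (s ^ 40) s y0) (hxy : dist x y0 ≤ (s : ℝ) ^ 2 / 4 + 4) {r : Z3 → ℝ}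
    (hr0 : ∀ z ∉ sub c (s ^ 40) s y0, r z = 0)
    (hrT : ∀ z ∈ sub c (s ^ 40) s y0, T δ E W r z = if z = x then 1 else 0)
    (hrd : ∀ z ∈ sub c (s ^ 40) s y0, (s : ℝ) ^ 2 / 8 ≤ dist z x →
      |r z| ≤ Real.exp (-(1 / M + 3 / s) * dist z x)) (w : Z3) :
    |Gf δ E (cube c (s ^ 40)) W w x - r w| ≤ 1 / (s : ℝ) ^ 130 := by
  have hM := hB.M_pos
  have hs0 := hB.s_pos
  have hs := hB.le_s
  have hL : s ^ 2 ≤ s ^ 40 := Nat.pow_le_pow_right hB.s_pos' (by norm_num)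
  have hQΛ := sub_subset (c := c) hL y0
  set Q := sub c (s ^ 40) s y0 with hQ
  set Λ := cube c (s ^ 40) with hΛ
  have hxΛ : x ∈ Λ := hQΛ hx
  set h : Z3 → ℝ := fun z => Gf δ E Λ W z x - r z with hh
  have hh0 : ∀ z ∉ Λ, h z = 0 := fun z hz => by
    simp only [hh]; rw [Gf_off_left hz, hr0 z fun hz' => hz (hQΛ hz'), sub_zero]
  have hs2 : (10 : ℝ) ^ 12 ≤ s ^ 2 := by nlinarith
  set ε1 := 6 * Real.exp (-((s : ℝ) ^ 2 / (8 * M))) with hε1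
  have hTQ : ∀ z ∈ Q, T δ E W h z = 0 := fun z hz => by
    simp only [hh]; rw [T_sub, T_Gf hdet (hQΛ hz) hxΛ, hrT z hz, sub_self]
  have hTo : ∀ z ∈ Λ, z ∉ Q → T δ E W h z = nbs r z := fun z hz hzQ => by
    have hzx : z ≠ x := by rintro rfl; exact hzQ hx
    simp only [hh]
    rw [T_sub, T_Gf hdet hz hxΛ, if_neg hzx, T, hr0 z hzQ]
    ring
  have hrb : ∀ z ∈ Λ, z ∉ Q → ∀ b, dist b z ≤ 1 → |r b| ≤ Real.exp (-((s : ℝ) ^ 2 / (8 * M))) := by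
    intro z hz hzQ b hb
    by_cases hbQ : b ∈ Q
    · have h1 := le_dist_of_notMem_sub hz hzQ
      have h2 := dist_triangle_left z y0 b
      have h3 := dist_triangle b x y0
      have h4 : (s : ℝ) ^ 2 / 8 ≤ dist b x := by linarith
      refine (hrd b hbQ h4).trans ?_
      rw [Real.exp_le_exp, neg_mul, neg_le_neg_iff]
      have h5 : 1 / M ≤ 1 / M + 3 / s := by
        have : 0 ≤ 3 / (s : ℝ) := by positivity
        linarith
      calc (s : ℝ) ^ 2 / (8 * M) = 1 / M * (s ^ 2 / 8) := by field_simp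
        _ ≤ _ := by gcongr
    · rw [hr0 b hbQ, abs_zero]; exact (Real.exp_pos _).le
  have hTb : ∀ z ∈ Λ, |T δ E W h z| ≤ ε1 := by
    intro z hz
    by_cases hzQ : z ∈ Q
    · rw [hTQ z hzQ, abs_zero]; positivity
    · rw [hTo z hz hzQ]
      exact nbs_abs_le (hrb z hz hzQ)
  have hnear : ∀ y ∈ nearSet s c P, |h y| ≤ (s : ℝ) ^ 120 * ε1 := by
    intro y hy
    rw [Gf_repr hdet hh0 y]
    have hcard : (Λ.card : ℝ) = s ^ 120 := card_big_cube s c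
    rw [← hcard, ← nsmul_eq_mul]
    refine (Finset.abs_sum_le_sum_abs _ _).trans (Finset.sum_le_card_nsmul _ _ _ fun z hz => ?_)
    by_cases hzQ : z ∈ Q
    · rw [hTQ z hzQ, mul_zero, abs_zero]; positivity
    by_cases hn : ∃ b, dist b z ≤ 1 ∧ b ∈ Q
    · obtain ⟨b, hb, hbQ⟩ := hn
      rw [abs_mul, Gf_symm]
      have h1 : |Gf δ E Λ W z y| ≤ 1 := by
        refine green_near_far hB hG hdet hK hz (fun p hp => ?_) hy
        have h1 := hyP p hp
        have h2 := dist_lt_of_mem_sub (mem_sub hB hL hy0) hbQ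
        have h3 := dist_triangle y0 b p
        have h4 := dist_triangle b z p
        linarith
      calc _ ≤ 1 * ε1 := mul_le_mul h1 (hTb z hz) (abs_nonneg _) zero_le_one
        _ = ε1 := one_mul _
    · push Not at hn
      have : T δ E W h z = 0 := by
        rw [hTo z hz hzQ]
        have h1 := nbs_abs_le (u := r) (a := z) (C := 0) fun b hb => by
          rw [hr0 b (hn b hb), abs_zero]
        rw [mul_zero] at h1
        exact abs_eq_zero.1 (le_antisymm h1 (abs_nonneg _))
      rw [this, mul_zero, abs_zero]; positivity
  have hn := close_numeric hB
  by_cases hw : w ∈ Λ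
  · have hmp := max_principle hB hL hh0 (fun w => w ∉ nearSet s c P) hG
      (Φ := fun _ => 0) (R := ε1) (A := (s : ℝ) ^ 120 * ε1)
      (fun a b => by
        rw [sub_zero, abs_zero]
        exact mul_nonneg hB.rate_nonneg dist_nonneg)
      (fun y hy hyP z hz => by
        rw [Real.exp_zero, mul_one]
        exact hTb z (sub_subset hL y hz))
      (fun y hy hyP => by
        rw [Real.exp_zero, mul_one]
        exact hnear y (not_not.1 hyP)) hw
    rw [Real.exp_zero, mul_one] at hmp
    exact hmp.trans (max_le hn.1 hn.2)
  · have := hh0 w hw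
    simp only [hh] at this
    rw [this, abs_zero]
    positivity

end HitStep

section HitNext

variable {δ E M : ℝ} {s : ℕ} {c : Z3} {P : Finset Z3} {V : Cfg}

lemma flipAt_or (V : Cfg) (x : Z3) :
    Function.update V x false = V ∨ Function.update V x false = flipAt V x := by
  rcases hV : V x with _ | _
  · left; rw [← hV, Function.update_eq_self]
  · right; simp [flipAt, hV]

lemma clean_numeric (hB : Big δ E M s) :
    1 / (s : ℝ) ^ 130 ≤ 1 / s - 1 / (s ^ 20 : ℕ) ∧
      (M - 1 / s) ^ 2 + (s : ℝ) ^ 120 * (3 * M * (1 / s ^ 130)) ≤ (M - 1 / (s ^ 20 : ℕ)) ^ 2 := by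
  have hs := hB.le_s
  have hs0 := hB.s_pos
  have hM := hB.hM
  push_cast
  have h1 : 1 / (s : ℝ) ^ 20 ≤ 1 / s * (1 / 100) := by
    rw [one_div_mul_one_div, div_le_div_iff₀ (by positivity) (by positivity), one_mul, one_mul]
    calc (s : ℝ) * 100 ≤ s * s := by gcongr; linarith
      _ = s ^ 2 := by ring
      _ ≤ s ^ 20 := pow_le_pow_right₀ (by linarith) (by norm_num)
  have h2 : 1 / (s : ℝ) ^ 130 ≤ 1 / s * (1 / 100) := by
    refine le_trans ?_ h1
    apply one_div_le_one_div_of_le (by positivity)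
    exact pow_le_pow_right₀ (by linarith) (by norm_num)
  have h3 : 0 < 1 / (s : ℝ) := by positivity
  refine ⟨by linarith, ?_⟩
  have h4 : (s : ℝ) ^ 120 * (3 * M * (1 / s ^ 130)) = 3 * M * (1 / s ^ 10) := by
    field_simp
    try ring
  have h5 : 1 / (s : ℝ) ^ 10 ≤ 1 / s * (1 / 100) := by
    rw [one_div_mul_one_div, div_le_div_iff₀ (by positivity) (by positivity), one_mul, one_mul]
    calc (s : ℝ) * 100 ≤ s * s := by gcongr; linarith
      _ = s ^ 2 := by ring
      _ ≤ s ^ 10 := pow_le_pow_right₀ (by linarith) (by norm_num)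
  have h6 : 1 / (s : ℝ) ≤ 1 := by rw [div_le_one hs0]; linarith
  rw [h4]
  have h8 : 0 < 1 / (s : ℝ) ^ 20 := by positivity
  generalize 1 / (s : ℝ) = a at *
  generalize 1 / (s : ℝ) ^ 20 = b at *
  generalize 1 / (s : ℝ) ^ 10 = d at *
  have h7 : 3 * M * d ≤ 3 * M * (a * (1 / 100)) := by gcongr
  have h9 : (a - b) * M ≤ (a - b) * (2 * M - a - b) := by
    apply mul_le_mul_of_nonneg_left <;> linarith
  nlinarith

lemma Clean.next (hB : Big δ E M s)
    (hG : ∀ y ∈ cube c (s ^ 40), y ∉ nearSet s c P →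
      Good δ E M s (sub c (s ^ 40) s y) (Function.update V x false))
    (hK : ∀ x' y, |Gf δ E (cube c (s ^ 40)) (Function.update V x false) x' y| ≤
      Real.exp (s ^ 20 / (2 * M)))
    (hgood : Good δ E M (s ^ 20) (cube c (s ^ 40)) (Function.update V x false))
    {y0 : Z3} (hy0 : y0 ∈ cube c (s ^ 40)) (hyP : ∀ p ∈ P, (s : ℝ) ^ 25 ≤ dist y0 p)
    (hxy : dist x y0 ≤ (s : ℝ) ^ 2 / 4 + 4) (h : Clean δ E M s V (sub c (s ^ 40) s y0) x) :
    Clean δ E M (s ^ 20) V (cube c (s ^ 40)) x := by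
  obtain ⟨hx, r, hr0, hrT, hrx, hr2, hrd⟩ := h
  have hL : s ^ 2 ≤ s ^ 40 := Nat.pow_le_pow_right hB.s_pos' (by norm_num)
  have hQΛ := sub_subset (c := c) hL y0
  have hM := hB.M_pos
  have hs0 := hB.s_pos
  have hcl := resolvent_close hB hG hgood.1 hK hy0 hyP hx hxy hr0 hrT hrd
  have hcard : ((cube c (s ^ 40)).card : ℝ) = s ^ 120 := card_big_cube s c
  have hnum := clean_numeric hB
  set Q := sub c (s ^ 40) s y0
  set Λ := cube c (s ^ 40)
  set W := Function.update V x false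
  set η := 1 / (s : ℝ) ^ 130 with hη
  have hη0 : 0 ≤ η := by positivity
  have hη1 : η ≤ 1 := by
    rw [hη, div_le_one (by positivity)]
    exact one_le_pow₀ (by linarith [hB.le_s])
  refine ⟨hQΛ hx, fun z => Gf δ E Λ W z x, fun z hz => Gf_off_left hz x,
    fun z hz => T_Gf hgood.1 hz (hQΛ hx), ?_, ?_, fun z hz hzx => ?_⟩
  · have := (abs_le.1 (hcl x)).1
    linarith [hnum.1]
  · have hsumQ : ∑ z ∈ Λ, r z ^ 2 = ∑ z ∈ Q, r z ^ 2 := by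
      symm
      apply Finset.sum_subset hQΛ
      intro z _ hz
      rw [hr0 z hz]; ring
    have hrM : ∀ z, |r z| ≤ M := by
      intro z
      by_cases hz : z ∈ Q
      · have h1 := (Clean.resolvent_bounds hB hx hrx hr2).2.2
        have h2 : r z ^ 2 ≤ M ^ 2 :=
          (Finset.single_le_sum (f := fun z => r z ^ 2) (fun z _ => sq_nonneg _) hz).trans h1
        exact abs_le_of_sq_le_sq h2 hM.le
      · rw [hr0 z hz, abs_zero]; exact hM.le
    calc ∑ z ∈ Λ, Gf δ E Λ W z x ^ 2 ≤ ∑ z ∈ Λ, (r z ^ 2 + 3 * M * η) := by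
          refine Finset.sum_le_sum fun z _ => ?_
          have h1 := hcl z
          have h2 := hrM z
          set g := Gf δ E Λ W z x
          have h3 : g ^ 2 = r z ^ 2 + 2 * (r z * (g - r z)) + (g - r z) ^ 2 := by ring
          have h4 : r z * (g - r z) ≤ M * η := by
            refine (le_abs_self _).trans ?_
            rw [abs_mul]
            exact mul_le_mul h2 h1 (abs_nonneg _) hM.le
          have h5 : (g - r z) ^ 2 ≤ M * η := by
            rw [← sq_abs]
            have := hB.one_le_M
            calc |g - r z| ^ 2 ≤ η ^ 2 := by gcongr
              _ ≤ M * η := by nlinarith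
          linarith
      _ = ∑ z ∈ Q, r z ^ 2 + (s : ℝ) ^ 120 * (3 * M * η) := by
          rw [Finset.sum_add_distrib, Finset.sum_const, nsmul_eq_mul, hcard, hsumQ]
      _ ≤ (M - 1 / s) ^ 2 + (s : ℝ) ^ 120 * (3 * M * η) := by gcongr
      _ ≤ _ := hnum.2
  · have := hgood.2 z hz x (hQΛ hx)
    rw [if_pos hzx] at this
    exact this.le

/-- A long path contains, in its first half, a site far from a given small set. -/
lemma exists_far_index {σ : ℤ} {γ : ℕ → Z3} {N D : ℕ} (hst : ∀ n < N, Step σ (γ n) (γ (n + 1)))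
    (hσ : σ = 1 ∨ σ = -1) (hN : P.card * (2 * D + 1) < N) :
    ∃ n ≤ P.card * (2 * D + 1), ∀ p ∈ P, (D : ℝ) ≤ dist (γ n) p := by
  classical
  by_contra hcon
  push Not at hcon
  set A := P.card * (2 * D + 1) with hA
  have h1 : Finset.range (A + 1) ⊆ P.biUnion fun p =>
      (Finset.range (A + 1)).filter fun n => dist (γ n) p < D := by
    intro n hn
    obtain ⟨p, hp, h⟩ := hcon n (by simpa [Nat.lt_succ_iff] using hn)
    exact Finset.mem_biUnion.2 ⟨p, hp, Finset.mem_filter.2 ⟨hn, h⟩⟩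
  have h2 : ∀ p ∈ P, ((Finset.range (A + 1)).filter fun n => dist (γ n) p < D).card ≤ 2 * D + 1 := by
    intro p _
    rcases Finset.eq_empty_or_nonempty ((Finset.range (A + 1)).filter fun n => dist (γ n) p < D) with
      h | h
    · rw [h]; simp
    set m := Finset.min' _ h with hm
    have hmm := Finset.mem_filter.1 (Finset.min'_mem _ h)
    have hsub : ((Finset.range (A + 1)).filter fun n => dist (γ n) p < D) ⊆
        Finset.Ico m (m + (2 * D + 1)) := by
      intro n hn
      have hmn : m ≤ n := Finset.min'_le _ _ hn
      have hn' := Finset.mem_filter.1 hn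
      rw [Finset.mem_Ico]
      refine ⟨hmn, ?_⟩
      have hnA : n ≤ N := by have := Finset.mem_range.1 hn'.1; omega
      have h3 := (path_gain hst hmn hnA).1
      have h4 := abs_hgt_sub_le hσ (γ n) (γ m)
      have h5 := dist_triangle_right (γ n) (γ m) p
      have h6 : ((hgt σ (γ n) - hgt σ (γ m) : ℤ) : ℝ) ≤ 2 * D := by
        have h7 : dist (γ m) p < D := hmm.2
        have h8 := (abs_le.1 h4).2
        push_cast at *
        linarith [hn'.2]
      have h7 : hgt σ (γ n) - hgt σ (γ m) ≤ 2 * D := by exact_mod_cast h6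
      omega
    exact (Finset.card_le_card hsub).trans (by simp)
  have h3 := (Finset.card_le_card h1).trans (Finset.card_biUnion_le_card_mul _ _ _ h2)
  rw [Finset.card_range] at h3
  omega

/-- The hitting property at the next scale. -/
lemma hit_next (hB : Big δ E M s) (hP : P.card ≤ 30)
    (hrg : ∀ y ∈ cube c (s ^ 40), y ∉ nearSet s c P → RG δ E M s (sub c (s ^ 40) s y) V)
    (hKV : ∀ x y, |Gf δ E (cube c (s ^ 40)) V x y| ≤ Real.exp (s ^ 20 / (2 * M)))
    (hgV : Good δ E M (s ^ 20) (cube c (s ^ 40)) V)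
    (hKF : ∀ i ∈ cube c (s ^ 40), ∀ x y, |Gf δ E (cube c (s ^ 40)) (flipAt V i) x y| ≤
      Real.exp (s ^ 20 / (2 * M)))
    (hgF : ∀ i ∈ cube c (s ^ 40), Good δ E M (s ^ 20) (cube c (s ^ 40)) (flipAt V i)) :
    Hit δ E M (s ^ 20) (cube c (s ^ 40)) V := by
  intro σ hσ γ N hst hmem hlen
  have hL : s ^ 2 ≤ s ^ 40 := Nat.pow_le_pow_right hB.s_pos' (by norm_num)
  have hs := hB.le_s
  have hs' : 10 ^ 6 ≤ s := by exact_mod_cast hs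
  have hlen1 : (s : ℝ) ^ 40 / 8 ≤ 2 * N := by
    have h1 := (path_gain hst (Nat.zero_le N) le_rfl).2
    have h2 : ((hgt σ (γ N) - hgt σ (γ 0) : ℤ) : ℝ) ≤ 2 * N := by
      exact_mod_cast (by simpa using h1 : hgt σ (γ N) - hgt σ (γ 0) ≤ 2 * (N : ℤ))
    push_cast at *
    rw [← pow_mul] at hlen
    norm_num at hlen
    linarith
  have hlen2 : s ^ 40 ≤ 16 * N := by
    have : (s : ℝ) ^ 40 ≤ 16 * N := by linarith
    exact_mod_cast this
  obtain ⟨q, hq⟩ : ∃ q : ℕ, s ^ 2 / 8 = q := ⟨_, rfl⟩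
  have hs2 : 10 ^ 12 ≤ s ^ 2 := by nlinarith
  have hq1 : 8 * q ≤ s ^ 2 := by omega
  have hq2 : s ^ 2 ≤ 8 * q + 7 := by omega
  have hbig : P.card * (2 * s ^ 25 + 1) + (q + 1) ≤ N := by
    have h1 : P.card * (2 * s ^ 25 + 1) ≤ 30 * (2 * s ^ 25 + 1) := Nat.mul_le_mul_right _ hP
    have h2 : s ^ 2 ≤ s ^ 25 := Nat.pow_le_pow_right hB.s_pos' (by norm_num)
    have h3 : 10 ^ 6 * s ^ 25 ≤ s ^ 40 := by
      calc 10 ^ 6 * s ^ 25 ≤ s * s ^ 25 := by gcongr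
        _ = s ^ 26 := by ring
        _ ≤ s ^ 40 := Nat.pow_le_pow_right hB.s_pos' (by norm_num)
    generalize s ^ 25 = A at *
    generalize s ^ 40 = B at *
    generalize s ^ 2 = C at *
    omega
  obtain ⟨n, hn, hfar⟩ := exists_far_index (P := P) (D := s ^ 25) hst hσ (by omega)
  have hnN : n + (q + 1) ≤ N := by omega
  have hyΛ := hmem n (by omega)
  have hnP : γ n ∉ nearSet s c P := by
    intro h
    obtain ⟨-, p, hp, hd⟩ := Finset.mem_filter.1 h
    have h1 := hfar p hp
    push_cast at h1
    have h2 : 2 * (s : ℝ) ^ 2 < s ^ 25 := by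
      calc 2 * (s : ℝ) ^ 2 < (s : ℝ) * (s : ℝ) ^ 2 := by gcongr; linarith
        _ = (s : ℝ) ^ 3 := by ring
        _ ≤ (s : ℝ) ^ 25 := pow_le_pow_right₀ (by linarith) (by norm_num)
    linarith
  have hqr1 : 8 * (q : ℝ) ≤ (s : ℝ) ^ 2 := by exact_mod_cast hq1
  have hqr2 : (s : ℝ) ^ 2 ≤ 8 * q + 7 := by exact_mod_cast hq2
  have hs2r : (10 : ℝ) ^ 12 ≤ s ^ 2 := by exact_mod_cast hs2
  have hclose : ∀ j ≤ q + 1, dist (γ (n + j)) (γ n) ≤ (s : ℝ) ^ 2 / 4 + 4 := by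
    intro j hj
    have h1 := path_dist_le hσ hst (Nat.le_add_right n j) (by omega)
    have h2 := (path_gain hst (Nat.le_add_right n j) (by omega)).2
    have h3 : hgt σ (γ (n + j)) - hgt σ (γ n) ≤ 2 * (q + 1) := by
      have : ((n + j - n : ℕ) : ℤ) ≤ q + 1 := by omega
      linarith
    have h4 : ((hgt σ (γ (n + j)) - hgt σ (γ n) : ℤ) : ℝ) ≤ 2 * (q + 1) := by exact_mod_cast h3
    rw [dist_comm]
    linarith
  obtain ⟨j, hj, hcl⟩ := (hrg _ hyΛ hnP).2.2 σ hσ (fun j => γ (n + j)) (q + 1)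
    (fun j hj => hst (n + j) (by omega)) (fun j hj => by
      by_contra h
      have h1 := le_dist_of_notMem_sub (hmem (n + j) (by omega)) h
      have h2 := hclose j hj
      linarith) (by
      have h1 := (path_gain hst (Nat.le_add_right n (q + 1)) hnN).1
      have h2 : ((q + 1 : ℕ) : ℤ) ≤ hgt σ (γ (n + (q + 1))) - hgt σ (γ n) := by
        simpa using h1
      have h3 : ((q + 1 : ℕ) : ℝ) ≤ ((hgt σ (γ (n + (q + 1))) - hgt σ (γ n) : ℤ) : ℝ) := by
        exact_mod_cast h2
      push_cast at h3
      simp only [add_zero]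
      linarith)
  refine ⟨n + j, by omega, ?_⟩
  have hxΛ := hmem (n + j) (by omega)
  refine Clean.next hB (P := P) ?_ ?_ ?_ hyΛ (fun p hp => by simpa using hfar p hp)
    (hclose j hj) hcl
  · intro y hy hyP
    rcases flipAt_or V (γ (n + j)) with h | h <;> rw [h]
    · exact (hrg y hy hyP).1
    · by_cases hxy : γ (n + j) ∈ sub c (s ^ 40) s y
      · exact (hrg y hy hyP).2.1 _ hxy
      · exact Good_congr (fun z hz => (flipAt_of_ne fun h => hxy (by rw [← h]; exact hz)).symm)
          (hrg y hy hyP).1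
  · rcases flipAt_or V (γ (n + j)) with h | h <;> rw [h]
    · exact hKV
    · exact hKF _ hxΛ
  · rcases flipAt_or V (γ (n + j)) with h | h <;> rw [h]
    · exact hgV
    · exact hgF _ hxΛ

/-- Robust goodness at the next scale, in the absence of quasimodes. -/
lemma rg_next (hB : Big δ E M s) (hP : P.card ≤ 30)
    (hrg : ∀ y ∈ cube c (s ^ 40), y ∉ nearSet s c P → RG δ E M s (sub c (s ^ 40) s y) V)
    {X : ℝ} (hX : X ≤ (s : ℝ) ^ 20)
    (hno : ∀ a ∈ cube c (s ^ 40), ∃ σ : ℤ, ∀ u,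
      ¬ QMode δ E M s c a σ (nearSet s c P) (Real.exp (-X / (2 * M))) X V u)
    (hnoF : ∀ i ∈ cube c (s ^ 40), ∀ a ∈ cube c (s ^ 40), ∃ σ : ℤ, ∀ u,
      ¬ QMode δ E M s c a σ (nearSet s c (insert i P)) (Real.exp (-X / (2 * M))) X (flipAt V i) u) :
    RG δ E M (s ^ 20) (cube c (s ^ 40)) V := by
  have hL : s ^ 2 ≤ s ^ 40 := Nat.pow_le_pow_right hB.s_pos' (by norm_num)
  have hM := hB.M_pos
  have hXK : 1 / Real.exp (-X / (2 * M)) ≤ Real.exp (s ^ 20 / (2 * M)) := by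
    rw [one_div, ← Real.exp_neg, Real.exp_le_exp, neg_div, neg_neg]
    gcongr
  have hV := resolvent_bound_of_no_mode hB (Real.exp_pos _) hrg hno
  have hKV := fun x y => (hV.2 x y).trans hXK
  have hgV := good_next hB (P := P) (by omega) (fun y hy hyP => (hrg y hy hyP).1) hV.1 hKV
  have hsub : ∀ i, nearSet s c P ⊆ nearSet s c (insert i P) := by
    intro i y hy
    obtain ⟨hy1, p, hp, hd⟩ := Finset.mem_filter.1 hy
    exact Finset.mem_filter.2 ⟨hy1, p, Finset.mem_insert_of_mem hp, hd⟩
  have hrgF : ∀ i ∈ cube c (s ^ 40), ∀ y ∈ cube c (s ^ 40), y ∉ nearSet s c (insert i P) →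
      RG δ E M s (sub c (s ^ 40) s y) (flipAt V i) := by
    intro i hi y hy hyP
    refine RG_congr (fun z hz => (flipAt_of_ne ?_).symm) (hrg y hy fun h => hyP (hsub i h))
    rintro rfl
    refine hyP (Finset.mem_filter.2 ⟨hy, z, Finset.mem_insert_self _ _, ?_⟩)
    have h1 := dist_lt_of_mem_sub (mem_sub hB hL hy) hz
    have : (0 : ℝ) ≤ s ^ 2 := by positivity
    linarith
  have hF := fun i hi => resolvent_bound_of_no_mode hB (Real.exp_pos _) (hrgF i hi) (hnoF i hi)
  have hKF := fun i hi x y => ((hF i hi).2 x y).trans hXK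
  have hgF : ∀ i ∈ cube c (s ^ 40), Good δ E M (s ^ 20) (cube c (s ^ 40)) (flipAt V i) :=
    fun i hi => good_next hB (P := insert i P) ((Finset.card_insert_le _ _).trans (by omega))
      (fun y hy hyP => (hrgF i hi y hy hyP).1) (hF i hi).1 (hKF i hi)
  exact ⟨hgV, hgF, hit_next hB hP hrg hKV hgV hKF hgF⟩

end HitNext

/-- An event which only depends on the potential in `S`. -/
def DepOn (S : Finset Z3) (A : Cfg → Prop) : Prop :=
  ∀ V W : Cfg, (∀ x ∈ S, V x = W x) → A V → A W

section Probability

variable {S S' : Finset Z3} {A B : Cfg → Prop} {μ : MeasureTheory.Measure Cfg}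

lemma DepOn.mono (h : DepOn S A) (hS : S ⊆ S') : DepOn S' A :=
  fun V W hVW => h V W fun x hx => hVW x (hS hx)

lemma DepOn.and (hA : DepOn S A) (hB : DepOn S B) : DepOn S (fun V => A V ∧ B V) :=
  fun V W h hV => ⟨hA V W h hV.1, hB V W h hV.2⟩

lemma DepOn.not (hA : DepOn S A) : DepOn S (fun V => ¬ A V) :=
  fun V W h hV hW => hV (hA W V (fun x hx => (h x hx).symm) hW)

/-- Restriction of a configuration, extended by `false`. -/
def restr (S : Finset Z3) (V : Cfg) : Cfg := fun x => if x ∈ S then V x else false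

lemma restr_mem (S : Finset Z3) (V : Cfg) : restr S V ∈ cfgs S :=
  mem_cfgs.2 fun x hx => by simp [restr, hx]

lemma restr_apply {x : Z3} (hx : x ∈ S) (V : Cfg) : restr S V x = V x := by simp [restr, hx]

lemma DepOn.restr_iff (hA : DepOn S A) (V : Cfg) : A (restr S V) ↔ A V :=
  ⟨hA _ _ fun _ hx => restr_apply hx V, hA _ _ fun _ hx => (restr_apply hx V).symm⟩

lemma restr_eq_self {V : Cfg} (hV : V ∈ cfgs S) : restr S V = V := by
  ext x
  by_cases hx : x ∈ S
  · simp [restr, hx]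
  · simp [restr, hx, mem_cfgs.1 hV x hx]

open Classical in
lemma prob_eq_count (hμ : IsBernoulliProduct μ) (hA : DepOn S A) :
    μ.real {V | A V} = ((cfgs S).filter A).card * (1 / 2) ^ S.card := by
  have hset : {V | A V} = ⋃ σ ∈ (cfgs S).filter A, {V | ∀ a ∈ S, V a = σ a} := by
    ext V
    simp only [Set.mem_ofPred_eq, Set.mem_iUnion, Finset.mem_filter, exists_prop]
    constructor
    · intro h
      exact ⟨restr S V, ⟨restr_mem S V, (hA.restr_iff V).2 h⟩, fun a ha => (restr_apply ha V).symm⟩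
    · rintro ⟨σ, ⟨-, h1⟩, h2⟩
      exact hA σ V (fun x hx => (h2 x hx).symm) h1
  have hmeas : ∀ σ : Cfg, MeasurableSet {V : Cfg | ∀ a ∈ S, V a = σ a} := by
    intro σ
    have : {V : Cfg | ∀ a ∈ S, V a = σ a} = ⋂ a ∈ S, (fun V : Cfg => V a) ⁻¹' {σ a} := by
      ext V; simp
    rw [this]
    exact Finset.measurableSet_biInter _ fun a _ => measurable_pi_apply a (MeasurableSet.singleton _)
  rw [hset, MeasureTheory.measureReal_def, MeasureTheory.measure_biUnion_finset _ fun σ _ => hmeas σ]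
  · simp only [hμ.2]
    rw [Finset.sum_const, nsmul_eq_mul, ENNReal.toReal_mul, ENNReal.toReal_pow]
    simp
  · intro σ hσ τ hτ hne
    rw [Function.onFun, Set.disjoint_left]
    intro V h1 h2
    apply hne
    rw [← restr_eq_self (Finset.mem_filter.1 hσ).1, ← restr_eq_self (Finset.mem_filter.1 hτ).1]
    ext x
    by_cases hx : x ∈ S
    · rw [restr_apply hx, restr_apply hx, ← h1 x hx, ← h2 x hx]
    · simp [restr, hx]

lemma prob_inter (hμ : IsBernoulliProduct μ) (hS : Disjoint S S') (hA : DepOn S A)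
    (hB : DepOn S' B) :
    μ.real {V | A V ∧ B V} = μ.real {V | A V} * μ.real {V | B V} := by
  classical
  rw [prob_eq_count hμ hA, prob_eq_count hμ hB, prob_eq_count (S := S ∪ S') hμ
    ((hA.mono Finset.subset_union_left).and (hB.mono Finset.subset_union_right)),
    Finset.card_union_of_disjoint hS, pow_add]
  have : ((cfgs (S ∪ S')).filter fun V => A V ∧ B V).card =
      ((cfgs S).filter A).card * ((cfgs S').filter B).card := by
    rw [← Finset.card_product]
    refine Finset.card_nbij' (fun V => (restr S V, restr S' V))
      (fun p x => if x ∈ S then p.1 x else p.2 x) ?_ ?_ ?_ ?_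
    · intro V hV
      have h := (Finset.mem_filter.1 hV).2
      exact Finset.mem_product.2 ⟨Finset.mem_filter.2 ⟨restr_mem S V, (hA.restr_iff V).2 h.1⟩,
        Finset.mem_filter.2 ⟨restr_mem S' V, (hB.restr_iff V).2 h.2⟩⟩
    · intro p hp
      obtain ⟨h1, h2⟩ := Finset.mem_product.1 hp
      obtain ⟨h3, h4⟩ := Finset.mem_filter.1 h1
      obtain ⟨h5, h6⟩ := Finset.mem_filter.1 h2
      refine Finset.mem_filter.2 ⟨mem_cfgs.2 fun x hx => ?_, ?_, ?_⟩
      · rw [Finset.mem_union, not_or] at hx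
        simp [hx.1, mem_cfgs.1 h5 x hx.2]
      · exact hA _ _ (fun x hx => by simp [hx]) h4
      · exact hB _ _ (fun x hx => by simp [Finset.disjoint_right.1 hS hx]) h6
    · intro V hV
      have h := mem_cfgs.1 (Finset.mem_filter.1 hV).1
      ext x
      by_cases hx : x ∈ S
      · simp [hx, restr]
      · by_cases hx' : x ∈ S'
        · simp [hx, hx', restr]
        · simp [hx, hx', restr, h x (by simp [hx, hx'])]
    · intro p hp
      obtain ⟨h1, h2⟩ := Finset.mem_product.1 hp
      have h3 := mem_cfgs.1 (Finset.mem_filter.1 h1).1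
      have h4 := mem_cfgs.1 (Finset.mem_filter.1 h2).1
      ext x
      · by_cases hx : x ∈ S
        · simp [hx, restr]
        · simp [hx, restr, h3 x hx]
      · by_cases hx : x ∈ S'
        · simp [hx, restr, Finset.disjoint_right.1 hS hx]
        · simp [hx, restr, h4 x hx]
  have h2 := congrArg (fun n : ℕ => (n : ℝ) * ((1 / 2) ^ S.card * (1 / 2) ^ S'.card)) this
  push_cast at h2
  refine Eq.trans ?_ (h2.trans (by ring))
  congr 3
  ext V
  simp only [Finset.mem_filter]

lemma prob_forall (hμ : IsBernoulliProduct μ) {ι : Type*} (I : Finset ι) (S : ι → Finset Z3)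
    (A : ι → Cfg → Prop) (hA : ∀ i ∈ I, DepOn (S i) (A i))
    (hS : ∀ i ∈ I, ∀ j ∈ I, i ≠ j → Disjoint (S i) (S j)) :
    μ.real {V | ∀ i ∈ I, A i V} = ∏ i ∈ I, μ.real {V | A i V} := by
  classical
  have := hμ.1
  induction I using Finset.induction_on with
  | empty => simp
  | insert i I hi ih =>
    rw [Finset.prod_insert hi, ← ih (fun j hj => hA j (Finset.mem_insert_of_mem hj))
      (fun j hj k hk => hS j (Finset.mem_insert_of_mem hj) k (Finset.mem_insert_of_mem hk)),
      ← prob_inter (S := S i) (S' := I.biUnion S) hμ]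
    · congr 1
      ext V
      simp
    · rw [Finset.disjoint_biUnion_right]
      exact fun j hj => hS i (Finset.mem_insert_self _ _) j (Finset.mem_insert_of_mem hj)
        fun h => hi (h ▸ hj)
    · exact hA i (Finset.mem_insert_self _ _)
    · intro V W hVW h j hj
      exact hA j (Finset.mem_insert_of_mem hj) V W
        (fun x hx => hVW x (Finset.mem_biUnion.2 ⟨j, hj, hx⟩)) (h j hj)

lemma prob_exists_le (hμ : IsBernoulliProduct μ) {ι : Type*} (I : Finset ι) (A : ι → Cfg → Prop)
    {q : ℝ} (hq : ∀ i ∈ I, μ.real {V | A i V} ≤ q) :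
    μ.real {V | ∃ i ∈ I, A i V} ≤ I.card * q := by
  have := hμ.1
  have h1 : {V | ∃ i ∈ I, A i V} = ⋃ i ∈ I, {V | A i V} := by ext V; simp
  rw [h1, ← nsmul_eq_mul]
  exact (MeasureTheory.measureReal_biUnion_finset_le _ _).trans (Finset.sum_le_card_nsmul _ _ _ hq)

lemma prob_mono (hμ : IsBernoulliProduct μ) (h : ∀ V, A V → B V) :
    μ.real {V | A V} ≤ μ.real {V | B V} := by
  have := hμ.1
  exact MeasureTheory.measureReal_mono h

lemma prob_or_le (μ : MeasureTheory.Measure Cfg) (A B : Cfg → Prop) :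
    μ.real {V | A V ∨ B V} ≤ μ.real {V | A V} + μ.real {V | B V} :=
  MeasureTheory.measureReal_union_le _ _

lemma prob_flip (hμ : IsBernoulliProduct μ) (hA : DepOn S A) {i : Z3} (hi : i ∈ S) :
    μ.real {V | A (flipAt V i)} = μ.real {V | A V} := by
  classical
  have hA' : DepOn S (fun V => A (flipAt V i)) := fun V W h =>
    hA _ _ fun x hx => flipAt_congr (h x hx) (h i hi)
  rw [prob_eq_count hμ hA, prob_eq_count hμ hA']
  congr 2
  refine Finset.card_nbij' (fun V => flipAt V i) (fun V => flipAt V i) ?_ ?_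
    (fun V _ => flipAt_flipAt i) (fun V _ => flipAt_flipAt i)
  · intro V hV
    have h := Finset.mem_filter.1 hV
    exact Finset.mem_filter.2 ⟨flipAt_mem_cfgs hi h.1, h.2⟩
  · intro V hV
    have h := Finset.mem_filter.1 hV
    refine Finset.mem_filter.2 ⟨flipAt_mem_cfgs hi h.1, ?_⟩
    rw [flipAt_flipAt]; exact h.2

end Probability

section Induction

variable {δ E M : ℝ} {s : ℕ} {c : Z3} {μ : MeasureTheory.Measure Cfg}

lemma Big.next (hB : Big δ E M s) : Big δ E M (s ^ 20) where
  hM := hB.hM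
  hδ := hB.hδ
  hδM := hB.hδM
  hδM' := hB.hδM'
  hE0 := hB.hE0
  hE1 := hB.hE1
  hs := by
    push_cast
    exact hB.hs.trans (le_self_pow₀ (by linarith [hB.le_s]) (by norm_num))
  hexp := by
    have h := hB.hexp
    have hM := hB.M_pos
    have hs := hB.le_s
    push_cast
    rw [Real.log_pow]
    push_cast
    have h1 : 20 * (s : ℝ) ≤ s ^ 20 := by
      calc 20 * (s : ℝ) ≤ s * s := by gcongr; linarith
        _ = (s : ℝ) ^ 2 := by ring
        _ ≤ (s : ℝ) ^ 20 := pow_le_pow_right₀ (by linarith) (by norm_num)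
    calc 20000 * (20 * Real.log s) = 20 * (20000 * Real.log s) := by ring
      _ ≤ 20 * (s / M ^ 10) := by gcongr
      _ = 20 * s / M ^ 10 := by ring
      _ ≤ s ^ 20 / M ^ 10 := by gcongr

lemma depOn_RG (Q : Finset Z3) : DepOn Q (RG δ E M s Q) := fun _ _ h hV => RG_congr h hV

lemma depOn_good (Q : Finset Z3) : DepOn Q (Good δ E M s Q) := fun _ _ h hV => Good_congr h hV

lemma QMode.congr {a : Z3} {σ : ℤ} {B : Finset Z3} {ε H : ℝ} {V W : Cfg} {u : Z3 → ℝ}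
    (hs : 0 < s) (hVW : ∀ x ∈ cube c (s ^ 40), V x = W x)
    (h : QMode δ E M s c a σ B ε H V u) : QMode δ E M s c a σ B ε H W u where
  supp := h.supp
  norm := h.norm
  top := h.top
  err := fun x hx => by
    rw [← T_congr (hVW x hx) fun _ _ => rfl]
    exact h.err x hx
  good := fun y hy hyB => Good_congr (fun z hz => hVW z (sub_subset
    (Nat.pow_le_pow_right hs (by norm_num)) y hz)) (h.good y hy hyB)
  rg := fun y hy hyB hH => RG_congr (fun z hz => hVW z (sub_subset
    (Nat.pow_le_pow_right hs (by norm_num)) y hz)) (h.rg y hy hyB hH)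

/-- There is a direction with enough room inside the cube. -/
lemma exists_room (hs : 10 ^ 6 ≤ s) {a : Z3} (ha : a ∈ cube c (s ^ 40)) :
    ∃ σ : ℤ, (σ = 1 ∨ σ = -1) ∧ ∀ y ∈ cube c (s ^ 40),
      ((hgt σ y - hgt σ a : ℤ) : ℝ) ≤ (s : ℝ) ^ 40 / 4 → y + σ • stdv 2 ∈ cube c (s ^ 40) := by
  have hL : 10 ^ 6 ≤ s ^ 40 := hs.trans (Nat.le_self_pow (by norm_num) s)
  have key : ∀ σ : ℤ, ∀ y : Z3, ((hgt σ y - hgt σ a : ℤ) : ℝ) ≤ (s : ℝ) ^ 40 / 4 →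
      4 * (hgt σ y - hgt σ a) ≤ ((s ^ 40 : ℕ) : ℤ) := by
    intro σ y h
    have h1 : 4 * ((hgt σ y - hgt σ a : ℤ) : ℝ) ≤ (s : ℝ) ^ 40 := by linarith
    have h2 : (((4 * (hgt σ y - hgt σ a)) : ℤ) : ℝ) ≤ (((s ^ 40 : ℕ) : ℤ) : ℝ) := by
      push_cast at *; exact h1
    exact_mod_cast h2
  generalize s ^ 40 = L at *
  have ha2 := mem_cube.1 ha 2
  by_cases h : 2 * (a 2 - c 2) < L
  · refine ⟨1, Or.inl rfl, fun y hy hyH => ?_⟩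
    have h1 := key 1 y hyH
    simp only [hgt, one_mul] at h1
    rw [mem_cube] at *
    intro i
    have h2 := hy i
    fin_cases i <;> simp [stdv] at * <;> omega
  · refine ⟨-1, Or.inr rfl, fun y hy hyH => ?_⟩
    have h1 := key (-1) y hyH
    simp only [hgt] at h1
    rw [mem_cube] at *
    intro i
    have h2 := hy i
    fin_cases i <;> simp [stdv] at * <;> omega

/-- The probability of a quasimode. -/
lemma prob_mode_le (hμ : IsBernoulliProduct μ) (hB : Big δ E M s) {t : ℕ}
    (ht : M ^ (6 * (t + 62)) ≤ s) {P : Finset Z3} (hP : P.card ≤ 31) {a : Z3} {σ : ℤ}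
    (hσ : σ = 1 ∨ σ = -1)
    (hroom : ∀ y ∈ cube c (s ^ 40), ((hgt σ y - hgt σ a : ℤ) : ℝ) ≤ (s : ℝ) ^ 40 / 4 →
      y + σ • stdv 2 ∈ cube c (s ^ 40)) :
    DepOn (cube c (s ^ 40)) (fun V => ∃ u, QMode δ E M s c a σ (nearSet s c P)
      (Real.exp (-zoneHt M s (t + 62) / (2 * M))) (zoneHt M s (t + 62)) V u) ∧
    μ.real {V | ∃ u, QMode δ E M s c a σ (nearSet s c P)
      (Real.exp (-zoneHt M s (t + 62) / (2 * M))) (zoneHt M s (t + 62)) V u} ≤ 1 / (s : ℝ) ^ t := by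
  classical
  have hdep : DepOn (cube c (s ^ 40)) (fun V => ∃ u, QMode δ E M s c a σ (nearSet s c P)
      (Real.exp (-zoneHt M s (t + 62) / (2 * M))) (zoneHt M s (t + 62)) V u) :=
    fun V W h ⟨u, hu⟩ => ⟨u, hu.congr hB.s_pos' h⟩
  refine ⟨hdep, ?_⟩
  have hs := hB.s_pos
  rw [prob_eq_count hμ hdep, le_div_iff₀ (by positivity), one_div, inv_pow,
    ← div_eq_mul_inv, div_mul_eq_mul_div, div_le_one (by positivity)]
  refine le_trans (le_of_eq ?_) (modeCfgs_card_le hB hσ hP hroom ht)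
  congr 2

/-- A maximal separated family of bad cubes. -/
lemma exists_cover (hs : 0 < s) (p : Z3 → Prop) :
    (∃ P ⊆ cube c (s ^ 40), P.card = 31 ∧ (∀ y ∈ P, p y) ∧
      ∀ y ∈ P, ∀ z ∈ P, y ≠ z → Disjoint (sub c (s ^ 40) s y) (sub c (s ^ 40) s z)) ∨
    ∃ P ⊆ cube c (s ^ 40), P.card ≤ 30 ∧
      ∀ y ∈ cube c (s ^ 40), y ∈ sub c (s ^ 40) s y → (∀ z ∈ P, z ∈ sub c (s ^ 40) s z) →
        y ∉ nearSet s c P → ¬ p y := by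
  classical
  set Λ := cube c (s ^ 40) with hΛ
  obtain ⟨pr, hpr⟩ : ∃ pr : Finset Z3 → Prop, ∀ P, pr P ↔ ((∀ y ∈ P, p y) ∧
      ∀ y ∈ P, ∀ z ∈ P, y ≠ z → ((s ^ 2 : ℕ) : ℝ) ≤
        dist (subc c (s ^ 40) (s ^ 2) y) (subc c (s ^ 40) (s ^ 2) z)) := ⟨_, fun _ => Iff.rfl⟩
  obtain ⟨P, hP, hmax⟩ := Finset.exists_max_image (Λ.powerset.filter pr) Finset.card
    ⟨∅, by simp [hpr]⟩
  obtain ⟨h1, h23⟩ := Finset.mem_filter.1 hP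
  obtain ⟨h2, h3⟩ := (hpr P).1 h23
  rw [Finset.mem_powerset] at h1
  by_cases hc : 31 ≤ P.card
  · obtain ⟨P', hP', hc'⟩ := Finset.exists_subset_card_eq hc
    exact Or.inl ⟨P', hP'.trans h1, hc', fun y hy => h2 y (hP' hy), fun y hy z hz hyz =>
      cube_disjoint_of_dist (h3 y (hP' hy) z (hP' hz) hyz)⟩
  · refine Or.inr ⟨P, h1, by omega, fun y hy hyy hzz hyP hpy => ?_⟩
    by_cases hall : ∀ z ∈ P, ((s ^ 2 : ℕ) : ℝ) ≤ dist (subc c (s ^ 40) (s ^ 2) y) (subc c (s ^ 40) (s ^ 2) z)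
    · have hyP' : y ∉ P := fun h => by
        refine hyP (Finset.mem_filter.2 ⟨hy, y, h, ?_⟩)
        rw [dist_self]; positivity
      have h4 : insert y P ∈ Λ.powerset.filter pr := by
        refine Finset.mem_filter.2 ⟨Finset.mem_powerset.2 (Finset.insert_subset hy h1),
          (hpr _).2 ⟨?_, ?_⟩⟩
        · intro z hz
          rcases Finset.mem_insert.1 hz with rfl | hz
          · exact hpy
          · exact h2 z hz
        · intro z hz w hw hzw
          rcases Finset.mem_insert.1 hz with hz' | hz <;> rcases Finset.mem_insert.1 hw with hw' | hw
          · exact absurd (hz'.trans hw'.symm) hzw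
          · rw [hz']; exact hall w hw
          · rw [hw', dist_comm]; exact hall z hz
          · exact h3 z hz w hw hzw
      have h5 := hmax _ h4
      rw [Finset.card_insert_of_notMem hyP'] at h5
      omega
    · push Not at hall
      obtain ⟨z, hz, hd⟩ := hall
      refine hyP (Finset.mem_filter.2 ⟨hy, z, hz, ?_⟩)
      have h0 : (0 : ℝ) ≤ 2 * (s : ℝ) ^ 2 := by positivity
      rw [dist_le_iff h0]
      intro i
      have hy' := mem_cube.1 hyy i
      have hz' := mem_cube.1 (hzz z hz) i
      have h6 := (abs_coord_le_dist (subc c (s ^ 40) (s ^ 2) y) (subc c (s ^ 40) (s ^ 2) z) i).trans_lt hd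
      have h7 : |subc c (s ^ 40) (s ^ 2) y i - subc c (s ^ 40) (s ^ 2) z i| < ((s ^ 2 : ℕ) : ℤ) := by
        exact_mod_cast h6
      have h8 : |y i - z i| ≤ 2 * ((s ^ 2 : ℕ) : ℤ) := by
        rw [abs_lt] at h7
        rw [abs_le]
        constructor <;> linarith [hy'.1, hy'.2, hz'.1, hz'.2, h7.1, h7.2]
      exact_mod_cast h8

end Induction

lemma pow_mul_one_div {x : ℝ} (hx : 0 < x) {a b c : ℕ} (h : a + b = c) :
    x ^ a * (1 / x ^ c) = 1 / x ^ b := by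
  rw [← h, pow_add]
  field_simp

/-- The event that a quasi-mode concentrated near `a` exists with exceptional set near `P`. -/
def ModeEvent (δ E M : ℝ) (s : ℕ) (c : Z3) (t : ℕ) (σ : Z3 → ℤ) (P : Finset Z3) (a : Z3)
    (V : Cfg) : Prop :=
  ∃ u, QMode δ E M s c a (σ a) (nearSet s c P)
      (Real.exp (-zoneHt M s (t + 62) / (2 * M))) (zoneHt M s (t + 62)) V u

lemma card_small_subsets (Λ : Finset Z3) (hΛ : Λ.Nonempty) :
    (((Finset.range 32).biUnion fun k : ℕ => Finset.powersetCard k Λ).card : ℝ) ≤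
      32 * (Λ.card : ℝ) ^ 31 := by
  have h1 : 1 ≤ Λ.card := hΛ.card_pos
  have : ((Finset.range 32).biUnion fun k : ℕ => Finset.powersetCard k Λ).card ≤
      32 * Λ.card ^ 31 := by
    refine (Finset.card_biUnion_le).trans ?_
    calc _ ≤ ∑ k ∈ Finset.range 32, Λ.card ^ 31 := by
          refine Finset.sum_le_sum fun k hk => ?_
          rw [Finset.card_powersetCard]
          refine (Nat.choose_le_pow _ _).trans (Nat.pow_le_pow_right h1 ?_)
          have := Finset.mem_range.1 hk
          omega
      _ = 32 * Λ.card ^ 31 := by simp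
  exact_mod_cast this

lemma mem_small_subsets {Λ P : Finset Z3} (hP : P ⊆ Λ) (hc : P.card ≤ 31) :
    P ∈ (Finset.range 32).biUnion fun k : ℕ => Finset.powersetCard k Λ := by
  rw [Finset.mem_biUnion]
  exact ⟨P.card, Finset.mem_range.2 (by omega), Finset.mem_powersetCard.2 ⟨hP, rfl⟩⟩

set_option maxRecDepth 4000 in
set_option maxHeartbeats 1600000 in
lemma msa_step {δ E M : ℝ} {s : ℕ} {μ : MeasureTheory.Measure Cfg} (hμ : IsBernoulliProduct μ)
    (hB : Big δ E M s) (ht : M ^ (6 * (11200 + 62)) ≤ s)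
    (hp : ∀ c, μ.real {V | ¬ RG δ E M s (cube c (s ^ 2)) V} ≤ 1 / (s : ℝ) ^ 360) (c : Z3) :
    μ.real {V | ¬ RG δ E M (s ^ 20) (cube c (s ^ 40)) V} ≤ 1 / (s : ℝ) ^ 7200 := by
  classical
  have hprob := hμ.1
  have hs6 : (10 : ℝ) ^ 6 ≤ s := hB.le_s
  have hs6' : 10 ^ 6 ≤ s := by exact_mod_cast hs6
  have hs0 : (0 : ℝ) < s := hB.s_pos
  have hs0' : 0 < s := by omega
  have hL : s ^ 2 ≤ s ^ 40 := Nat.pow_le_pow_right hs0' (by norm_num)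
  set Λ := cube c (s ^ 40) with hΛ
  have hcard : (Λ.card : ℝ) = (s : ℝ) ^ 120 := card_big_cube s c
  have hne : Λ.Nonempty := by
    rw [← Finset.card_pos]
    have : (0 : ℝ) < Λ.card := by rw [hcard]; exact pow_pos hs0 _
    exact_mod_cast this
  have hσ : ∀ a : Z3, ∃ σ : ℤ, a ∈ Λ → (σ = 1 ∨ σ = -1) ∧ ∀ y ∈ Λ,
      ((hgt σ y - hgt σ a : ℤ) : ℝ) ≤ (s : ℝ) ^ 40 / 4 → y + σ • stdv 2 ∈ Λ := by
    intro a
    by_cases ha : a ∈ Λ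
    · obtain ⟨σ, h⟩ := exists_room hs6' ha
      exact ⟨σ, fun _ => h⟩
    · exact ⟨0, fun h => absurd h ha⟩
  choose σ hσ using hσ
  set PP := (Finset.range 32).biUnion fun k : ℕ => Finset.powersetCard k Λ with hPP
  have hPPP : ∀ P ∈ PP, P.card ≤ 31 := by
    intro P hP
    rw [hPP, Finset.mem_biUnion] at hP
    obtain ⟨k, hk, hP⟩ := hP
    have := (Finset.mem_powersetCard.1 hP).2
    have := Finset.mem_range.1 hk
    omega
  have hmode : ∀ P ∈ PP, ∀ a ∈ Λ, DepOn Λ (ModeEvent δ E M s c 11200 σ P a) ∧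
      μ.real {V | ModeEvent δ E M s c 11200 σ P a V} ≤ 1 / (s : ℝ) ^ 11200 := fun P hP a ha =>
    prob_mode_le hμ hB ht (hPPP P hP) (hσ a ha).1 (hσ a ha).2
  obtain ⟨I, hI⟩ : ∃ I : Finset (Finset Z3), ∀ P, P ∈ I ↔ P ∈ Finset.powersetCard 31 Λ ∧
      ∀ y ∈ P, ∀ z ∈ P, y ≠ z → Disjoint (sub c (s ^ 40) s y) (sub c (s ^ 40) s z) :=
    ⟨(Finset.powersetCard 31 Λ).filter fun P => ∀ y ∈ P, ∀ z ∈ P, y ≠ z →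
      Disjoint (sub c (s ^ 40) s y) (sub c (s ^ 40) s z), fun P => by rw [Finset.mem_filter]⟩
  have hinc : ∀ V, ¬ RG δ E M (s ^ 20) Λ V →
      (∃ P ∈ I, ∀ y ∈ P, ¬ RG δ E M s (sub c (s ^ 40) s y) V) ∨
      ((∃ P ∈ PP, ∃ a ∈ Λ, ModeEvent δ E M s c 11200 σ P a V) ∨
      ∃ P ∈ PP, ∃ i ∈ Λ, ∃ a ∈ Λ, ModeEvent δ E M s c 11200 σ P a (flipAt V i)) := by
    intro V hV
    by_contra hcon
    rw [not_or, not_or] at hcon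
    obtain ⟨h1, h2, h3⟩ := hcon
    rcases exists_cover (c := c) hs0' (fun y => ¬ RG δ E M s (sub c (s ^ 40) s y) V) with
      ⟨P, hPs, hPc, hPp, hPd⟩ | ⟨P, hPs, hPc, hPp⟩
    · exact h1 ⟨P, (hI P).2 ⟨Finset.mem_powersetCard.2 ⟨hPs, hPc⟩, hPd⟩, hPp⟩
    · refine hV (rg_next hB hPc (fun y hy hyB => ?_) (X := zoneHt M s (11200 + 62)) ?_
        (fun a ha => ⟨σ a, fun u hu => h2 ⟨P, mem_small_subsets hPs (by omega), a, ha, u, hu⟩⟩)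
        (fun i hi a ha => ⟨σ a, fun u hu => h3 ⟨insert i P, mem_small_subsets ?_ ?_, i, hi, a, ha,
          u, hu⟩⟩))
      · exact not_not.1 (hPp y hy (mem_sub hB hL hy) (fun z hz => mem_sub hB hL (hPs hz)) hyB)
      · unfold zoneHt
        calc (s : ℝ) ^ 19 * M ^ (6 * (11200 + 62)) ≤ (s : ℝ) ^ 19 * s :=
              mul_le_mul_of_nonneg_left ht (pow_nonneg hs0.le _)
          _ = (s : ℝ) ^ 20 := by rw [← pow_succ]
      · exact Finset.insert_subset hi hPs
      · exact (Finset.card_insert_le _ _).trans (by omega)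
  have hb1 : μ.real {V | ∃ P ∈ I, ∀ y ∈ P, ¬ RG δ E M s (sub c (s ^ 40) s y) V} ≤
      1 / (s : ℝ) ^ 7440 := by
    have h := prob_exists_le hμ I (fun P V => ∀ y ∈ P, ¬ RG δ E M s (sub c (s ^ 40) s y) V)
      (q := 1 / (s : ℝ) ^ 11160) (by
        intro P hP
        obtain ⟨hP1, hPd⟩ := (hI P).1 hP
        have hPc := (Finset.mem_powersetCard.1 hP1).2
        rw [prob_forall hμ P (fun y => sub c (s ^ 40) s y)
          (fun y V => ¬ RG δ E M s (sub c (s ^ 40) s y) V) (fun y _ => (depOn_RG _).not) hPd]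
        calc _ ≤ ∏ y ∈ P, 1 / (s : ℝ) ^ 360 :=
              Finset.prod_le_prod (fun _ _ => MeasureTheory.measureReal_nonneg)
                (fun y _ => hp _)
          _ = 1 / (s : ℝ) ^ 11160 := by
              rw [Finset.prod_const, hPc, div_pow, one_pow, ← pow_mul])
    refine h.trans ?_
    have hIc : (I.card : ℝ) ≤ (s : ℝ) ^ 3720 := by
      have h1 : I.card ≤ Λ.card ^ 31 := by
        calc I.card ≤ (Finset.powersetCard 31 Λ).card :=
              Finset.card_le_card fun P hP => ((hI P).1 hP).1
          _ ≤ Λ.card ^ 31 := by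
              rw [Finset.card_powersetCard]
              exact Nat.choose_le_pow _ _
      calc (I.card : ℝ) ≤ (Λ.card : ℝ) ^ 31 := by exact_mod_cast h1
        _ = (s : ℝ) ^ 3720 := by rw [hcard, ← pow_mul]
    calc _ ≤ (s : ℝ) ^ 3720 * (1 / (s : ℝ) ^ 11160) :=
          mul_le_mul_of_nonneg_right hIc (by positivity)
      _ = 1 / (s : ℝ) ^ 7440 := pow_mul_one_div hs0 (by norm_num)
  have hPPc : (PP.card : ℝ) ≤ 32 * (s : ℝ) ^ 3720 := by
    have := card_small_subsets Λ hne
    rwa [hcard, ← pow_mul] at this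
  have hq0 : (0 : ℝ) ≤ 1 / (s : ℝ) ^ 11200 := div_nonneg zero_le_one (pow_nonneg hs0.le _)
  have hb2' : ∀ P ∈ PP, μ.real {V | ∃ a ∈ Λ, ModeEvent δ E M s c 11200 σ P a V} ≤
      1 / (s : ℝ) ^ 11080 := by
    intro P hP
    refine (prob_exists_le hμ Λ _ fun a ha => (hmode P hP a ha).2).trans (le_of_eq ?_)
    rw [hcard]
    exact pow_mul_one_div hs0 (by norm_num)
  have hb2 : μ.real {V | ∃ P ∈ PP, ∃ a ∈ Λ, ModeEvent δ E M s c 11200 σ P a V} ≤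
      32 * (1 / (s : ℝ) ^ 7360) := by
    refine (prob_exists_le hμ PP _ hb2').trans ?_
    calc _ ≤ 32 * (s : ℝ) ^ 3720 * (1 / (s : ℝ) ^ 11080) :=
          mul_le_mul_of_nonneg_right hPPc (div_nonneg zero_le_one (pow_nonneg hs0.le _))
      _ = 32 * (1 / (s : ℝ) ^ 7360) := by
          rw [mul_assoc, pow_mul_one_div hs0 (b := 7360) (by norm_num)]
  have hb3' : ∀ P ∈ PP, μ.real {V | ∃ i ∈ Λ, ∃ a ∈ Λ,
      ModeEvent δ E M s c 11200 σ P a (flipAt V i)} ≤ 1 / (s : ℝ) ^ 10960 := by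
    intro P hP
    refine (prob_exists_le hμ Λ (fun i V => ∃ a ∈ Λ,
      ModeEvent δ E M s c 11200 σ P a (flipAt V i)) (q := 1 / (s : ℝ) ^ 11080)
      fun i hi => ?_).trans (le_of_eq ?_)
    · refine (prob_exists_le hμ Λ _ fun a ha => (?_ : _ ≤ 1 / (s : ℝ) ^ 11200)).trans
        (le_of_eq ?_)
      · rw [prob_flip hμ (hmode P hP a ha).1 hi]
        exact (hmode P hP a ha).2
      · rw [hcard]
        exact pow_mul_one_div hs0 (by norm_num)
    · rw [hcard]
      exact pow_mul_one_div hs0 (by norm_num)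
  have hb3 : μ.real {V | ∃ P ∈ PP, ∃ i ∈ Λ, ∃ a ∈ Λ,
      ModeEvent δ E M s c 11200 σ P a (flipAt V i)} ≤ 32 * (1 / (s : ℝ) ^ 7240) := by
    refine (prob_exists_le hμ PP _ hb3').trans ?_
    calc _ ≤ 32 * (s : ℝ) ^ 3720 * (1 / (s : ℝ) ^ 10960) :=
          mul_le_mul_of_nonneg_right hPPc (div_nonneg zero_le_one (pow_nonneg hs0.le _))
      _ = 32 * (1 / (s : ℝ) ^ 7240) := by
          rw [mul_assoc, pow_mul_one_div hs0 (b := 7240) (by norm_num)]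
  have htot := (prob_mono hμ hinc).trans ((prob_or_le μ _ _).trans
    (add_le_add_right (prob_or_le μ _ _) _))
  have h1s : (1 : ℝ) ≤ s := by linarith
  have hm1 : 1 / (s : ℝ) ^ 7440 ≤ 1 / (s : ℝ) ^ 7240 :=
    one_div_le_one_div_of_le (pow_pos hs0 _) (pow_le_pow_right₀ h1s (by norm_num))
  have hm2 : 1 / (s : ℝ) ^ 7360 ≤ 1 / (s : ℝ) ^ 7240 :=
    one_div_le_one_div_of_le (pow_pos hs0 _) (pow_le_pow_right₀ h1s (by norm_num))
  have hm3 : 1 / (s : ℝ) ^ 7200 = (s : ℝ) ^ 40 * (1 / (s : ℝ) ^ 7240) :=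
    (pow_mul_one_div hs0 (by norm_num)).symm
  have hm4 : (65 : ℝ) ≤ (s : ℝ) ^ 40 := by
    calc (65 : ℝ) ≤ s := by linarith
      _ = (s : ℝ) ^ 1 := (pow_one _).symm
      _ ≤ (s : ℝ) ^ 40 := pow_le_pow_right₀ h1s (by norm_num)
  have hx0 : (0 : ℝ) ≤ 1 / (s : ℝ) ^ 7240 := div_nonneg zero_le_one (pow_nonneg hs0.le _)
  rw [hm3]
  have hm5 := mul_le_mul_of_nonneg_right hm4 hx0
  generalize (1 : ℝ) / (s : ℝ) ^ 7240 = a1 at *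
  generalize (1 : ℝ) / (s : ℝ) ^ 7440 = a2 at *
  generalize (1 : ℝ) / (s : ℝ) ^ 7360 = a3 at *
  refine le_trans ?_ hm5
  linarith

/-- The sequence of scales `s₀ ^ (20 ^ k)`. -/
def scale (s₀ k : ℕ) : ℕ := s₀ ^ 20 ^ k

lemma scale_zero (s₀ : ℕ) : scale s₀ 0 = s₀ := by simp [scale]

lemma scale_succ (s₀ k : ℕ) : scale s₀ (k + 1) = scale s₀ k ^ 20 := by
  rw [scale, scale, ← pow_mul, pow_succ]

lemma le_scale {s₀ : ℕ} (h : 1 ≤ s₀) (k : ℕ) : s₀ ≤ scale s₀ k := by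
  calc s₀ = s₀ ^ 1 := (pow_one _).symm
    _ ≤ _ := Nat.pow_le_pow_right h (Nat.one_le_pow _ _ (by norm_num))

lemma Big.scale {δ E M : ℝ} {s₀ : ℕ} (hB : Big δ E M s₀) : ∀ k, Big δ E M (scale s₀ k)
  | 0 => by rw [scale_zero]; exact hB
  | k + 1 => by rw [scale_succ]; exact (Big.scale hB k).next

theorem msa_all_scales {δ E M : ℝ} {s₀ : ℕ} {μ : MeasureTheory.Measure Cfg}
    (hμ : IsBernoulliProduct μ) (hB : Big δ E M s₀) (ht : M ^ (6 * (11200 + 62)) ≤ s₀)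
    (hp : ∀ c, μ.real {V | ¬ RG δ E M s₀ (cube c (s₀ ^ 2)) V} ≤ 1 / (s₀ : ℝ) ^ 360) (k : ℕ) :
    ∀ c, μ.real {V | ¬ RG δ E M (scale s₀ k) (cube c (scale s₀ k ^ 2)) V} ≤
      1 / (scale s₀ k : ℝ) ^ 360 := by
  induction k with
  | zero => rw [scale_zero]; exact hp
  | succ k ih =>
    intro c
    have h1 : 1 ≤ s₀ := by
      have := hB.s_pos
      exact_mod_cast this
    have hk : M ^ (6 * (11200 + 62)) ≤ (scale s₀ k : ℝ) :=
      ht.trans (by exact_mod_cast le_scale h1 k)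
    have h := msa_step hμ (hB.scale k) hk ih c
    rw [scale_succ, ← pow_mul, Nat.cast_pow, ← pow_mul]
    exact h

section Supersolution

/-- The `ℓ¹` distance. -/
def lone (x p : Z3) : ℕ := ∑ i, (x i - p i).natAbs

lemma lone_add_le (x p : Z3) (i : Fin 3) : lone (x + stdv i) p ≤ lone x p + 1 := by
  simp only [lone, Fin.sum_univ_three, Pi.add_apply, stdv]
  fin_cases i <;> simp <;> omega

lemma lone_sub_le (x p : Z3) (i : Fin 3) : lone (x - stdv i) p ≤ lone x p + 1 := by
  simp only [lone, Fin.sum_univ_three, Pi.sub_apply, stdv]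
  fin_cases i <;> simp <;> omega

lemma exists_lone_lt {x p : Z3} (h : lone x p ≠ 0) :
    ∃ i, lone (x + stdv i) p + 1 = lone x p ∨ lone (x - stdv i) p + 1 = lone x p := by
  have : x 0 - p 0 ≠ 0 ∨ x 1 - p 1 ≠ 0 ∨ x 2 - p 2 ≠ 0 := by
    by_contra hc
    simp only [not_or, not_not] at hc
    apply h
    simp [lone, Fin.sum_univ_three, hc]
  simp only [lone, Fin.sum_univ_three, Pi.add_apply, Pi.sub_apply, stdv]
  rcases this with h | h | h
  · refine ⟨0, ?_⟩
    simp
    omega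
  · refine ⟨1, ?_⟩
    simp
    omega
  · refine ⟨2, ?_⟩
    simp
    omega

lemma eq_of_lone_eq_zero {x p : Z3} (h : lone x p = 0) : x = p := by
  funext i
  have := (Finset.sum_eq_zero_iff.1 h) i (Finset.mem_univ i)
  omega

lemma lone_le_of_dist_lt {x p : Z3} {n : ℕ} (h : dist x p < n) : lone x p ≤ 3 * n := by
  have : ∀ i, (x i - p i).natAbs ≤ n := by
    intro i
    have h1 := (abs_coord_le_dist x p i).trans h.le
    have h2 : |x i - p i| ≤ (n : ℤ) := by exact_mod_cast h1
    have h3 := abs_le.1 h2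
    omega
  have h0 := this 0
  have h1 := this 1
  have h2 := this 2
  simp only [lone, Fin.sum_univ_three]
  omega

variable {δ E η κ : ℝ} {V : Cfg} {Q : Finset Z3} {D : ℕ}

lemma exists_supersolution (hη : 0 < η) (hη1 : η ≤ 1) (hηδ : 10 * η ≤ δ) (hE0 : 0 ≤ E)
    (hE : 8 * E ≤ η * (1 / 6) ^ D) (hQ : Q.Nonempty)
    (hD : ∀ x ∈ Q, ∃ p ∈ Q, V p = true ∧ lone x p ≤ D) :
    ∃ w : Z3 → ℝ, (∀ x, 1 ≤ w x ∧ w x ≤ 2) ∧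
      ∀ x ∈ Q, η / 2 * (1 / 6) ^ D ≤ T δ E V w x := by
  classical
  set S := Q.filter fun p => V p = true with hS
  have hSne : S.Nonempty := by
    obtain ⟨x, hx⟩ := hQ
    obtain ⟨p, hp, hV, -⟩ := hD x hx
    exact ⟨p, Finset.mem_filter.2 ⟨hp, hV⟩⟩
  have hd : ∀ x, ∃ d : ℕ, (∃ p ∈ S, lone x p = d) ∧ ∀ p ∈ S, d ≤ lone x p := by
    intro x
    obtain ⟨p, hp, hmin⟩ := S.exists_min_image (lone x) hSne
    exact ⟨lone x p, ⟨p, hp, rfl⟩, hmin⟩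
  choose d hd1 hd2 using hd
  set g : Z3 → ℝ := fun x => (1 / 6) ^ d x with hg
  have hg0 : ∀ x, 0 < g x := fun x => by simp only [hg]; positivity
  have hg1 : ∀ x, g x ≤ 1 := fun x => pow_le_one₀ (by norm_num) (by norm_num)
  refine ⟨fun x => 1 + η - η * g x, fun x => ⟨?_, ?_⟩, fun x hx => ?_⟩
  · nlinarith [hg0 x, hg1 x]
  · nlinarith [hg0 x, hg1 x]
  have hnb : nbs (fun x => 1 + η - η * g x) x = 6 * (1 + η) - η * nbs g x := by
    simp only [nbs, Fin.sum_univ_three]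
    ring
  obtain ⟨p, hpQ, hVp, hpD⟩ := hD x hx
  have hdD : d x ≤ D := (hd2 x p (Finset.mem_filter.2 ⟨hpQ, hVp⟩)).trans hpD
  have h6D : (0 : ℝ) < (1 / 6) ^ D := by positivity
  have h6D1 : ((1 : ℝ) / 6) ^ D ≤ 1 := pow_le_one₀ (by norm_num) (by norm_num)
  have hηD : 0 < η * (1 / 6) ^ D := by positivity
  have hηD1 : η * (1 / 6) ^ D ≤ η := by nlinarith
  rw [T, hnb]
  have hVn : (0 : ℝ) ≤ if V x then 1 else 0 := by split_ifs <;> norm_num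
  have hw1 : 1 ≤ 1 + η - η * g x := by nlinarith [hg0 x, hg1 x]
  have hw2 : 1 + η - η * g x ≤ 2 := by nlinarith [hg0 x, hg1 x]
  have hEw : E * (1 + η - η * g x) ≤ η * (1 / 6) ^ D / 4 := by nlinarith
  by_cases h0 : d x = 0
  · have hxV : V x = true := by
      obtain ⟨q, hq, hq0⟩ := hd1 x
      rw [h0] at hq0
      rw [eq_of_lone_eq_zero hq0]
      exact (Finset.mem_filter.1 hq).2
    have hgx : g x = 1 := by simp [hg, h0]
    have hng : 0 ≤ nbs g x := by
      unfold nbs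
      exact Finset.sum_nonneg fun i _ => add_nonneg (hg0 _).le (hg0 _).le
    have h2 : 0 ≤ η * nbs g x := mul_nonneg hη.le hng
    rw [hgx] at hEw ⊢
    rw [hxV]
    simp only [if_true]
    nlinarith
  · obtain ⟨q, hq, hqd⟩ := hd1 x
    have hq0 : lone x q ≠ 0 := by omega
    have hup : ∀ i, (1 / 6) * g x ≤ g (x + stdv i) ∧ (1 / 6) * g x ≤ g (x - stdv i) := by
      intro i
      have h1 := (hd2 (x + stdv i) q hq).trans (lone_add_le x q i)
      have h2 := (hd2 (x - stdv i) q hq).trans (lone_sub_le x q i)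
      rw [hqd] at h1 h2
      simp only [hg, ← pow_succ']
      exact ⟨pow_le_pow_of_le_one (by norm_num) (by norm_num) h1,
        pow_le_pow_of_le_one (by norm_num) (by norm_num) h2⟩
    have hdown : ∀ y, d y + 1 ≤ d x → 6 * g x ≤ g y := by
      intro y hy
      have : ((1 : ℝ) / 6) ^ d x ≤ (1 / 6) ^ (d y + 1) :=
        pow_le_pow_of_le_one (by norm_num) (by norm_num) hy
      rw [pow_succ] at this
      simp only [hg]
      linarith
    have hkey : 6 * g x + 5 / 6 * g x ≤ nbs g x := by
      have hx0 := hup 0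
      have hx1 := hup 1
      have hx2 := hup 2
      simp only [nbs, Fin.sum_univ_three]
      obtain ⟨i, hi | hi⟩ := exists_lone_lt hq0
      · have h3 := hdown (x + stdv i) (by have := hd2 (x + stdv i) q hq; omega)
        fin_cases i <;> simp only [Fin.zero_eta, Fin.mk_one, Fin.reduceFinMk] at h3 <;>
          linarith [hx0.1, hx0.2, hx1.1, hx1.2, hx2.1, hx2.2, hg0 x]
      · have h3 := hdown (x - stdv i) (by have := hd2 (x - stdv i) q hq; omega)
        fin_cases i <;> simp only [Fin.zero_eta, Fin.mk_one, Fin.reduceFinMk] at h3 <;>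
          linarith [hx0.1, hx0.2, hx1.1, hx1.2, hx2.1, hx2.2, hg0 x]
    have hgD : ((1 : ℝ) / 6) ^ D ≤ g x :=
      pow_le_pow_of_le_one (by norm_num) (by norm_num) hdD
    have h4 := mul_le_mul_of_nonneg_left hkey hη.le
    have h5 := mul_le_mul_of_nonneg_left hgD hη.le
    have hδ0 : 0 ≤ δ := by linarith
    have h6 : 0 ≤ δ * (if V x then 1 else 0) * (1 + η - η * g x) :=
      mul_nonneg (mul_nonneg hδ0 hVn) (by linarith)
    nlinarith

/-- Comparison principle in the presence of a positive strict supersolution. -/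
lemma comparison {w v : Z3 → ℝ} (hκ : 0 < κ) (hw : ∀ x, 1 ≤ w x)
    (hTw : ∀ x ∈ Q, κ ≤ T δ E V w x) (hv : ∀ x ∉ Q, 0 ≤ v x)
    (hTv : ∀ x ∈ Q, 0 ≤ T δ E V v x) (x : Z3) : 0 ≤ v x := by
  by_contra hx
  rw [not_le] at hx
  have hxQ : x ∈ Q := by
    by_contra h
    exact absurd (hv x h) (not_le.2 hx)
  obtain ⟨y, hy, hmin⟩ := Q.exists_min_image (fun z => v z / w z) ⟨x, hxQ⟩
  set ρ := v y / w y with hρ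
  have hw0 : ∀ z, 0 < w z := fun z => lt_of_lt_of_le one_pos (hw z)
  have hρ0 : ρ < 0 := lt_of_le_of_lt (hmin x hxQ) (div_neg_of_neg_of_pos hx (hw0 x))
  have hle : ∀ z, ρ * w z ≤ v z := by
    intro z
    by_cases hz : z ∈ Q
    · exact (le_div_iff₀ (hw0 z)).1 (hmin z hz)
    · exact (mul_neg_of_neg_of_pos hρ0 (hw0 z)).le.trans (hv z hz)
  have heq : v y = ρ * w y := by
    rw [hρ, div_mul_cancel₀ _ (hw0 y).ne']
  have hn : ρ * nbs w y ≤ nbs v y := by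
    rw [← nbs_mul]
    exact Finset.sum_le_sum fun i _ => add_le_add (hle _) (hle _)
  have h1 := hTv y hy
  have h2 := hTw y hy
  rw [T] at h1 h2
  rw [heq] at h1
  nlinarith [mul_le_mul_of_nonpos_left h2 hρ0.le]

/-- Bounds on the Green function coming from a supersolution. -/
lemma green_of_supersolution {w : Z3 → ℝ} (hκ : 0 < κ) (hκ1 : κ ≤ 1) (hw : ∀ x, 1 ≤ w x ∧ w x ≤ 2) (hTw : ∀ x ∈ Q, κ ≤ T δ E V w x) :
    (opMat δ E Q V).det ≠ 0 ∧ (∀ x y, 0 ≤ Gf δ E Q V x y) ∧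
      (∀ x y, Gf δ E Q V x y ≤ 4 / κ * Real.exp (-(κ / 48) * dist x y)) ∧
      ∀ x, ∑ y ∈ Q, Gf δ E Q V x y ≤ 2 / κ := by
  have hcmp : ∀ v : Z3 → ℝ, (∀ x ∉ Q, 0 ≤ v x) → (∀ x ∈ Q, 0 ≤ T δ E V v x) → ∀ x, 0 ≤ v x :=
    fun v h1 h2 => comparison hκ (fun x => (hw x).1) hTw h1 h2
  have hdet : (opMat δ E Q V).det ≠ 0 := by
    refine det_ne_zero_of_inj fun v hv hTv x => le_antisymm ?_ ?_
    · have := hcmp (fun z => (-1) * v z) (fun z hz => by simp [hv z hz])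
        (fun z hz => by rw [T_mul, hTv z hz]; simp) x
      linarith
    · exact hcmp v (fun z hz => (hv z hz).ge) (fun z hz => (hTv z hz).ge) x
  have hpos : ∀ x y, 0 ≤ Gf δ E Q V x y := by
    intro x y
    by_cases hy : y ∈ Q
    · refine hcmp (fun z => Gf δ E Q V z y) (fun z hz => (Gf_off_left hz y).ge) (fun z hz => ?_) x
      rw [T_Gf hdet hz hy]
      split_ifs <;> norm_num
    · exact (Gf_off_right hy x).ge
  refine ⟨hdet, hpos, fun x y => ?_, fun x => ?_⟩
  · by_cases hy : y ∈ Q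
    swap
    · rw [Gf_off_right hy]
      positivity
    set α := κ / 48 with hα
    have hα0 : 0 < α := by positivity
    have hexpα : Real.exp α ≤ 1 + κ / 24 := by
      have h1 : |α| ≤ 1 := by rw [abs_of_pos hα0]; linarith
      have h2 := Real.abs_exp_sub_one_sub_id_le h1
      have h3 := (abs_le.1 h2).2
      nlinarith
    set v : Z3 → ℝ := fun z => Real.exp (-α * dist z y) * w z with hv
    have hv0 : ∀ z, 0 ≤ v z := fun z =>
      mul_nonneg (Real.exp_pos _).le (zero_le_one.trans (hw z).1)
    have hTv : ∀ z ∈ Q, Real.exp (-α * dist z y) * (κ / 2) ≤ T δ E V v z := by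
      intro z hz
      have hb : ∀ b, dist b z ≤ 1 →
          v b ≤ Real.exp (-α * dist z y) * Real.exp α * w b := by
        intro b hb
        refine mul_le_mul_of_nonneg_right ?_ (zero_le_one.trans (hw b).1)
        rw [← Real.exp_add, Real.exp_le_exp]
        have h1 := dist_triangle z b y
        rw [dist_comm z b] at h1
        nlinarith
      have hn : nbs v z ≤ Real.exp (-α * dist z y) * Real.exp α * nbs w z := by
        rw [← nbs_mul]
        exact Finset.sum_le_sum fun i _ =>
          add_le_add (hb _ (dist_add_stdv z i)) (hb _ (dist_sub_stdv z i))
      have hw12 : nbs w z ≤ 12 := by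
        have h0 := (hw (z + stdv 0)).2
        have h1 := (hw (z + stdv 1)).2
        have h2 := (hw (z + stdv 2)).2
        have h3 := (hw (z - stdv 0)).2
        have h4 := (hw (z - stdv 1)).2
        have h5 := (hw (z - stdv 2)).2
        simp only [nbs, Fin.sum_univ_three]
        linarith
      have hw0 : 0 ≤ nbs w z := Finset.sum_nonneg fun i _ =>
        add_nonneg (zero_le_one.trans (hw _).1) (zero_le_one.trans (hw _).1)
      have hTz := hTw z hz
      rw [T] at hTz ⊢
      have he := Real.exp_pos (-α * dist z y)
      have h1 : Real.exp α * nbs w z ≤ nbs w z + κ / 2 := by nlinarith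
      have h2 := mul_le_mul_of_nonneg_left h1 he.le
      have h3 := mul_le_mul_of_nonneg_left hTz he.le
      simp only [hv]
      simp only [hv] at hn
      nlinarith
    have h := hcmp (fun z => 2 / κ * v z - Gf δ E Q V z y)
      (fun z hz => by
        simp only [Gf_off_left hz, sub_zero]
        exact mul_nonneg (by positivity) (hv0 z))
      (fun z hz => by
        rw [T_sub, T_mul, T_Gf hdet hz hy]
        have h1 := hTv z hz
        have h2 := mul_le_mul_of_nonneg_left h1 (by positivity : 0 ≤ 2 / κ)
        have h3 : 2 / κ * (Real.exp (-α * dist z y) * (κ / 2)) = Real.exp (-α * dist z y) := by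
          field_simp
        rw [h3] at h2
        split_ifs with hzy
        · rw [hzy, dist_self, mul_zero, Real.exp_zero] at h2
          rw [hzy]
          linarith
        · have := Real.exp_pos (-α * dist z y)
          linarith) x
    have h1 : 2 / κ * v x ≤ 4 / κ * Real.exp (-α * dist x y) := by
      have : v x ≤ Real.exp (-α * dist x y) * 2 :=
        mul_le_mul_of_nonneg_left (hw x).2 (Real.exp_pos _).le
      have h2 := mul_le_mul_of_nonneg_left this (by positivity : 0 ≤ 2 / κ)
      refine h2.trans (le_of_eq ?_)
      ring
    linarith
  · have h := hcmp (fun z => 1 / κ * w z - ∑ y ∈ Q, Gf δ E Q V z y)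
      (fun z hz => by
        have : ∑ y ∈ Q, Gf δ E Q V z y = 0 :=
          Finset.sum_eq_zero fun y _ => Gf_off_left hz y
        rw [this, sub_zero]
        exact mul_nonneg (by positivity) (zero_le_one.trans (hw z).1))
      (fun z hz => by
        rw [T_sub, T_mul, T_sum Q (fun y z => Gf δ E Q V z y)]
        have h1 : ∑ y ∈ Q, T δ E V (fun z => Gf δ E Q V z y) z = 1 := by
          rw [Finset.sum_congr rfl fun y hy => T_Gf hdet hz hy, Finset.sum_ite_eq, if_pos hz]
        rw [h1]
        have h2 := mul_le_mul_of_nonneg_left (hTw z hz) (by positivity : 0 ≤ 1 / κ)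
        have h3 : 1 / κ * κ = 1 := by field_simp
        linarith) x
    have h1 := mul_le_mul_of_nonneg_left (hw x).2 (by positivity : 0 ≤ 1 / κ)
    have h2 : 1 / κ * 2 = 2 / κ := by ring
    linarith

end Supersolution

section Initial

variable {δ E M κ η : ℝ} {s l : ℕ} {V : Cfg} {Q : Finset Z3}

lemma good_of_green (hB : Big δ E M s) (hκ : 0 < κ) (hκM : 1000 ≤ κ * M)
    (hdet : (opMat δ E Q V).det ≠ 0) (h0 : ∀ x y, 0 ≤ Gf δ E Q V x y)
    (h1 : ∀ x y, Gf δ E Q V x y ≤ 4 / κ * Real.exp (-(κ / 48) * dist x y)) :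
    Good δ E M s Q V ∧ ∀ x y, (s : ℝ) ^ 2 / 8 ≤ dist x y →
      Gf δ E Q V x y < Real.exp (-(1 / M + 3 / s) * dist x y) := by
  have hM := hB.M_pos
  have hs := hB.s_pos
  have hMs : M ^ 2 ≤ s := hB.pow_le (by norm_num)
  have hM6 := hB.hM
  have h3M : 3 * M ≤ s := by nlinarith
  have hκM' : 1000 / M ≤ κ := by rwa [div_le_iff₀ hM]
  have h4κ : 4 / κ < Real.exp s := by
    have : 4 / κ ≤ s := by
      rw [div_le_iff₀ hκ]
      nlinarith
    have := Real.add_one_le_exp (s : ℝ)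
    linarith
  have hfar : ∀ x y, (s : ℝ) ^ 2 / 8 ≤ dist x y →
      Gf δ E Q V x y < Real.exp (-(1 / M + 3 / s) * dist x y) := by
    intro x y hd
    refine (h1 x y).trans_lt ?_
    calc _ < Real.exp s * Real.exp (-(κ / 48) * dist x y) :=
          mul_lt_mul_of_pos_right h4κ (Real.exp_pos _)
      _ ≤ Real.exp (-(1 / M + 3 / s) * dist x y) := by
          rw [← Real.exp_add, Real.exp_le_exp]
          have h3 : 3 / (s : ℝ) ≤ 1 / M := by
            rw [div_le_div_iff₀ hs hM]
            linarith
          have h4 : 1000 / M = 1000 * (1 / M) := by ring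
          have hd0 : 0 ≤ dist x y := dist_nonneg
          have hM1 : 0 < 1 / M := by positivity
          have h5 : 8 * (1 / M) * dist x y ≤ (κ / 48 - 1 / M - 3 / s) * dist x y :=
            mul_le_mul_of_nonneg_right (by linarith) hd0
          have h6 : 8 * (1 / M) * ((s : ℝ) ^ 2 / 8) ≤ 8 * (1 / M) * dist x y :=
            mul_le_mul_of_nonneg_left hd (by positivity)
          have h7 : 8 * (1 / M) * ((s : ℝ) ^ 2 / 8) = (s : ℝ) ^ 2 / M := by ring
          have h8 : (s : ℝ) ≤ (s : ℝ) ^ 2 / M := by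
            rw [le_div_iff₀ hM]
            nlinarith
          linarith
  refine ⟨⟨hdet, fun x _ y _ => ?_⟩, hfar⟩
  rw [abs_of_nonneg (h0 x y)]
  split_ifs with hd
  · exact hfar x y hd
  · refine (h1 x y).trans_lt (lt_of_le_of_lt ?_ h4κ)
    refine mul_le_of_le_one_right (by positivity) (Real.exp_le_one_iff.2 ?_)
    have hd0 : 0 ≤ dist x y := dist_nonneg
    have : 0 ≤ κ / 48 * dist x y := by positivity
    linarith

lemma clean_of_green (hB : Big δ E M s) (hκ : 0 < κ) (hκM : 1000 ≤ κ * M) (hκ1 : κ ≤ 1) {x : Z3}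
    (hx : x ∈ Q) (hdet : (opMat δ E Q (Function.update V x false)).det ≠ 0)
    (h0 : ∀ y z, 0 ≤ Gf δ E Q (Function.update V x false) y z)
    (h1 : ∀ y z, Gf δ E Q (Function.update V x false) y z ≤
      4 / κ * Real.exp (-(κ / 48) * dist y z))
    (h2 : ∀ y, ∑ z ∈ Q, Gf δ E Q (Function.update V x false) y z ≤ 2 / κ) :
    Clean δ E M s V Q x := by
  have hM := hB.M_pos
  have hs := hB.s_pos
  have hMs : M ^ 2 ≤ s := hB.pow_le (by norm_num)
  have hM6 := hB.hM
  have h2M : 2 * M ≤ s := by nlinarith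
  refine ⟨hx, fun z => Gf δ E Q (Function.update V x false) z x, fun z hz => Gf_off_left hz x,
    fun z hz => T_Gf hdet hz hx, ?_, ?_, fun z _ hd => ?_⟩
  · have : 1 / (s : ℝ) ≤ 1 / (2 * M) := one_div_le_one_div_of_le (by positivity) h2M
    linarith [h0 x x]
  · have hb : ∀ z ∈ Q, Gf δ E Q (Function.update V x false) z x ^ 2 ≤
        4 / κ * Gf δ E Q (Function.update V x false) x z := by
      intro z _
      rw [Gf_symm Q x z, sq]
      refine mul_le_mul_of_nonneg_right ((h1 z x).trans ?_) (h0 z x)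
      refine mul_le_of_le_one_right (by positivity) (Real.exp_le_one_iff.2 ?_)
      have : 0 ≤ κ / 48 * dist z x := by positivity
      linarith
    have h3 : 4 / κ ≤ M - 1 / s := by
      have h4 : 1 / (s : ℝ) ≤ 1 := by
        rw [div_le_one hs]
        nlinarith
      have h5 : 4 / κ ≤ M - 1 := by
        rw [div_le_iff₀ hκ]
        nlinarith
      linarith
    calc _ ≤ ∑ z ∈ Q, 4 / κ * Gf δ E Q (Function.update V x false) x z := Finset.sum_le_sum hb
      _ = 4 / κ * ∑ z ∈ Q, Gf δ E Q (Function.update V x false) x z := by rw [Finset.mul_sum]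
      _ ≤ 4 / κ * (2 / κ) := mul_le_mul_of_nonneg_left (h2 x) (by positivity)
      _ ≤ (4 / κ) ^ 2 := by
          rw [sq]
          refine mul_le_mul_of_nonneg_left ?_ (by positivity)
          exact div_le_div_of_nonneg_right (by norm_num) hκ.le
      _ ≤ (M - 1 / s) ^ 2 := pow_le_pow_left₀ (by positivity) h3 2
  · rw [abs_of_nonneg (h0 z x)]
    exact ((good_of_green hB hκ hκM hdet h0 h1).2 z x hd).le

lemma rg_of_dense (hB : Big δ E M s) (hη : 0 < η) (hη1 : η ≤ 1) (hηδ : 10 * η ≤ δ)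
    (hE : 8 * E ≤ η * (1 / 6) ^ (3 * l)) (hM : 1000 ≤ η / 2 * (1 / 6) ^ (3 * l) * M)
    (hD : ∀ y ∈ Q, ∀ x, ∃ p ∈ Q, p ≠ x ∧ V p = true ∧ dist y p < l) : RG δ E M s Q V := by
  have h6D : (0 : ℝ) < (1 / 6) ^ (3 * l) := by positivity
  have h6D1 : ((1 : ℝ) / 6) ^ (3 * l) ≤ 1 := pow_le_one₀ (by norm_num) (by norm_num)
  set κ := η / 2 * (1 / 6) ^ (3 * l) with hκ
  have hκ0 : 0 < κ := by positivity
  have hκ1 : κ ≤ 1 := by nlinarith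
  have key : ∀ W : Cfg, Q.Nonempty → (∃ x, ∀ z, z ≠ x → W z = V z) →
      (opMat δ E Q W).det ≠ 0 ∧ (∀ x y, 0 ≤ Gf δ E Q W x y) ∧
      (∀ x y, Gf δ E Q W x y ≤ 4 / κ * Real.exp (-(κ / 48) * dist x y)) ∧
      ∀ x, ∑ y ∈ Q, Gf δ E Q W x y ≤ 2 / κ := by
    rintro W hQ ⟨x, hx⟩
    obtain ⟨w, hw, hTw⟩ := exists_supersolution (V := W) hη hη1 hηδ hB.hE0 hE hQ (by
      intro y hy
      obtain ⟨p, hp, hpx, hVp, hd⟩ := hD y hy x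
      exact ⟨p, hp, by rw [hx p hpx]; exact hVp, lone_le_of_dist_lt hd⟩)
    exact green_of_supersolution hκ0 hκ1 hw hTw
  refine ⟨?_, fun x hx => ?_, ?_⟩
  · rcases Q.eq_empty_or_nonempty with h | h
    · subst h
      exact ⟨by simp, fun x hx => absurd hx (Finset.notMem_empty x)⟩
    · obtain ⟨h1, h2, h3, -⟩ := key V h ⟨0, fun _ _ => rfl⟩
      exact (good_of_green hB hκ0 hM h1 h2 h3).1
  · obtain ⟨h1, h2, h3, -⟩ := key (flipAt V x) ⟨x, hx⟩ ⟨x, fun z hz => flipAt_of_ne hz⟩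
    exact (good_of_green hB hκ0 hM h1 h2 h3).1
  · intro σ _ γ N _ hγ _
    have hx := hγ 0 (Nat.zero_le _)
    obtain ⟨h1, h2, h3, h4⟩ := key (Function.update V (γ 0) false) ⟨γ 0, hx⟩
      ⟨γ 0, fun z hz => Function.update_of_ne hz _ _⟩
    exact ⟨0, Nat.zero_le _, clean_of_green hB hκ0 hM hκ1 hx h1 h2 h3 h4⟩

lemma prob_all_false {μ : MeasureTheory.Measure Cfg} (hμ : IsBernoulliProduct μ) (S : Finset Z3) :
    μ.real {V | ∀ a ∈ S, V a = false} = (1 / 2) ^ S.card := by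
  have := hμ.2 S (fun _ => false)
  rw [MeasureTheory.measureReal_def, this, ENNReal.toReal_pow]
  simp

lemma prob_not_rg_initial {μ : MeasureTheory.Measure Cfg} (hμ : IsBernoulliProduct μ)
    (hB : Big δ E M s) (hη : 0 < η) (hη1 : η ≤ 1) (hηδ : 10 * η ≤ δ)
    (hE : 8 * E ≤ η * (1 / 6) ^ (3 * l)) (hM : 1000 ≤ η / 2 * (1 / 6) ^ (3 * l) * M)
    (hl : 1 ≤ l) (hls : l ≤ s ^ 2) (c : Z3) :
    μ.real {V | ¬ RG δ E M s (cube c (s ^ 2)) V} ≤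
      (s : ℝ) ^ 6 * ((l : ℝ) ^ 3 * (1 / 2) ^ (l ^ 3 - 1)) := by
  classical
  have hprob := hμ.1
  set Q := cube c (s ^ 2) with hQ
  have hinc : ∀ V, ¬ RG δ E M s Q V → ∃ y ∈ Q, ∃ x ∈ cube (subc c (s ^ 2) l y) l,
      ∀ p ∈ (cube (subc c (s ^ 2) l y) l).erase x, V p = false := by
    intro V hV
    by_contra hcon
    push Not at hcon
    refine hV (rg_of_dense hB hη hη1 hηδ hE hM fun y hy x => ?_)
    have hyc := mem_subcube hl hls hy
    obtain ⟨x', hx', hxx⟩ : ∃ x' ∈ cube (subc c (s ^ 2) l y) l,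
        x ∈ cube (subc c (s ^ 2) l y) l → x' = x := by
      by_cases h : x ∈ cube (subc c (s ^ 2) l y) l
      · exact ⟨x, h, fun _ => rfl⟩
      · exact ⟨y, hyc, fun h' => absurd h' h⟩
    obtain ⟨p, hp, hVp⟩ := hcon y hy x' hx'
    obtain ⟨hpx, hpc⟩ := Finset.mem_erase.1 hp
    refine ⟨p, subcube_subset hls y hpc, fun h => hpx ?_, by simpa using hVp,
      dist_lt_of_mem_cube hyc hpc⟩
    rw [hxx (by rw [← h]; exact hpc), h]
  refine (prob_mono hμ hinc).trans ((prob_exists_le hμ Q (fun y V =>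
    ∃ x ∈ cube (subc c (s ^ 2) l y) l, ∀ p ∈ (cube (subc c (s ^ 2) l y) l).erase x, V p = false)
    (q := (l : ℝ) ^ 3 * (1 / 2) ^ (l ^ 3 - 1)) fun y hy => ?_).trans (le_of_eq ?_))
  · refine (prob_exists_le hμ (cube (subc c (s ^ 2) l y) l) (fun x V =>
      ∀ p ∈ (cube (subc c (s ^ 2) l y) l).erase x, V p = false)
      (q := (1 / 2) ^ (l ^ 3 - 1)) fun x hx => ?_).trans (le_of_eq ?_)
    · rw [prob_all_false hμ, Finset.card_erase_of_mem hx, card_cube]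
    · rw [card_cube, Nat.cast_pow]
  · rw [hQ, card_cube, ← pow_mul, Nat.cast_pow]

end Initial

set_option maxHeartbeats 800000 in
lemma exists_initial_scale {δ : ℝ} (hδ : 0 < δ) :
    ∃ (M lam : ℝ) (s₀ : ℕ), 0 < lam ∧ lam ≤ 1 ∧ M ^ (6 * (11200 + 62)) ≤ s₀ ∧
      ∀ E, 0 ≤ E → E ≤ lam → Big δ E M s₀ ∧
        ∀ μ : MeasureTheory.Measure Cfg, IsBernoulliProduct μ → ∀ c : Z3,
          μ.real {V | ¬ RG δ E M s₀ (cube c (s₀ ^ 2)) V} ≤ 1 / (s₀ : ℝ) ^ 360 := by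
  set η : ℝ := min 1 (δ / 10) with hη
  have hη0 : 0 < η := by positivity
  have hη1 : η ≤ 1 := min_le_left _ _
  have hηδ : 10 * η ≤ δ := by
    have : η ≤ δ / 10 := min_le_right _ _
    linarith
  obtain ⟨B, hB⟩ : ∃ B : ℕ, 10 ^ 6 + 13 + δ + 1 / δ + 2000 / η ≤ (2 : ℝ) ^ B :=
    (pow_unbounded_of_one_lt _ (by norm_num)).imp fun _ h => h.le
  have hδi : 0 < 1 / δ := by positivity
  have hηi : 0 < 2000 / η := by positivity
  obtain ⟨N, hN⟩ : ∃ N : ℕ, N = 70000 := ⟨_, rfl⟩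
  obtain ⟨K, hK⟩ : ∃ K : ℕ, K = N * 366 := ⟨_, rfl⟩
  set l : ℕ := B + 10 * K with hl
  have hl1 : 1 ≤ l := by omega
  set m : ℕ := 2 ^ B * 216 ^ l with hm
  have h216 : (1 : ℝ) ≤ 216 ^ l := one_le_pow₀ (by norm_num)
  have hmR : (m : ℝ) = 2 ^ B * 216 ^ l := by rw [hm]; push_cast; ring
  have h2m : (2 : ℝ) ^ B ≤ m := by
    rw [hmR]
    exact le_mul_of_one_le_right (by positivity) h216
  have hm6 : (10 : ℝ) ^ 6 ≤ m := by linarith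
  have hm0 : (0 : ℝ) < m := by linarith
  have hm1 : (1 : ℝ) ≤ m := by linarith
  have h6l : ((1 : ℝ) / 6) ^ (3 * l) * 216 ^ l = 1 := by
    rw [pow_mul, ← mul_pow]
    norm_num
  have h6l0 : (0 : ℝ) < (1 / 6) ^ (3 * l) := by positivity
  have h6l1 : ((1 : ℝ) / 6) ^ (3 * l) ≤ 1 := pow_le_one₀ (by norm_num) (by norm_num)
  have hlm : l ≤ m := by
    calc l ≤ 2 ^ l := Nat.lt_two_pow_self.le
      _ ≤ 216 ^ l := Nat.pow_le_pow_left (by norm_num) l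
      _ ≤ m := Nat.le_mul_of_pos_left _ (by positivity)
  have hm1' : 1 ≤ m := by exact_mod_cast hm1
  set s : ℕ := m ^ N with hs
  have hsR : (s : ℝ) = (m : ℝ) ^ N := by rw [hs]; push_cast; ring
  have hms : m ≤ s := Nat.le_self_pow (by omega) m
  have hs1 : 1 ≤ s := hm1'.trans hms
  have hs0 : (0 : ℝ) < s := by exact_mod_cast hs1
  refine ⟨m, η * (1 / 6) ^ (3 * l) / 8, s, by positivity, by nlinarith, ?_, fun E hE0 hE => ?_⟩
  · rw [hsR]
    exact pow_le_pow_right₀ hm1 (by omega)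
  have hBig : Big δ E m s := by
    refine ⟨hm6, hδ, by linarith, ?_, hE0, by nlinarith, ?_, ?_⟩
    · have : 1 / δ ≤ m := by linarith
      rw [div_le_iff₀ hδ] at this
      linarith
    · rw [hsR]
      exact pow_le_pow_right₀ hm1 (by omega)
    · rw [hsR, Real.log_pow, le_div_iff₀ (by positivity)]
      have hlog : Real.log m ≤ m := (Real.log_le_sub_one_of_pos hm0).trans (by linarith)
      have hNR : (N : ℝ) = 70000 := by exact_mod_cast hN
      have h1 : (m : ℝ) ^ 13 ≤ (m : ℝ) ^ N := pow_le_pow_right₀ hm1 (by omega)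
      refine le_trans ?_ h1
      rw [hNR]
      have h2 : (m : ℝ) ^ 13 = (m : ℝ) ^ 2 * m * (m : ℝ) ^ 10 := by ring
      rw [h2]
      refine mul_le_mul_of_nonneg_right ?_ (by positivity)
      have h3 : (10 : ℝ) ^ 12 ≤ (m : ℝ) ^ 2 := by nlinarith
      nlinarith
  refine ⟨hBig, fun μ hμ c => ?_⟩
  refine (prob_not_rg_initial (l := l) hμ hBig hη0 hη1 hηδ (by linarith) ?_ hl1
    ((hlm.trans hms).trans (Nat.le_self_pow (by norm_num) s)) c).trans ?_
  · rw [hmR]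
    have h1 : 2000 / η ≤ 2 ^ B := by linarith
    rw [div_le_iff₀ hη0] at h1
    calc (1000 : ℝ) ≤ η / 2 * 2 ^ B * 1 := by linarith
      _ = η / 2 * 2 ^ B * ((1 / 6) ^ (3 * l) * 216 ^ l) := by rw [h6l]
      _ = _ := by ring
  · have hm2 : m ≤ 2 ^ (B + 8 * l) := by
      have h : (2 : ℕ) ^ (B + 8 * l) = 2 ^ B * (2 ^ 8) ^ l := by rw [pow_add, pow_mul 2 8 l]
      rw [hm, h]
      exact Nat.mul_le_mul_left _ (Nat.pow_le_pow_left (by norm_num : 216 ≤ 2 ^ 8) l)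
    have hBl : B ≤ l := by omega
    have hexp : (B + 8 * l) * K + 3 * l + 1 ≤ l ^ 3 := by
      have h1 : (B + 8 * l) * K ≤ 9 * l * K := Nat.mul_le_mul_right _ (by omega)
      have h2 : 3 * l + 1 ≤ l * K := by nlinarith
      have h3 : 10 * K * l ≤ l * l := Nat.mul_le_mul_right _ (by omega)
      have h4 : l * l ≤ l ^ 3 := by
        rw [← sq]
        exact Nat.pow_le_pow_right hl1 (by norm_num)
      nlinarith
    have hmain : s ^ 366 * l ^ 3 * 2 ≤ 2 ^ (l ^ 3) := by
      calc s ^ 366 * l ^ 3 * 2 ≤ 2 ^ ((B + 8 * l) * K) * 2 ^ (3 * l) * 2 := by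
            refine Nat.mul_le_mul_right _ (Nat.mul_le_mul ?_ ?_)
            · rw [hs, ← pow_mul, ← hK, pow_mul]
              exact Nat.pow_le_pow_left hm2 K
            · rw [mul_comm 3 l, pow_mul]
              exact Nat.pow_le_pow_left Nat.lt_two_pow_self.le 3
        _ = 2 ^ ((B + 8 * l) * K + 3 * l + 1) := by rw [pow_succ, pow_add]
        _ ≤ 2 ^ (l ^ 3) := Nat.pow_le_pow_right (by norm_num) hexp
    have hmainR : (s : ℝ) ^ 366 * (l : ℝ) ^ 3 * 2 ≤ 2 ^ (l ^ 3) := by exact_mod_cast hmain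
    have hl3 : l ^ 3 = (l ^ 3 - 1) + 1 := by
      have : 1 ≤ l ^ 3 := Nat.one_le_pow _ _ hl1
      omega
    rw [le_div_iff₀ (by positivity), one_div_pow]
    have hpw : (2 : ℝ) ^ (l ^ 3) = 2 ^ (l ^ 3 - 1) * 2 := by
      rw [← pow_succ, ← hl3]
    rw [hpw] at hmainR
    have h2p : (0 : ℝ) < 2 ^ (l ^ 3 - 1) := by positivity
    have h5 : (s : ℝ) ^ 366 * (l : ℝ) ^ 3 ≤ 2 ^ (l ^ 3 - 1) :=
      le_of_mul_le_mul_right hmainR (by norm_num : (0 : ℝ) < 2)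
    calc _ = (s : ℝ) ^ 366 * (l : ℝ) ^ 3 * (1 / 2 ^ (l ^ 3 - 1)) := by
          have : (s : ℝ) ^ 366 = (s : ℝ) ^ 6 * (s : ℝ) ^ 360 := by rw [← pow_add]
          rw [this]
          ring
      _ ≤ 2 ^ (l ^ 3 - 1) * (1 / 2 ^ (l ^ 3 - 1)) :=
          mul_le_mul_of_nonneg_right h5 (by positivity)
      _ = 1 := by field_simp

section Energies

open Polynomial

variable {δ E M lam : ℝ} {s : ℕ} {V W : Cfg} {Q Q' : Finset Z3}

/-- The operator matrix with the energy as a polynomial variable. -/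
noncomputable def polyMat (δ : ℝ) (Q : Finset Z3) (V : Cfg) : Matrix Q Q ℝ[X] :=
  (X : ℝ[X]) • (-1 : Matrix Q Q ℝ).map C + (opMat δ 0 Q V).map C

lemma polyMat_eval (δ E : ℝ) (Q : Finset Z3) (V : Cfg) :
    (evalRingHom E).mapMatrix (polyMat δ Q V) = opMat δ E Q V := by
  ext x y
  simp only [polyMat, RingHom.mapMatrix_apply, Matrix.map_apply, Matrix.add_apply,
    Matrix.smul_apply, smul_eq_mul, coe_evalRingHom, eval_add, eval_mul, eval_X, eval_C,
    Matrix.neg_apply, Matrix.one_apply, opMat, T, Pi.single_apply]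
  by_cases h : x = y
  · simp [h]
    ring
  · have h' : (x : Z3) ≠ y := fun hc => h (Subtype.ext hc)
    simp [h, h']

lemma adjugate_polyMat_eval (δ E : ℝ) (Q : Finset Z3) (V : Cfg) (x y : Q) :
    eval E ((polyMat δ Q V).adjugate x y) = (opMat δ E Q V).adjugate x y := by
  have h := congrFun (congrFun (RingHom.map_adjugate (evalRingHom E) (polyMat δ Q V)) x) y
  rw [polyMat_eval] at h
  simpa using h

lemma det_polyMat_eval (δ E : ℝ) (Q : Finset Z3) (V : Cfg) :
    eval E (polyMat δ Q V).det = (opMat δ E Q V).det := by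
  rw [← polyMat_eval, ← RingHom.map_det, coe_evalRingHom]

lemma adjugate_polyMat_coeff (δ : ℝ) (Q : Finset Z3) (V : Cfg) (x y : Q) :
    ((polyMat δ Q V).adjugate x y).natDegree ≤ Fintype.card Q ∧
      ((polyMat δ Q V).adjugate x y).coeff (Fintype.card Q) = 0 := by
  have h : (polyMat δ Q V).updateRow y (Pi.single x 1) =
      (X : ℝ[X]) • ((-1 : Matrix Q Q ℝ).updateRow y 0).map C +
        ((opMat δ 0 Q V).updateRow y (Pi.single x 1)).map C := by
    ext i j : 2
    by_cases hi : i = y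
    · subst hi
      by_cases hj : j = x
      · subst hj
        simp
      · simp [hj]
    · simp [Matrix.updateRow_ne hi, polyMat]
  rw [Matrix.adjugate_apply, h]
  refine ⟨natDegree_det_X_add_C_le _ _, ?_⟩
  rw [coeff_det_X_add_C_card]
  exact Matrix.det_eq_zero_of_row_eq_zero y fun j => by simp

/-- The threshold for the Green function in the definition of a good cube. -/
noncomputable def thr (M : ℝ) (s : ℕ) (x y : Z3) : ℝ :=
  if (s : ℝ) ^ 2 / 8 ≤ dist x y then Real.exp (-(1 / M + 3 / s) * dist x y) else Real.exp s

lemma thr_pos (M : ℝ) (s : ℕ) (x y : Z3) : 0 < thr M s x y := by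
  unfold thr
  split_ifs <;> exact Real.exp_pos _

/-- The polynomial in the energy which detects a violated Green function bound. -/
noncomputable def critPoly (δ M : ℝ) (s : ℕ) (Q : Finset Z3) (V : Cfg) (x y : Q) : ℝ[X] :=
  (polyMat δ Q V).adjugate x y * (polyMat δ Q V).adjugate x y -
    C (thr M s x y ^ 2) * ((polyMat δ Q V).det * (polyMat δ Q V).det)

lemma critPoly_eval (δ E M : ℝ) (s : ℕ) (Q : Finset Z3) (V : Cfg) (x y : Q) :
    eval E (critPoly δ M s Q V x y) =
      (opMat δ E Q V).adjugate x y ^ 2 - thr M s x y ^ 2 * (opMat δ E Q V).det ^ 2 := by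
  simp only [critPoly, eval_sub, eval_mul, eval_C, adjugate_polyMat_eval, det_polyMat_eval]
  ring

lemma critPoly_ne_zero (δ M : ℝ) (s : ℕ) (Q : Finset Z3) (V : Cfg) (x y : Q) :
    critPoly δ M s Q V x y ≠ 0 ∧
      (critPoly δ M s Q V x y).natDegree ≤ Fintype.card Q + Fintype.card Q := by
  obtain ⟨h1, h2⟩ := adjugate_polyMat_coeff δ Q V x y
  have h3 : (polyMat δ Q V).det.natDegree ≤ Fintype.card Q := natDegree_det_X_add_C_le _ _
  have h4 : (polyMat δ Q V).det.coeff (Fintype.card Q) = (-1) ^ Fintype.card Q := by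
    rw [polyMat, coeff_det_X_add_C_card, Matrix.det_neg, Matrix.det_one, mul_one]
  refine ⟨fun h0 => ?_, ?_⟩
  · have h5 : (critPoly δ M s Q V x y).coeff (Fintype.card Q + Fintype.card Q) = 0 := by
      rw [h0, coeff_zero]
    rw [critPoly, coeff_sub, coeff_C_mul, coeff_mul_add_eq_of_natDegree_le h1 h1,
      coeff_mul_add_eq_of_natDegree_le h3 h3, h2, h4, ← mul_pow] at h5
    have := pow_pos (thr_pos M s x y) 2
    norm_num at h5
    exact this.ne' (by rw [h5]; norm_num)
  · refine (natDegree_sub_le _ _).trans (max_le ?_ ((natDegree_C_mul_le _ _).trans ?_))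
    · exact natDegree_mul_le.trans (add_le_add h1 h1)
    · exact natDegree_mul_le.trans (add_le_add h3 h3)

lemma not_good_iff (hQ : Q.Nonempty) :
    ¬ Good δ E M s Q V ↔ ∃ x y : Q, 0 ≤ eval E (critPoly δ M s Q V x y) := by
  have hG : (opMat δ E Q V).det ≠ 0 → ∀ x y : Q, Gf δ E Q V x y * (opMat δ E Q V).det =
      (opMat δ E Q V).adjugate x y := by
    intro hd x y
    have h : Gf δ E Q V x y = (opMat δ E Q V)⁻¹ x y := by simp [Gf]
    rw [h, Matrix.inv_def, Matrix.smul_apply, Ring.inverse_eq_inv', smul_eq_mul]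
    field_simp
  constructor
  · intro h
    by_cases hd : (opMat δ E Q V).det = 0
    · obtain ⟨x, hx⟩ := hQ
      refine ⟨⟨x, hx⟩, ⟨x, hx⟩, ?_⟩
      rw [critPoly_eval, hd]
      have := sq_nonneg ((opMat δ E Q V).adjugate ⟨x, hx⟩ ⟨x, hx⟩)
      simpa using this
    · by_contra hc
      push Not at hc
      refine h ⟨hd, fun x hx y hy => ?_⟩
      have h1 := hc ⟨x, hx⟩ ⟨y, hy⟩
      rw [critPoly_eval, ← hG hd, mul_pow, ← sub_mul] at h1
      have h2 : 0 < (opMat δ E Q V).det ^ 2 := by positivity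
      have h3 : Gf δ E Q V x y ^ 2 - thr M s x y ^ 2 < 0 := by
        by_contra h4
        exact absurd (mul_nonneg (not_lt.1 h4) h2.le) (not_le.2 h1)
      have h4 : |Gf δ E Q V x y| < thr M s x y :=
        abs_lt_of_sq_lt_sq (by linarith) (thr_pos M s x y).le
      exact h4
  · rintro ⟨x, y, h⟩ hgood
    obtain ⟨hd, hb⟩ := hgood
    rw [critPoly_eval, ← hG hd, mul_pow, ← sub_mul] at h
    have h1 : |Gf δ E Q V x y| < thr M s x y := hb x x.2 y y.2
    have h2 : 0 < (opMat δ E Q V).det ^ 2 := by positivity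
    have h3 : Gf δ E Q V x y ^ 2 < thr M s x y ^ 2 := by
      rw [← sq_abs]
      exact pow_lt_pow_left₀ h1 (abs_nonneg _) (by norm_num)
    nlinarith

/-- The energies at which a Green function bound changes its validity. -/
noncomputable def critEnergies (δ M : ℝ) (s : ℕ) (Q : Finset Z3) (V : Cfg) : Finset ℝ :=
  (Finset.univ : Finset (Q × Q)).biUnion fun z => (critPoly δ M s Q V z.1 z.2).roots.toFinset

lemma card_critEnergies_le (δ M : ℝ) (s : ℕ) (Q : Finset Z3) (V : Cfg) :
    (critEnergies δ M s Q V).card ≤ 2 * Q.card ^ 3 := by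
  refine Finset.card_biUnion_le.trans ?_
  calc _ ≤ ∑ _z : Q × Q, 2 * Q.card := by
        refine Finset.sum_le_sum fun z _ => (Multiset.toFinset_card_le _).trans
          ((card_roots' _).trans ((critPoly_ne_zero δ M s Q V z.1 z.2).2.trans (le_of_eq ?_)))
        rw [Fintype.card_coe, two_mul]
    _ = 2 * Q.card ^ 3 := by
        rw [Finset.sum_const, Finset.card_univ, Fintype.card_prod, Fintype.card_coe, smul_eq_mul]
        ring

lemma mem_critEnergies {x y : Q} (h : eval E (critPoly δ M s Q V x y) = 0) :
    E ∈ critEnergies δ M s Q V := by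
  refine Finset.mem_biUnion.2 ⟨(x, y), Finset.mem_univ _, ?_⟩
  rw [Multiset.mem_toFinset, mem_roots (critPoly_ne_zero δ M s Q V x y).1]
  exact h

lemma critEnergies_congr (h : ∀ x ∈ Q, V x = W x) :
    critEnergies δ M s Q V = critEnergies δ M s Q W := by
  unfold critEnergies critPoly polyMat
  rw [opMat_congr h]

lemma exists_least_energy {f g : ℝ → ℝ} (hf : Continuous f) (hg : Continuous g)
    (h : ∃ e, 0 ≤ e ∧ e ≤ lam ∧ 0 ≤ f e ∧ 0 ≤ g e) :
    ∃ e, 0 ≤ e ∧ e ≤ lam ∧ 0 ≤ f e ∧ 0 ≤ g e ∧ (e = 0 ∨ f e = 0 ∨ g e = 0) := by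
  set S : Set ℝ := Set.Icc 0 lam ∩ ({e | 0 ≤ f e} ∩ {e | 0 ≤ g e}) with hS
  have hne : S.Nonempty := h.imp fun e he => ⟨⟨he.1, he.2.1⟩, he.2.2.1, he.2.2.2⟩
  have hc : IsCompact S := isCompact_Icc.inter_right
    ((isClosed_le continuous_const hf).inter (isClosed_le continuous_const hg))
  obtain ⟨e, ⟨⟨he0, he1⟩, hfe, hge⟩, hmin⟩ := hc.exists_isLeast hne
  refine ⟨e, he0, he1, hfe, hge, ?_⟩
  by_contra hcon
  simp only [not_or] at hcon
  obtain ⟨h0, h1, h2⟩ := hcon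
  have he0' : 0 < e := lt_of_le_of_ne he0 (Ne.symm h0)
  have hfe' : 0 < f e := lt_of_le_of_ne hfe (Ne.symm h1)
  have hge' : 0 < g e := lt_of_le_of_ne hge (Ne.symm h2)
  have hev : ∀ᶠ x in nhds e, 0 < f x ∧ 0 < g x ∧ 0 < x :=
    (hf.continuousAt.eventually_const_lt hfe').and
      ((hg.continuousAt.eventually_const_lt hge').and (lt_mem_nhds he0'))
  obtain ⟨r, hr, hball⟩ := Metric.eventually_nhds_iff.1 hev
  have hd : dist (e - r / 2) e < r := by
    rw [Real.dist_eq]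
    have : e - r / 2 - e = -(r / 2) := by ring
    rw [this, abs_neg, abs_of_pos (by linarith)]
    linarith
  obtain ⟨a, b, c⟩ := hball hd
  have := hmin ⟨⟨c.le, by linarith⟩, a.le, b.le⟩
  linarith

/-- If two cubes are simultaneously bad at some energy, they are so at a critical energy. -/
lemma exists_critical_energy (hQ : Q.Nonempty) (hQ' : Q'.Nonempty)
    (h : ∃ e, 0 ≤ e ∧ e ≤ lam ∧ ¬ Good δ e M s Q V ∧ ¬ Good δ e M s Q' V) :
    ∃ e, 0 ≤ e ∧ e ≤ lam ∧ ¬ Good δ e M s Q V ∧ ¬ Good δ e M s Q' V ∧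
      (e = 0 ∨ e ∈ critEnergies δ M s Q V ∨ e ∈ critEnergies δ M s Q' V) := by
  obtain ⟨e, h0, h1, h2, h3⟩ := h
  obtain ⟨x, y, hxy⟩ := (not_good_iff hQ).1 h2
  obtain ⟨x', y', hxy'⟩ := (not_good_iff hQ').1 h3
  obtain ⟨e', k0, k1, k2, k3, k4⟩ := exists_least_energy (lam := lam)
    (critPoly δ M s Q V x y).continuous (critPoly δ M s Q' V x' y').continuous
    ⟨e, h0, h1, hxy, hxy'⟩
  exact ⟨e', k0, k1, (not_good_iff hQ).2 ⟨x, y, k2⟩, (not_good_iff hQ').2 ⟨x', y', k3⟩,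
    k4.imp id (Or.imp mem_critEnergies mem_critEnergies)⟩

variable {μ : MeasureTheory.Measure Cfg}

/-- Union bound over random energies which are independent of the event. -/
lemma prob_random_energy (hμ : IsBernoulliProduct μ) {S S' : Finset Z3} (hS : Disjoint S S')
    {R : Cfg → Finset ℝ} (hR : ∀ V W, (∀ x ∈ S, V x = W x) → R V = R W) {K : ℕ}
    (hK : ∀ V, (R V).card ≤ K) {A : ℝ → Cfg → Prop} (hA : ∀ e, DepOn S' (A e)) {q : ℝ}
    (hq : ∀ V, ∀ e ∈ R V, μ.real {W | A e W} ≤ q) (hq0 : 0 ≤ q) :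
    μ.real {V | ∃ e ∈ R V, A e V} ≤ K * q := by
  classical
  have hprob := hμ.1
  have h1 : ∀ V, (∃ e ∈ R V, A e V) →
      ∃ W ∈ cfgs S, (∀ x ∈ S, V x = W x) ∧ ∃ e ∈ R W, A e V := by
    rintro V ⟨e, he, hAe⟩
    refine ⟨restr S V, restr_mem S V, fun x hx => (restr_apply hx V).symm, e, ?_, hAe⟩
    rwa [hR (restr S V) V fun x hx => restr_apply hx V]
  refine (prob_mono hμ h1).trans ((prob_exists_le hμ (cfgs S)
    (fun W V => (∀ x ∈ S, V x = W x) ∧ ∃ e ∈ R W, A e V)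
    (q := (1 / 2) ^ S.card * (K * q)) fun W _ => ?_).trans (le_of_eq ?_))
  · have hdep : DepOn S (fun V => ∀ x ∈ S, V x = W x) := fun V V' h hV x hx =>
      (h x hx).symm.trans (hV x hx)
    have hdep' : DepOn S' (fun V => ∃ e ∈ R W, A e V) := fun V V' h hV =>
      hV.imp fun e he => ⟨he.1, hA e V V' h he.2⟩
    rw [prob_inter hμ hS hdep hdep']
    have h2 : μ.real {V | ∀ x ∈ S, V x = W x} = (1 / 2) ^ S.card := by
      rw [MeasureTheory.measureReal_def, hμ.2 S W, ENNReal.toReal_pow]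
      simp
    rw [h2]
    refine mul_le_mul_of_nonneg_left ?_ (by positivity)
    refine (prob_exists_le hμ (R W) A (hq W)).trans (mul_le_mul_of_nonneg_right ?_ hq0)
    exact_mod_cast hK W
  · rw [card_cfgs]
    push_cast
    rw [← mul_assoc, ← mul_pow]
    norm_num

/-- Two disjoint cubes are rarely simultaneously bad at some common energy. -/
lemma prob_common_bad (hμ : IsBernoulliProduct μ) (hlam : 0 ≤ lam) (hdis : Disjoint Q Q')
    (hne : Q.Nonempty) (hne' : Q'.Nonempty) {K : ℕ} (hK : 2 * Q.card ^ 3 ≤ K)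
    (hK' : 2 * Q'.card ^ 3 ≤ K) {q : ℝ} (hq0 : 0 ≤ q)
    (hq : ∀ e, 0 ≤ e → e ≤ lam → μ.real {V | ¬ Good δ e M s Q V} ≤ q)
    (hq' : ∀ e, 0 ≤ e → e ≤ lam → μ.real {V | ¬ Good δ e M s Q' V} ≤ q) :
    μ.real {V | ∃ e, 0 ≤ e ∧ e ≤ lam ∧ ¬ Good δ e M s Q V ∧ ¬ Good δ e M s Q' V} ≤
      q + (K * q + K * q) := by
  classical
  have hprob := hμ.1
  obtain ⟨R, hR⟩ : ∃ R : Finset Z3 → Cfg → Finset ℝ, ∀ S V,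
      R S V = (critEnergies δ M s S V).filter fun e => 0 ≤ e ∧ e ≤ lam := ⟨_, fun _ _ => rfl⟩
  have hRm : ∀ S V, ∀ e ∈ R S V, 0 ≤ e ∧ e ≤ lam := by
    intro S V e he
    rw [hR] at he
    exact (Finset.mem_filter.1 he).2
  have hRc : ∀ S V W, (∀ x ∈ S, V x = W x) → R S V = R S W := by
    intro S V W h
    rw [hR, hR, critEnergies_congr h]
  have hRk : ∀ S V, 2 * S.card ^ 3 ≤ K → (R S V).card ≤ K := by
    intro S V h
    rw [hR]
    exact (Finset.card_filter_le _ _).trans ((card_critEnergies_le δ M s S V).trans h)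
  have hinc : ∀ V, (∃ e, 0 ≤ e ∧ e ≤ lam ∧ ¬ Good δ e M s Q V ∧ ¬ Good δ e M s Q' V) →
      (¬ Good δ 0 M s Q V) ∨ ((∃ e ∈ R Q V, ¬ Good δ e M s Q' V) ∨
        ∃ e ∈ R Q' V, ¬ Good δ e M s Q V) := by
    intro V h
    obtain ⟨e, h0, h1, h2, h3, h4⟩ := exists_critical_energy hne hne' h
    rw [hR, hR]
    rcases h4 with h4 | h4 | h4
    · left
      rwa [h4] at h2
    · exact Or.inr (Or.inl ⟨e, Finset.mem_filter.2 ⟨h4, h0, h1⟩, h3⟩)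
    · exact Or.inr (Or.inr ⟨e, Finset.mem_filter.2 ⟨h4, h0, h1⟩, h2⟩)
  have hb1 : μ.real {V | ∃ e ∈ R Q V, ¬ Good δ e M s Q' V} ≤ K * q :=
    prob_random_energy hμ hdis (hRc Q) (fun V => hRk Q V hK)
      (A := fun e V => ¬ Good δ e M s Q' V) (fun e => (depOn_good Q').not)
      (fun V e he => hq' e (hRm Q V e he).1 (hRm Q V e he).2) hq0
  have hb2 : μ.real {V | ∃ e ∈ R Q' V, ¬ Good δ e M s Q V} ≤ K * q :=
    prob_random_energy hμ hdis.symm (hRc Q') (fun V => hRk Q' V hK')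
      (A := fun e V => ¬ Good δ e M s Q V) (fun e => (depOn_good Q).not)
      (fun V e he => hq e (hRm Q' V e he).1 (hRm Q' V e he).2) hq0
  have hb0 := hq 0 le_rfl hlam
  have h1 := prob_mono hμ hinc
  have h2 := prob_or_le μ (fun V => ¬ Good δ 0 M s Q V) (fun V =>
    (∃ e ∈ R Q V, ¬ Good δ e M s Q' V) ∨ ∃ e ∈ R Q' V, ¬ Good δ e M s Q V)
  have h3 := prob_or_le μ (fun V => ∃ e ∈ R Q V, ¬ Good δ e M s Q' V)
    (fun V => ∃ e ∈ R Q' V, ¬ Good δ e M s Q V)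
  linarith

lemma prob_pair_bad (hμ : IsBernoulliProduct μ) (hs : 1 ≤ s) (hlam : 0 ≤ lam)
    (hq : ∀ e, 0 ≤ e → e ≤ lam → ∀ c, μ.real {V | ¬ Good δ e M s (cube c (s ^ 2)) V} ≤
      1 / (s : ℝ) ^ 360) {c d : Z3} (hcd : (s : ℝ) ^ 2 ≤ dist c d) :
    μ.real {V | ∃ e, 0 ≤ e ∧ e ≤ lam ∧ ¬ Good δ e M s (cube c (s ^ 2)) V ∧
      ¬ Good δ e M s (cube d (s ^ 2)) V} ≤ 5 * (1 / (s : ℝ) ^ 342) := by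
  have hs1 : (1 : ℝ) ≤ s := by exact_mod_cast hs
  have hs0 : (0 : ℝ) < s := by linarith
  have hcard : ∀ c : Z3, (cube c (s ^ 2)).card = s ^ 6 := fun c => by rw [card_cube, ← pow_mul]
  have hne : ∀ c : Z3, (cube c (s ^ 2)).Nonempty := fun c => by
    rw [← Finset.card_pos, hcard]
    exact Nat.pow_pos hs
  have hK : ∀ c : Z3, 2 * (cube c (s ^ 2)).card ^ 3 ≤ 2 * s ^ 18 := fun c => by
    rw [hcard, ← pow_mul]
  have hdis : Disjoint (cube c (s ^ 2)) (cube d (s ^ 2)) :=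
    cube_disjoint_of_dist (by push_cast; exact hcd)
  have htot := prob_common_bad hμ hlam hdis (hne c) (hne d) (hK c) (hK d) (by positivity)
    (fun e h0 h1 => hq e h0 h1 c) (fun e h0 h1 => hq e h0 h1 d)
  have h18 : (s : ℝ) ^ 18 * (1 / (s : ℝ) ^ 360) = 1 / (s : ℝ) ^ 342 :=
    pow_mul_one_div hs0 (by norm_num)
  have h1 : 1 / (s : ℝ) ^ 360 ≤ 1 / (s : ℝ) ^ 342 :=
    one_div_le_one_div_of_le (pow_pos hs0 _) (pow_le_pow_right₀ hs1 (by norm_num))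
  refine htot.trans ?_
  push_cast
  rw [mul_assoc, h18]
  linarith

end Energies

section BorelCantelli

variable {δ M lam : ℝ} {s₀ : ℕ} {μ : MeasureTheory.Measure Cfg}

/-- A large box of corners around the origin. -/
noncomputable def cornerBox (s : ℕ) : Finset Z3 := cube (fun _ => -((s ^ 42 : ℕ) : ℤ)) (3 * s ^ 42)

/-- Two distant cubes at scale `s` with corners in the large box are never both bad. -/
def NoPair (δ M lam : ℝ) (s : ℕ) (V : Cfg) : Prop :=
  ∀ c ∈ cornerBox s, ∀ d ∈ cornerBox s, (s : ℝ) ^ 2 ≤ dist c d → ∀ e, 0 ≤ e → e ≤ lam →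
    ¬ Good δ e M s (cube c (s ^ 2)) V → Good δ e M s (cube d (s ^ 2)) V

lemma prob_not_noPair_le (hμ : IsBernoulliProduct μ) {s : ℕ} (hs : 10 ^ 6 ≤ s) (hlam : 0 ≤ lam)
    (hq : ∀ e, 0 ≤ e → e ≤ lam → ∀ c, μ.real {V | ¬ Good δ e M s (cube c (s ^ 2)) V} ≤
      1 / (s : ℝ) ^ 360) :
    μ.real {V | ¬ NoPair δ M lam s V} ≤ 1 / s := by
  have hs1 : 1 ≤ s := le_trans (by norm_num) hs
  have hsr : (10 : ℝ) ^ 6 ≤ s := by exact_mod_cast hs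
  have hs0 : (0 : ℝ) < s := lt_of_lt_of_le (by norm_num) hsr
  have h := prob_exists_le hμ (cornerBox s ×ˢ cornerBox s)
    (fun z V => (s : ℝ) ^ 2 ≤ dist z.1 z.2 ∧ ∃ e, 0 ≤ e ∧ e ≤ lam ∧
      ¬ Good δ e M s (cube z.1 (s ^ 2)) V ∧ ¬ Good δ e M s (cube z.2 (s ^ 2)) V)
    (q := 5 * (1 / (s : ℝ) ^ 342)) (fun z _ => by
      by_cases hz : (s : ℝ) ^ 2 ≤ dist z.1 z.2
      · exact (prob_mono hμ fun V hV => hV.2).trans (prob_pair_bad hμ hs1 hlam hq hz)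
      · have : {V : Cfg | (s : ℝ) ^ 2 ≤ dist z.1 z.2 ∧ ∃ e, 0 ≤ e ∧ e ≤ lam ∧
            ¬ Good δ e M s (cube z.1 (s ^ 2)) V ∧ ¬ Good δ e M s (cube z.2 (s ^ 2)) V} = ∅ := by
          ext V
          simp [hz]
        rw [this, MeasureTheory.measureReal_empty]
        positivity)
  have hcard : ((cornerBox s ×ˢ cornerBox s).card : ℝ) = 729 * (s : ℝ) ^ 252 := by
    rw [Finset.card_product, cornerBox, card_cube]
    push_cast
    ring
  rw [hcard] at h
  have h1 : (s : ℝ) ^ 252 * (1 / (s : ℝ) ^ 342) = 1 / (s : ℝ) ^ 90 :=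
    pow_mul_one_div hs0 (by norm_num)
  have h2 : (s : ℝ) ^ 1 * (1 / (s : ℝ) ^ 90) = 1 / (s : ℝ) ^ 89 :=
    pow_mul_one_div hs0 (by norm_num)
  have h3 : 1 / (s : ℝ) ^ 89 ≤ 1 / (s : ℝ) :=
    one_div_le_one_div_of_le hs0 (le_self_pow₀ (by linarith) (by norm_num))
  have h4 : 0 ≤ 1 / (s : ℝ) ^ 90 := by positivity
  refine (prob_mono hμ fun V hV => ?_).trans (h.trans ?_)
  · unfold NoPair at hV
    push Not at hV
    obtain ⟨c, hc, d, hd, hcd, e, h0, h1, h2, h3⟩ := hV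
    exact ⟨(c, d), Finset.mem_product.2 ⟨hc, hd⟩, hcd, e, h0, h1, h2, h3⟩
  · calc 729 * (s : ℝ) ^ 252 * (5 * (1 / (s : ℝ) ^ 342)) =
          3645 * ((s : ℝ) ^ 252 * (1 / (s : ℝ) ^ 342)) := by
            generalize (s : ℝ) ^ 252 = P
            generalize 1 / (s : ℝ) ^ 342 = P'
            ring
      _ ≤ (s : ℝ) ^ 1 * (1 / (s : ℝ) ^ 90) := by
            rw [h1]
            refine mul_le_mul_of_nonneg_right ?_ h4
            rw [pow_one]
            linarith
      _ ≤ 1 / s := by rw [h2]; exact h3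

lemma two_pow_le_scale (hs : 2 ≤ s₀) (k : ℕ) : 2 ^ k ≤ scale s₀ k :=
  (Nat.pow_le_pow_right (by norm_num) (Nat.lt_pow_self (by norm_num)).le).trans
    (Nat.pow_le_pow_left hs (20 ^ k))

lemma ae_eventually_noPair (hμ : IsBernoulliProduct μ) (hs : 10 ^ 6 ≤ s₀) (hlam : 0 ≤ lam)
    (hq : ∀ k, ∀ e, 0 ≤ e → e ≤ lam → ∀ c,
      μ.real {V | ¬ Good δ e M (scale s₀ k) (cube c (scale s₀ k ^ 2)) V} ≤
        1 / (scale s₀ k : ℝ) ^ 360) :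
    ∀ᵐ V ∂μ, ∀ᶠ k in Filter.atTop, NoPair δ M lam (scale s₀ k) V := by
  have hprob := hμ.1
  have hle : ∀ k, μ.real {V | ¬ NoPair δ M lam (scale s₀ k) V} ≤ (1 / 2 : ℝ) ^ k := by
    intro k
    refine (prob_not_noPair_le hμ (hs.trans (le_scale (le_trans (by norm_num) hs) k)) hlam
      (hq k)).trans ?_
    rw [one_div_pow]
    refine one_div_le_one_div_of_le (by positivity) ?_
    exact_mod_cast two_pow_le_scale (le_trans (by norm_num) hs) k
  have hsum : ∑' k, μ {V | ¬ NoPair δ M lam (scale s₀ k) V} ≠ ⊤ := by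
    have h1 : ∑' k, ENNReal.ofReal ((1 / 2 : ℝ) ^ k) ≠ ⊤ :=
      (summable_geometric_of_lt_one (by norm_num) (by norm_num)).tsum_ofReal_ne_top
    refine ne_top_of_le_ne_top h1 (ENNReal.tsum_le_tsum fun k => ?_)
    rw [← MeasureTheory.ofReal_measureReal (MeasureTheory.measure_ne_top _ _)]
    exact ENNReal.ofReal_le_ofReal (hle k)
  filter_upwards [MeasureTheory.ae_eventually_notMem hsum] with V hV
  filter_upwards [hV] with k hk
  by_contra h
  exact hk h

end BorelCantelli

section Decay

variable {δ E M lam : ℝ} {s : ℕ} {V : Cfg}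

lemma corner_mem_cube {c : Z3} {n : ℕ} (hn : 0 < n) : c ∈ cube c n := by
  rw [mem_cube]
  intro i
  omega

lemma Big.pow_le_exp (h : Big δ E M s) {k : ℕ} (hk : k ≤ 20000) : (s : ℝ) ^ k ≤ Real.exp s := by
  rw [h.pow_eq, Real.exp_le_exp]
  refine (mul_le_mul_of_nonneg_right ?_ h.log_nonneg).trans h.log_le
  exact_mod_cast hk

lemma Big.mul_le_sq (h : Big δ E M s) : 5000 * (s : ℝ) ≤ (s : ℝ) ^ 2 / (4 * M) := by
  have h1 : M ^ 2 ≤ s := h.pow_le (by norm_num)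
  have h2 := h.hM
  have h3 := h.s_pos
  rw [le_div_iff₀ (by linarith)]
  have h4 : 20000 * M ≤ s := by nlinarith
  nlinarith

/-- The corner of the cube of side `n` centred at `x`. -/
def ctr (x : Z3) (n : ℕ) : Z3 := fun i => x i - (n / 2 : ℕ)

lemma mem_ctr {x : Z3} {n : ℕ} (hn : 0 < n) : x ∈ cube (ctr x n) n := by
  rw [mem_cube]
  intro i
  simp only [ctr]
  omega

lemma le_dist_of_notMem_ctr {x b : Z3} {n : ℕ} (hb : b ∉ cube (ctr x n) n) :
    ((n : ℝ) - 1) / 2 ≤ dist b x := by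
  rw [mem_cube] at hb
  push Not at hb
  obtain ⟨i, hi⟩ := hb
  simp only [ctr] at hi
  apply le_dist_of_coord i
  have h1 : (n : ℤ) - 1 ≤ 2 * |b i - x i| := by
    rcases abs_cases (b i - x i) with h | h <;> omega
  have h2 : ((n : ℤ) : ℝ) - 1 ≤ 2 * |(b i : ℝ) - x i| := by exact_mod_cast h1
  push_cast at h2
  linarith

lemma dist_le_of_mem_ctr {x b : Z3} {n : ℕ} (hn : 0 < n) (hb : b ∈ cube (ctr x n) n) :
    dist b x ≤ n / 2 := by
  rw [dist_le_iff (by positivity)]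
  intro i
  have h := mem_cube.1 hb i
  simp only [ctr] at h
  have h1 : 2 * |b i - x i| ≤ n := by
    rcases abs_cases (b i - x i) with h | h <;> omega
  have h2 : 2 * |(b i : ℝ) - x i| ≤ ((n : ℤ) : ℝ) := by exact_mod_cast h1
  push_cast at h2
  linarith

/-- A cube centred at a point where a tame solution is not too small must be bad. -/
lemma not_good_of_solution (h : Big δ E M s) {u : Z3 → ℝ} (hT : ∀ a, T δ E V u a = 0) {x : Z3}
    (hu : ∀ a, dist a x ≤ (s : ℝ) ^ 2 → |u a| ≤ Real.exp s) (hx : Real.exp (-s) ≤ |u x|) :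
    ¬ Good δ E M s (cube (ctr x (s ^ 2)) (s ^ 2)) V := by
  intro hgood
  have hs := h.le_s
  have hs0 := h.s_pos
  have hM := h.M_pos
  set Q := cube (ctr x (s ^ 2)) (s ^ 2) with hQ
  have hn : 0 < s ^ 2 := pow_pos h.s_pos' 2
  have hxQ : x ∈ Q := mem_ctr hn
  have hrep := Gf_repr_boundary hgood.1 u hxQ
  have hterm : ∀ y ∈ Q, |Gf δ E Q V x y *
      (T δ E V u y + nbs (fun w => if w ∈ Q then 0 else u w) y)| ≤ Real.exp (-4998 * s) := by
    intro y hy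
    rw [hT, zero_add, abs_mul]
    have hyx := dist_le_of_mem_ctr hn hy
    push_cast at hyx
    by_cases hb : ∃ b, b ∉ Q ∧ dist b y ≤ 1
    · obtain ⟨b, hbQ, hby⟩ := hb
      have h1 := le_dist_of_notMem_ctr hbQ
      push_cast at h1
      have h2 : dist b x ≤ dist b y + dist y x := dist_triangle _ _ _
      have h3 : (s : ℝ) ^ 2 / 4 ≤ dist x y := by
        rw [dist_comm]
        nlinarith
      have h4 := hgood.2 x hxQ y hy
      rw [if_pos (by nlinarith)] at h4
      have h5 : |Gf δ E Q V x y| ≤ Real.exp (-5000 * s) := by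
        refine h4.le.trans (Real.exp_le_exp.2 ?_)
        have h6 : 1 / M * ((s : ℝ) ^ 2 / 4) ≤ (1 / M + 3 / s) * dist x y :=
          mul_le_mul (le_add_of_nonneg_right (by positivity)) h3 (by positivity) (by positivity)
        have h7 : 1 / M * ((s : ℝ) ^ 2 / 4) = (s : ℝ) ^ 2 / (4 * M) := by
          field_simp
        linarith [h.mul_le_sq]
      have h8 : |nbs (fun w => if w ∈ Q then 0 else u w) y| ≤ 6 * Real.exp s := by
        refine nbs_abs_le fun w hw => ?_
        split_ifs
        · simpa using (Real.exp_pos _).le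
        · refine hu w ?_
          have : dist w x ≤ dist w y + dist y x := dist_triangle _ _ _
          nlinarith
      have h9 : (6 : ℝ) ≤ Real.exp s := by linarith [Real.add_one_le_exp (s : ℝ)]
      calc _ ≤ Real.exp (-5000 * s) * (Real.exp s * Real.exp s) :=
            mul_le_mul h5 (h8.trans (mul_le_mul_of_nonneg_right h9 (Real.exp_pos _).le))
              (abs_nonneg _) (Real.exp_pos _).le
        _ = Real.exp (-4998 * s) := by
            rw [← Real.exp_add, ← Real.exp_add]
            congr 1
            ring
    · push Not at hb
      have : nbs (fun w => if w ∈ Q then 0 else u w) y = nbs (fun _ => 0) y := by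
        refine nbs_congr fun b hby => ?_
        have : b ∈ Q := by
          by_contra hbQ
          linarith [hb b hbQ]
        simp [this]
      rw [this]
      simp only [nbs, add_zero, Finset.sum_const_zero, abs_zero, mul_zero]
      exact (Real.exp_pos _).le
  have hcard : (Q.card : ℝ) = (s : ℝ) ^ 6 := by
    rw [hQ, card_cube]
    push_cast
    ring
  have hsum : |u x| ≤ (s : ℝ) ^ 6 * Real.exp (-4998 * s) := by
    rw [hrep, ← hcard, ← nsmul_eq_mul]
    exact (Finset.abs_sum_le_sum_abs _ _).trans (Finset.sum_le_card_nsmul _ _ _ hterm)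
  have h6 : (s : ℝ) ^ 6 * Real.exp (-4998 * s) ≤ Real.exp (-4997 * s) := by
    refine (mul_le_mul_of_nonneg_right (h.pow_le_exp (k := 6) (by norm_num))
      (Real.exp_pos _).le).trans (le_of_eq ?_)
    rw [← Real.exp_add]
    congr 1
    ring
  have h7 := Real.exp_le_exp.1 (hx.trans (hsum.trans h6))
  linarith

lemma mem_cornerBox (h : Big δ E M s) {x b : Z3} (hx : dist x 0 ≤ s)
    (hb : dist b x ≤ (s : ℝ) ^ 41) : b ∈ cornerBox s := by
  rw [cornerBox, mem_cube]
  intro i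
  have hs := h.le_s
  have h1 := (abs_coord_le_dist b x i).trans hb
  have h2 := (abs_coord_le_dist x 0 i).trans hx
  simp only [Pi.zero_apply, Int.cast_zero, sub_zero] at h2
  have hp : (s : ℝ) ^ 42 = (s : ℝ) ^ 41 * s := pow_succ _ _
  have hp1 : (s : ℝ) ≤ (s : ℝ) ^ 41 := le_self_pow₀ (by linarith) (by norm_num)
  rw [abs_le] at h1 h2
  have h3 : -(s : ℝ) ^ 42 ≤ b i := by
    rw [hp]
    generalize (s : ℝ) ^ 41 = P at *
    nlinarith
  have h4 : (b i : ℝ) < -(s : ℝ) ^ 42 + 3 * (s : ℝ) ^ 42 := by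
    rw [hp]
    generalize (s : ℝ) ^ 41 = P at *
    nlinarith
  constructor
  · have : ((-((s ^ 42 : ℕ) : ℤ) : ℤ) : ℝ) ≤ b i := by push_cast; exact h3
    exact_mod_cast this
  · have : (b i : ℝ) < ((-((s ^ 42 : ℕ) : ℤ) + ((3 * s ^ 42 : ℕ) : ℤ) : ℤ) : ℝ) := by
      push_cast
      exact h4
    exact_mod_cast this

end Decay

section LocalDecay

variable {δ E M lam : ℝ} {s : ℕ} {V : Cfg}

lemma abs_T_le (h : Big δ E M s) {u : Z3 → ℝ} {a : Z3} {C : ℝ}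
    (hu : ∀ b, dist b a ≤ 1 → |u b| ≤ C) : |T δ E V u a| ≤ 2 * s * C := by
  have hC : 0 ≤ C := (abs_nonneg _).trans (hu a (by simp))
  have h1 : |6 + δ * (if V a then 1 else 0) - E| ≤ M := by
    have h0 := h.hE0
    have h1 := h.hE1
    have h2 := h.hδM
    have h3 := h.hδ
    rw [abs_le]
    split_ifs <;> constructor <;> linarith
  have h2 : |T δ E V u a| ≤ M * C + 6 * C := by
    unfold T
    refine (abs_sub _ _).trans (add_le_add ?_ (nbs_abs_le hu))
    rw [abs_mul]
    exact mul_le_mul h1 (hu a (by simp)) (abs_nonneg _) h.M_pos.le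
  have h3 := h.M_le
  have h4 := h.le_s
  nlinarith

lemma abs_min_sub_min_le (m a a' b b' d : ℝ) (hm : 0 ≤ m) (h : |a - a'| ≤ d) (h' : |b - b'| ≤ d) :
    |m * min a b - m * min a' b'| ≤ m * d := by
  rw [← mul_sub, abs_mul, abs_of_nonneg hm]
  exact mul_le_mul_of_nonneg_left ((abs_min_sub_min_le_max _ _ _ _).trans (max_le h h')) hm

set_option maxRecDepth 4000 in
/-- A tame solution decays exponentially in an annulus at each scale without bad pairs. -/
lemma local_decay (h : Big δ E M s) (hE : E ≤ lam) {u : Z3 → ℝ} (hT : ∀ a, T δ E V u a = 0)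
    {o : Z3} (ho : dist o 0 ≤ s) (hu : ∀ a, dist a o ≤ (s : ℝ) ^ 41 → |u a| ≤ Real.exp s)
    (hx : Real.exp (-s) ≤ |u o|) (hV : NoPair δ M lam s V) {x : Z3}
    (h1x : 1000 * M * (s : ℝ) ^ 2 ≤ dist x o) (h2x : dist x o ≤ (s : ℝ) ^ 41 / 4) :
    |u x| ≤ Real.exp (-(1 / (2 * M)) * dist x o) := by
  have hs := h.le_s
  have hs0 := h.s_pos
  have hM := h.M_pos
  have hM1 := h.one_le_M
  have hL41 : (s : ℝ) ^ 41 = (s : ℝ) ^ 2 * (s : ℝ) ^ 39 := by rw [← pow_add]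
  have hs39 : (s : ℝ) ≤ (s : ℝ) ^ 39 := le_self_pow₀ (by linarith) (by norm_num)
  have hs2 : (s : ℝ) * s = (s : ℝ) ^ 2 := (sq _).symm
  have hbigL : 1000 * (s : ℝ) ^ 2 ≤ (s : ℝ) ^ 41 := by
    rw [hL41, mul_comm]
    exact mul_le_mul_of_nonneg_left (by linarith) (by positivity)
  obtain ⟨L, hL⟩ : ∃ L : ℕ, L = s ^ 41 := ⟨_, rfl⟩
  have hLr : (L : ℝ) = (s : ℝ) ^ 41 := by rw [hL]; push_cast; rfl
  rw [← hLr] at hbigL hu h2x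
  have hLs : s ^ 2 ≤ L := by rw [hL]; exact Nat.pow_le_pow_right h.s_pos' (by norm_num)
  have hn : 0 < s ^ 2 := pow_pos h.s_pos' 2
  have hLpos : 0 < L := lt_of_lt_of_le hn hLs
  have hbad := not_good_of_solution h hT (x := o) (fun a ha => hu a (by nlinarith)) hx
  obtain ⟨Λ, hΛ⟩ : ∃ Λ, Λ = cube (ctr o L) L := ⟨_, rfl⟩
  obtain ⟨v, hv⟩ : ∃ v : Z3 → ℝ, ∀ w, v w = if w ∈ Λ then u w else 0 := ⟨_, fun _ => rfl⟩
  have hΛd : ∀ y ∈ Λ, dist y o ≤ L / 2 := fun y hy => dist_le_of_mem_ctr hLpos (by rw [← hΛ]; exact hy)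
  have hΛd' : ∀ y ∉ Λ, ((L : ℝ) - 1) / 2 ≤ dist y o :=
    fun y hy => le_dist_of_notMem_ctr (by rw [← hΛ]; exact hy)
  have hvb : ∀ w, |v w| ≤ Real.exp s := by
    intro w
    rw [hv]
    split_ifs with hw
    · exact hu w ((hΛd w hw).trans (by linarith))
    · simpa using (Real.exp_pos _).le
  obtain ⟨m, hm⟩ : ∃ m, m = 1 / M + 2 / (s : ℝ) := ⟨_, rfl⟩
  have hm0 : 1 / M ≤ m := by
    rw [hm]
    exact le_add_of_nonneg_right (by positivity)
  have hmpos : 0 ≤ m := le_trans (by positivity) hm0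
  have hm1 : m ≤ 1 := by
    have h1 : 1 / M ≤ 1 / 4 := one_div_le_one_div_of_le (by norm_num) (by linarith [h.hM])
    have h2 : 2 / (s : ℝ) ≤ 1 / 4 := by
      rw [div_le_iff₀ hs0]
      linarith
    linarith
  obtain ⟨Φ, hΦ⟩ : ∃ Φ : Z3 → ℝ, ∀ y, Φ y = m * min (dist y o) ((L : ℝ) / 2 - dist y o) :=
    ⟨_, fun _ => rfl⟩
  have hΦL : ∀ x y, |Φ x - Φ y| ≤ (1 / M + 2 / (s : ℝ)) * dist x y := by
    intro x y
    rw [hΦ, hΦ, ← hm]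
    have h1 : |dist x o - dist y o| ≤ dist x y := abs_dist_sub_le x y o
    refine abs_min_sub_min_le _ _ _ _ _ _ hmpos h1 ?_
    rw [show (L : ℝ) / 2 - dist x o - (L / 2 - dist y o) = -(dist x o - dist y o) by ring, abs_neg]
    exact h1
  have hG : ∀ y ∈ cube (ctr o L) L, 3 * (s : ℝ) ^ 2 ≤ dist y o →
      Good δ E M s (sub (ctr o L) L s y) V := by
    intro y hy hyd
    have hys : y ∈ sub (ctr o L) L s y := mem_sub h hLs hy
    have hcs : subc (ctr o L) L (s ^ 2) y ∈ sub (ctr o L) L s y := corner_mem_cube hn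
    have hcΛ := sub_subset hLs y hcs
    have d1 := dist_lt_of_mem_sub hys hcs
    have hoq : o ∈ cube (ctr o (s ^ 2)) (s ^ 2) := mem_ctr hn
    have d2 := dist_lt_of_mem_cube hoq (corner_mem_cube hn)
    push_cast at d2
    have d3 := dist_le_of_mem_ctr hLpos hcΛ
    have t1 : dist y o ≤ dist y (subc (ctr o L) L (s ^ 2) y) +
        dist (subc (ctr o L) L (s ^ 2) y) o := dist_triangle _ _ _
    have t2 : dist (subc (ctr o L) L (s ^ 2) y) o ≤ dist (subc (ctr o L) L (s ^ 2) y)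
        (ctr o (s ^ 2)) + dist (ctr o (s ^ 2)) o := dist_triangle _ _ _
    have hco : dist (ctr o (s ^ 2)) o ≤ (s : ℝ) ^ 2 := by rw [dist_comm]; exact d2.le
    refine hV (ctr o (s ^ 2)) (mem_cornerBox h ho ?_) _ (mem_cornerBox h ho ?_) ?_ E h.hE0 hE hbad
    · rw [← hLr]
      linarith
    · rw [← hLr]
      linarith
    · rw [dist_comm]
      linarith
  have key := max_principle h hLs (u := v) (fun w hw => by
      rw [hv, if_neg (by rw [hΛ]; exact hw)]) (fun y => 3 * (s : ℝ) ^ 2 ≤ dist y o) hG hΦL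
    (R := 2 * s * Real.exp s * Real.exp (2 * (s : ℝ) ^ 2))
    (A := Real.exp s * Real.exp (3 * (s : ℝ) ^ 2)) (V := V) (E := E) (δ := δ) (fun y hy _ z hz => ?_)
    (fun y _ hy => ?_) (x := x) ?_
  rotate_left
  · by_cases hb : ∃ b, b ∉ Λ ∧ dist b z ≤ 1
    · obtain ⟨b, hbΛ, hbz⟩ := hb
      refine mul_le_mul (abs_T_le h fun w _ => hvb w) (Real.exp_le_exp.2 ?_) (Real.exp_pos _).le
        (by positivity)
      have d1 := hΛd' b hbΛ
      have d2 := dist_lt_of_mem_sub hz (mem_sub h hLs hy)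
      have t1 : dist b o ≤ dist b z + dist z o := dist_triangle _ _ _
      have t2 : dist z o ≤ dist z y + dist y o := dist_triangle _ _ _
      rw [hΦ]
      refine (mul_le_mul_of_nonneg_left (min_le_right _ _) hmpos).trans ?_
      have h3 : (L : ℝ) / 2 - dist y o ≤ 2 * (s : ℝ) ^ 2 := by nlinarith
      refine (mul_le_mul_of_nonneg_left h3 hmpos).trans ?_
      exact mul_le_of_le_one_left (by positivity) hm1
    · push Not at hb
      have h0 : T δ E V v z = 0 := by
        rw [← hT z]
        refine T_congr rfl fun b hbz => ?_
        have : b ∈ Λ := by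
          by_contra hbQ
          linarith [hb b hbQ]
        rw [hv, if_pos this]
      rw [h0, abs_zero, zero_mul]
      positivity
  · rw [not_le] at hy
    refine mul_le_mul (hvb y) (Real.exp_le_exp.2 ?_) (Real.exp_pos _).le (Real.exp_pos _).le
    rw [hΦ]
    refine (mul_le_mul_of_nonneg_left (min_le_left _ _) hmpos).trans ?_
    exact (mul_le_of_le_one_left dist_nonneg hm1).trans hy.le
  · by_contra hxΛ
    have := hΛd' x (by rw [hΛ]; exact hxΛ)
    nlinarith
  have hxΛ : x ∈ Λ := by
    by_contra hxΛ
    have := hΛd' x hxΛ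
    nlinarith
  rw [hv, if_pos hxΛ, hΦ, min_eq_left (by linarith)] at key
  have hmax : max (Real.exp s * Real.exp (3 * (s : ℝ) ^ 2))
      (2 * s ^ 6 * Real.exp s * (2 * s * Real.exp s * Real.exp (2 * (s : ℝ) ^ 2))) ≤
      Real.exp (4 * (s : ℝ) ^ 2) := by
    refine max_le ?_ ?_
    · rw [← Real.exp_add, Real.exp_le_exp]
      nlinarith
    · have h4 : (4 : ℝ) ≤ Real.exp s := by linarith [Real.add_one_le_exp (s : ℝ)]
      have h7 := h.pow_le_exp (k := 7) (by norm_num)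
      calc 2 * (s : ℝ) ^ 6 * Real.exp s * (2 * s * Real.exp s * Real.exp (2 * (s : ℝ) ^ 2)) =
            4 * (s : ℝ) ^ 7 * (Real.exp s * Real.exp s * Real.exp (2 * (s : ℝ) ^ 2)) := by ring
        _ ≤ Real.exp s * Real.exp s * (Real.exp s * Real.exp s * Real.exp (2 * (s : ℝ) ^ 2)) :=
            mul_le_mul_of_nonneg_right (mul_le_mul h4 h7 (by positivity) (Real.exp_pos _).le)
              (by positivity)
        _ = Real.exp (4 * s + 2 * (s : ℝ) ^ 2) := by
            rw [← Real.exp_add, ← Real.exp_add, ← Real.exp_add]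
            congr 1
            ring
        _ ≤ _ := by
            rw [Real.exp_le_exp]
            nlinarith
  have h5 : |u x| ≤ Real.exp (4 * (s : ℝ) ^ 2 - m * dist x o) := by
    rw [Real.exp_sub, le_div_iff₀ (Real.exp_pos _)]
    exact key.trans hmax
  refine h5.trans (Real.exp_le_exp.2 ?_)
  have h6 : 1 / M * dist x o ≤ m * dist x o := mul_le_mul_of_nonneg_right hm0 dist_nonneg
  have h7 : 1 / M * dist x o = 1 / (2 * M) * dist x o + 1 / (2 * M) * dist x o := by
    field_simp
    ring
  have h8 : 500 * (s : ℝ) ^ 2 ≤ 1 / (2 * M) * dist x o := by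
    rw [one_div, inv_mul_eq_div, le_div_iff₀ (by linarith)]
    linarith
  nlinarith

end LocalDecay

section GlobalDecay

variable {δ E M lam : ℝ} {s₀ : ℕ} {V : Cfg}

lemma tendsto_scale (hs : 2 ≤ s₀) :
    Filter.Tendsto (fun k => (scale s₀ k : ℝ)) Filter.atTop Filter.atTop := by
  refine Filter.tendsto_atTop_mono (fun k => ?_)
    (tendsto_pow_atTop_atTop_of_one_lt (by norm_num : (1 : ℝ) < 2))
  exact_mod_cast two_pow_le_scale hs k

set_option maxRecDepth 4000 in
/-- Decay in the annuli at all large scales gives decay everywhere. -/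
lemma exists_decay_of_annuli (hB : Big δ E M s₀) {u : Z3 → ℝ} {o : Z3} {K : ℕ}
    (hu : ∀ a, dist a o ≤ (scale s₀ K : ℝ) ^ 41 → |u a| ≤ Real.exp (scale s₀ K))
    (hd : ∀ k, K ≤ k → ∀ x, 1000 * M * (scale s₀ k : ℝ) ^ 2 ≤ dist x o →
      dist x o ≤ (scale s₀ k : ℝ) ^ 41 / 4 → |u x| ≤ Real.exp (-(1 / (2 * M)) * dist x o)) :
    ∃ C, ∀ x, |u x| ≤ C * Real.exp (-(1 / (2 * M)) * dist x o) := by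
  have hM := hB.M_pos
  have hs2 : 2 ≤ s₀ := by
    have := hB.le_s
    have h2 : (2 : ℝ) ≤ s₀ := by linarith
    exact_mod_cast h2
  have hall : ∀ j x, 1000 * M * (scale s₀ K : ℝ) ^ 2 ≤ dist x o →
      dist x o ≤ (scale s₀ (K + j) : ℝ) ^ 41 / 4 →
      |u x| ≤ Real.exp (-(1 / (2 * M)) * dist x o) := by
    intro j
    induction j with
    | zero => exact fun x h1 h2 => hd K le_rfl x h1 h2
    | succ j ih =>
      intro x h1 h2
      rcases le_total (dist x o) ((scale s₀ (K + j) : ℝ) ^ 41 / 4) with h3 | h3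
      · exact ih x h1 h3
      · refine hd (K + (j + 1)) (by omega) x (le_trans ?_ h3) h2
        have hb := hB.scale (K + j)
        have h4 : 4000 * M ≤ scale s₀ (K + j) := by
          have h5 : M ^ 2 ≤ scale s₀ (K + j) := hb.pow_le (by norm_num)
          have h6 := hb.hM
          nlinarith
        rw [← add_assoc, scale_succ]
        push_cast
        rw [← pow_mul, pow_succ (scale s₀ (K + j) : ℝ) 40]
        have h7 : (0 : ℝ) ≤ (scale s₀ (K + j) : ℝ) ^ 40 := by positivity
        norm_num only
        generalize (scale s₀ (K + j) : ℝ) ^ 40 = P at *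
        nlinarith
  have hfar : ∀ x, 1000 * M * (scale s₀ K : ℝ) ^ 2 ≤ dist x o →
      |u x| ≤ Real.exp (-(1 / (2 * M)) * dist x o) := by
    intro x hx
    obtain ⟨k, hk1, hk2⟩ := (((tendsto_scale hs2).eventually_ge_atTop
      (4 * dist x o + 1)).and (Filter.eventually_ge_atTop K)).exists
    obtain ⟨j, rfl⟩ := Nat.exists_eq_add_of_le hk2
    refine hall j x hx ?_
    have h0 : (0 : ℝ) ≤ dist x o := dist_nonneg
    have := le_self_pow₀ (a := (scale s₀ (K + j) : ℝ)) (by linarith) (n := 41) (by norm_num)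
    linarith
  have hb := hB.scale K
  obtain ⟨s, hs⟩ : ∃ s, s = scale s₀ K := ⟨_, rfl⟩
  rw [← hs] at hfar hu hb
  refine ⟨max 1 (Real.exp s * Real.exp (1 / (2 * M) * (1000 * M * (s : ℝ) ^ 2))), fun x => ?_⟩
  rcases le_total (1000 * M * (s : ℝ) ^ 2) (dist x o) with h1 | h1
  · refine (hfar x h1).trans ?_
    exact le_mul_of_one_le_left (Real.exp_pos _).le (le_max_left _ _)
  · have h2 : dist x o ≤ (s : ℝ) ^ 41 := by
      refine h1.trans ?_
      have h3 : (s : ℝ) ^ 41 = (s : ℝ) ^ 39 * (s : ℝ) ^ 2 := by rw [← pow_add]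
      rw [h3]
      refine mul_le_mul_of_nonneg_right ?_ (by positivity)
      have h4 : (s : ℝ) ≤ (s : ℝ) ^ 39 := le_self_pow₀ (by linarith [hb.le_s]) (by norm_num)
      have h5 : M ^ 2 ≤ s := hb.pow_le (by norm_num)
      have h6 := hb.hM
      nlinarith
    refine le_trans ?_ (mul_le_mul_of_nonneg_right (le_max_right _ _) (Real.exp_pos _).le)
    rw [mul_assoc, ← Real.exp_add]
    refine (hu x h2).trans (le_mul_of_one_le_right (Real.exp_pos _).le ?_)
    rw [Real.one_le_exp_iff, neg_mul, ← sub_eq_add_neg, ← mul_sub]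
    exact mul_nonneg (by positivity) (by linarith)

lemma eventually_tame {u : Z3 → ℝ} {C : ℝ} {n : ℕ} (hC : 0 ≤ C)
    (hu : ∀ a, |u a| ≤ C * (1 + 2 * dist a 0) ^ n) (o : Z3) :
    ∀ᶠ x : ℝ in Filter.atTop, ∀ a, dist a o ≤ x ^ 41 → |u a| ≤ Real.exp x := by
  have h1 := (Real.tendsto_pow_mul_exp_neg_atTop_nhds_zero (42 * n)).eventually_lt_const
    (u := 1 / (C + 1)) (by positivity)
  filter_upwards [h1, Filter.eventually_ge_atTop (5 + dist o 0)] with x hx hxo a ha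
  have hd : (0 : ℝ) ≤ dist o 0 := dist_nonneg
  have hx1 : (1 : ℝ) ≤ x := by linarith
  have ht : dist a 0 ≤ dist a o + dist o 0 := dist_triangle _ _ _
  have h2 : 1 + 2 * dist a 0 ≤ x ^ 42 := by
    have h3 : x ^ 42 = x ^ 41 * x := pow_succ _ _
    have h4 : x ≤ x ^ 41 := le_self_pow₀ hx1 (by norm_num)
    rw [h3]
    generalize x ^ 41 = P at *
    nlinarith
  have h5 : (1 + 2 * dist a 0) ^ n ≤ x ^ (42 * n) := by
    rw [pow_mul]
    exact pow_le_pow_left₀ (by positivity) h2 n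
  rw [Real.exp_neg, ← div_eq_mul_inv, div_lt_div_iff₀ (Real.exp_pos _) (by positivity), one_mul] at hx
  refine (hu a).trans ((mul_le_mul_of_nonneg_left h5 hC).trans ?_)
  have : 0 ≤ x ^ (42 * n) := by positivity
  generalize x ^ (42 * n) = P at *
  nlinarith

lemma exists_decay (hB : Big δ E M s₀) (hE : E ≤ lam)
    (hV : ∀ᶠ k in Filter.atTop, NoPair δ M lam (scale s₀ k) V) {u : Z3 → ℝ}
    (hT : ∀ a, T δ E V u a = 0) {C : ℝ} {n : ℕ} (hC : 0 ≤ C)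
    (hu : ∀ a, |u a| ≤ C * (1 + 2 * dist a 0) ^ n) {o : Z3} (ho : u o ≠ 0) :
    ∃ C, ∀ x, |u x| ≤ C * Real.exp (-(1 / (2 * M)) * dist x o) := by
  have hs2 : 2 ≤ s₀ := by
    have := hB.le_s
    have h2 : (2 : ℝ) ≤ s₀ := by linarith
    exact_mod_cast h2
  have hsc := tendsto_scale hs2
  have h1 : ∀ᶠ x : ℝ in Filter.atTop, Real.exp (-x) ≤ |u o| :=
    (Real.tendsto_exp_neg_atTop_nhds_zero.eventually_lt_const (abs_pos.2 ho)).mono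
      fun _ h => h.le
  obtain ⟨K, hK⟩ := Filter.eventually_atTop.1 (((hsc.eventually (eventually_tame hC hu o)).and
    (hsc.eventually h1)).and ((hsc.eventually_ge_atTop (dist o 0)).and hV))
  refine exists_decay_of_annuli hB (hK K le_rfl).1.1 fun k hk x h1x h2x => ?_
  obtain ⟨⟨a1, a2⟩, a3, a4⟩ := hK k hk
  exact local_decay (hB.scale k) hE hT a3 a1 a2 a4 h1x h2x

end GlobalDecay

lemma znorm_le (a : Z3) : znorm a ≤ 2 * dist a 0 := by
  unfold znorm
  rw [Real.sqrt_le_left (by positivity)]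
  have h : ∀ i, ((a i : ℝ)) ^ 2 ≤ dist a 0 ^ 2 := by
    intro i
    have := abs_coord_le_dist a 0 i
    simp only [Pi.zero_apply, Int.cast_zero, sub_zero] at this
    rw [← sq_abs]
    exact pow_le_pow_left₀ (abs_nonneg _) this 2
  rw [Fin.sum_univ_three]
  nlinarith [h 0, h 1, h 2, sq_nonneg (dist a 0)]

lemma exists_poly_bound {u : Z3 → ℝ} (h : (⨅ n : ℕ, ⨆ a : Fin 3 → ℤ,
    ENNReal.ofReal (((1 + znorm a) ^ n)⁻¹ * |u a|)) < ⊤) :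
    ∃ (C : ℝ) (n : ℕ), 0 ≤ C ∧ ∀ a, |u a| ≤ C * (1 + 2 * dist a 0) ^ n := by
  obtain ⟨n, hn⟩ := iInf_lt_iff.1 h
  refine ⟨(⨆ a : Fin 3 → ℤ, ENNReal.ofReal (((1 + znorm a) ^ n)⁻¹ * |u a|)).toReal, n,
    ENNReal.toReal_nonneg, fun a => ?_⟩
  have h1 := le_iSup (fun a : Fin 3 → ℤ => ENNReal.ofReal (((1 + znorm a) ^ n)⁻¹ * |u a|)) a
  have h2 := (ENNReal.ofReal_le_iff_le_toReal hn.ne).1 h1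
  have h0 : 0 ≤ znorm a := Real.sqrt_nonneg _
  rw [inv_mul_le_iff₀ (by positivity), mul_comm] at h2
  refine h2.trans (mul_le_mul_of_nonneg_left ?_ ENNReal.toReal_nonneg)
  exact pow_le_pow_left₀ (by positivity) (by linarith [znorm_le a]) n

lemma exp_decay_of_bound {u : Z3 → ℝ} {M C : ℝ} {o : Z3} (hM : 0 < M)
    (h : ∀ x, |u x| ≤ C * Real.exp (-(1 / (2 * M)) * dist x o)) :
    (⨅ t ∈ Set.Ioi (0 : ℝ), ⨆ a : Fin 3 → ℤ,
      ENNReal.ofReal (Real.exp (t * znorm a) * |u a|)) < ⊤ := by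
  have hC : 0 ≤ C := by
    have := (abs_nonneg _).trans (h o)
    exact nonneg_of_mul_nonneg_left this (Real.exp_pos _)
  refine lt_of_le_of_lt (iInf₂_le (1 / (4 * M)) (by simp only [Set.mem_Ioi]; positivity)) ?_
  refine lt_of_le_of_lt (iSup_le fun a => ENNReal.ofReal_le_ofReal
    (q := C * Real.exp (1 / (2 * M) * dist o 0)) ?_) ENNReal.ofReal_lt_top
  calc Real.exp (1 / (4 * M) * znorm a) * |u a|
      ≤ Real.exp (1 / (2 * M) * (dist a o + dist o 0)) *
          (C * Real.exp (-(1 / (2 * M)) * dist a o)) := by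
        refine mul_le_mul (Real.exp_le_exp.2 ?_) (h a) (abs_nonneg _) (Real.exp_pos _).le
        have h1 : znorm a ≤ 2 * (dist a o + dist o 0) :=
          (znorm_le a).trans (mul_le_mul_of_nonneg_left (dist_triangle _ _ _) (by norm_num))
        calc _ ≤ 1 / (4 * M) * (2 * (dist a o + dist o 0)) :=
              mul_le_mul_of_nonneg_left h1 (by positivity)
          _ = _ := by
              field_simp
              norm_num
    _ = C * Real.exp (1 / (2 * M) * dist o 0) := by
        rw [mul_left_comm, ← Real.exp_add]
        congr 2
        ring

/-- Anderson–Bernoulli localization near the bottom of the spectrum on the 3D lattice. -/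
theorem anderson_bernoulli_localization_3d (δ : ℝ) (hδ : 0 < δ) :
    ∃ lamStar : ℝ, 0 < lamStar ∧
      ∀ μ : MeasureTheory.Measure ((Fin 3 → ℤ) → Bool), IsBernoulliProduct μ →
        ∀ᵐ V ∂μ, ∀ (u : (Fin 3 → ℤ) → ℝ) (lam : ℝ), lam ∈ Set.Icc 0 lamStar →
          (∀ a, -discLap u a + δ * (if V a then 1 else 0) * u a = lam * u a) →
          (⨅ n : ℕ, ⨆ a : Fin 3 → ℤ,
              ENNReal.ofReal (((1 + znorm a) ^ n)⁻¹ * |u a|)) < ⊤ →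
          (⨅ t ∈ Set.Ioi (0 : ℝ), ⨆ a : Fin 3 → ℤ,
              ENNReal.ofReal (Real.exp (t * znorm a) * |u a|)) < ⊤ := by
  obtain ⟨M, lamStar, s₀, hlam0, -, ht, hinit⟩ := exists_initial_scale hδ
  refine ⟨lamStar, hlam0, fun μ hμ => ?_⟩
  have hB := fun E h0 h1 => (hinit E h0 h1).1
  have hprob := hμ.1
  have hs : 10 ^ 6 ≤ s₀ := by exact_mod_cast (hB 0 le_rfl hlam0.le).le_s
  have hae := ae_eventually_noPair (δ := δ) (M := M) hμ hs hlam0.le fun k E h0 h1 c =>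
    (prob_mono hμ fun V hV hR => hV hR.1).trans
      (msa_all_scales hμ (hB E h0 h1) ht ((hinit E h0 h1).2 μ hμ) k c)
  filter_upwards [hae] with V hV u lam hlam heq hpoly
  by_cases hu : ∃ o, u o ≠ 0
  · obtain ⟨o, ho⟩ := hu
    obtain ⟨C, n, hC, hb⟩ := exists_poly_bound hpoly
    have hT : ∀ a, T δ lam V u a = 0 := by
      intro a
      have h1 := heq a
      unfold discLap at h1
      unfold T nbs
      linarith
    obtain ⟨C', hC'⟩ := exists_decay (hB lam hlam.1 hlam.2) hlam.2 hV hT hC hb ho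
    exact exp_decay_of_bound (hB lam hlam.1 hlam.2).M_pos hC'
  · push Not at hu
    exact exp_decay_of_bound (u := u) (M := 1) (C := 0) (o := 0) one_pos fun x => by simp [hu x]
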